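/- Let u be a monotone traveling wave solution of the balanced Allen-Cahn equation in the plane. Then there exist Y₀ > 0, C³ functions k₁, k₂ : (Y₀, ∞) → ℝ with k₁(y) < k₂(y), and constants C₁, C₂ ∈ ℝ such that for every y > Y₀ the set {x ∈ ℝ : u(x,y) = 0} equals {k₁(y), k₂(y)}, and the asymptotic formulas k₁(y) = −(1/(2μ)) ln y + C₁ + o(1) and k₂(y) = (1/(2μ)) ln y + C₂ + o(1) hold as y → ∞, where μ := √(F''(1)) > 0 (that is, k₁(y) + (1/(2μ)) ln y → C₁ and k₂(y) − (1/(2μ)) ln y → C₂ as y → ∞). -/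

import Mathlib

open Real Filter MeasureTheory Metric

noncomputable def pdx (u : ℝ → ℝ → ℝ) (x y : ℝ) : ℝ := deriv (fun t => u t y) x

noncomputable def pdy (u : ℝ → ℝ → ℝ) (x y : ℝ) : ℝ := deriv (fun t => u x t) y

noncomputable def pdxx (u : ℝ → ℝ → ℝ) (x y : ℝ) : ℝ := deriv (fun t => pdx u t y) x

noncomputable def pdyy (u : ℝ → ℝ → ℝ) (x y : ℝ) : ℝ := deriv (fun t => pdy u x t) y

/-- `F` is a balanced double-well potential. -/
def BalancedDoubleWell (F : ℝ → ℝ) : Prop :=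
  ContDiff ℝ 3 F ∧ deriv F (-1) = 0 ∧ deriv F 1 = 0 ∧
  0 < deriv (deriv F) (-1) ∧ 0 < deriv (deriv F) 1 ∧
  (∀ s ∈ Set.Ioo (-1 : ℝ) 0, 0 < deriv F s) ∧
  (∀ s ∈ Set.Ioo (0 : ℝ) 1, deriv F s < 0) ∧
  F (-1) = 0 ∧ F 1 = 0

/-- `u` is a `C³` solution of `Δu + c uᵧ = F'(u)` on `ℝ²` with `|u| ≤ 1`
which is monotone in `y`. -/
def IsSolution (F : ℝ → ℝ) (c : ℝ) (u : ℝ → ℝ → ℝ) : Prop :=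
  ContDiff ℝ 3 (fun p : ℝ × ℝ => u p.1 p.2) ∧
  (∀ x y : ℝ, pdxx u x y + pdyy u x y + c * pdy u x y = deriv F (u x y)) ∧
  (∀ x y : ℝ, |u x y| ≤ 1) ∧
  (∀ x y : ℝ, 0 < pdy u x y)

/-- A monotone traveling wave solution connecting `-1` to `1`. -/
def IsTravelingWave (F : ℝ → ℝ) (c : ℝ) (u : ℝ → ℝ → ℝ) : Prop :=
  IsSolution F c u ∧
  (∀ x : ℝ, Tendsto (fun y => u x y) atTop (nhds 1)) ∧
  (∀ x : ℝ, Tendsto (fun y => u x y) atBot (nhds (-1)))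

section

open Set Topology

/-! ### The potential -/

section potential

/-- `a(s) = √(2 F(s))`. -/
noncomputable def wa (F : ℝ → ℝ) (s : ℝ) : ℝ := √(2 * F s)

/-- The primitive of `a` vanishing at `-1`. -/
noncomputable def wPhi (F : ℝ → ℝ) (s : ℝ) : ℝ := ∫ t in (-1 : ℝ)..s, wa F t

variable {F : ℝ → ℝ}

namespace BalancedDoubleWell

lemma contDiff (hF : BalancedDoubleWell F) : ContDiff ℝ 3 F := hF.1

lemma contDiff_deriv (hF : BalancedDoubleWell F) : ContDiff ℝ 2 (deriv F) := by
  have h : ContDiff ℝ (2 + 1) F := by simpa [show (2 + 1 : WithTop ℕ∞) = 3 by norm_num] using hF.1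
  exact (contDiff_succ_iff_deriv.1 h).2.2

lemma contDiff_deriv2 (hF : BalancedDoubleWell F) : ContDiff ℝ 1 (deriv (deriv F)) := by
  have h : ContDiff ℝ (1 + 1) (deriv F) := by
    simpa [show (1 + 1 : WithTop ℕ∞) = 2 by norm_num] using hF.contDiff_deriv
  exact (contDiff_succ_iff_deriv.1 h).2.2

lemma hasDerivAt (hF : BalancedDoubleWell F) (s : ℝ) : HasDerivAt F (deriv F s) s :=
  (hF.contDiff.differentiable (by norm_num) s).hasDerivAt

lemma hasDerivAt_deriv (hF : BalancedDoubleWell F) (s : ℝ) :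
    HasDerivAt (deriv F) (deriv (deriv F) s) s :=
  (hF.contDiff_deriv.differentiable (by norm_num) s).hasDerivAt

lemma hasDerivAt_deriv2 (hF : BalancedDoubleWell F) (s : ℝ) :
    HasDerivAt (deriv (deriv F)) (deriv (deriv (deriv F)) s) s :=
  (hF.contDiff_deriv2.differentiable (by norm_num) s).hasDerivAt

lemma continuous (hF : BalancedDoubleWell F) : Continuous F := hF.contDiff.continuous

lemma continuous_deriv (hF : BalancedDoubleWell F) : Continuous (deriv F) :=
  hF.contDiff_deriv.continuous

lemma continuous_deriv2 (hF : BalancedDoubleWell F) : Continuous (deriv (deriv F)) :=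
  hF.contDiff_deriv2.continuous

lemma continuous_deriv3 (hF : BalancedDoubleWell F) : Continuous (deriv (deriv (deriv F))) :=
  hF.contDiff_deriv2.continuous_deriv (by norm_num)

lemma reflect (hF : BalancedDoubleWell F) : BalancedDoubleWell (fun s => F (-s)) := by
  have h1 : deriv (fun s => F (-s)) = fun s => - deriv F (-s) := by
    funext s; exact deriv_comp_neg F s
  have h2 : deriv (deriv (fun s => F (-s))) = fun s => deriv (deriv F) (-s) := by
    rw [h1]; funext s
    have : HasDerivAt (fun s => - deriv F (-s)) (deriv (deriv F) (-s)) s :=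
      ((hF.hasDerivAt_deriv (-s)).comp s (hasDerivAt_neg s)).neg.congr_deriv (by simp)
    exact this.deriv
  obtain ⟨h3, a1, a2, b1, b2, c1, c2, d1, d2⟩ := hF
  refine ⟨h3.comp contDiff_neg, ?_, ?_, ?_, ?_, ?_, ?_, ?_, ?_⟩
  · rw [h1]; simpa using a2
  · rw [h1]; simpa using a1
  · rw [h2]; simpa using b2
  · rw [h2]; simpa using b1
  · intro s hs; rw [h1]
    have := c2 (-s) ⟨by linarith [hs.2], by linarith [hs.1]⟩
    simp only; linarith
  · intro s hs; rw [h1]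
    have := c1 (-s) ⟨by linarith [hs.2], by linarith [hs.1]⟩
    simp only; linarith
  · simpa using d2
  · simpa using d1

lemma deriv2_reflect (hF : BalancedDoubleWell F) :
    deriv (deriv (fun s => F (-s))) = fun s => deriv (deriv F) (-s) := by
  have h1 : deriv (fun s => F (-s)) = fun s => - deriv F (-s) := by
    funext s; exact deriv_comp_neg F s
  rw [h1]; funext s
  have : HasDerivAt (fun s => - deriv F (-s)) (deriv (deriv F) (-s)) s :=
    ((hF.hasDerivAt_deriv (-s)).comp s (hasDerivAt_neg s)).neg.congr_deriv (by simp)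
  exact this.deriv

lemma antitoneOn (hF : BalancedDoubleWell F) : StrictAntiOn F (Icc 0 1) := by
  apply strictAntiOn_of_deriv_neg (convex_Icc 0 1) hF.continuous.continuousOn
  intro x hx; rw [interior_Icc] at hx; exact hF.2.2.2.2.2.2.1 x hx

lemma monotoneOn (hF : BalancedDoubleWell F) : StrictMonoOn F (Icc (-1) 0) := by
  apply strictMonoOn_of_deriv_pos (convex_Icc (-1) 0) hF.continuous.continuousOn
  intro x hx; rw [interior_Icc] at hx; exact hF.2.2.2.2.2.1 x hx

lemma zero_one (hF : BalancedDoubleWell F) : F 1 = 0 := hF.2.2.2.2.2.2.2.2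

lemma zero_neg_one (hF : BalancedDoubleWell F) : F (-1) = 0 := hF.2.2.2.2.2.2.2.1

lemma pos (hF : BalancedDoubleWell F) {s : ℝ} (h1 : -1 < s) (h2 : s < 1) : 0 < F s := by
  rcases le_total s 0 with h | h
  · have := hF.monotoneOn (a := -1) (b := s) ⟨le_rfl, by norm_num⟩ ⟨h1.le, h⟩ h1
    rwa [hF.zero_neg_one] at this
  · have := hF.antitoneOn (a := s) (b := 1) ⟨h, h2.le⟩ ⟨by norm_num, le_rfl⟩ h2
    rwa [hF.zero_one] at this

lemma nonneg (hF : BalancedDoubleWell F) {s : ℝ} (h1 : -1 ≤ s) (h2 : s ≤ 1) : 0 ≤ F s := by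
  rcases h1.eq_or_lt with h | h
  · rw [← h, hF.zero_neg_one]
  rcases h2.eq_or_lt with h' | h'
  · rw [h', hF.zero_one]
  exact (hF.pos h h').le

lemma exists_bound (hF : BalancedDoubleWell F) : ∃ C, 0 < C ∧ ∀ s ∈ Icc (-1 : ℝ) 1,
    |F s| ≤ C ∧ |deriv F s| ≤ C ∧ |deriv (deriv F) s| ≤ C ∧ |deriv (deriv (deriv F)) s| ≤ C := by
  obtain ⟨C0, h0⟩ := (isCompact_Icc (a := (-1 : ℝ)) (b := 1)).exists_bound_of_continuousOn
    hF.continuous.continuousOn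
  obtain ⟨C1, h1⟩ := (isCompact_Icc (a := (-1 : ℝ)) (b := 1)).exists_bound_of_continuousOn
    hF.continuous_deriv.continuousOn
  obtain ⟨C2, h2⟩ := (isCompact_Icc (a := (-1 : ℝ)) (b := 1)).exists_bound_of_continuousOn
    hF.continuous_deriv2.continuousOn
  obtain ⟨C3, h3⟩ := (isCompact_Icc (a := (-1 : ℝ)) (b := 1)).exists_bound_of_continuousOn
    hF.continuous_deriv3.continuousOn
  simp only [Real.norm_eq_abs] at *
  have hb : (0 : ℝ) ∈ Icc (-1 : ℝ) 1 := by constructor <;> norm_num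
  have e0 := (abs_nonneg _).trans (h0 0 hb)
  have e1 := (abs_nonneg _).trans (h1 0 hb)
  have e2 := (abs_nonneg _).trans (h2 0 hb)
  have e3 := (abs_nonneg _).trans (h3 0 hb)
  refine ⟨C0 + C1 + C2 + C3 + 1, by linarith, fun s hs => ⟨?_, ?_, ?_, ?_⟩⟩
  · linarith [h0 s hs]
  · linarith [h1 s hs]
  · linarith [h2 s hs]
  · linarith [h3 s hs]

/-- Taylor bounds at the well `1`. -/
lemma exists_taylor (hF : BalancedDoubleWell F) : ∃ C, 0 < C ∧ ∀ w ∈ Icc (0 : ℝ) 2,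
    |deriv (deriv F) (1 - w) - deriv (deriv F) 1| ≤ C * w ∧
    |deriv F (1 - w) + deriv (deriv F) 1 * w| ≤ C * w ^ 2 ∧
    |F (1 - w) - deriv (deriv F) 1 * w ^ 2 / 2| ≤ C * w ^ 3 := by
  obtain ⟨C, hC, hb⟩ := hF.exists_bound
  have A1 : ∀ w ∈ Icc (0 : ℝ) 2, |deriv (deriv F) (1 - w) - deriv (deriv F) 1| ≤ C * w := by
    intro w hw
    have := Convex.norm_image_sub_le_of_norm_hasDerivWithin_le (C := C)
      (f := deriv (deriv F)) (s := Icc (-1) 1) (x := 1) (y := 1 - w)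
      (fun x hx => (hF.hasDerivAt_deriv2 x).hasDerivWithinAt) (fun x hx => (hb x hx).2.2.2)
      (convex_Icc _ _) (by constructor <;> norm_num) ⟨by linarith [hw.2], by linarith [hw.1]⟩
    simpa [abs_of_nonneg hw.1] using this
  have d1 : ∀ w : ℝ, HasDerivAt (fun w => deriv F (1 - w) + deriv (deriv F) 1 * w)
      (-(deriv (deriv F) (1 - w) - deriv (deriv F) 1)) w := by
    intro w
    have := ((hF.hasDerivAt_deriv (1 - w)).comp w ((hasDerivAt_id w).const_sub 1)).add
      ((hasDerivAt_id w).const_mul (deriv (deriv F) 1))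
    exact this.congr_deriv (by simp; ring)
  have A2 : ∀ w ∈ Icc (0 : ℝ) 2, |deriv F (1 - w) + deriv (deriv F) 1 * w| ≤ C * w ^ 2 := by
    intro w hw
    have := Convex.norm_image_sub_le_of_norm_hasDerivWithin_le (C := C * w)
      (f := fun w => deriv F (1 - w) + deriv (deriv F) 1 * w) (s := Icc 0 w) (x := 0) (y := w)
      (fun x hx => (d1 x).hasDerivWithinAt)
      (fun x hx => by
        rw [norm_neg]
        exact (A1 x ⟨hx.1, hx.2.trans hw.2⟩).trans (by gcongr; exact hx.2))
      (convex_Icc _ _) ⟨le_rfl, hw.1⟩ ⟨hw.1, le_rfl⟩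
    simp only [sub_zero, mul_zero, add_zero, hF.2.2.1, Real.norm_eq_abs, abs_of_nonneg hw.1] at this
    calc _ ≤ _ := this
      _ = _ := by ring
  have d2 : ∀ w : ℝ, HasDerivAt (fun w => F (1 - w) - deriv (deriv F) 1 * w ^ 2 / 2)
      (-(deriv F (1 - w) + deriv (deriv F) 1 * w)) w := by
    intro w
    have := ((hF.hasDerivAt (1 - w)).comp w ((hasDerivAt_id w).const_sub 1)).sub
      ((((hasDerivAt_id w).pow 2).const_mul (deriv (deriv F) 1)).div_const 2)
    exact this.congr_deriv (by simp; ring)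
  have A3 : ∀ w ∈ Icc (0 : ℝ) 2, |F (1 - w) - deriv (deriv F) 1 * w ^ 2 / 2| ≤ C * w ^ 3 := by
    intro w hw
    have := Convex.norm_image_sub_le_of_norm_hasDerivWithin_le (C := C * w ^ 2)
      (f := fun w => F (1 - w) - deriv (deriv F) 1 * w ^ 2 / 2) (s := Icc 0 w) (x := 0) (y := w)
      (fun x hx => (d2 x).hasDerivWithinAt)
      (fun x hx => by
        rw [norm_neg]
        exact (A2 x ⟨hx.1, hx.2.trans hw.2⟩).trans (by have := hx.1; gcongr; exact hx.2))
      (convex_Icc _ _) ⟨le_rfl, hw.1⟩ ⟨hw.1, le_rfl⟩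
    simp only [sub_zero, hF.zero_one, Real.norm_eq_abs, abs_of_nonneg hw.1] at this
    norm_num at this
    calc _ ≤ _ := this
      _ = _ := by ring
  exact ⟨C, hC, fun w hw => ⟨A1 w hw, A2 w hw, A3 w hw⟩⟩

lemma deriv2_pos (hF : BalancedDoubleWell F) : 0 < deriv (deriv F) 1 := hF.2.2.2.2.1

lemma exists_lower_half (hF : BalancedDoubleWell F) : ∃ κ, 0 < κ ∧ ∀ s ∈ Icc (0 : ℝ) 1,
    κ * (1 - s) ^ 2 ≤ F s := by
  obtain ⟨C, hC, hT⟩ := hF.exists_taylor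
  set m := deriv (deriv F) 1 with hm
  have hm0 : 0 < m := hF.deriv2_pos
  set η := min (1 / 2) (m / (4 * C)) with hη
  have hη0 : 0 < η := by positivity
  have hη1 : η ≤ 1 / 2 := min_le_left _ _
  have hη2 : C * η ≤ m / 4 := by
    have : η ≤ m / (4 * C) := min_le_right _ _
    calc C * η ≤ C * (m / (4 * C)) := by gcongr
      _ = m / 4 := by field_simp
  have hp : 0 < F (1 - η) := hF.pos (by linarith) (by linarith)
  refine ⟨min (m / 4) (F (1 - η)), by positivity, fun s hs => ?_⟩
  have h1s : (0:ℝ) ≤ 1 - s := by linarith [hs.2]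
  rcases le_total (1 - s) η with h | h
  · have := (hT (1 - s) ⟨h1s, by linarith [hs.1]⟩).2.2
    rw [abs_le, sub_sub_cancel] at this
    have e1 : C * (1 - s) ^ 3 ≤ m / 4 * (1 - s) ^ 2 := by
      calc C * (1 - s) ^ 3 = C * (1 - s) * (1 - s) ^ 2 := by ring
        _ ≤ m / 4 * (1 - s) ^ 2 := by
          gcongr
          exact (mul_le_mul_of_nonneg_left h hC.le).trans hη2
    have e2 : min (m / 4) (F (1 - η)) * (1 - s) ^ 2 ≤ m / 4 * (1 - s) ^ 2 := by
      gcongr; exact min_le_left _ _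
    linarith [this.1]
  · have e1 : F (1 - η) ≤ F s := hF.antitoneOn.antitoneOn hs ⟨by linarith, by linarith⟩ (by linarith)
    have e2 : min (m / 4) (F (1 - η)) * (1 - s) ^ 2 ≤ F (1 - η) * 1 := by
      gcongr
      · exact min_le_right _ _
      · nlinarith [hs.1, hs.2]
    linarith

lemma exists_lower (hF : BalancedDoubleWell F) : ∃ κ, 0 < κ ∧ ∀ s ∈ Icc (-1 : ℝ) 1,
    κ * (1 - s ^ 2) ^ 2 ≤ F s := by
  obtain ⟨κ1, h1, H1⟩ := hF.exists_lower_half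
  obtain ⟨κ2, h2, H2⟩ := hF.reflect.exists_lower_half
  have key : ∀ κ, 0 < κ → min κ1 κ2 ≤ κ → ∀ t ∈ Icc (0 : ℝ) 1,
      min κ1 κ2 / 4 * (1 - t ^ 2) ^ 2 ≤ κ * (1 - t) ^ 2 := by
    intro κ hκ hle t ht
    have e : 0 ≤ 1 - t := by linarith [ht.2]
    have : (1 - t ^ 2) ^ 2 ≤ 4 * (1 - t) ^ 2 := by
      have : (1 - t ^ 2) ^ 2 = (1 + t) ^ 2 * (1 - t) ^ 2 := by ring
      rw [this]; gcongr; nlinarith [ht.1, ht.2]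
    have hmp : 0 < min κ1 κ2 := by positivity
    calc min κ1 κ2 / 4 * (1 - t ^ 2) ^ 2 ≤ min κ1 κ2 / 4 * (4 * (1 - t) ^ 2) := by gcongr
      _ = min κ1 κ2 * (1 - t) ^ 2 := by ring
      _ ≤ κ * (1 - t) ^ 2 := by gcongr
  refine ⟨min κ1 κ2 / 4, by positivity, fun s hs => ?_⟩
  rcases le_total 0 s with h | h
  · exact (key κ1 h1 (min_le_left _ _) s ⟨h, hs.2⟩).trans (H1 s ⟨h, hs.2⟩)
  · have a1 := key κ2 h2 (min_le_right _ _) (-s) ⟨by linarith, by linarith [hs.1]⟩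
    have a2 := H2 (-s) ⟨by linarith, by linarith [hs.1]⟩
    simp only [neg_neg, neg_sq] at a1 a2
    linarith

lemma exists_upper_half (hF : BalancedDoubleWell F) : ∃ C, 0 < C ∧ ∀ s ∈ Icc (0 : ℝ) 1,
    F s ≤ C * (1 - s) ^ 2 ∧ |deriv F s| ≤ C * (1 - s) := by
  obtain ⟨C, hC, hT⟩ := hF.exists_taylor
  have hm0 : 0 < deriv (deriv F) 1 := hF.deriv2_pos
  refine ⟨C + deriv (deriv F) 1, by positivity, fun s hs => ?_⟩
  have h1s : (0:ℝ) ≤ 1 - s := by linarith [hs.2]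
  have h2s : 1 - s ≤ 1 := by linarith [hs.1]
  obtain ⟨-, h1, h2⟩ := hT (1 - s) ⟨h1s, by linarith⟩
  rw [sub_sub_cancel] at h1 h2
  rw [abs_le] at h1 h2
  have e2 : C * (1 - s) ^ 2 ≤ C * (1 - s) := by apply mul_le_mul_of_nonneg_left _ hC.le; nlinarith
  have e3 : C * (1 - s) ^ 3 ≤ C * (1 - s) ^ 2 := by
    apply mul_le_mul_of_nonneg_left _ hC.le
    nlinarith [sq_nonneg (1 - s), mul_nonneg (sq_nonneg (1 - s)) hs.1]
  have e4 : 0 ≤ deriv (deriv F) 1 * (1 - s) := by positivity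
  have e5 : 0 ≤ deriv (deriv F) 1 * (1 - s) ^ 2 := by positivity
  refine ⟨by linarith [h2.2], abs_le.2 ⟨by linarith [h1.1], by nlinarith [h1.2]⟩⟩

lemma exists_upper (hF : BalancedDoubleWell F) : ∃ C, 0 < C ∧ ∀ s ∈ Icc (-1 : ℝ) 1,
    F s ≤ C * (1 - s ^ 2) ^ 2 ∧ |deriv F s| ≤ C * (1 - s ^ 2) := by
  obtain ⟨C1, h1, H1⟩ := hF.exists_upper_half
  obtain ⟨C2, h2, H2⟩ := hF.reflect.exists_upper_half
  have key : ∀ t ∈ Icc (0 : ℝ) 1, 1 - t ≤ 1 - t ^ 2 := by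
    intro t ht; nlinarith [ht.1, ht.2]
  refine ⟨C1 + C2, by positivity, fun s hs => ?_⟩
  rcases le_total 0 s with h | h
  · have k := key s ⟨h, hs.2⟩
    have hp : 0 ≤ 1 - s := by linarith [hs.2]
    obtain ⟨a, b⟩ := H1 s ⟨h, hs.2⟩
    constructor
    · calc _ ≤ _ := a
        _ ≤ (C1 + C2) * (1 - s ^ 2) ^ 2 := by gcongr; linarith
    · calc _ ≤ _ := b
        _ ≤ (C1 + C2) * (1 - s ^ 2) := by gcongr; linarith
  · have hs' : -s ∈ Icc (0 : ℝ) 1 := ⟨by linarith, by linarith [hs.1]⟩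
    have k := key (-s) hs'
    have hp : 0 ≤ 1 - -s := by linarith [hs.1]
    obtain ⟨a, b⟩ := H2 (-s) hs'
    rw [deriv_comp_neg] at b
    simp only [neg_neg, abs_neg, neg_sq] at a b k
    have hp' : 0 ≤ 1 - s ^ 2 := by nlinarith [hs.1, hs.2]
    constructor
    · calc _ ≤ _ := a
        _ ≤ (C1 + C2) * (1 - s ^ 2) ^ 2 := by gcongr; linarith
    · calc _ ≤ _ := b
        _ ≤ (C1 + C2) * (1 - s ^ 2) := by gcongr; linarith

lemma wa_sq (hF : BalancedDoubleWell F) {s : ℝ} (h : s ∈ Icc (-1 : ℝ) 1) :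
    wa F s ^ 2 = 2 * F s := Real.sq_sqrt (by linarith [hF.nonneg h.1 h.2])

lemma wa_pos (hF : BalancedDoubleWell F) {s : ℝ} (h : s ∈ Ioo (-1 : ℝ) 1) : 0 < wa F s :=
  Real.sqrt_pos.2 (by linarith [hF.pos h.1 h.2])

lemma continuous_wa (hF : BalancedDoubleWell F) : Continuous (wa F) := by
  unfold wa; have := hF.continuous; fun_prop

lemma hasDerivAt_wa (hF : BalancedDoubleWell F) {s : ℝ} (h : s ∈ Ioo (-1 : ℝ) 1) :
    HasDerivAt (wa F) (deriv F s / wa F s) s := by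
  have h0 : 2 * F s ≠ 0 := by linarith [hF.pos h.1 h.2]
  have := ((hF.hasDerivAt s).const_mul 2).sqrt h0
  exact this.congr_deriv (by unfold wa; field_simp)

/-- Two sided bounds for `a`, bound of `F'` by `a`. -/
lemma exists_wa_bounds (hF : BalancedDoubleWell F) : ∃ κ C, 0 < κ ∧ 0 < C ∧
    ∀ s ∈ Icc (-1 : ℝ) 1, κ * (1 - s ^ 2) ≤ wa F s ∧ wa F s ≤ C * (1 - s ^ 2) ∧
      |deriv F s| ≤ C * wa F s := by
  obtain ⟨κ, hκ, H⟩ := hF.exists_lower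
  obtain ⟨C, hC, H'⟩ := hF.exists_upper
  refine ⟨√(2 * κ), √(2 * C) + C / √(2 * κ), by positivity, by positivity, fun s hs => ?_⟩
  have hp' : 0 ≤ 1 - s ^ 2 := by nlinarith [hs.1, hs.2]
  have e1 : √(2 * κ) * (1 - s ^ 2) ≤ wa F s := by
    rw [← Real.sqrt_sq hp', ← Real.sqrt_mul (by positivity)]
    apply Real.sqrt_le_sqrt; linarith [H s hs]
  refine ⟨e1, ?_, ?_⟩
  · have : wa F s ≤ √(2 * C) * (1 - s ^ 2) := by
      rw [← Real.sqrt_sq hp', ← Real.sqrt_mul (by positivity)]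
      apply Real.sqrt_le_sqrt; linarith [(H' s hs).1]
    have : 0 ≤ C / √(2 * κ) * (1 - s ^ 2) := by positivity
    linarith
  · have h1 : C * (1 - s ^ 2) ≤ C / √(2 * κ) * wa F s := by
      calc C * (1 - s ^ 2) = C / √(2 * κ) * (√(2 * κ) * (1 - s ^ 2)) := by field_simp
        _ ≤ _ := by gcongr
    have h2 : 0 ≤ √(2 * C) * wa F s := mul_nonneg (Real.sqrt_nonneg _) (Real.sqrt_nonneg _)
    linarith [(H' s hs).2]

lemma hasDerivAt_wPhi (hF : BalancedDoubleWell F) (s : ℝ) : HasDerivAt (wPhi F) (wa F s) s :=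
  intervalIntegral.integral_hasDerivAt_right (hF.continuous_wa.intervalIntegrable _ _)
    (hF.continuous_wa.stronglyMeasurableAtFilter _ _) hF.continuous_wa.continuousAt

lemma wPhi_sub (hF : BalancedDoubleWell F) (s t : ℝ) :
    wPhi F t - wPhi F s = ∫ r in s..t, wa F r :=
  intervalIntegral.integral_interval_sub_left (hF.continuous_wa.intervalIntegrable _ _)
    (hF.continuous_wa.intervalIntegrable _ _)

lemma continuous_wPhi (hF : BalancedDoubleWell F) : Continuous (wPhi F) :=
  continuous_iff_continuousAt.2 fun s => (hF.hasDerivAt_wPhi s).continuousAt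

lemma monotone_wPhi (hF : BalancedDoubleWell F) : Monotone (wPhi F) :=
  monotone_of_hasDerivAt_nonneg hF.hasDerivAt_wPhi (fun _ => Real.sqrt_nonneg _)

lemma strictMonoOn_wPhi (hF : BalancedDoubleWell F) : StrictMonoOn (wPhi F) (Icc (-1) 1) := by
  apply strictMonoOn_of_deriv_pos (convex_Icc _ _) hF.continuous_wPhi.continuousOn
  intro x hx; rw [interior_Icc] at hx
  rw [(hF.hasDerivAt_wPhi x).deriv]; exact hF.wa_pos hx

lemma wPhi_neg_one (F : ℝ → ℝ) : wPhi F (-1) = 0 := by simp [wPhi]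

lemma wPhi_nonneg (hF : BalancedDoubleWell F) {s : ℝ} (h : -1 ≤ s) : 0 ≤ wPhi F s := by
  have := hF.monotone_wPhi h; rwa [wPhi_neg_one] at this

lemma wPhi_one_pos (hF : BalancedDoubleWell F) : 0 < wPhi F 1 := by
  have := hF.strictMonoOn_wPhi (a := -1) (b := 1) (by norm_num) (by norm_num) (by norm_num)
  rwa [wPhi_neg_one] at this

lemma wPhi_le_one (hF : BalancedDoubleWell F) {s : ℝ} (h : s ≤ 1) : wPhi F s ≤ wPhi F 1 :=
  hF.monotone_wPhi h

lemma exists_one_sub_wPhi_le (hF : BalancedDoubleWell F) : ∃ C, 0 < C ∧ ∀ s ∈ Icc (0 : ℝ) 1,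
    wPhi F 1 - wPhi F s ≤ C * F s := by
  obtain ⟨κ, hκ, H⟩ := hF.exists_lower_half
  obtain ⟨κ', C, -, hC, H'⟩ := hF.exists_wa_bounds
  refine ⟨2 * C / κ, by positivity, fun s hs => ?_⟩
  have hd : ∀ t : ℝ, HasDerivAt (fun t => -(2 * C * (1 - t) ^ 2 / 2)) (2 * C * (1 - t)) t := by
    intro t
    have := (((((hasDerivAt_id t).const_sub 1).pow 2).const_mul (2 * C)).div_const 2).neg
    exact this.congr_deriv (by simp; ring)
  have : ∫ r in s..1, wa F r ≤ ∫ r in s..1, 2 * C * (1 - r) := by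
    apply intervalIntegral.integral_mono_on hs.2 (hF.continuous_wa.intervalIntegrable _ _)
      (by apply Continuous.intervalIntegrable; fun_prop)
    intro r hr
    have hr' : r ∈ Icc (-1 : ℝ) 1 := ⟨by linarith [hr.1, hs.1], hr.2⟩
    calc wa F r ≤ C * (1 - r ^ 2) := (H' r hr').2.1
      _ ≤ C * (2 * (1 - r)) := by gcongr; nlinarith [hr.2, hr.1]
      _ = _ := by ring
  rw [hF.wPhi_sub]
  refine this.trans ?_
  rw [intervalIntegral.integral_eq_sub_of_hasDerivAt (fun t _ => hd t)
    (by apply Continuous.intervalIntegrable; fun_prop)]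
  have h1 := H s hs
  calc _ = C * (1 - s) ^ 2 := by ring
    _ ≤ C * (2 * (1 - s) ^ 2) := by nlinarith [mul_nonneg hC.le (sq_nonneg (1 - s))]
    _ = 2 * C / κ * (κ * (1 - s) ^ 2) := by field_simp
    _ ≤ 2 * C / κ * F s := by gcongr

lemma wPhi_reflect (hF : BalancedDoubleWell F) (s : ℝ) :
    wPhi (fun t => F (-t)) s = wPhi F 1 - wPhi F (-s) := by
  rw [hF.wPhi_sub]
  unfold wPhi wa
  have := intervalIntegral.integral_comp_neg (fun t => √(2 * F t)) (a := -1) (b := s)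
  simpa using this

lemma exists_wPhi_le (hF : BalancedDoubleWell F) : ∃ C, 0 < C ∧ ∀ s ∈ Icc (-1 : ℝ) 0,
    wPhi F s ≤ C * F s := by
  obtain ⟨C, hC, H⟩ := hF.reflect.exists_one_sub_wPhi_le
  refine ⟨C, hC, fun s hs => ?_⟩
  have := H (-s) ⟨by linarith [hs.2], by linarith [hs.1]⟩
  rw [hF.wPhi_reflect, hF.wPhi_reflect, neg_neg, wPhi_neg_one] at this
  linarith

end BalancedDoubleWell

end potential

/-! ### Functions of two variables -/

section calculus

/-- Joint `Cⁿ` regularity of a curried function of two variables. -/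
def Sm (n : ℕ) (v : ℝ → ℝ → ℝ) : Prop := ContDiff ℝ n (fun p : ℝ × ℝ => v p.1 p.2)

variable {v w : ℝ → ℝ → ℝ} {n : ℕ}

namespace Sm

lemma mono {m : ℕ} (h : Sm n v) (hm : m ≤ n) : Sm m v :=
  ContDiff.of_le h (by exact_mod_cast hm)

lemma continuous (h : Sm n v) : Continuous (fun p : ℝ × ℝ => v p.1 p.2) := ContDiff.continuous h

lemma continuous_comp (h : Sm n v) {f g : ℝ → ℝ} (hf : Continuous f) (hg : Continuous g) :
    Continuous (fun t => v (f t) (g t)) := h.continuous.comp (hf.prodMk hg)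

lemma continuous_x (h : Sm n v) (y : ℝ) : Continuous (fun t => v t y) :=
  h.continuous_comp continuous_id continuous_const

lemma continuous_y (h : Sm n v) (x : ℝ) : Continuous (fun t => v x t) :=
  h.continuous_comp continuous_const continuous_id

lemma differentiable (h : Sm (n + 1) v) : Differentiable ℝ (fun p : ℝ × ℝ => v p.1 p.2) :=
  ContDiff.differentiable h (by norm_cast)

lemma hasDerivAt_comp (h : Sm (n + 1) v) {f g : ℝ → ℝ} {t f' g' : ℝ} (hf : HasDerivAt f f' t)
    (hg : HasDerivAt g g' t) : HasDerivAt (fun t => v (f t) (g t))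
      (fderiv ℝ (fun p : ℝ × ℝ => v p.1 p.2) (f t, g t) (f', g')) t :=
  HasFDerivAt.comp_hasDerivAt (l := fun p : ℝ × ℝ => v p.1 p.2) t
    ((h.differentiable (f t, g t)).hasFDerivAt) (hf.prodMk hg)

lemma pdx_eq (h : Sm (n + 1) v) (x y : ℝ) :
    pdx v x y = fderiv ℝ (fun p : ℝ × ℝ => v p.1 p.2) (x, y) (1, 0) :=
  (h.hasDerivAt_comp (hasDerivAt_id x) (hasDerivAt_const x y)).deriv

lemma pdy_eq (h : Sm (n + 1) v) (x y : ℝ) :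
    pdy v x y = fderiv ℝ (fun p : ℝ × ℝ => v p.1 p.2) (x, y) (0, 1) :=
  (h.hasDerivAt_comp (hasDerivAt_const y x) (hasDerivAt_id y)).deriv

lemma hasDerivAt_x (h : Sm (n + 1) v) (x y : ℝ) : HasDerivAt (fun t => v t y) (pdx v x y) x := by
  rw [h.pdx_eq]; exact h.hasDerivAt_comp (hasDerivAt_id x) (hasDerivAt_const x y)

lemma hasDerivAt_y (h : Sm (n + 1) v) (x y : ℝ) : HasDerivAt (fun t => v x t) (pdy v x y) y := by
  rw [h.pdy_eq]; exact h.hasDerivAt_comp (hasDerivAt_const y x) (hasDerivAt_id y)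

/-- Chain rule along a curve. -/
lemma chain (h : Sm (n + 1) v) {f g : ℝ → ℝ} {t f' g' : ℝ} (hf : HasDerivAt f f' t)
    (hg : HasDerivAt g g' t) : HasDerivAt (fun t => v (f t) (g t))
      (pdx v (f t) (g t) * f' + pdy v (f t) (g t) * g') t := by
  refine (h.hasDerivAt_comp hf hg).congr_deriv ?_
  rw [h.pdx_eq, h.pdy_eq]
  have : ((f', g') : ℝ × ℝ) = f' • (1, 0) + g' • (0, 1) := by simp
  rw [this, map_add, map_smul, map_smul, smul_eq_mul, smul_eq_mul]; ring

lemma fderiv_contDiff (h : Sm (n + 1) v) :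
    ContDiff ℝ n (fderiv ℝ (fun p : ℝ × ℝ => v p.1 p.2)) :=
  ContDiff.fderiv_right (m := n) h (by norm_cast)

lemma dx (h : Sm (n + 1) v) : Sm n (pdx v) := by
  have : (fun p : ℝ × ℝ => pdx v p.1 p.2) =
      fun p => fderiv ℝ (fun p : ℝ × ℝ => v p.1 p.2) p (1, 0) := by
    funext p; exact h.pdx_eq p.1 p.2
  unfold Sm; rw [this]
  exact h.fderiv_contDiff.clm_apply contDiff_const

lemma dy (h : Sm (n + 1) v) : Sm n (pdy v) := by
  have : (fun p : ℝ × ℝ => pdy v p.1 p.2) =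
      fun p => fderiv ℝ (fun p : ℝ × ℝ => v p.1 p.2) p (0, 1) := by
    funext p; exact h.pdy_eq p.1 p.2
  unfold Sm; rw [this]
  exact h.fderiv_contDiff.clm_apply contDiff_const

lemma pdx_pdy (h : Sm 2 v) (x y : ℝ) :
    pdx (pdy v) x y = pdy (pdx v) x y := by
  set f := fun p : ℝ × ℝ => v p.1 p.2 with hf
  have hd : Differentiable ℝ (fderiv ℝ f) :=
    (h.fderiv_contDiff (n := 1)).differentiable (by norm_num)
  have e1 : pdx (pdy v) x y = fderiv ℝ (fderiv ℝ f) (x, y) (1, 0) (0, 1) := by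
    have : HasDerivAt (fun t => fderiv ℝ f (t, y) (0, 1))
        (fderiv ℝ (fderiv ℝ f) (x, y) (1, 0) (0, 1)) x := by
      have h1 := (hd (x, y)).hasFDerivAt.comp_hasDerivAt x
        ((hasDerivAt_id x).prodMk (hasDerivAt_const x y))
      simpa using h1.clm_apply (hasDerivAt_const x ((0, 1) : ℝ × ℝ))
    have h2 : (fun t => pdy v t y) = fun t => fderiv ℝ f (t, y) (0, 1) := by
      funext t; exact h.pdy_eq t y
    unfold pdx; rw [h2]; exact this.deriv
  have e2 : pdy (pdx v) x y = fderiv ℝ (fderiv ℝ f) (x, y) (0, 1) (1, 0) := by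
    have : HasDerivAt (fun t => fderiv ℝ f (x, t) (1, 0))
        (fderiv ℝ (fderiv ℝ f) (x, y) (0, 1) (1, 0)) y := by
      have h1 := (hd (x, y)).hasFDerivAt.comp_hasDerivAt y
        ((hasDerivAt_const y x).prodMk (hasDerivAt_id y))
      simpa using h1.clm_apply (hasDerivAt_const y ((1, 0) : ℝ × ℝ))
    have h2 : (fun t => pdx v x t) = fun t => fderiv ℝ f (x, t) (1, 0) := by
      funext t; exact h.pdx_eq x t
    unfold pdy; rw [h2]; exact this.deriv
  rw [e1, e2]
  have hs : IsSymmSndFDerivAt ℝ f (x, y) :=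
    (ContDiff.contDiffAt h).isSymmSndFDerivAt (by simp [minSmoothness_of_isRCLikeNormedField])
  exact hs (1, 0) (0, 1)

lemma comp₂ (h : Sm n v) {f g : ℝ × ℝ → ℝ} (hf : ContDiff ℝ n f) (hg : ContDiff ℝ n g) :
    ContDiff ℝ n (fun p => v (f p) (g p)) := ContDiff.comp h (hf.prodMk hg)

lemma swap (h : Sm n v) : Sm n (fun x y => v y x) := h.comp₂ contDiff_snd contDiff_fst

lemma reflect (h : Sm n v) : Sm n (fun x y => v (-x) y) := h.comp₂ contDiff_fst.neg contDiff_snd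

end Sm

/-- Second derivative test at a local maximum. -/
lemma deriv_test {f f' : ℝ → ℝ} {f'' x : ℝ} (h1 : ∀ t, HasDerivAt f (f' t) t)
    (h2 : HasDerivAt f' f'' x) (hm : IsLocalMax f x) : f' x = 0 ∧ f'' ≤ 0 := by
  have h0 : f' x = 0 := hm.hasDerivAt_eq_zero (h1 x)
  refine ⟨h0, ?_⟩
  by_contra! hpos
  have hd : deriv f = f' := by funext t; exact (h1 t).deriv
  have hmin : IsLocalMin f x := isLocalMin_of_deriv_deriv_pos
    (by rw [hd, h2.deriv]; exact hpos) (by rw [hd]; exact h0) (h1 x).continuousAt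
  have hc : ∀ᶠ t in 𝓝 x, f t = f x := by
    filter_upwards [hm, hmin] with t a b using le_antisymm a b
  have hz : ∀ᶠ t in 𝓝 x, f' t = 0 := by
    filter_upwards [hc.eventually_nhds] with t ht
    have e : f =ᶠ[𝓝 t] fun _ => f x := ht
    have := (h1 t).deriv
    rw [e.deriv_eq] at this
    simpa using this.symm
  have : f'' = 0 := by
    have e : f' =ᶠ[𝓝 x] fun _ => 0 := hz
    rw [← h2.deriv, e.deriv_eq]; simp
  linarith

lemma HasDerivAt.nonneg_of_right {h : ℝ → ℝ} {h' a b : ℝ} (hd : HasDerivAt h h' a) (hab : a < b)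
    (hp : ∀ x ∈ Ioo a b, h a ≤ h x) : 0 ≤ h' := by
  have ht := hd.hasDerivWithinAt (s := Ioi a)
  rw [hasDerivWithinAt_iff_tendsto_slope' (by simp)] at ht
  refine ge_of_tendsto ht ?_
  filter_upwards [Ioo_mem_nhdsGT hab] with x hx
  rw [slope_def_field]
  exact div_nonneg (by linarith [hp x hx]) (by linarith [hx.1])

/-- Interior gradient estimate for the Laplacian. -/
lemma grad_est_x (h : Sm 2 w) {x0 y0 M A : ℝ} (hM : 0 < M)
    (hw : ∀ x y, |x - x0| ≤ 1 → |y - y0| ≤ 1 → |w x y| ≤ M)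
    (hA : ∀ x y, |x - x0| ≤ 1 → |y - y0| ≤ 1 → |pdx (pdx w) x y + pdy (pdy w) x y| ≤ A) :
    pdx w x0 y0 ≤ 5 * M + 2 * A := by
  have hA0 : 0 ≤ A := (abs_nonneg _).trans (hA x0 y0 (by simp) (by simp))
  set K := 2 * M + A with hK
  have hxx := fun x y => (h.dx (n := 1)).hasDerivAt_x (n := 0) x y
  have hyy := fun x y => (h.dy (n := 1)).hasDerivAt_y (n := 0) x y
  have hx := fun x y => h.hasDerivAt_x (n := 1) x y
  have hy := fun x y => h.hasDerivAt_y (n := 1) x y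
  set z : ℝ → ℝ → ℝ := fun x y => (w (x0 + x) (y0 + y) - w (x0 - x) (y0 + y)) / 2
    - (M * (y ^ 2 + x) + K * (2 * x - x ^ 2)) with hz
  have zc : Continuous (fun p : ℝ × ℝ => z p.1 p.2) := by
    have c1 := h.continuous.comp (f := fun p : ℝ × ℝ => (x0 + p.1, y0 + p.2)) (by fun_prop)
    have c2 := h.continuous.comp (f := fun p : ℝ × ℝ => (x0 - p.1, y0 + p.2)) (by fun_prop)
    exact ((c1.sub c2).div_const 2).sub (by fun_prop)
  have key : ∀ x ∈ Icc (0 : ℝ) 1, ∀ y ∈ Icc (-1 : ℝ) 1, z x y ≤ 0 := by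
    by_contra! hcon
    obtain ⟨x1, hx1, y1, hy1, hpos⟩ := hcon
    obtain ⟨⟨xm, ym⟩, hm, hmax⟩ := (isCompact_Icc.prod isCompact_Icc).exists_isMaxOn
      (⟨(x1, y1), ⟨hx1, hy1⟩⟩ : (Icc (0 : ℝ) 1 ×ˢ Icc (-1 : ℝ) 1).Nonempty) zc.continuousOn
    obtain ⟨⟨hm1, hm2⟩, hm3, hm4⟩ := hm
    simp only at hm1 hm2 hm3 hm4
    have hzp : 0 < z xm ym := hpos.trans_le (hmax (⟨hx1, hy1⟩ : (x1, y1) ∈ _ ×ˢ _))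
    have b1 := abs_le.1 (hw (x0 + xm) (y0 + ym) (by simp [abs_le]; constructor <;> linarith)
      (by simp [abs_le]; constructor <;> linarith))
    have b2 := abs_le.1 (hw (x0 - xm) (y0 + ym) (by simp [abs_le]; constructor <;> linarith)
      (by simp [abs_le]; constructor <;> linarith))
    have a1 := abs_le.1 (hA (x0 + xm) (y0 + ym) (by simp [abs_le]; constructor <;> linarith)
      (by simp [abs_le]; constructor <;> linarith))
    have a2 := abs_le.1 (hA (x0 - xm) (y0 + ym) (by simp [abs_le]; constructor <;> linarith)
      (by simp [abs_le]; constructor <;> linarith))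
    have hK0 : 0 < K := by positivity
    have i1 : 0 < xm := by
      rcases hm1.eq_or_lt with e | e
      · exfalso; rw [← e] at hzp; simp [hz] at hzp
        nlinarith [mul_nonneg hM.le (sq_nonneg ym)]
      · exact e
    have i0 : (M * (ym ^ 2 + xm) + K * (2 * xm - xm ^ 2)) < M := by
      simp only [hz] at hzp; linarith [b1.2, b2.1]
    have i2 : xm < 1 := by
      rcases hm2.eq_or_lt with e | e
      · exfalso; rw [e] at i0
        nlinarith [mul_nonneg hM.le (sq_nonneg ym)]
      · exact e
    have q0 : 0 ≤ K * (2 * xm - xm ^ 2) := mul_nonneg hK0.le (by nlinarith)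
    have i3 : ym < 1 := by
      rcases hm4.eq_or_lt with e | e
      · exfalso; rw [e] at i0; nlinarith
      · exact e
    have i4 : -1 < ym := by
      rcases hm3.eq_or_lt with e | e
      · exfalso; rw [← e] at i0; nlinarith
      · exact e
    have lm : IsLocalMax (fun p : ℝ × ℝ => z p.1 p.2) (xm, ym) :=
      hmax.isLocalMax (prod_mem_nhds (Icc_mem_nhds i1 i2) (Icc_mem_nhds i4 i3))
    have mx : IsLocalMax (fun t => z t ym) xm :=
      ((Continuous.prodMk_left ym).tendsto xm).eventually lm
    have my : IsLocalMax (fun t => z xm t) ym :=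
      ((Continuous.prodMk_right xm).tendsto ym).eventually lm
    have dx : ∀ t, HasDerivAt (fun t => z t ym) ((pdx w (x0 + t) (y0 + ym) +
        pdx w (x0 - t) (y0 + ym)) / 2 - (M + K * (2 - 2 * t))) t := by
      intro t
      have e1 := (hx (x0 + t) (y0 + ym)).comp_const_add x0 t
      have e2 := (hx (x0 - t) (y0 + ym)).comp_const_sub x0 t
      have e3 := (((hasDerivAt_id t).const_add (ym ^ 2)).const_mul M).add
        ((((hasDerivAt_id t).const_mul 2).sub ((hasDerivAt_id t).pow 2)).const_mul K)
      exact (((e1.sub e2).div_const 2).sub e3).congr_deriv (by simp)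
    have dxx : HasDerivAt (fun t => (pdx w (x0 + t) (y0 + ym) +
        pdx w (x0 - t) (y0 + ym)) / 2 - (M + K * (2 - 2 * t)))
        ((pdx (pdx w) (x0 + xm) (y0 + ym) - pdx (pdx w) (x0 - xm) (y0 + ym)) / 2 + 2 * K) xm := by
      have e1 := (hxx (x0 + xm) (y0 + ym)).comp_const_add x0 xm
      have e2 := (hxx (x0 - xm) (y0 + ym)).comp_const_sub x0 xm
      have e3 := ((((hasDerivAt_id xm).const_mul 2).const_sub 2).const_mul K).const_add M
      exact (((e1.add e2).div_const 2).sub e3).congr_deriv (by simp; ring)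
    have dy : ∀ t, HasDerivAt (fun t => z xm t) ((pdy w (x0 + xm) (y0 + t) -
        pdy w (x0 - xm) (y0 + t)) / 2 - M * (2 * t)) t := by
      intro t
      have e1 := (hy (x0 + xm) (y0 + t)).comp_const_add y0 t
      have e2 := (hy (x0 - xm) (y0 + t)).comp_const_add y0 t
      have e3 := ((((hasDerivAt_id t).pow 2).add_const xm).const_mul M).add_const
        (K * (2 * xm - xm ^ 2))
      exact (((e1.sub e2).div_const 2).sub e3).congr_deriv (by simp)
    have dyy : HasDerivAt (fun t => (pdy w (x0 + xm) (y0 + t) -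
        pdy w (x0 - xm) (y0 + t)) / 2 - M * (2 * t))
        ((pdy (pdy w) (x0 + xm) (y0 + ym) - pdy (pdy w) (x0 - xm) (y0 + ym)) / 2 - M * 2) ym := by
      have e1 := (hyy (x0 + xm) (y0 + ym)).comp_const_add y0 ym
      have e2 := (hyy (x0 - xm) (y0 + ym)).comp_const_add y0 ym
      have e3 := ((hasDerivAt_id ym).const_mul 2).const_mul M
      exact (((e1.sub e2).div_const 2).sub e3).congr_deriv (by simp)
    have c1 := (deriv_test dx dxx mx).2
    have c2 := (deriv_test dy dyy my).2
    linarith [a1.1, a2.2]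
  have hd : HasDerivAt (fun x => (M + 2 * K) * x - (w (x0 + x) y0 - w (x0 - x) y0) / 2)
      (M + 2 * K - pdx w x0 y0) 0 := by
    have e1 := (hx (x0 + 0) y0).comp_const_add x0 0
    have e2 := (hx (x0 - 0) y0).comp_const_sub x0 0
    have e3 := (hasDerivAt_id (0 : ℝ)).const_mul (M + 2 * K)
    exact (e3.sub ((e1.sub e2).div_const 2)).congr_deriv (by simp)
  have := hd.nonneg_of_right (b := 1) one_pos (fun x hx => by
    have := key x ⟨hx.1.le, hx.2.le⟩ 0 (by norm_num)
    simp only [hz, add_zero] at this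
    simp only [mul_zero, add_zero, sub_zero, sub_self, zero_div]
    nlinarith [mul_nonneg (show 0 ≤ K by positivity) (sq_nonneg x)])
  linarith

lemma grad_est_abs (h : Sm 2 w) {x0 y0 M A : ℝ} (hM : 0 < M)
    (hw : ∀ x y, |x - x0| ≤ 1 → |y - y0| ≤ 1 → |w x y| ≤ M)
    (hA : ∀ x y, |x - x0| ≤ 1 → |y - y0| ≤ 1 → |pdx (pdx w) x y + pdy (pdy w) x y| ≤ A) :
    |pdx w x0 y0| ≤ 5 * M + 2 * A ∧ |pdy w x0 y0| ≤ 5 * M + 2 * A := by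
  have neg : ∀ w : ℝ → ℝ → ℝ, ∀ x y, pdx (fun x y => - w x y) x y = - pdx w x y := by
    intro w x y; simp [pdx]
  have neg' : ∀ w : ℝ → ℝ → ℝ, ∀ x y, pdy (fun x y => - w x y) x y = - pdy w x y := by
    intro w x y; simp [pdy]
  have main : ∀ w : ℝ → ℝ → ℝ, Sm 2 w → ∀ x0 y0,
      (∀ x y, |x - x0| ≤ 1 → |y - y0| ≤ 1 → |w x y| ≤ M) →
      (∀ x y, |x - x0| ≤ 1 → |y - y0| ≤ 1 → |pdx (pdx w) x y + pdy (pdy w) x y| ≤ A) →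
      |pdx w x0 y0| ≤ 5 * M + 2 * A := by
    intro w h x0 y0 hw hA
    refine abs_le.2 ⟨?_, grad_est_x h hM hw hA⟩
    have := grad_est_x (w := fun x y => - w x y) (ContDiff.neg h) hM (x0 := x0) (y0 := y0) (A := A)
      (by simpa using hw) (by
        intro x y h1 h2
        have e1 : pdx (fun x y => - w x y) = fun x y => - pdx w x y := by
          funext x y; exact neg w x y
        have e2 : pdy (fun x y => - w x y) = fun x y => - pdy w x y := by
          funext x y; exact neg' w x y
        rw [e1, e2, neg, neg', ← neg_add, abs_neg]
        exact hA x y h1 h2)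
    rw [neg] at this; linarith
  refine ⟨main w h x0 y0 hw hA, ?_⟩
  exact main (fun x y => w y x) h.swap y0 x0 (fun x y h1 h2 => hw y x h2 h1)
    (fun x y h1 h2 => by rw [add_comm]; exact hA y x h2 h1)

/-- Interior gradient estimate for `Δ + c ∂y`. -/
lemma exists_grad_est (c : ℝ) : ∃ C, 0 < C ∧ ∀ w : ℝ → ℝ → ℝ, Sm 2 w → ∀ x0 y0 M : ℝ, 0 < M →
    (∀ x y, |x - x0| ≤ 1 → |y - y0| ≤ 1 → |w x y| ≤ M) →
    (∀ x y, |x - x0| ≤ 1 → |y - y0| ≤ 1 →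
      |pdx (pdx w) x y + pdy (pdy w) x y + c * pdy w x y| ≤ M) →
    |pdx w x0 y0| ≤ C * M ∧ |pdy w x0 y0| ≤ C * M := by
  set E := Real.exp (|c| / 2) with hE
  have hE0 : 0 < E := Real.exp_pos _
  refine ⟨E * (7 + c ^ 2) + |c| , by positivity, fun w h x0 y0 M hM hw hA => ?_⟩
  set W : ℝ → ℝ → ℝ := fun x y => Real.exp (c / 2 * (y - y0)) * w x y with hW
  have hWs : Sm 2 W := by
    unfold Sm; simp only [hW]
    exact ContDiff.mul (by fun_prop) h
  have ed : ∀ y, HasDerivAt (fun y => Real.exp (c / 2 * (y - y0)))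
      (c / 2 * Real.exp (c / 2 * (y - y0))) y := by
    intro y
    have := ((((hasDerivAt_id y).sub_const y0).const_mul (c / 2))).exp
    exact this.congr_deriv (by simp; ring)
  have Wx : pdx W = fun x y => Real.exp (c / 2 * (y - y0)) * pdx w x y := by
    funext x y; exact ((h.hasDerivAt_x (n := 1) x y).const_mul _).deriv
  have Wxx : pdx (pdx W) = fun x y => Real.exp (c / 2 * (y - y0)) * pdx (pdx w) x y := by
    rw [Wx]; funext x y
    exact (((h.dx (n := 1)).hasDerivAt_x (n := 0) x y).const_mul _).deriv
  have Wy : pdy W = fun x y => Real.exp (c / 2 * (y - y0)) * (pdy w x y + c / 2 * w x y) := by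
    funext x y; exact (((ed y).mul (h.hasDerivAt_y (n := 1) x y)).congr_deriv (by ring)).deriv
  have Wyy : pdy (pdy W) = fun x y => Real.exp (c / 2 * (y - y0)) *
      (pdy (pdy w) x y + c * pdy w x y + c ^ 2 / 4 * w x y) := by
    rw [Wy]; funext x y
    exact (((ed y).mul (((h.dy (n := 1)).hasDerivAt_y (n := 0) x y).add
      ((h.hasDerivAt_y (n := 1) x y).const_mul (c / 2)))).congr_deriv (by
        simp only [Pi.add_apply]; ring)).deriv
  have hexp : ∀ y, |y - y0| ≤ 1 → Real.exp (c / 2 * (y - y0)) ≤ E := by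
    intro y hy
    apply Real.exp_le_exp.2
    calc c / 2 * (y - y0) ≤ |c / 2 * (y - y0)| := le_abs_self _
      _ = |c| / 2 * |y - y0| := by rw [abs_mul, abs_div]; simp
      _ ≤ |c| / 2 * 1 := by gcongr
      _ = |c| / 2 := by ring
  have B := grad_est_abs hWs (x0 := x0) (y0 := y0) (M := E * M) (A := E * (M + c ^ 2 / 4 * M))
    (by positivity) (fun x y h1 h2 => by
      simp only [hW]; rw [abs_mul, abs_of_pos (Real.exp_pos _)]
      exact mul_le_mul (hexp y h2) (hw x y h1 h2) (abs_nonneg _) hE0.le) (fun x y h1 h2 => by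
      rw [Wxx, Wyy]; simp only
      rw [← mul_add, abs_mul, abs_of_pos (Real.exp_pos _)]
      refine mul_le_mul (hexp y h2) ?_ (abs_nonneg _) hE0.le
      have e1 := hA x y h1 h2
      have e2 : |c ^ 2 / 4 * w x y| ≤ c ^ 2 / 4 * M := by
        rw [abs_mul, abs_of_nonneg (by positivity)]; have := hw x y h1 h2; gcongr
      calc _ = |(pdx (pdx w) x y + pdy (pdy w) x y + c * pdy w x y) + c ^ 2 / 4 * w x y| := by
            congr 1; ring
        _ ≤ _ := (abs_add_le _ _).trans (add_le_add e1 e2))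
  rw [Wx, Wy] at B
  simp only [sub_self, mul_zero, Real.exp_zero, one_mul] at B
  have e3 : 5 * (E * M) + 2 * (E * (M + c ^ 2 / 4 * M)) ≤ E * (7 + c ^ 2) * M := by
    have : 0 ≤ E * c ^ 2 * M := by positivity
    nlinarith
  have e4 : |c / 2 * w x0 y0| ≤ |c| * M := by
    rw [abs_mul, abs_div]
    have := hw x0 y0 (by simp) (by simp)
    have h2 : |(2 : ℝ)| = 2 := by norm_num
    rw [h2]
    have := mul_le_mul_of_nonneg_left this (abs_nonneg c)
    have := mul_nonneg (abs_nonneg c) hM.le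
    nlinarith
  refine ⟨?_, ?_⟩
  · have := mul_nonneg (abs_nonneg c) hM.le
    linarith [B.1]
  · have : |pdy w x0 y0| ≤ |pdy w x0 y0 + c / 2 * w x0 y0| + |c / 2 * w x0 y0| := by
      have := abs_sub (pdy w x0 y0 + c / 2 * w x0 y0) (c / 2 * w x0 y0)
      simpa using this
    linarith [B.2]

end calculus

/-! ### Basic properties of waves and the Modica estimate -/

section modica

/-- Bundled hypotheses: a balanced potential, a positive speed and a traveling wave. -/
structure Wave (F : ℝ → ℝ) (c : ℝ) (u : ℝ → ℝ → ℝ) : Prop where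
  hF : BalancedDoubleWell F
  hc : 0 < c
  hu : IsTravelingWave F c u

variable {F : ℝ → ℝ} {c : ℝ} {u : ℝ → ℝ → ℝ}

namespace Wave

lemma sm (W : Wave F c u) : Sm 3 u := by
  have := W.hu.1.1; unfold Sm; exact_mod_cast this

lemma smx (W : Wave F c u) : Sm 2 (pdx u) := W.sm.dx
lemma smy (W : Wave F c u) : Sm 2 (pdy u) := W.sm.dy
lemma smxx (W : Wave F c u) : Sm 1 (pdx (pdx u)) := W.smx.dx
lemma smyx (W : Wave F c u) : Sm 1 (pdy (pdx u)) := W.smx.dy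
lemma smxy (W : Wave F c u) : Sm 1 (pdx (pdy u)) := W.smy.dx
lemma smyy (W : Wave F c u) : Sm 1 (pdy (pdy u)) := W.smy.dy

lemma pde (W : Wave F c u) (x y : ℝ) :
    pdx (pdx u) x y + pdy (pdy u) x y + c * pdy u x y = deriv F (u x y) := W.hu.1.2.1 x y

lemma uy_pos (W : Wave F c u) (x y : ℝ) : 0 < pdy u x y := W.hu.1.2.2.2 x y

lemma strictMono (W : Wave F c u) (x : ℝ) : StrictMono (fun y => u x y) :=
  strictMono_of_hasDerivAt_pos (fun y => W.sm.hasDerivAt_y x y) (W.uy_pos x)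

lemma lt_one (W : Wave F c u) (x y : ℝ) : u x y < 1 :=
  (W.strictMono x (lt_add_one y)).trans_le (abs_le.1 (W.hu.1.2.2.1 x (y + 1))).2

lemma neg_one_lt (W : Wave F c u) (x y : ℝ) : -1 < u x y :=
  (abs_le.1 (W.hu.1.2.2.1 x (y - 1))).1.trans_lt (W.strictMono x (sub_one_lt y))

lemma mem (W : Wave F c u) (x y : ℝ) : u x y ∈ Ioo (-1 : ℝ) 1 := ⟨W.neg_one_lt x y, W.lt_one x y⟩

lemma mem' (W : Wave F c u) (x y : ℝ) : u x y ∈ Icc (-1 : ℝ) 1 := Ioo_subset_Icc_self (W.mem x y)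

lemma F_pos (W : Wave F c u) (x y : ℝ) : 0 < F (u x y) :=
  W.hF.pos (W.neg_one_lt x y) (W.lt_one x y)

lemma a_pos (W : Wave F c u) (x y : ℝ) : 0 < wa F (u x y) := W.hF.wa_pos (W.mem x y)

lemma pdyx (W : Wave F c u) : pdy (pdx u) = pdx (pdy u) := by
  funext x y; exact ((W.sm.mono (by norm_num)).pdx_pdy x y).symm

lemma reflect (W : Wave F c u) : Wave F c (fun x y => u (-x) y) := by
  have h1 : pdx (fun x y => u (-x) y) = fun x y => - pdx u (-x) y := by
    funext x y; exact deriv_comp_neg (fun t => u t y) x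
  have h2 : pdxx (fun x y => u (-x) y) = fun x y => pdxx u (-x) y := by
    funext x y; unfold pdxx; rw [h1]
    have := deriv_comp_neg (fun t => - pdx u t y) x
    rw [this, deriv.fun_neg, neg_neg]
  refine ⟨W.hF, W.hc, ⟨?_, ?_, ?_, ?_⟩, ?_, ?_⟩
  · have := W.sm.reflect; unfold Sm at this; exact_mod_cast this
  · intro x y; rw [h2]; exact W.hu.1.2.1 (-x) y
  · intro x y; exact W.hu.1.2.2.1 (-x) y
  · intro x y; exact W.hu.1.2.2.2 (-x) y
  · intro x; exact W.hu.2.1 (-x)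
  · intro x; exact W.hu.2.2 (-x)

lemma pdx_reflect (u : ℝ → ℝ → ℝ) :
    pdx (fun x y => u (-x) y) = fun x y => - pdx u (-x) y := by
  funext x y; exact deriv_comp_neg (fun t => u t y) x

lemma pdy_reflect (u : ℝ → ℝ → ℝ) :
    pdy (fun x y => u (-x) y) = fun x y => pdy u (-x) y := rfl

lemma pde_y (W : Wave F c u) (x y : ℝ) :
    pdx (pdx (pdy u)) x y + pdy (pdy (pdy u)) x y + c * pdy (pdy u) x y
      = deriv (deriv F) (u x y) * pdy u x y := by
  have e1 : HasDerivAt (fun t => pdx (pdx u) x t + pdy (pdy u) x t + c * pdy u x t)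
      (pdx (pdx (pdy u)) x y + pdy (pdy (pdy u)) x y + c * pdy (pdy u) x y) y := by
    have h1 := W.smxx.hasDerivAt_y x y
    rw [← W.smx.pdx_pdy x y, W.pdyx] at h1
    exact (h1.add (W.smyy.hasDerivAt_y x y)).add ((W.smy.hasDerivAt_y x y).const_mul c)
  have e2 : HasDerivAt (fun t => deriv F (u x t)) (deriv (deriv F) (u x y) * pdy u x y) y :=
    (W.hF.hasDerivAt_deriv (u x y)).comp y (W.sm.hasDerivAt_y x y)
  have : (fun t => pdx (pdx u) x t + pdy (pdy u) x t + c * pdy u x t) =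
      fun t => deriv F (u x t) := by funext t; exact W.pde x t
  rw [this] at e1
  exact e1.unique e2

lemma pde_x (W : Wave F c u) (x y : ℝ) :
    pdx (pdx (pdx u)) x y + pdy (pdy (pdx u)) x y + c * pdy (pdx u) x y
      = deriv (deriv F) (u x y) * pdx u x y := by
  have e1 : HasDerivAt (fun t => pdx (pdx u) t y + pdy (pdy u) t y + c * pdy u t y)
      (pdx (pdx (pdx u)) x y + pdy (pdy (pdx u)) x y + c * pdy (pdx u) x y) x := by
    have h1 := W.smyy.hasDerivAt_x x y
    rw [W.smy.pdx_pdy x y, ← W.pdyx] at h1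
    have h2 := W.smy.hasDerivAt_x x y
    rw [← W.pdyx] at h2
    exact ((W.smxx.hasDerivAt_x x y).add h1).add (h2.const_mul c)
  have e2 : HasDerivAt (fun t => deriv F (u t y)) (deriv (deriv F) (u x y) * pdx u x y) x :=
    HasDerivAt.comp (h₂ := deriv F) x (W.hF.hasDerivAt_deriv (u x y)) (W.sm.hasDerivAt_x x y)
  have : (fun t => pdx (pdx u) t y + pdy (pdy u) t y + c * pdy u t y) =
      fun t => deriv F (u t y) := by funext t; exact W.pde t y
  rw [this] at e1
  exact e1.unique e2

lemma exists_grad_bound (W : Wave F c u) : ∃ G, 0 < G ∧ ∀ x y,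
    |pdx u x y| ≤ G ∧ |pdy u x y| ≤ G := by
  obtain ⟨C, hC, H⟩ := exists_grad_est c
  obtain ⟨B, hB, hb⟩ := W.hF.exists_bound
  refine ⟨C * (1 + B), by positivity, fun x y => ?_⟩
  apply H u (W.sm.mono (by norm_num)) x y (1 + B) (by positivity)
  · intro x' y' _ _
    have := abs_lt.2 (W.mem x' y'); linarith
  · intro x' y' _ _
    rw [W.pde]; have := (hb _ (W.mem' x' y')).2.1; linarith

/-- The second derivatives `uxy`, `uyy` are controlled by `uy`. -/
lemma exists_uyy_bound (W : Wave F c u) : ∃ C, 0 < C ∧ ∀ x0 y0 M, 0 < M →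
    (∀ x y, |x - x0| ≤ 1 → |y - y0| ≤ 1 → pdy u x y ≤ M) →
    |pdx (pdy u) x0 y0| ≤ C * M ∧ |pdy (pdy u) x0 y0| ≤ C * M := by
  obtain ⟨C, hC, H⟩ := exists_grad_est c
  obtain ⟨B, hB, hb⟩ := W.hF.exists_bound
  refine ⟨C * (1 + B), by positivity, fun x0 y0 M hM h => ?_⟩
  rw [mul_assoc]
  apply H (pdy u) W.smy x0 y0 ((1 + B) * M) (by positivity)
  · intro x y h1 h2
    rw [abs_of_pos (W.uy_pos x y)]; nlinarith [h x y h1 h2]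
  · intro x y h1 h2
    rw [W.pde_y, abs_mul, abs_of_pos (W.uy_pos x y)]
    calc _ ≤ B * M := mul_le_mul (hb _ (W.mem' x y)).2.2.1 (h x y h1 h2) (W.uy_pos x y).le hB.le
      _ ≤ _ := by linarith

/-- Pointwise algebra behind the Modica estimate. -/
lemma modica_algebra {p q A B D f e L N dx dy δ c G K η r : ℝ} (hN : N = p ^ 2 + q ^ 2)
    (hx : p * A + q * B - f * p - e * p = dx) (hy : p * B + q * D - f * q - e * q = dy)
    (hs : A ^ 2 + 2 * B ^ 2 + D ^ 2 - c * dy - (f + e) * f + L * e * N - 4 * δ ≤ 0)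
    (hp : |p| ≤ G) (hq : |q| ≤ G) (hK : |f + e| ≤ K) (hdx : |dx| ≤ η) (hdy : |dy| ≤ η)
    (hη : 0 ≤ η) (hc : 0 ≤ c) (hδ : δ ≤ η) (hr : 0 ≤ r) (he : 0 ≤ e)
    (hpos : 1 ≤ f + e + L * N) (hrN : r ≤ N) :
    r * e ≤ (2 * G ^ 2 * (4 + c) + 4 * K * G) * η := by
  have hG : 0 ≤ G := (abs_nonneg p).trans hp
  have hK0 : 0 ≤ K := (abs_nonneg _).trans hK
  have hNG : N ≤ 2 * G ^ 2 := by
    have := sq_le_sq' (abs_le.1 hp).1 (abs_le.1 hp).2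
    have := sq_le_sq' (abs_le.1 hq).1 (abs_le.1 hq).2
    rw [hN]; linarith
  have hN0 : 0 ≤ N := hr.trans hrN
  have cs : (p * A + q * B) ^ 2 + (p * B + q * D) ^ 2 ≤ (A ^ 2 + 2 * B ^ 2 + D ^ 2) * N := by
    rw [hN]; nlinarith [sq_nonneg (p * B - q * A), sq_nonneg (p * D - q * B)]
  have e1 : p * A + q * B = dx + (f + e) * p := by linarith
  have e2 : p * B + q * D = dy + (f + e) * q := by linarith
  rw [e1, e2] at cs
  have cross : |(f + e) * (dx * p + dy * q)| ≤ K * (2 * G * η) := by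
    rw [abs_mul]
    refine mul_le_mul hK ?_ (abs_nonneg _) hK0
    have a1 : |dx * p| ≤ η * G := by rw [abs_mul]; exact mul_le_mul hdx hp (abs_nonneg _) hη
    have a2 : |dy * q| ≤ η * G := by rw [abs_mul]; exact mul_le_mul hdy hq (abs_nonneg _) hη
    exact (abs_add_le _ _).trans (by linarith)
  have cross' := (abs_le.1 cross).1
  have h1 : (f + e) ^ 2 * N - 2 * (K * (2 * G * η)) ≤ (A ^ 2 + 2 * B ^ 2 + D ^ 2) * N := by
    have : (dx + (f + e) * p) ^ 2 + (dy + (f + e) * q) ^ 2 =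
        dx ^ 2 + dy ^ 2 + 2 * ((f + e) * (dx * p + dy * q)) + (f + e) ^ 2 * N := by rw [hN]; ring
    nlinarith [sq_nonneg dx, sq_nonneg dy]
  have h2 : (A ^ 2 + 2 * B ^ 2 + D ^ 2) * N ≤ (c * dy + (f + e) * f - L * e * N + 4 * δ) * N :=
    mul_le_mul_of_nonneg_right (by linarith) hN0
  have h3 : (c * dy + 4 * δ) * N ≤ ((4 + c) * η) * (2 * G ^ 2) := by
    have : c * dy + 4 * δ ≤ (4 + c) * η := by
      nlinarith [mul_le_mul_of_nonneg_left ((le_abs_self dy).trans hdy) hc]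
    calc _ ≤ ((4 + c) * η) * N := mul_le_mul_of_nonneg_right this hN0
      _ ≤ _ := mul_le_mul_of_nonneg_left hNG (by positivity)
  have h4 : e * N ≤ e * (f + e + L * N) * N :=
    mul_le_mul_of_nonneg_right (le_mul_of_one_le_right he hpos) hN0
  have h5 : r * e ≤ e * N := by rw [mul_comm]; exact mul_le_mul_of_nonneg_left hrN he
  have h6 : (c * dy + (f + e) * f - L * e * N + 4 * δ) * N = (c * dy + 4 * δ) * N
    + (f + e) ^ 2 * N - e * (f + e + L * N) * N := by ring
  linarith

set_option maxHeartbeats 2000000 in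
/-- The Modica gradient bound. -/
theorem modica (W : Wave F c u) (x y : ℝ) :
    pdx u x y ^ 2 + pdy u x y ^ 2 ≤ 2 * F (u x y) := by
  by_contra! hcon
  obtain ⟨G, hG, hg⟩ := W.exists_grad_bound
  obtain ⟨B, hB, hb⟩ := W.hF.exists_bound
  obtain ⟨s, hs⟩ : ∃ s, s = (pdx u x y ^ 2 + pdy u x y ^ 2 - 2 * F (u x y)) / 4 := ⟨_, rfl⟩
  have hs0 : 0 < s := by rw [hs]; linarith
  obtain ⟨Λ, hΛ⟩ : ∃ Λ, Λ = (B + 1) / s := ⟨_, rfl⟩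
  have hΛ0 : 0 < Λ := by rw [hΛ]; positivity
  have hΛs : s * Λ = B + 1 := by rw [hΛ]; field_simp
  set κ := s * Λ * Real.exp (-(2 * Λ)) with hκ
  have hκ0 : 0 < κ := by positivity
  set K := 2 * B + 1 with hK
  set T := 2 * G ^ 2 * (4 + c) + 4 * K * G with hT
  have hc := W.hc
  have hT0 : 0 < T := by positivity
  suffices key : ∀ η, 0 < η → η ≤ 1 → s * κ ≤ T * η by
    have h1 := key (min 1 (s * κ / (2 * T))) (by positivity) (min_le_left _ _)
    have h2 : T * min 1 (s * κ / (2 * T)) ≤ T * (s * κ / (2 * T)) := by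
      gcongr; exact min_le_right _ _
    have h3 : T * (s * κ / (2 * T)) = s * κ / 2 := by field_simp
    have : 0 < s * κ := by positivity
    linarith
  intro η hη hη1
  set δ := η ^ 2 / (4 * (G ^ 2 + 1)) with hδ
  have hδ0 : 0 < δ := by positivity
  have hδG : δ * (4 * (G ^ 2 + 1)) = η ^ 2 := by rw [hδ]; field_simp
  have hδη : δ ≤ η := by nlinarith [mul_pos hδ0 (pow_pos hG 2)]
  obtain ⟨R, hR⟩ : ∃ R : ℝ → ℝ → ℝ, R = fun t r => (pdx u t r ^ 2 + pdy u t r ^ 2) / 2 - F (u t r)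
    - s * (1 - Real.exp (-Λ * (u t r + 1))) - δ * ((t - x) ^ 2 + (r - y) ^ 2) := ⟨_, rfl⟩
  have Rc : Continuous (fun p : ℝ × ℝ => R p.1 p.2) := by
    have c1 := W.smx.continuous
    have c2 := W.smy.continuous
    have c3 := W.sm.continuous
    have c4 := W.hF.continuous.comp c3
    simp only [hR]
    exact (((((c1.pow 2).add (c2.pow 2)).div_const 2).sub c4).sub (continuous_const.mul
      (continuous_const.sub (Real.continuous_exp.comp
        (continuous_const.mul (c3.add continuous_const)))))).sub (by fun_prop)
  have kpos : ∀ t r, 0 ≤ 1 - Real.exp (-Λ * (u t r + 1)) := by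
    intro t r
    have : Real.exp (-Λ * (u t r + 1)) ≤ 1 := Real.exp_le_one_iff.2
      (by nlinarith [W.neg_one_lt t r])
    linarith
  have R0 : s ≤ R x y := by
    simp only [hR, sub_self]
    have := mul_pos hs0 (Real.exp_pos (-Λ * (u x y + 1)))
    linarith
  have Rup : ∀ t r, R t r ≤ G ^ 2 - δ * ((t - x) ^ 2 + (r - y) ^ 2) := by
    intro t r
    have a1 := sq_le_sq' (abs_le.1 (hg t r).1).1 (abs_le.1 (hg t r).1).2
    have a2 := sq_le_sq' (abs_le.1 (hg t r).2).1 (abs_le.1 (hg t r).2).2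
    have a3 := mul_nonneg hs0.le (kpos t r)
    have a4 := W.F_pos t r
    simp only [hR]; linarith
  obtain ⟨ρ, hρ⟩ : ∃ ρ, ρ = √((G ^ 2 + 1) / δ) := ⟨_, rfl⟩
  have hρ0 : 0 < ρ := by rw [hρ]; positivity
  have hρ2 : δ * ρ ^ 2 = G ^ 2 + 1 := by rw [hρ, Real.sq_sqrt (by positivity)]; field_simp
  obtain ⟨⟨xm, ym⟩, hm, hmax⟩ := (isCompact_Icc.prod isCompact_Icc).exists_isMaxOn
      (⟨(x, y), ⟨⟨by linarith, by linarith⟩, ⟨by linarith, by linarith⟩⟩⟩ :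
        (Icc (x - ρ) (x + ρ) ×ˢ Icc (y - ρ) (y + ρ)).Nonempty) Rc.continuousOn
  obtain ⟨⟨hm1, hm2⟩, hm3, hm4⟩ := hm
  simp only at hm1 hm2 hm3 hm4
  have Rm : s ≤ R xm ym := R0.trans (hmax (⟨⟨by linarith, by linarith⟩,
    ⟨by linarith, by linarith⟩⟩ : (x, y) ∈ Icc (x - ρ) (x + ρ) ×ˢ Icc (y - ρ) (y + ρ)))
  have dist : δ * ((xm - x) ^ 2 + (ym - y) ^ 2) ≤ G ^ 2 := by linarith [Rup xm ym]
  have hlt : ∀ t, (δ * t ^ 2 ≤ G ^ 2) → |t| < ρ := by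
    intro t ht
    apply abs_lt_of_sq_lt_sq _ hρ0.le
    have : δ * t ^ 2 < δ * ρ ^ 2 := by linarith
    exact lt_of_mul_lt_mul_left this hδ0.le
  have distx : δ * (xm - x) ^ 2 ≤ G ^ 2 := by
    linarith [mul_nonneg hδ0.le (sq_nonneg (ym - y))]
  have disty : δ * (ym - y) ^ 2 ≤ G ^ 2 := by
    linarith [mul_nonneg hδ0.le (sq_nonneg (xm - x))]
  have ix := abs_lt.1 (hlt (xm - x) distx)
  have iy := abs_lt.1 (hlt (ym - y) disty)
  have lm : IsLocalMax (fun p : ℝ × ℝ => R p.1 p.2) (xm, ym) :=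
    hmax.isLocalMax (prod_mem_nhds (Icc_mem_nhds (by linarith) (by linarith))
      (Icc_mem_nhds (by linarith) (by linarith)))
  have mx : IsLocalMax (fun t => R t ym) xm :=
    ((Continuous.prodMk_left ym).tendsto xm).eventually lm
  have my : IsLocalMax (fun t => R xm t) ym :=
    ((Continuous.prodMk_right xm).tendsto ym).eventually lm
  have ex : ∀ t, HasDerivAt (fun t => Real.exp (-Λ * (u t ym + 1)))
      (-Λ * pdx u t ym * Real.exp (-Λ * (u t ym + 1))) t := fun t =>
    ((((W.sm.hasDerivAt_x t ym).add_const 1).const_mul (-Λ)).exp).congr_deriv (by ring)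
  have ey : ∀ t, HasDerivAt (fun t => Real.exp (-Λ * (u xm t + 1)))
      (-Λ * pdy u xm t * Real.exp (-Λ * (u xm t + 1))) t := fun t =>
    ((((W.sm.hasDerivAt_y xm t).add_const 1).const_mul (-Λ)).exp).congr_deriv (by ring)
  have dx : ∀ t, HasDerivAt (fun t => R t ym) (pdx u t ym * pdx (pdx u) t ym
      + pdy u t ym * pdx (pdy u) t ym - deriv F (u t ym) * pdx u t ym
      - s * (Λ * pdx u t ym * Real.exp (-Λ * (u t ym + 1))) - δ * (2 * (t - x))) t := by
    intro t
    rw [hR]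
    have h1 := (((W.smx.hasDerivAt_x t ym).pow 2).add ((W.smy.hasDerivAt_x t ym).pow 2)).div_const 2
    have h2 := (W.hF.hasDerivAt (u t ym)).comp t (W.sm.hasDerivAt_x t ym)
    have h3 := ((ex t).const_sub 1).const_mul s
    have h4 := ((((hasDerivAt_id t).sub_const x).pow 2).add_const ((ym - y) ^ 2)).const_mul δ
    exact (((h1.sub h2).sub h3).sub h4).congr_deriv (by simp; ring)
  have dxx : HasDerivAt (fun t => pdx u t ym * pdx (pdx u) t ym
      + pdy u t ym * pdx (pdy u) t ym - deriv F (u t ym) * pdx u t ym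
      - s * (Λ * pdx u t ym * Real.exp (-Λ * (u t ym + 1))) - δ * (2 * (t - x)))
      (pdx (pdx u) xm ym ^ 2 + pdx u xm ym * pdx (pdx (pdx u)) xm ym
      + pdx (pdy u) xm ym ^ 2 + pdy u xm ym * pdx (pdx (pdy u)) xm ym
      - deriv (deriv F) (u xm ym) * pdx u xm ym ^ 2 - deriv F (u xm ym) * pdx (pdx u) xm ym
      + Λ * (s * Λ * Real.exp (-Λ * (u xm ym + 1))) * pdx u xm ym ^ 2
      - s * Λ * Real.exp (-Λ * (u xm ym + 1)) * pdx (pdx u) xm ym - 2 * δ) xm := by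
    have h1 := ((W.smx.hasDerivAt_x xm ym).mul (W.smxx.hasDerivAt_x xm ym)).add
      ((W.smy.hasDerivAt_x xm ym).mul (W.smxy.hasDerivAt_x xm ym))
    have h2 := ((W.hF.hasDerivAt_deriv (u xm ym)).comp xm (W.sm.hasDerivAt_x xm ym)).mul
      (W.smx.hasDerivAt_x xm ym)
    have h3 := ((((W.smx.hasDerivAt_x xm ym).const_mul Λ).mul (ex xm))).const_mul s
    have h4 := ((((hasDerivAt_id xm).sub_const x).const_mul 2)).const_mul δ
    exact (((h1.sub h2).sub h3).sub h4).congr_deriv (by simp; ring)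
  have dy : ∀ t, HasDerivAt (fun t => R xm t) (pdx u xm t * pdy (pdx u) xm t
      + pdy u xm t * pdy (pdy u) xm t - deriv F (u xm t) * pdy u xm t
      - s * (Λ * pdy u xm t * Real.exp (-Λ * (u xm t + 1))) - δ * (2 * (t - y))) t := by
    intro t
    rw [hR]
    have h1 := (((W.smx.hasDerivAt_y xm t).pow 2).add ((W.smy.hasDerivAt_y xm t).pow 2)).div_const 2
    have h2 := (W.hF.hasDerivAt (u xm t)).comp t (W.sm.hasDerivAt_y xm t)
    have h3 := ((ey t).const_sub 1).const_mul s
    have h4 := ((((hasDerivAt_id t).sub_const y).pow 2).const_add ((xm - x) ^ 2)).const_mul δ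
    exact (((h1.sub h2).sub h3).sub h4).congr_deriv (by simp; ring)
  have dyy : HasDerivAt (fun t => pdx u xm t * pdy (pdx u) xm t
      + pdy u xm t * pdy (pdy u) xm t - deriv F (u xm t) * pdy u xm t
      - s * (Λ * pdy u xm t * Real.exp (-Λ * (u xm t + 1))) - δ * (2 * (t - y)))
      (pdy (pdx u) xm ym ^ 2 + pdx u xm ym * pdy (pdy (pdx u)) xm ym
      + pdy (pdy u) xm ym ^ 2 + pdy u xm ym * pdy (pdy (pdy u)) xm ym
      - deriv (deriv F) (u xm ym) * pdy u xm ym ^ 2 - deriv F (u xm ym) * pdy (pdy u) xm ym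
      + Λ * (s * Λ * Real.exp (-Λ * (u xm ym + 1))) * pdy u xm ym ^ 2
      - s * Λ * Real.exp (-Λ * (u xm ym + 1)) * pdy (pdy u) xm ym - 2 * δ) ym := by
    have h1 := ((W.smx.hasDerivAt_y xm ym).mul (W.smyx.hasDerivAt_y xm ym)).add
      ((W.smy.hasDerivAt_y xm ym).mul (W.smyy.hasDerivAt_y xm ym))
    have h2 := ((W.hF.hasDerivAt_deriv (u xm ym)).comp ym (W.sm.hasDerivAt_y xm ym)).mul
      (W.smy.hasDerivAt_y xm ym)
    have h3 := ((((W.smy.hasDerivAt_y xm ym).const_mul Λ).mul (ey ym))).const_mul s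
    have h4 := ((((hasDerivAt_id ym).sub_const y).const_mul 2)).const_mul δ
    exact (((h1.sub h2).sub h3).sub h4).congr_deriv (by simp; ring)
  obtain ⟨x1, x2⟩ := deriv_test dx dxx mx
  obtain ⟨y1, y2⟩ := deriv_test dy dyy my
  have pe := W.pde xm ym
  have px := W.pde_x xm ym
  have py := W.pde_y xm ym
  rw [W.pdyx] at y1 y2 px
  obtain ⟨e, he⟩ : ∃ e, e = s * Λ * Real.exp (-Λ * (u xm ym + 1)) := ⟨_, rfl⟩
  have heκ : κ ≤ e := by
    rw [he, hκ]; gcongr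
    have := mul_le_mul_of_nonneg_left (W.lt_one xm ym).le hΛ0.le
    linarith
  have heB : e ≤ B + 1 := by
    rw [he, ← hΛs]
    have : Real.exp (-Λ * (u xm ym + 1)) ≤ 1 := by linarith [kpos xm ym]
    exact mul_le_of_le_one_right (by positivity) this
  have hf := abs_le.1 (hb _ (W.mem' xm ym)).2.1
  have hN2 : 2 * s ≤ pdx u xm ym ^ 2 + pdy u xm ym ^ 2 := by
    have a1 := W.F_pos xm ym
    have a2 := mul_nonneg hs0.le (kpos xm ym)
    have a3 : 0 ≤ δ * ((xm - x) ^ 2 + (ym - y) ^ 2) := by positivity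
    simp only [hR] at Rm; linarith
  have hN : s ≤ pdx u xm ym ^ 2 + pdy u xm ym ^ 2 := by linarith
  have hdd : ∀ t, δ * t ^ 2 ≤ G ^ 2 → |δ * (2 * t)| ≤ η := by
    intro t ht
    apply abs_le_of_sq_le_sq _ hη.le
    calc (δ * (2 * t)) ^ 2 = 4 * δ * (δ * t ^ 2) := by ring
      _ ≤ 4 * δ * G ^ 2 := by gcongr
      _ ≤ η ^ 2 := by rw [← hδG]; linarith
  have fin := modica_algebra (p := pdx u xm ym) (q := pdy u xm ym) (A := pdx (pdx u) xm ym)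
    (B := pdx (pdy u) xm ym) (D := pdy (pdy u) xm ym) (f := deriv F (u xm ym)) (e := e)
    (L := Λ) (N := pdx u xm ym ^ 2 + pdy u xm ym ^ 2) (dx := δ * (2 * (xm - x)))
    (dy := δ * (2 * (ym - y))) (δ := δ) (c := c) (G := G) (K := K) (η := η) (r := s) rfl
    (by rw [he]; linarith) (by rw [he]; linarith)
    (by
      rw [he]
      linear_combination x2 + y2 - pdx u xm ym * px - pdy u xm ym * py
        + (deriv F (u xm ym) + s * Λ * Real.exp (-Λ * (u xm ym + 1))) * pe + c * y1)
    (hg xm ym).1 (hg xm ym).2 (abs_le.2 ⟨by linarith [hf.1], by linarith [hf.2]⟩)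
    (hdd _ distx) (hdd _ disty)
    hη.le hc.le hδη hs0.le (hκ0.le.trans heκ)
    (by
      have : Λ * (2 * s) ≤ Λ * (pdx u xm ym ^ 2 + pdy u xm ym ^ 2) := by gcongr
      linarith [hf.1]) hN
  calc s * κ ≤ s * e := by gcongr
    _ ≤ T * η := fin

end Wave

end modica

/-! ### Pointwise consequences of the Modica estimate -/

section pointwise

variable {F : ℝ → ℝ} {c : ℝ} {u : ℝ → ℝ → ℝ}

namespace Wave

lemma abs_ux_le (W : Wave F c u) (x y : ℝ) : |pdx u x y| ≤ wa F (u x y) := by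
  apply Real.abs_le_sqrt; nlinarith [W.modica x y, sq_nonneg (pdy u x y)]

lemma uy_le (W : Wave F c u) (x y : ℝ) : pdy u x y ≤ wa F (u x y) := by
  apply Real.le_sqrt_of_sq_le; nlinarith [W.modica x y, sq_nonneg (pdx u x y)]

lemma a_sq (W : Wave F c u) (x y : ℝ) : wa F (u x y) ^ 2 = 2 * F (u x y) :=
  W.hF.wa_sq (W.mem' x y)

lemma hasDerivAt_a_x (W : Wave F c u) (x y : ℝ) : HasDerivAt (fun t => wa F (u t y))
    (deriv F (u x y) / wa F (u x y) * pdx u x y) x :=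
  HasDerivAt.comp (h₂ := wa F) x (W.hF.hasDerivAt_wa (W.mem x y)) (W.sm.hasDerivAt_x x y)

lemma hasDerivAt_a_y (W : Wave F c u) (x y : ℝ) : HasDerivAt (fun t => wa F (u x t))
    (deriv F (u x y) / wa F (u x y) * pdy u x y) y :=
  HasDerivAt.comp (h₂ := wa F) y (W.hF.hasDerivAt_wa (W.mem x y)) (W.sm.hasDerivAt_y x y)

lemma abs_le_of_lipschitz {f f' : ℝ → ℝ} {C : ℝ} (hd : ∀ t, HasDerivAt f (f' t) t)
    (hb : ∀ t, |f' t| ≤ C) (s t : ℝ) : |f t - f s| ≤ C * |t - s| :=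
  Convex.norm_image_sub_le_of_norm_hasDerivWithin_le (s := univ)
    (fun x _ => (hd x).hasDerivWithinAt) (fun x _ => hb x) convex_univ (mem_univ _) (mem_univ _)

/-- Harnack inequality for `a(u)`. -/
lemma exists_harnack (W : Wave F c u) : ∃ C, 0 < C ∧ ∀ x y x' y',
    wa F (u x' y') ≤ Real.exp (C * (|x' - x| + |y' - y|)) * wa F (u x y) := by
  obtain ⟨κ, C, -, hC, H⟩ := W.hF.exists_wa_bounds
  refine ⟨C, hC, fun x y x' y' => ?_⟩
  have dx : ∀ t, HasDerivAt (fun t => Real.log (wa F (u t y)))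
      (deriv F (u t y) / wa F (u t y) * pdx u t y / wa F (u t y)) t := fun t =>
    (W.hasDerivAt_a_x t y).log (W.a_pos t y).ne'
  have dy : ∀ t, HasDerivAt (fun t => Real.log (wa F (u x' t)))
      (deriv F (u x' t) / wa F (u x' t) * pdy u x' t / wa F (u x' t)) t := fun t =>
    (W.hasDerivAt_a_y x' t).log (W.a_pos x' t).ne'
  have bd : ∀ x y d, |d| ≤ wa F (u x y) →
      |deriv F (u x y) / wa F (u x y) * d / wa F (u x y)| ≤ C := by
    intro x y d hd
    have ha := W.a_pos x y
    rw [abs_div, abs_mul, abs_div, abs_of_pos ha, div_le_iff₀ ha]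
    have h1 := (H _ (W.mem' x y)).2.2
    have : |deriv F (u x y)| / wa F (u x y) ≤ C := by rwa [div_le_iff₀ ha]
    exact mul_le_mul this hd (abs_nonneg _) hC.le
  have b1 := abs_le_of_lipschitz dx (fun t => bd t y _ (W.abs_ux_le t y)) x x'
  have b2 := abs_le_of_lipschitz dy (fun t => bd x' t _
    (by rw [abs_of_pos (W.uy_pos _ _)]; exact W.uy_le x' t)) y y'
  have : Real.log (wa F (u x' y')) ≤ C * (|x' - x| + |y' - y|) + Real.log (wa F (u x y)) := by
    linarith [(abs_le.1 b1).2, (abs_le.1 b2).2]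
  have := Real.exp_le_exp.2 this
  rwa [Real.exp_add, Real.exp_log (W.a_pos _ _), Real.exp_log (W.a_pos _ _)] at this

/-- All second derivatives are controlled by `a(u)`. -/
lemma exists_second_bound (W : Wave F c u) : ∃ C, 0 < C ∧ ∀ x y,
    |pdx (pdx u) x y| ≤ C * wa F (u x y) ∧ |pdx (pdy u) x y| ≤ C * wa F (u x y) ∧
    |pdy (pdy u) x y| ≤ C * wa F (u x y) := by
  obtain ⟨C1, h1, H1⟩ := W.exists_harnack
  obtain ⟨C2, h2, H2⟩ := W.exists_uyy_bound
  obtain ⟨κ, C3, -, h3, H3⟩ := W.hF.exists_wa_bounds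
  have hc := W.hc
  have B : ∀ x y, |pdx (pdy u) x y| ≤ C2 * Real.exp (C1 * 2) * wa F (u x y) ∧
      |pdy (pdy u) x y| ≤ C2 * Real.exp (C1 * 2) * wa F (u x y) := by
    intro x y
    rw [mul_assoc]
    apply H2 x y
    · exact mul_pos (Real.exp_pos _) (W.a_pos _ _)
    · intro x' y' hx hy
      refine (W.uy_le _ _).trans ((H1 x y x' y').trans ?_)
      have := W.a_pos x y
      gcongr; linarith
  set D := C2 * Real.exp (C1 * 2) with hD
  have hD0 : 0 < D := by positivity
  refine ⟨C3 + D + c, by positivity, fun x y => ?_⟩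
  have ha := W.a_pos x y
  obtain ⟨b1, b2⟩ := B x y
  have b3 := (H3 _ (W.mem' x y)).2.2
  have b4 := W.uy_le x y
  have m1 := mul_pos h3 ha
  have m2 := mul_pos hD0 ha
  have m3 := mul_pos hc ha
  refine ⟨?_, by linarith, by linarith⟩
  have e : pdx (pdx u) x y = deriv F (u x y) - pdy (pdy u) x y - c * pdy u x y := by
    linarith [W.pde x y]
  rw [e]
  have m4 : c * pdy u x y ≤ c * wa F (u x y) := by gcongr
  have m5 : 0 < c * pdy u x y := mul_pos hc (W.uy_pos x y)
  rw [abs_le] at *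
  constructor <;> nlinarith
 
end Wave

end pointwise

/-! ### Hamiltonian identity on strips -/

section hamiltonian

variable {F : ℝ → ℝ} {c : ℝ} {u : ℝ → ℝ → ℝ}

/-- Differentiation under a finite integral with continuous integrands. -/
lemma hasDerivAt_intervalIntegral_param {f f' : ℝ → ℝ → ℝ}
    (hf : Continuous (fun p : ℝ × ℝ => f p.1 p.2)) (hf' : Continuous (fun p : ℝ × ℝ => f' p.1 p.2))
    (hd : ∀ x y, HasDerivAt (fun t => f x t) (f' x y) y) (a b y : ℝ) :
    HasDerivAt (fun y => ∫ x in a..b, f x y) (∫ x in a..b, f' x y) y := by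
  have hc : ∀ y, Continuous (fun x => f x y) := fun y => hf.comp (Continuous.prodMk_left y)
  have hc' : ∀ y, Continuous (fun x => f' x y) := fun y => hf'.comp (Continuous.prodMk_left y)
  obtain ⟨C, hC⟩ := (isCompact_uIcc (a := a) (b := b)).prod
    (isCompact_Icc (a := y - 1) (b := y + 1)) |>.exists_bound_of_continuousOn hf'.continuousOn
  refine (intervalIntegral.hasDerivAt_integral_of_dominated_loc_of_deriv_le (μ := volume)
    (F := fun y x => f x y) (F' := fun y x => f' x y) (s := Icc (y - 1) (y + 1))
    (bound := fun _ => C) (Icc_mem_nhds (by linarith) (by linarith))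
    (Eventually.of_forall fun y => (hc y).aestronglyMeasurable)
    ((hc y).intervalIntegrable _ _) (hc' y).aestronglyMeasurable ?_ ?_ ?_).2
  · exact Eventually.of_forall fun x hx t ht => hC (x, t) ⟨uIoc_subset_uIcc hx, ht⟩
  · exact intervalIntegrable_const
  · exact Eventually.of_forall fun x _ t _ => hd x t

/-- Energy density of horizontal slices. -/
noncomputable def ed (F : ℝ → ℝ) (u : ℝ → ℝ → ℝ) (x y : ℝ) : ℝ :=
  pdx u x y ^ 2 / 2 + F (u x y) - pdy u x y ^ 2 / 2

namespace Wave

lemma ed_ge (W : Wave F c u) (x y : ℝ) : pdx u x y ^ 2 ≤ ed F u x y := by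
  unfold ed; linarith [W.modica x y]

lemma ed_nonneg (W : Wave F c u) (x y : ℝ) : 0 ≤ ed F u x y := (sq_nonneg _).trans (W.ed_ge x y)

lemma ed_le (W : Wave F c u) (x y : ℝ) : ed F u x y ≤ 2 * F (u x y) := by
  unfold ed; nlinarith [W.modica x y, sq_nonneg (pdy u x y)]

lemma continuous_ux (W : Wave F c u) : Continuous (fun p : ℝ × ℝ => pdx u p.1 p.2) :=
  W.smx.continuous
lemma continuous_uy (W : Wave F c u) : Continuous (fun p : ℝ × ℝ => pdy u p.1 p.2) :=
  W.smy.continuous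
lemma continuous_Fu (W : Wave F c u) : Continuous (fun p : ℝ × ℝ => F (u p.1 p.2)) :=
  W.hF.continuous.comp W.sm.continuous

lemma continuous_au (W : Wave F c u) : Continuous (fun p : ℝ × ℝ => wa F (u p.1 p.2)) :=
  W.hF.continuous_wa.comp W.sm.continuous

lemma continuous_ed (W : Wave F c u) : Continuous (fun p : ℝ × ℝ => ed F u p.1 p.2) :=
  (((W.continuous_ux.pow 2).div_const 2).add W.continuous_Fu).sub
    ((W.continuous_uy.pow 2).div_const 2)

lemma hasDerivAt_Fu_y (W : Wave F c u) (x y : ℝ) :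
    HasDerivAt (fun t => F (u x t)) (deriv F (u x y) * pdy u x y) y :=
  HasDerivAt.comp (h₂ := F) y (W.hF.hasDerivAt (u x y)) (W.sm.hasDerivAt_y x y)

lemma hasDerivAt_Fu_x (W : Wave F c u) (x y : ℝ) :
    HasDerivAt (fun t => F (u t y)) (deriv F (u x y) * pdx u x y) x :=
  HasDerivAt.comp (h₂ := F) x (W.hF.hasDerivAt (u x y)) (W.sm.hasDerivAt_x x y)

lemma hasDerivAt_Phi_y (W : Wave F c u) (x y : ℝ) :
    HasDerivAt (fun t => wPhi F (u x t)) (wa F (u x y) * pdy u x y) y :=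
  HasDerivAt.comp (h₂ := wPhi F) y (W.hF.hasDerivAt_wPhi (u x y)) (W.sm.hasDerivAt_y x y)

lemma hasDerivAt_Phi_x (W : Wave F c u) (x y : ℝ) :
    HasDerivAt (fun t => wPhi F (u t y)) (wa F (u x y) * pdx u x y) x :=
  HasDerivAt.comp (h₂ := wPhi F) x (W.hF.hasDerivAt_wPhi (u x y)) (W.sm.hasDerivAt_x x y)

lemma hasDerivAt_ux_y (W : Wave F c u) (x y : ℝ) :
    HasDerivAt (fun t => pdx u x t) (pdx (pdy u) x y) y := by
  rw [← W.pdyx]; exact W.smx.hasDerivAt_y x y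

lemma hasDerivAt_ed_y (W : Wave F c u) (x y : ℝ) : HasDerivAt (fun t => ed F u x t)
    (pdx (pdx u) x y * pdy u x y + pdx u x y * pdx (pdy u) x y + c * pdy u x y ^ 2) y := by
  have h := ((((W.hasDerivAt_ux_y x y).pow 2).div_const 2).add (W.hasDerivAt_Fu_y x y)).sub
    (((W.smy.hasDerivAt_y x y).pow 2).div_const 2)
  refine h.congr_deriv ?_
  rw [← W.pde x y]; simp; ring

lemma hasDerivAt_flux_x (W : Wave F c u) (x y : ℝ) :
    HasDerivAt (fun t => pdx u t y * pdy u t y)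
      (pdx (pdx u) x y * pdy u x y + pdx u x y * pdx (pdy u) x y) x :=
  (W.smx.hasDerivAt_x x y).mul (W.smy.hasDerivAt_x x y)

lemma continuous_flux' (W : Wave F c u) : Continuous (fun p : ℝ × ℝ =>
    pdx (pdx u) p.1 p.2 * pdy u p.1 p.2 + pdx u p.1 p.2 * pdx (pdy u) p.1 p.2) :=
  (W.smxx.continuous.mul W.continuous_uy).add (W.continuous_ux.mul W.smxy.continuous)

lemma continuous_strip (W : Wave F c u) (a b : ℝ) :
    Continuous (fun y => ∫ x in a..b, pdy u x y ^ 2) := by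
  apply intervalIntegral.continuous_parametric_intervalIntegral_of_continuous'
    (f := fun y x => pdy u x y ^ 2)
  exact (W.continuous_uy.comp continuous_swap).pow 2

lemma hasDerivAt_energy (W : Wave F c u) (a b y : ℝ) :
    HasDerivAt (fun y => ∫ x in a..b, ed F u x y)
      (pdx u b y * pdy u b y - pdx u a y * pdy u a y + c * ∫ x in a..b, pdy u x y ^ 2) y := by
  have h := hasDerivAt_intervalIntegral_param (f := ed F u) (f' := fun x y =>
    pdx (pdx u) x y * pdy u x y + pdx u x y * pdx (pdy u) x y + c * pdy u x y ^ 2)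
    W.continuous_ed (W.continuous_flux'.add ((W.continuous_uy.pow 2).const_mul c))
    W.hasDerivAt_ed_y a b y
  refine h.congr_deriv ?_
  have c1 : Continuous (fun x => pdx (pdx u) x y * pdy u x y + pdx u x y * pdx (pdy u) x y) :=
    W.continuous_flux'.comp (Continuous.prodMk_left y)
  have c2 : Continuous (fun x => c * pdy u x y ^ 2) :=
    ((W.continuous_uy.comp (Continuous.prodMk_left y)).pow 2).const_mul c
  rw [intervalIntegral.integral_add (c1.intervalIntegrable _ _) (c2.intervalIntegrable _ _),
    intervalIntegral.integral_eq_sub_of_hasDerivAt (fun x _ => W.hasDerivAt_flux_x x y)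
      (c1.intervalIntegrable _ _), intervalIntegral.integral_const_mul]

lemma tendsto_F_zero (W : Wave F c u) (x : ℝ) : Tendsto (fun y => F (u x y)) atTop (𝓝 0) := by
  rw [← W.hF.zero_one]; exact (W.hF.continuous.tendsto 1).comp (W.hu.2.1 x)

lemma tendsto_energy (W : Wave F c u) (a b : ℝ) :
    Tendsto (fun y => ∫ x in a..b, ed F u x y) atTop (𝓝 0) := by
  obtain ⟨B, hB, hb⟩ := W.hF.exists_bound
  have := intervalIntegral.tendsto_integral_filter_of_dominated_convergence (μ := volume)
    (l := atTop) (a := a) (b := b) (F := fun y x => ed F u x y) (f := fun _ => 0)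
    (bound := fun _ => 2 * B)
    (Eventually.of_forall fun y =>
      (W.continuous_ed.comp (Continuous.prodMk_left y)).aestronglyMeasurable)
    (Eventually.of_forall fun y => Eventually.of_forall fun x _ => by
      rw [Real.norm_eq_abs, abs_of_nonneg (W.ed_nonneg x y)]
      have := le_abs_self (F (u x y))
      linarith [W.ed_le x y, (hb _ (W.mem' x y)).1])
    intervalIntegrable_const
    (Eventually.of_forall fun x _ => by
      refine squeeze_zero (fun y => W.ed_nonneg x y) (fun y => W.ed_le x y) ?_
      simpa using (W.tendsto_F_zero x).const_mul 2)
  simpa using this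

/-- The fundamental energy inequality on half strips. -/
theorem strip_ineq (W : Wave F c u) {a b Y1 Y2 : ℝ} (hab : a ≤ b) (hY : Y1 ≤ Y2) :
    c * (∫ y in Y1..Y2, ∫ x in a..b, pdy u x y ^ 2) + ∫ x in a..b, ed F u x Y1
      ≤ 2 * wPhi F 1 - wPhi F (u a Y1) - wPhi F (u b Y1) := by
  set g := fun y => ∫ x in a..b, pdy u x y ^ 2 with hg
  have gc : Continuous g := W.continuous_strip a b
  have g0 : ∀ y, 0 ≤ g y := fun y =>
    intervalIntegral.integral_nonneg hab fun x _ => sq_nonneg _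
  set h := fun y => (∫ x in a..b, ed F u x y) + wPhi F (u a y) + wPhi F (u b y)
    - c * ∫ t in Y1..y, g t with hh
  have hmono : Monotone h := by
    apply monotone_of_hasDerivAt_nonneg (f' := fun y => (pdx u b y * pdy u b y -
      pdx u a y * pdy u a y + c * g y) + wa F (u a y) * pdy u a y + wa F (u b y) * pdy u b y
      - c * g y)
    · intro y
      exact (((W.hasDerivAt_energy a b y).add (W.hasDerivAt_Phi_y a y)).add
        (W.hasDerivAt_Phi_y b y)).sub ((gc.integral_hasStrictDerivAt Y1 y).hasDerivAt.const_mul c)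
    · intro y
      have h1 := (abs_le.1 (W.abs_ux_le a y))
      have h2 := (abs_le.1 (W.abs_ux_le b y))
      have h3 := W.uy_pos a y
      have h4 := W.uy_pos b y
      have m1 := mul_nonneg (by linarith : 0 ≤ wa F (u a y) - pdx u a y) h3.le
      have m2 := mul_nonneg (by linarith : 0 ≤ wa F (u b y) + pdx u b y) h4.le
      simp only [Pi.zero_apply]; linarith
  have key : ∀ᶠ y in atTop, c * (∫ y in Y1..Y2, g y) + (∫ x in a..b, ed F u x Y1)
      + wPhi F (u a Y1) + wPhi F (u b Y1) ≤ (∫ x in a..b, ed F u x y) + 2 * wPhi F 1 := by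
    filter_upwards [eventually_ge_atTop Y2] with y hy
    have h1 : h Y1 ≤ h y := hmono (hY.trans hy)
    simp only [hh, intervalIntegral.integral_same, mul_zero, sub_zero] at h1
    have h2 : (∫ t in Y1..Y2, g t) ≤ ∫ t in Y1..y, g t := by
      rw [← intervalIntegral.integral_add_adjacent_intervals (gc.intervalIntegrable Y1 Y2)
        (gc.intervalIntegrable Y2 y)]
      linarith [intervalIntegral.integral_nonneg (μ := volume) hy fun t _ => g0 t]
    have h3 := mul_le_mul_of_nonneg_left h2 W.hc.le
    linarith [W.hF.wPhi_le_one (W.lt_one a y).le, W.hF.wPhi_le_one (W.lt_one b y).le]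
  have := ge_of_tendsto ((W.tendsto_energy a b).add_const (2 * wPhi F 1)) key
  linarith

end Wave

end hamiltonian

/-! ### Decay at infinity -/

section decay

/-- A nonnegative integrable Lipschitz function tends to zero at infinity. -/
lemma eventually_small_of_integrable_lipschitz {E : Type*} [NormedAddCommGroup E]
    [NormedSpace ℝ E] [FiniteDimensional ℝ E] [MeasurableSpace E] [BorelSpace E]
    (μ : Measure E) [μ.IsAddHaarMeasure] {g : E → ℝ} {C : ℝ} (h0 : ∀ p, 0 ≤ g p)
    (hi : Integrable g μ) (hL : ∀ p q, |g p - g q| ≤ C * ‖p - q‖) {ε : ℝ} (hε : 0 < ε) :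
    ∃ R, ∀ p, R ≤ ‖p‖ → g p < ε := by
  have hC : 0 < |C| + 1 := by positivity
  obtain ⟨d, hd⟩ : ∃ d, d = ε / (2 * (|C| + 1)) := ⟨_, rfl⟩
  have d0 : 0 < d := by rw [hd]; positivity
  have hCd : (|C| + 1) * d = ε / 2 := by rw [hd]; field_simp
  have hv : 0 < μ.real (ball (0 : E) d) :=
    ENNReal.toReal_pos (measure_ball_pos μ 0 d0).ne' measure_ball_lt_top.ne
  have ht := tendsto_setIntegral_of_antitone (μ := μ) (f := g)
    (s := fun n : ℕ => (closedBall (0 : E) n)ᶜ) (fun n => isClosed_closedBall.measurableSet.compl)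
    (fun m n hmn => compl_subset_compl.2 (closedBall_subset_closedBall (by exact_mod_cast hmn)))
    ⟨0, hi.integrableOn⟩
  have hemp : ⋂ n : ℕ, (closedBall (0 : E) n)ᶜ = ∅ := by
    rw [← compl_iUnion, iUnion_closedBall_nat, compl_univ]
  rw [hemp, setIntegral_empty] at ht
  obtain ⟨n, hn⟩ := (ht.eventually (gt_mem_nhds (by positivity :
    0 < ε / 2 * μ.real (ball (0 : E) d)))).exists
  refine ⟨n + d, fun p hp => ?_⟩
  by_contra hge
  push Not at hge
  have hsub : ball p d ⊆ (closedBall (0 : E) n)ᶜ := by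
    intro q hq
    simp only [mem_compl_iff, mem_closedBall, dist_zero_right, not_le]
    have h1 := norm_sub_norm_le p q
    rw [mem_ball, dist_eq_norm, norm_sub_rev] at hq
    linarith
  have h1 : ε / 2 * μ.real (ball p d) ≤ ∫ q in ball p d, g q ∂μ := by
    refine setIntegral_ge_of_const_le_real measurableSet_ball measure_ball_lt_top.ne ?_
      hi.integrableOn
    intro q hq
    have h2 := (abs_le.1 (hL p q)).2
    rw [mem_ball, dist_eq_norm, norm_sub_rev] at hq
    have h3 : C * ‖p - q‖ ≤ (|C| + 1) * d :=
      mul_le_mul (by linarith [le_abs_self C]) hq.le (norm_nonneg _) hC.le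
    linarith
  have h2 : ∫ q in ball p d, g q ∂μ ≤ ∫ q in (closedBall (0 : E) n)ᶜ, g q ∂μ :=
    setIntegral_mono_set hi.integrableOn (Eventually.of_forall h0) hsub.eventuallyLE
  have h3 : μ.real (ball p d) = μ.real (ball (0 : E) d) := by
    simp only [Measure.real, Measure.addHaar_ball_center μ p d]
  rw [h3] at h1
  linarith

namespace Wave

variable {F : ℝ → ℝ} {c : ℝ} {u : ℝ → ℝ → ℝ}

lemma exists_deriv_bound (W : Wave F c u) : ∃ G, 0 < G ∧ ∀ x y,
    F (u x y) ≤ G ∧ |deriv F (u x y)| ≤ G ∧ wa F (u x y) ≤ G ∧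
    |pdx u x y| ≤ G ∧ |pdy u x y| ≤ G ∧ |pdx (pdx u) x y| ≤ G ∧
    |pdx (pdy u) x y| ≤ G ∧ |pdy (pdy u) x y| ≤ G := by
  obtain ⟨B, hB, hb⟩ := W.hF.exists_bound
  obtain ⟨κ, A, -, hA, H⟩ := W.hF.exists_wa_bounds
  obtain ⟨C, hC, hC2⟩ := W.exists_second_bound
  have ha : ∀ x y, wa F (u x y) ≤ A := fun x y =>
    ((H _ (W.mem' x y)).2.1).trans (by nlinarith [sq_nonneg (u x y)])
  have h2 : ∀ x y, C * wa F (u x y) ≤ C * A := fun x y => mul_le_mul_of_nonneg_left (ha x y) hC.le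
  have hCA : 0 < C * A := by positivity
  refine ⟨B + A + C * A, by positivity, fun x y => ?_⟩
  obtain ⟨h3, h4, h5⟩ := hC2 x y
  have h6 := W.abs_ux_le x y
  have h7 := W.uy_le x y
  have h8 := ha x y
  have h9 := h2 x y
  have h10 := abs_of_pos (W.uy_pos x y)
  obtain ⟨h11, h12, -⟩ := hb _ (W.mem' x y)
  have h13 := le_abs_self (F (u x y))
  refine ⟨?_, ?_, ?_, ?_, ?_, ?_, ?_, ?_⟩ <;> linarith

lemma integrable_uy_sq (W : Wave F c u) :
    Integrable (fun p : ℝ × ℝ => pdy u p.1 p.2 ^ 2) := by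
  have hcont : Continuous (fun p : ℝ × ℝ => pdy u p.1 p.2 ^ 2) := W.continuous_uy.pow 2
  have hset : ∀ n : ℕ, closedBall (0 : ℝ × ℝ) n = Icc (-(n : ℝ)) n ×ˢ Icc (-(n : ℝ)) n := by
    intro n
    rw [show (0 : ℝ × ℝ) = (0, 0) from rfl, ← closedBall_prod_same, Real.closedBall_eq_Icc]; simp
  have hI : ∀ n : ℕ, IntegrableOn (fun p : ℝ × ℝ => pdy u p.1 p.2 ^ 2)
      (closedBall (0 : ℝ × ℝ) n) := fun n =>
    hcont.continuousOn.integrableOn_compact (isCompact_closedBall _ _)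
  refine (aecover_closedBall (x := (0 : ℝ × ℝ)) (r := fun n : ℕ => (n : ℝ))
    tendsto_natCast_atTop_atTop).integrable_of_integral_bounded_of_nonneg_ae
    (2 * wPhi F 1 / c) hI (Eventually.of_forall fun p => sq_nonneg _)
    (Eventually.of_forall fun n => ?_)
  have hn : -(n : ℝ) ≤ n := by have := Nat.cast_nonneg (α := ℝ) n; linarith
  have h1 := W.strip_ineq hn hn
  have h2 := intervalIntegral.integral_nonneg (μ := volume) hn fun x _ => W.ed_nonneg x (-(n : ℝ))
  have h3 := W.hF.wPhi_nonneg (W.neg_one_lt (-(n : ℝ)) (-(n : ℝ))).le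
  have h4 := W.hF.wPhi_nonneg (W.neg_one_lt (n : ℝ) (-(n : ℝ))).le
  have hIn := hI n
  rw [hset] at hIn ⊢
  rw [Measure.volume_eq_prod] at hIn ⊢
  rw [setIntegral_prod _ hIn, ← integral_integral_swap]
  · rw [le_div_iff₀ W.hc]
    simp only [integral_Icc_eq_integral_Ioc, ← intervalIntegral.integral_of_le hn]
    linarith
  · rw [Measure.prod_restrict]; exact hIn.swap

/-- `u_y` tends to zero at infinity of the plane. -/
theorem exists_uy_small (W : Wave F c u) {δ : ℝ} (hδ : 0 < δ) :
    ∃ R, ∀ x y, (R ≤ |x| ∨ R ≤ |y|) → pdy u x y < δ := by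
  obtain ⟨G, hG, hg⟩ := W.exists_deriv_bound
  have hL : ∀ p q : ℝ × ℝ, |pdy u p.1 p.2 ^ 2 - pdy u q.1 q.2 ^ 2| ≤ (4 * G * G) * ‖p - q‖ := by
    intro p q
    have h1 : |pdy u p.1 p.2 - pdy u q.1 p.2| ≤ G * |p.1 - q.1| :=
      abs_le_of_lipschitz (fun t => W.smy.hasDerivAt_x t p.2)
        (fun t => (hg t p.2).2.2.2.2.2.2.1) q.1 p.1
    have h2 : |pdy u q.1 p.2 - pdy u q.1 q.2| ≤ G * |p.2 - q.2| :=
      abs_le_of_lipschitz (fun t => W.smy.hasDerivAt_y q.1 t)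
        (fun t => (hg q.1 t).2.2.2.2.2.2.2) q.2 p.2
    have h3 : |p.1 - q.1| ≤ ‖p - q‖ := norm_fst_le (p - q)
    have h4 : |p.2 - q.2| ≤ ‖p - q‖ := norm_snd_le (p - q)
    have h5 : |pdy u p.1 p.2 - pdy u q.1 q.2| ≤ 2 * G * ‖p - q‖ := by
      have := abs_add_le (pdy u p.1 p.2 - pdy u q.1 p.2) (pdy u q.1 p.2 - pdy u q.1 q.2)
      rw [sub_add_sub_cancel] at this
      have e1 := mul_le_mul_of_nonneg_left h3 hG.le
      have e2 := mul_le_mul_of_nonneg_left h4 hG.le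
      linarith
    have h6 : |pdy u p.1 p.2 + pdy u q.1 q.2| ≤ 2 * G := by
      have := abs_add_le (pdy u p.1 p.2) (pdy u q.1 q.2)
      linarith [(hg p.1 p.2).2.2.2.2.1, (hg q.1 q.2).2.2.2.2.1]
    rw [sq_sub_sq, abs_mul]
    calc _ ≤ (2 * G) * (2 * G * ‖p - q‖) := mul_le_mul h6 h5 (abs_nonneg _) (by positivity)
      _ = _ := by ring
  obtain ⟨R, hR⟩ := eventually_small_of_integrable_lipschitz volume
    (g := fun p : ℝ × ℝ => pdy u p.1 p.2 ^ 2) (fun p => sq_nonneg _) W.integrable_uy_sq hL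
    (by positivity : 0 < δ ^ 2)
  refine ⟨R, fun x y h => ?_⟩
  have h1 : R ≤ ‖((x, y) : ℝ × ℝ)‖ := by
    rcases h with h | h
    · exact h.trans (norm_fst_le (x, y))
    · exact h.trans (norm_snd_le (x, y))
  exact lt_of_pow_lt_pow_left₀ 2 hδ.le (hR (x, y) h1)

lemma integrable_ed (W : Wave F c u) (y : ℝ) : Integrable (fun x => ed F u x y) := by
  have hcont : Continuous (fun x => ed F u x y) := W.continuous_ed.comp (Continuous.prodMk_left y)
  refine integrable_of_intervalIntegral_norm_bounded (l := atTop) (a := fun n : ℝ => -n)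
    (b := fun n => n) (2 * wPhi F 1) (fun n => (hcont.intervalIntegrable _ _).1)
    tendsto_neg_atTop_atBot tendsto_id ?_
  filter_upwards [eventually_ge_atTop 0] with n hn
  have hn' : -n ≤ n := by linarith
  simp only [Real.norm_eq_abs, abs_of_nonneg (W.ed_nonneg _ _)]
  have h1 := W.strip_ineq hn' (le_refl y)
  rw [intervalIntegral.integral_same] at h1
  linarith [W.hF.wPhi_nonneg (W.neg_one_lt (-n) y).le, W.hF.wPhi_nonneg (W.neg_one_lt n y).le]

lemma exists_F_small (W : Wave F c u) (y : ℝ) {δ : ℝ} (hδ : 0 < δ) :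
    ∃ R, ∀ x, R ≤ |x| → F (u x y) < δ := by
  obtain ⟨G, hG, hg⟩ := W.exists_deriv_bound
  have hd : ∀ t, HasDerivAt (fun t => ed F u t y) (pdx u t y * pdx (pdx u) t y +
      deriv F (u t y) * pdx u t y - pdy u t y * pdx (pdy u) t y) t := by
    intro t
    refine (((((W.smx.hasDerivAt_x t y).pow 2).div_const 2).add (W.hasDerivAt_Fu_x t y)).sub
      (((W.smy.hasDerivAt_x t y).pow 2).div_const 2)).congr_deriv ?_
    simp; ring
  have hL := fun p q => abs_le_of_lipschitz (C := 3 * (G * G)) hd (fun t => by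
    obtain ⟨-, h1, -, h2, h3, h4, h5, -⟩ := hg t y
    have e1 : |pdx u t y * pdx (pdx u) t y| ≤ G * G := by
      rw [abs_mul]; exact mul_le_mul h2 h4 (abs_nonneg _) hG.le
    have e2 : |deriv F (u t y) * pdx u t y| ≤ G * G := by
      rw [abs_mul]; exact mul_le_mul h1 h2 (abs_nonneg _) hG.le
    have e3 : |pdy u t y * pdx (pdy u) t y| ≤ G * G := by
      rw [abs_mul]; exact mul_le_mul h3 h5 (abs_nonneg _) hG.le
    rw [abs_le] at *
    constructor <;> linarith [e1.1, e1.2, e2.1, e2.2, e3.1, e3.2]) q p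
  obtain ⟨R1, hR1⟩ := eventually_small_of_integrable_lipschitz volume
    (fun x => W.ed_nonneg x y) (W.integrable_ed y) hL (by positivity : 0 < δ / 2)
  obtain ⟨R2, hR2⟩ := W.exists_uy_small (by positivity : 0 < Real.sqrt (δ / 2))
  refine ⟨max R1 R2, fun x hx => ?_⟩
  have h1 := hR1 x ((le_max_left _ _).trans hx)
  have h2 := hR2 x y (Or.inl ((le_max_right _ _).trans hx))
  have h3 : pdy u x y ^ 2 < δ / 2 := by
    rwa [Real.lt_sqrt (W.uy_pos x y).le] at h2
  unfold ed at h1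
  nlinarith [sq_nonneg (pdx u x y)]

lemma abs_Phi_sub_le (W : Wave F c u) {a b : ℝ} (hab : a ≤ b) (y : ℝ) :
    |wPhi F (u b y) - wPhi F (u a y)| ≤ (∫ x in a..b, ed F u x y)
      + (∫ x in a..b, pdy u x y ^ 2) / 2 := by
  have c1 : Continuous (fun x => wa F (u x y) * pdx u x y) :=
    (W.continuous_au.mul W.continuous_ux).comp (Continuous.prodMk_left y)
  have c2 : Continuous (fun x => ed F u x y) := W.continuous_ed.comp (Continuous.prodMk_left y)
  have c3 : Continuous (fun x => pdy u x y ^ 2) :=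
    (W.continuous_uy.comp (Continuous.prodMk_left y)).pow 2
  rw [← intervalIntegral.integral_eq_sub_of_hasDerivAt (fun x _ => W.hasDerivAt_Phi_x x y)
    (c1.intervalIntegrable _ _), ← intervalIntegral.integral_div,
    ← intervalIntegral.integral_add (c2.intervalIntegrable _ _)
    ((c3.div_const 2).intervalIntegrable _ _)]
  refine (intervalIntegral.abs_integral_le_integral_abs hab).trans
    (intervalIntegral.integral_mono_on hab (c1.abs.intervalIntegrable _ _)
    ((c2.add (c3.div_const 2)).intervalIntegrable _ _) fun x _ => ?_)
  have h := W.a_sq x y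
  unfold ed
  rw [abs_le]; constructor
  · nlinarith [sq_nonneg (wa F (u x y) + pdx u x y)]
  · nlinarith [sq_nonneg (wa F (u x y) - pdx u x y)]

lemma not_tendsto_one (W : Wave F c u)
    (h : ∀ y, Tendsto (fun x => u x y) atTop (𝓝 1)) : False := by
  have hc := W.hc
  obtain ⟨κ, hκ⟩ : ∃ κ, κ = ∫ y in (0 : ℝ)..1, ∫ x in (0 : ℝ)..1, pdy u x y ^ 2 := ⟨_, rfl⟩
  have sl : ∀ y, Continuous (fun x => pdy u x y ^ 2) := fun y =>
    (W.continuous_uy.comp (Continuous.prodMk_left y)).pow 2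
  have κ0 : 0 < κ := by
    rw [hκ]
    refine intervalIntegral.intervalIntegral_pos_of_pos
      ((W.continuous_strip 0 1).intervalIntegrable _ _) (fun y => ?_) one_pos
    exact intervalIntegral.intervalIntegral_pos_of_pos
      ((sl y).intervalIntegrable _ _) (fun x => pow_pos (W.uy_pos x y) 2) one_pos
  have key : ∀ Z, 0 ≤ Z → ∀ b, 1 ≤ b →
      c * κ * Z ≤ 2 * Z * (wPhi F 1 - wPhi F (u b (-Z))) + wPhi F 1 / c := by
    intro Z hZ b hb
    obtain ⟨g, hg⟩ : ∃ g, g = fun y => ∫ x in (0 : ℝ)..b, pdy u x y ^ 2 := ⟨_, rfl⟩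
    have hb0 : (0 : ℝ) ≤ b := by linarith
    have gc : Continuous g := by rw [hg]; exact W.continuous_strip 0 b
    have g0 : ∀ y, 0 ≤ g y := fun y => by
      rw [hg]; exact intervalIntegral.integral_nonneg hb0 fun x _ => sq_nonneg _
    have hgκ : κ ≤ ∫ y in (0 : ℝ)..1, g y := by
      rw [hκ]
      refine intervalIntegral.integral_mono_on zero_le_one
        ((W.continuous_strip 0 1).intervalIntegrable _ _) (gc.intervalIntegrable _ _) fun y _ => ?_
      rw [hg]
      exact intervalIntegral.integral_mono_interval le_rfl zero_le_one hb
        (Eventually.of_forall fun x => sq_nonneg _) ((sl y).intervalIntegrable _ _)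
    have pt : ∀ Y ∈ Icc (-Z) 0, c * κ ≤ 2 * (wPhi F 1 - wPhi F (u b (-Z))) + 2⁻¹ * g Y := by
      intro Y hY
      have h1 := W.strip_ineq hb0 (by linarith [hY.2] : Y ≤ 1)
      have h2 := le_of_abs_le (W.abs_Phi_sub_le hb0 Y)
      have h3 : (∫ y in (0 : ℝ)..1, g y) ≤ ∫ y in Y..1, g y :=
        intervalIntegral.integral_mono_interval hY.2 zero_le_one le_rfl
          (Eventually.of_forall g0) (gc.intervalIntegrable _ _)
      have h4 : wPhi F (u b (-Z)) ≤ wPhi F (u b Y) :=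
        W.hF.monotone_wPhi ((W.strictMono b).monotone hY.1)
      rw [← show g Y = _ from congrFun hg Y] at h2
      have h5 := mul_le_mul_of_nonneg_left (hgκ.trans h3) hc.le
      simp only [hg] at h5 ⊢
      simp only [hg] at h2
      linarith
    have hi : (∫ _ in (-Z)..0, c * κ) ≤
        ∫ Y in (-Z)..0, (2 * (wPhi F 1 - wPhi F (u b (-Z))) + 2⁻¹ * g Y) :=
      intervalIntegral.integral_mono_on (by linarith) intervalIntegrable_const
        ((continuous_const.add (gc.const_mul _)).intervalIntegrable _ _) pt
    rw [intervalIntegral.integral_add intervalIntegrable_const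
      ((gc.const_mul _).intervalIntegrable _ _)] at hi
    simp only [intervalIntegral.integral_const, smul_eq_mul, intervalIntegral.integral_const_mul]
      at hi
    have h6 := W.strip_ineq hb0 (by linarith : -Z ≤ 0)
    have h7 := intervalIntegral.integral_nonneg (μ := volume) hb0 fun x _ => W.ed_nonneg x (-Z)
    have h8 : (∫ Y in (-Z)..0, g Y) ≤ 2 * wPhi F 1 / c := by
      rw [le_div_iff₀ hc, hg]
      linarith [W.hF.wPhi_nonneg (W.neg_one_lt 0 (-Z)).le, W.hF.wPhi_nonneg (W.neg_one_lt b (-Z)).le]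
    have h9 : 2 * wPhi F 1 / c = 2 * (wPhi F 1 / c) := by ring
    linarith
  have lim : ∀ Z, 0 ≤ Z → c * κ * Z ≤ wPhi F 1 / c := by
    intro Z hZ
    have h1 : Tendsto (fun b => 2 * Z * (wPhi F 1 - wPhi F (u b (-Z))) + wPhi F 1 / c) atTop
        (𝓝 (2 * Z * (wPhi F 1 - wPhi F 1) + wPhi F 1 / c)) :=
      ((((W.hF.continuous_wPhi.tendsto 1).comp (h (-Z))).const_sub _).const_mul _).add_const _
    have := ge_of_tendsto h1 ((eventually_ge_atTop 1).mono fun b hb => key Z hZ b hb)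
    simpa using this
  have he := W.hF.wPhi_one_pos
  have h1 := lim (wPhi F 1 / c / (c * κ) + 1) (by positivity)
  have h2 : c * κ * (wPhi F 1 / c / (c * κ) + 1) = wPhi F 1 / c + c * κ := by
    field_simp
  have : 0 < c * κ := by positivity
  linarith

lemma tendsto_neg_one_atTop (W : Wave F c u) (y : ℝ) :
    Tendsto (fun x => u x y) atTop (𝓝 (-1)) := by
  obtain ⟨κ, hκ, Hp⟩ := W.hF.exists_lower_half
  obtain ⟨κ', hκ', Hm⟩ := W.hF.reflect.exists_lower_half
  have hF0 : 0 < F 0 := W.hF.pos (by norm_num) (by norm_num)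
  have sq_lim : ∀ (k : ℝ), 0 < k → ∀ f : ℝ → ℝ, (∀ y δ, 0 < δ → ∃ R, ∀ x, R ≤ |x| → F (u x y) < δ) →
    ∀ y, (∀ᶠ x in atTop, 0 ≤ f x ∧ k * (f x) ^ 2 ≤ F (u x y)) → Tendsto f atTop (𝓝 0) := by
    intro k hk f hs y hf
    rw [Metric.tendsto_atTop']
    intro ε hε
    obtain ⟨R, hR⟩ := hs y (k * ε ^ 2) (by positivity)
    obtain ⟨N, hN⟩ := eventually_atTop.1 hf
    refine ⟨max (max R N) 0, fun x hx => ?_⟩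
    have hx0 : 0 < x := (le_max_right _ _).trans_lt hx
    have hxR : R ≤ |x| := by
      rw [abs_of_pos hx0]; exact ((le_max_left _ _).trans ((le_max_left _ _).trans hx.le))
    obtain ⟨h1, h2⟩ := hN x (((le_max_right _ _).trans ((le_max_left _ _).trans hx.le)))
    have h3 : f x ^ 2 < ε ^ 2 := lt_of_mul_lt_mul_left (h2.trans_lt (hR x hxR)) hk.le
    rw [Real.dist_eq, sub_zero, abs_of_nonneg h1]
    exact lt_of_pow_lt_pow_left₀ 2 hε.le h3
  have small := fun y δ (hδ : 0 < δ) => W.exists_F_small y hδ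
  have dich : ∀ y, (∀ᶠ x in atTop, 0 < u x y) ∨ (∀ᶠ x in atTop, u x y < 0) := by
    intro y
    obtain ⟨R, hR⟩ := W.exists_F_small y hF0
    have ne : ∀ x, max R 0 ≤ x → u x y ≠ 0 := by
      intro x hx h0
      have := hR x (((le_max_left _ _).trans hx).trans (le_abs_self _))
      rw [h0] at this; exact lt_irrefl _ this
    have hcont : ContinuousOn (fun x => u x y) (Ici (max R 0)) := (W.sm.continuous_x y).continuousOn
    have hpc : IsPreconnected (Ici (max R 0)) := isPreconnected_Ici
    rcases lt_or_gt_of_ne (ne _ le_rfl) with h | h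
    · right
      filter_upwards [eventually_ge_atTop (max R 0)] with x hx
      by_contra hge
      push Not at hge
      obtain ⟨z, hz, hz0⟩ := hpc.intermediate_value (mem_Ici.2 le_rfl) hx hcont
        (show (0:ℝ) ∈ Icc _ _ from ⟨h.le, hge⟩)
      exact ne z hz hz0
    · left
      filter_upwards [eventually_ge_atTop (max R 0)] with x hx
      by_contra hge
      push Not at hge
      obtain ⟨z, hz, hz0⟩ := hpc.intermediate_value hx (mem_Ici.2 le_rfl) hcont
        (show (0:ℝ) ∈ Icc _ _ from ⟨hge, h.le⟩)
      exact ne z hz hz0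
  rcases dich y with h | h
  · exfalso
    have t1 : Tendsto (fun x => 1 - u x y) atTop (𝓝 0) := by
      refine sq_lim κ hκ _ small y (h.mono fun x hx => ⟨?_, ?_⟩)
      · linarith [W.lt_one x y]
      · exact Hp _ ⟨hx.le, (W.lt_one x y).le⟩
    refine W.not_tendsto_one fun z => ?_
    have t2 : Tendsto (fun x => u x z - u x y) atTop (𝓝 0) := by
      rw [Metric.tendsto_atTop']
      intro ε hε
      obtain ⟨R, hR⟩ := W.exists_uy_small (by positivity : 0 < ε / (|z - y| + 1))
      refine ⟨R, fun x hx => ?_⟩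
      have := abs_le_of_lipschitz (C := ε / (|z - y| + 1)) (fun t => W.sm.hasDerivAt_y x t)
        (fun t => by
          rw [abs_of_pos (W.uy_pos x t)]
          exact (hR x t (Or.inl (hx.le.trans (le_abs_self _)))).le) y z
      rw [Real.dist_eq, sub_zero]
      refine this.trans_lt ?_
      rw [div_mul_eq_mul_div, div_lt_iff₀ (by positivity)]
      nlinarith
    have := (t2.sub t1).add_const 1
    simpa using this
  · have t1 : Tendsto (fun x => 1 + u x y) atTop (𝓝 0) := by
      refine sq_lim κ' hκ' _ small y (h.mono fun x hx => ⟨?_, ?_⟩)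
      · linarith [W.neg_one_lt x y]
      · have := Hm (-u x y) ⟨by linarith, by linarith [W.neg_one_lt x y]⟩
        rwa [neg_neg, sub_neg_eq_add] at this
    have := t1.sub_const 1
    simpa using this

lemma tendsto_neg_one_atBot (W : Wave F c u) (y : ℝ) :
    Tendsto (fun x => u x y) atBot (𝓝 (-1)) := by
  have := (W.reflect.tendsto_neg_one_atTop y).comp tendsto_neg_atBot_atTop
  simpa [Function.comp_def] using this

end Wave

end decay

/-! ### Barriers -/

section barrier

namespace Wave

variable {F : ℝ → ℝ} {c : ℝ} {u : ℝ → ℝ → ℝ}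

/-- Comparison principle for `u_y` in a region where `F''(u)` is positive. -/
lemma comparison (W : Wave F c u) {w B Bx By Bxx Byy : ℝ → ℝ → ℝ} {Y η d : ℝ} (hd : 0 < d)
    (hw : Continuous (fun p : ℝ × ℝ => w p.1 p.2)) (hB : Continuous (fun p : ℝ × ℝ => B p.1 p.2))
    (h1 : ∀ x y, HasDerivAt (fun t => B t y) (Bx x y) x)
    (h2 : ∀ x y, HasDerivAt (fun t => B x t) (By x y) y)
    (h11 : ∀ x y, HasDerivAt (fun t => Bx t y) (Bxx x y) x)
    (h22 : ∀ x y, HasDerivAt (fun t => By x t) (Byy x y) y)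
    (hBd : ∀ x y, Y ≤ y → w x y ≤ η → d ≤ B x y)
    (hpos : ∀ x y, w x y ≤ η → 0 < deriv (deriv F) (u x y))
    (hsup : ∀ x y, Y ≤ y → w x y ≤ η →
      Bxx x y + Byy x y + c * By x y ≤ deriv (deriv F) (u x y) * B x y)
    (hbot : ∀ x, w x Y ≤ η → pdy u x Y ≤ B x Y)
    (hside : ∀ x y, Y ≤ y → w x y = η → pdy u x y ≤ B x y)
    (x y : ℝ) (hy : Y ≤ y) (hxy : w x y ≤ η) : pdy u x y ≤ B x y := by
  by_contra hcon
  push Not at hcon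
  obtain ⟨R, hR⟩ := W.exists_uy_small hd
  obtain ⟨S, hS⟩ : ∃ S, S = {p : ℝ × ℝ | Y ≤ p.2 ∧ w p.1 p.2 ≤ η} := ⟨_, rfl⟩
  have hSc : IsClosed S := by
    rw [hS]; exact (isClosed_le continuous_const continuous_snd).inter
      (isClosed_le hw continuous_const)
  have hK : IsCompact (S ∩ closedBall (0 : ℝ × ℝ) R) :=
    (isCompact_closedBall _ _).inter_left hSc
  have hf : Continuous (fun p : ℝ × ℝ => pdy u p.1 p.2 - B p.1 p.2) := W.continuous_uy.sub hB
  have hout : ∀ p ∈ S, p ∉ closedBall (0 : ℝ × ℝ) R → pdy u p.1 p.2 - B p.1 p.2 < 0 := by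
    intro p hp hpR
    rw [mem_closedBall, dist_zero_right, not_le] at hpR
    rw [hS] at hp
    have h3 : R ≤ |p.1| ∨ R ≤ |p.2| := by
      by_contra hh; push Not at hh
      exact absurd (max_lt hh.1 hh.2) (not_lt.2 hpR.le)
    linarith [hR p.1 p.2 h3, hBd p.1 p.2 hp.1 hp.2]
  have hmem : (x, y) ∈ S := by rw [hS]; exact ⟨hy, hxy⟩
  have hmemR : (x, y) ∈ S ∩ closedBall (0 : ℝ × ℝ) R := by
    refine ⟨hmem, ?_⟩
    by_contra hh
    linarith [hout _ hmem hh]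
  obtain ⟨⟨a, b⟩, ⟨hqS, hqR⟩, hmax⟩ := hK.exists_isMaxOn ⟨_, hmemR⟩ hf.continuousOn
  have hq0 : 0 < pdy u a b - B a b := by
    have := hmax hmemR
    simp only [mem_ofPred_eq] at this
    linarith
  have hmax' : ∀ p ∈ S, pdy u p.1 p.2 - B p.1 p.2 ≤ pdy u a b - B a b := by
    intro p hp
    by_cases hpR : p ∈ closedBall (0 : ℝ × ℝ) R
    · exact hmax ⟨hp, hpR⟩
    · linarith [hout p hp hpR]
  rw [hS] at hqS
  obtain ⟨hb, hwq⟩ : Y ≤ b ∧ w a b ≤ η := hqS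
  have hb' : Y < b := by
    rcases hb.lt_or_eq with h | h
    · exact h
    · subst h; linarith [hbot a hwq]
  have hw' : w a b < η := by
    rcases hwq.lt_or_eq with h | h
    · exact h
    · linarith [hside a b hb h]
  have lm : IsLocalMax (fun p : ℝ × ℝ => pdy u p.1 p.2 - B p.1 p.2) (a, b) := by
    have e1 : ∀ᶠ p : ℝ × ℝ in 𝓝 (a, b), Y < p.2 :=
      continuous_snd.continuousAt.eventually (lt_mem_nhds hb')
    have e2 : ∀ᶠ p : ℝ × ℝ in 𝓝 (a, b), w p.1 p.2 < η :=
      hw.continuousAt.eventually (gt_mem_nhds hw')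
    filter_upwards [e1, e2] with p hp1 hp2
    exact hmax' p (by rw [hS]; exact ⟨hp1.le, hp2.le⟩)
  have mx : IsLocalMax (fun t => pdy u t b - B t b) a :=
    ((Continuous.prodMk_left b).tendsto a).eventually lm
  have my : IsLocalMax (fun t => pdy u a t - B a t) b :=
    ((Continuous.prodMk_right a).tendsto b).eventually lm
  have t1 := deriv_test (fun t => (W.smy.hasDerivAt_x t b).sub (h1 t b))
    ((W.smy.dx.hasDerivAt_x a b).sub (h11 a b)) mx
  have t2 := deriv_test (fun t => (W.smy.hasDerivAt_y a t).sub (h2 a t))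
    ((W.smy.dy.hasDerivAt_y a b).sub (h22 a b)) my
  have e := W.pde_y a b
  have h5 := hsup a b hb hwq
  have h6 := mul_pos (hpos a b hwq) hq0
  have h7 : c * pdy (pdy u) a b = c * By a b := by rw [sub_eq_zero.1 t2.1]
  linarith [t1.2, t2.2]

lemma barrier_aux (W : Wave F c u) {σ m C K η A p q κ Y : ℝ} (hC : 0 < C)
    (hK : 4 * C ≤ K * m) (hη : 0 < η) (hη1 : 6 * (C * η) ≤ m) (hη2 : 2 * (K * η) ≤ 1)
    (hK0 : 0 < K) (hA : 0 ≤ A) (hp : 0 ≤ p) (hq : 0 ≤ q)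
    (hw : ∀ x y, 0 < 1 + σ * u x y)
    (hT1 : ∀ x y, 1 + σ * u x y ≤ η →
      |σ * deriv F (u x y) - m * (1 + σ * u x y)| ≤ C * (1 + σ * u x y) ^ 2)
    (hT2 : ∀ x y, 1 + σ * u x y ≤ η → |deriv (deriv F) (u x y) - m| ≤ C * (1 + σ * u x y))
    (hE : ∀ x y, 1 + σ * u x y ≤ η → q * (σ * deriv F (u x y)) - 2 * κ * q * (σ * pdy u x y) +
      (κ ^ 2 - c * κ) * (p + q * (1 + σ * u x y)) ≤
      deriv (deriv F) (u x y) * (p + q * (1 + σ * u x y)))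
    (hbot : ∀ x, 1 + σ * u x Y ≤ η → pdy u x Y ≤ p + q * (1 + σ * u x Y))
    (hside : ∀ x y, Y ≤ y → 1 + σ * u x y = η → pdy u x y ≤ A * (η / 2))
    (x y : ℝ) (hy : Y ≤ y) (hxy : 1 + σ * u x y ≤ η) :
    pdy u x y ≤ A * (1 + σ * u x y) + (p + q * (1 + σ * u x y)) * Real.exp (-κ * (y - Y)) := by
  have hf2 : ∀ x y, 1 + σ * u x y ≤ η → 0 < deriv (deriv F) (u x y) := by
    intro x y h
    have h1 := (abs_le.1 (hT2 x y h)).1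
    have h2 := mul_le_mul_of_nonneg_left h hC.le
    have h3 := mul_pos hC hη
    linarith
  have hφ : ∀ x y, 1 + σ * u x y ≤ η → K * (1 + σ * u x y) ^ 2 ≤ (1 + σ * u x y) / 2 := by
    intro x y h
    have h1 := mul_le_mul_of_nonneg_left h hK0.le
    have h2 := mul_le_mul_of_nonneg_right (by linarith : K * (1 + σ * u x y) ≤ 1 / 2) (hw x y).le
    linarith
  have key : ∀ d, 0 < d → pdy u x y ≤ A * ((1 + σ * u x y) - K * (1 + σ * u x y) ^ 2) +
      (p + q * (1 + σ * u x y)) * Real.exp (-κ * (y - Y)) + d := by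
    intro d hd
    have dwx : ∀ x y, HasDerivAt (fun t => 1 + σ * u t y) (σ * pdx u x y) x := fun x y =>
      ((W.sm.hasDerivAt_x x y).const_mul σ).const_add 1
    have dwy : ∀ x y, HasDerivAt (fun t => 1 + σ * u x t) (σ * pdy u x y) y := fun x y =>
      ((W.sm.hasDerivAt_y x y).const_mul σ).const_add 1
    have dwxx : ∀ x y, HasDerivAt (fun t => σ * pdx u t y) (σ * pdx (pdx u) x y) x := fun x y =>
      (W.smx.hasDerivAt_x x y).const_mul σ
    have dwyy : ∀ x y, HasDerivAt (fun t => σ * pdy u x t) (σ * pdy (pdy u) x y) y := fun x y =>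
      (W.smy.hasDerivAt_y x y).const_mul σ
    have dE : ∀ y, HasDerivAt (fun t => Real.exp (-κ * (t - Y)))
        (-κ * Real.exp (-κ * (y - Y))) y := fun y => by
      refine ((((hasDerivAt_id y).sub_const Y).const_mul (-κ)).exp).congr_deriv ?_
      simp; ring
    have hwc : Continuous (fun p : ℝ × ℝ => 1 + σ * u p.1 p.2) :=
      continuous_const.add (W.sm.continuous.const_mul σ)
    refine W.comparison (w := fun x y => 1 + σ * u x y)
      (B := fun x y => A * ((1 + σ * u x y) - K * (1 + σ * u x y) ^ 2) +
        (p + q * (1 + σ * u x y)) * Real.exp (-κ * (y - Y)) + d)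
      (Bx := fun x y => A * (σ * pdx u x y - K * (2 * (1 + σ * u x y) * (σ * pdx u x y))) +
        q * (σ * pdx u x y) * Real.exp (-κ * (y - Y)))
      (By := fun x y => A * (σ * pdy u x y - K * (2 * (1 + σ * u x y) * (σ * pdy u x y))) +
        (q * (σ * pdy u x y) * Real.exp (-κ * (y - Y)) +
          (p + q * (1 + σ * u x y)) * (-κ * Real.exp (-κ * (y - Y)))))
      (Bxx := fun x y => A * (σ * pdx (pdx u) x y - K * (2 * (σ * pdx u x y) * (σ * pdx u x y) +
          2 * (1 + σ * u x y) * (σ * pdx (pdx u) x y))) +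
        q * (σ * pdx (pdx u) x y) * Real.exp (-κ * (y - Y)))
      (Byy := fun x y => A * (σ * pdy (pdy u) x y - K * (2 * (σ * pdy u x y) * (σ * pdy u x y) +
          2 * (1 + σ * u x y) * (σ * pdy (pdy u) x y))) +
        ((q * (σ * pdy (pdy u) x y) * Real.exp (-κ * (y - Y)) +
          q * (σ * pdy u x y) * (-κ * Real.exp (-κ * (y - Y)))) +
        (q * (σ * pdy u x y) * (-κ * Real.exp (-κ * (y - Y))) +
          (p + q * (1 + σ * u x y)) * (-κ * (-κ * Real.exp (-κ * (y - Y)))))))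
      (Y := Y) (η := η) hd hwc ?_ ?_ ?_ ?_ ?_ ?_ hf2 ?_ ?_ ?_ x y hy hxy
    · exact (((hwc.sub ((hwc.pow 2).const_mul K)).const_mul A).add ((continuous_const.add
        (hwc.const_mul q)).mul (Real.continuous_exp.comp ((continuous_snd.sub
        continuous_const).const_mul (-κ))))).add continuous_const
    · intro x y
      refine (((((dwx x y).sub (((dwx x y).pow 2).const_mul K)).const_mul A).add
        ((((dwx x y).const_mul q).const_add p).mul_const _)).add_const d).congr_deriv ?_
      simp
    · intro x y
      refine (((((dwy x y).sub (((dwy x y).pow 2).const_mul K)).const_mul A).add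
        ((((dwy x y).const_mul q).const_add p).mul (dE y))).add_const d).congr_deriv ?_
      simp
    · intro x y
      exact (((dwxx x y).sub ((((dwx x y).const_mul 2).mul (dwxx x y)).const_mul K)).const_mul
        A).add (((dwxx x y).const_mul q).mul_const _)
    · intro x y
      exact (((dwyy x y).sub ((((dwy x y).const_mul 2).mul (dwyy x y)).const_mul K)).const_mul
        A).add ((((dwyy x y).const_mul q).mul (dE y)).add
        ((((dwy x y).const_mul q).const_add p).mul ((dE y).const_mul (-κ))))
    · intro x y _ h
      have h1 := hφ x y h
      have h2 := hw x y
      have h3 := mul_nonneg hA (by linarith : 0 ≤ (1 + σ * u x y) - K * (1 + σ * u x y) ^ 2)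
      have h4 : 0 ≤ (p + q * (1 + σ * u x y)) * Real.exp (-κ * (y - Y)) :=
        mul_nonneg (add_nonneg hp (mul_nonneg hq h2.le)) (Real.exp_pos _).le
      linarith
    · intro x y _ h
      have e := W.pde x y
      have t1 := hT1 x y h
      have t2 := hT2 x y h
      have t3 := mul_le_mul_of_nonneg_right (hE x y h) (Real.exp_pos (-κ * (y - Y))).le
      have t4 := mul_pos (hf2 x y h) hd
      have w0 := hw x y
      generalize Real.exp (-κ * (y - Y)) = E at *
      have hL : σ * pdx (pdx u) x y = σ * deriv F (u x y) - σ * pdy (pdy u) x y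
          - c * (σ * pdy u x y) := by rw [← e]; ring
      rw [hL]
      generalize deriv (deriv F) (u x y) = f2 at *
      generalize σ * deriv F (u x y) = f1 at *
      generalize σ * pdx u x y = wx at *
      generalize σ * pdy u x y = wy at *
      generalize σ * pdy (pdy u) x y = wyy at *
      generalize 1 + σ * u x y = w at *
      have main : f1 - K * (2 * w * f1) - f2 * (w - K * w ^ 2) ≤ 0 := by
        obtain ⟨a1, a2⟩ := abs_le.1 t1
        obtain ⟨b1, b2⟩ := abs_le.1 t2
        have k1 := mul_le_mul_of_nonneg_left a1 (by positivity : 0 ≤ 2 * K * w)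
        have k2 := mul_le_mul_of_nonneg_left b1 w0.le
        have k3 := mul_le_mul_of_nonneg_left b2 (by positivity : 0 ≤ K * w ^ 2)
        have k4 := mul_le_mul_of_nonneg_right hK (by positivity : 0 ≤ w ^ 2)
        have k5 := mul_le_mul_of_nonneg_right h (by positivity : 0 ≤ K * C * w ^ 2)
        have k6 := mul_le_mul_of_nonneg_right hη1 (by positivity : 0 ≤ K * w ^ 2)
        linarith
      have m1 := mul_nonneg hA (neg_nonneg.2 main)
      have m2 := mul_nonneg hA (mul_nonneg hK0.le (sq_nonneg wx))
      have m3 := mul_nonneg hA (mul_nonneg hK0.le (sq_nonneg wy))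
      linarith
    · intro x h
      have h1 := hφ x Y h
      have h2 := hw x Y
      have h3 := mul_nonneg hA (by linarith : 0 ≤ (1 + σ * u x Y) - K * (1 + σ * u x Y) ^ 2)
      have h4 := hbot x h
      simp only [sub_self, mul_zero, Real.exp_zero, mul_one]; linarith
    · intro x y hy h
      have h1 := hφ x y h.le
      have h2 := hw x y
      have h3 := mul_le_mul_of_nonneg_left (by linarith :
        η / 2 ≤ (1 + σ * u x y) - K * (1 + σ * u x y) ^ 2) hA
      have h4 : 0 ≤ (p + q * (1 + σ * u x y)) * Real.exp (-κ * (y - Y)) :=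
        mul_nonneg (add_nonneg hp (mul_nonneg hq h2.le)) (Real.exp_pos _).le
      have h5 := hside x y hy h
      linarith
  refine le_of_forall_pos_le_add fun d hd => (key d hd).trans ?_
  have h1 := mul_nonneg hA (mul_nonneg hK0.le (sq_nonneg (1 + σ * u x y)))
  linarith

lemma exists_barrier_inner (W : Wave F c u) : ∃ η θ A, 0 < η ∧ η ≤ 1 ∧ 0 < θ ∧ 0 < A ∧
    ∀ Y δ ω, 0 < ω → ω ≤ η → (∀ x y, Y ≤ y → pdy u x y ≤ δ) → (∀ x, ω ≤ 1 - u x Y) →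
    ∀ x y, Y ≤ y → 1 - u x y ≤ η →
      pdy u x y ≤ δ * (A + Real.exp (-θ * (y - Y)) / ω) * (1 - u x y) := by
  have hc := W.hc
  obtain ⟨C, hC, hT⟩ := W.hF.exists_taylor
  obtain ⟨m, hm⟩ : ∃ m, m = deriv (deriv F) 1 := ⟨_, rfl⟩
  have hm0 : 0 < m := by rw [hm]; exact W.hF.deriv2_pos
  rw [← hm] at hT
  obtain ⟨μ, hμ0, hμ⟩ : ∃ μ, 0 < μ ∧ μ ^ 2 = m := ⟨√m, Real.sqrt_pos.2 hm0, Real.sq_sqrt hm0.le⟩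
  obtain ⟨θ, hθ0, hθ⟩ : ∃ θ, 0 < θ ∧ 2 * μ * θ + θ ^ 2 ≤ c * μ / 2 := by
    refine ⟨min 1 (c * μ / (2 * (2 * μ + 1))), by positivity, ?_⟩
    have h1 := min_le_left 1 (c * μ / (2 * (2 * μ + 1)))
    have h2 := min_le_right 1 (c * μ / (2 * (2 * μ + 1)))
    have h0 : 0 < min 1 (c * μ / (2 * (2 * μ + 1))) := by positivity
    rw [le_div_iff₀ (by positivity)] at h2
    generalize min 1 (c * μ / (2 * (2 * μ + 1))) = t at *
    nlinarith
  obtain ⟨X, hX0, hX1, hX2, hX3⟩ : ∃ X, 0 < X ∧ X ≤ m / 6 ∧ X ≤ c * μ / 2 ∧ X ≤ μ * θ / 2 :=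
    ⟨min (m / 6) (min (c * μ / 2) (μ * θ / 2)), by positivity, min_le_left _ _,
      (min_le_right _ _).trans (min_le_left _ _), (min_le_right _ _).trans (min_le_right _ _)⟩
  obtain ⟨K, hK0, hK⟩ : ∃ K, 0 < K ∧ K * m = 4 * C := ⟨4 * C / m, by positivity, by field_simp⟩
  obtain ⟨η, hη0, hη1, hη2, hη3⟩ : ∃ η, 0 < η ∧ η ≤ 1 ∧ C * η ≤ X ∧ 2 * (K * η) ≤ 1 := by
    refine ⟨min 1 (min (X / C) (1 / (2 * K))), by positivity, min_le_left _ _, ?_, ?_⟩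
    · have := (min_le_right 1 (min (X / C) (1 / (2 * K)))).trans (min_le_left _ _)
      rw [le_div_iff₀ hC] at this; linarith
    · have := (min_le_right 1 (min (X / C) (1 / (2 * K)))).trans (min_le_right _ _)
      rw [le_div_iff₀ (by positivity)] at this; linarith
  refine ⟨η, θ / 2, 2 / η, hη0, hη1, by positivity, by positivity, ?_⟩
  intro Y δ ω hω hωη hδ hbot x y hy hxy
  have hδ0 : 0 < δ := (W.uy_pos 0 Y).trans_le (hδ 0 Y le_rfl)
  have hmw : ∀ x y, 0 < 1 - u x y := fun x y => by linarith [W.lt_one x y]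
  have hT' : ∀ x y, |deriv (deriv F) (u x y) - m| ≤ C * (1 - u x y) ∧
      |deriv F (u x y) + m * (1 - u x y)| ≤ C * (1 - u x y) ^ 2 ∧
      |F (u x y) - m * (1 - u x y) ^ 2 / 2| ≤ C * (1 - u x y) ^ 3 := by
    intro x y
    have := hT (1 - u x y) ⟨(hmw x y).le, by linarith [W.neg_one_lt x y]⟩
    rwa [sub_sub_cancel] at this
  have b := W.barrier_aux (σ := -1) (m := m) (C := C) (K := K) (η := η) (A := 2 / η * δ) (p := δ)
    (q := 0) (κ := μ + θ) (Y := Y) hC hK.ge hη0 (by linarith) hη3 hK0 (by positivity) hδ0.le le_rfl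
    (fun x y => by linarith [W.lt_one x y])
    (fun x y _ => by
      have := (hT' x y).2.1
      rw [show -1 * deriv F (u x y) - m * (1 + -1 * u x y) = -(deriv F (u x y) + m * (1 - u x y))
        by ring, abs_neg, show 1 + -1 * u x y = 1 - u x y by ring]
      exact this)
    (fun x y _ => by rw [show 1 + -1 * u x y = 1 - u x y by ring]; exact (hT' x y).1)
    (fun x y h => by
      have h1 := (abs_le.1 (hT' x y).1).1
      have h2 : C * (1 - u x y) ≤ C * η := mul_le_mul_of_nonneg_left (by linarith) hC.le
      have h3 : (μ + θ) ^ 2 - c * (μ + θ) ≤ deriv (deriv F) (u x y) := by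
        have := mul_pos hc hθ0
        linarith [hμ]
      have := mul_le_mul_of_nonneg_right h3 hδ0.le
      linarith)
    (fun x _ => by linarith [hδ x Y le_rfl])
    (fun x y h _ => by
      have : 2 / η * δ * (η / 2) = δ := by field_simp
      rw [this]; exact hδ x y h)
    x y hy (by linarith)
  have hlow : ω * Real.exp (-(μ + θ / 2) * (y - Y)) ≤ 1 - u x y := by
    obtain ⟨y1, hy1, hy1y, hω1, hy1η⟩ : ∃ y1, Y ≤ y1 ∧ y1 ≤ y ∧ ω ≤ 1 - u x y1 ∧
        1 - u x y1 ≤ η := by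
      rcases le_or_gt (1 - u x Y) η with h | h
      · exact ⟨Y, le_rfl, hy, hbot x, h⟩
      · obtain ⟨z, hz, hz'⟩ := intermediate_value_Icc' (f := fun t => 1 - u x t) hy
          ((continuous_const.sub (W.sm.continuous_y x)).continuousOn)
          (show η ∈ Icc _ _ from ⟨hxy, h.le⟩)
        simp only at hz'
        exact ⟨z, hz.1, hz.2, by rw [hz']; exact hωη, hz'.le⟩
    have hmono : MonotoneOn (fun t => (1 - u x t) * Real.exp ((μ + θ / 2) * t)) (Ici y1) := by
      have hd : ∀ t, HasDerivAt (fun t => (1 - u x t) * Real.exp ((μ + θ / 2) * t))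
          (Real.exp ((μ + θ / 2) * t) * ((μ + θ / 2) * (1 - u x t) - pdy u x t)) t := by
        intro t
        refine (((W.sm.hasDerivAt_y x t).const_sub 1).mul
          ((((hasDerivAt_id t).const_mul (μ + θ / 2)).exp))).congr_deriv ?_
        simp; ring
      refine monotoneOn_of_deriv_nonneg (convex_Ici y1)
        (fun t _ => (hd t).continuousAt.continuousWithinAt)
        (fun t _ => (hd t).differentiableAt.differentiableWithinAt) fun t ht => ?_
      rw [interior_Ici] at ht
      rw [(hd t).deriv]
      refine mul_nonneg (Real.exp_pos _).le (sub_nonneg.2 ?_)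
      have hw0 := hmw x t
      have hwη : 1 - u x t ≤ η := by
        linarith [(W.strictMono x).monotone ht.le]
      refine (W.uy_le x t).trans ?_
      apply Real.sqrt_le_iff.2
      refine ⟨by positivity, ?_⟩
      have h1 := (abs_le.1 (hT' x t).2.2).2
      have h2 : C * (1 - u x t) ≤ C * η := mul_le_mul_of_nonneg_left hwη hC.le
      have h3 := mul_le_mul_of_nonneg_right (h2.trans (hη2.trans hX3)) (sq_nonneg (1 - u x t))
      have h4 := mul_nonneg (sq_nonneg θ) (sq_nonneg (1 - u x t))
      have h5 : m * (1 - u x t) ^ 2 = μ ^ 2 * (1 - u x t) ^ 2 := by rw [hμ]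
      linarith
    have h1 := hmono (mem_Ici.2 le_rfl) (mem_Ici.2 hy1y) hy1y
    simp only at h1
    have h2 : ω * Real.exp ((μ + θ / 2) * Y) ≤ (1 - u x y1) * Real.exp ((μ + θ / 2) * y1) :=
      mul_le_mul hω1 (Real.exp_le_exp.2 (mul_le_mul_of_nonneg_left hy1 (by positivity)))
        (Real.exp_pos _).le (hmw _ _).le
    have h3 := h2.trans h1
    rw [show -(μ + θ / 2) * (y - Y) = (μ + θ / 2) * Y - (μ + θ / 2) * y by ring, Real.exp_sub,
      mul_div_assoc', div_le_iff₀ (Real.exp_pos _)]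
    exact h3
  have hexp : Real.exp (-(μ + θ) * (y - Y)) =
      Real.exp (-(μ + θ / 2) * (y - Y)) * Real.exp (-(θ / 2) * (y - Y)) := by
    rw [← Real.exp_add]; congr 1; ring
  have h1 : Real.exp (-(μ + θ) * (y - Y)) ≤
      Real.exp (-(θ / 2) * (y - Y)) / ω * (1 - u x y) := by
    rw [hexp, div_mul_eq_mul_div, le_div_iff₀ hω]
    have := mul_le_mul_of_nonneg_left hlow (Real.exp_pos (-(θ / 2) * (y - Y))).le
    linarith
  have h2 := mul_le_mul_of_nonneg_left h1 hδ0.le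
  have h3 : 2 / η * δ * (1 + -1 * u x y) + (δ + 0 * (1 + -1 * u x y)) *
    Real.exp (-(μ + θ) * (y - Y)) = 2 / η * δ * (1 - u x y) +
      δ * Real.exp (-(μ + θ) * (y - Y)) := by ring
  rw [h3] at b
  linarith

lemma exists_barrier_outer (W : Wave F c u) : ∃ η A, 0 < η ∧ η ≤ 1 ∧ 0 < A ∧
    ∀ Y δ, (∀ x y, Y ≤ y → pdy u x y ≤ δ) →
    ∀ x y, Y ≤ y → 1 + u x y ≤ η →
      pdy u x y ≤ A * (δ + Real.exp (-(c / 2) * (y - Y))) * (1 + u x y) := by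
  have hc := W.hc
  obtain ⟨κ0, C0, -, hC0, H0⟩ := W.hF.exists_wa_bounds
  obtain ⟨C, hC, hT⟩ := W.hF.reflect.exists_taylor
  have dr : deriv (fun s => F (-s)) = fun s => - deriv F (-s) := by
    funext s; exact deriv_comp_neg F s
  rw [W.hF.deriv2_reflect, dr] at hT
  obtain ⟨m, hm⟩ : ∃ m, m = deriv (deriv F) (-1) := ⟨_, rfl⟩
  have hm0 : 0 < m := by rw [hm]; exact W.hF.2.2.2.1
  simp only [← hm, neg_sub] at hT
  obtain ⟨X, hX0, hX1, hX2⟩ : ∃ X, 0 < X ∧ X ≤ m / 6 ∧ X ≤ c ^ 2 / 8 :=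
    ⟨min (m / 6) (c ^ 2 / 8), by positivity, min_le_left _ _, min_le_right _ _⟩
  obtain ⟨K, hK0, hK⟩ : ∃ K, 0 < K ∧ K * m = 4 * C := ⟨4 * C / m, by positivity, by field_simp⟩
  obtain ⟨η, hη0, hη1, hη2, hη3⟩ : ∃ η, 0 < η ∧ η ≤ 1 ∧ C * η ≤ X ∧ 2 * (K * η) ≤ 1 := by
    refine ⟨min 1 (min (X / C) (1 / (2 * K))), by positivity, min_le_left _ _, ?_, ?_⟩
    · have := (min_le_right 1 (min (X / C) (1 / (2 * K)))).trans (min_le_left _ _)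
      rw [le_div_iff₀ hC] at this; linarith
    · have := (min_le_right 1 (min (X / C) (1 / (2 * K)))).trans (min_le_right _ _)
      rw [le_div_iff₀ (by positivity)] at this; linarith
  refine ⟨η, 2 / η + 2 * C0, hη0, hη1, by positivity, ?_⟩
  intro Y δ hδ x y hy hxy
  have hδ0 : 0 < δ := (W.uy_pos 0 Y).trans_le (hδ 0 Y le_rfl)
  have hmw : ∀ x y, 0 < 1 + u x y := fun x y => by linarith [W.neg_one_lt x y]
  have hT' : ∀ x y, |deriv (deriv F) (u x y) - m| ≤ C * (1 + u x y) ∧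
      |deriv F (u x y) - m * (1 + u x y)| ≤ C * (1 + u x y) ^ 2 := by
    intro x y
    obtain ⟨h1, h2, -⟩ := hT (1 + u x y) ⟨(hmw x y).le, by linarith [W.lt_one x y]⟩
    rw [add_sub_cancel_left] at h1 h2
    refine ⟨h1, ?_⟩
    rw [← abs_neg, neg_sub]
    rwa [neg_add_eq_sub] at h2
  have b := W.barrier_aux (σ := 1) (m := m) (C := C) (K := K) (η := η) (A := 2 / η * δ) (p := 0)
    (q := 2 * C0) (κ := c / 2) (Y := Y) hC hK.ge hη0 (by linarith) hη3 hK0 (by positivity)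
    le_rfl (by positivity)
    (fun x y => by linarith [W.neg_one_lt x y])
    (fun x y _ => by rw [one_mul, one_mul]; exact (hT' x y).2)
    (fun x y _ => by rw [one_mul]; exact (hT' x y).1)
    (fun x y h => by
      rw [one_mul] at h
      have w0 := hmw x y
      have h1 := (abs_le.1 (hT' x y).1).1
      have h2 := (abs_le.1 (hT' x y).2).2
      have h3 : C * (1 + u x y) ≤ C * η := mul_le_mul_of_nonneg_left h hC.le
      have h4 := mul_le_mul_of_nonneg_right (h3.trans (hη2.trans hX2)) w0.le
      have h5 := mul_le_mul_of_nonneg_right h1 w0.le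
      have h6 := mul_pos hc (W.uy_pos x y)
      have h7 : deriv F (u x y) - c * pdy u x y - c ^ 2 / 4 * (1 + u x y) ≤
        deriv (deriv F) (u x y) * (1 + u x y) := by linarith
      have h8 := mul_le_mul_of_nonneg_left h7 (by positivity : 0 ≤ 2 * C0)
      linarith)
    (fun x _ => by
      have h1 := (H0 _ (W.mem' x Y)).2.1
      have h2 := W.uy_le x Y
      have h3 : C0 * (1 - u x Y ^ 2) ≤ C0 * (2 * (1 + u x Y)) :=
        mul_le_mul_of_nonneg_left (by nlinarith [W.lt_one x Y, W.neg_one_lt x Y]) hC0.le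
      linarith)
    (fun x y h _ => by
      have : 2 / η * δ * (η / 2) = δ := by field_simp
      rw [this]; exact hδ x y h)
    x y hy (by linarith)
  simp only [one_mul, zero_add] at b
  have h1 : 0 ≤ 2 / η * Real.exp (-(c / 2) * (y - Y)) * (1 + u x y) := by
    have := hmw x y; positivity
  have h2 : 0 ≤ 2 * C0 * δ * (1 + u x y) := by have := hmw x y; positivity
  linarith

/-- Quantitative smallness of `u_y` relative to `a(u)`. -/
theorem exists_barrier (W : Wave F c u) : ∃ C θ, 0 < C ∧ 0 < θ ∧
    ∀ Y δ ω, δ ≤ 1 → 0 < ω → ω ≤ 1 → (∀ x y, Y ≤ y → pdy u x y ≤ δ) → (∀ x, ω ≤ 1 - u x Y) →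
    ∀ x y, Y + 1 ≤ y →
      pdy u x y ≤ C * (δ + Real.exp (-θ * (y - Y)) / ω) * wa F (u x y) ∧
      |pdx (pdy u) x y| ≤ C * (δ + Real.exp (-θ * (y - Y)) / ω) * wa F (u x y) ∧
      |pdy (pdy u) x y| ≤ C * (δ + Real.exp (-θ * (y - Y)) / ω) * wa F (u x y) := by
  have hc := W.hc
  obtain ⟨η1, θ1, A1, hη1, hη1', hθ1, hA1, H1⟩ := W.exists_barrier_inner
  obtain ⟨η2, A2, hη2, hη2', hA2, H2⟩ := W.exists_barrier_outer
  obtain ⟨κ, C0, hκ, hC0, H0⟩ := W.hF.exists_wa_bounds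
  obtain ⟨C1, hC1, Har⟩ := W.exists_harnack
  obtain ⟨C2, hC2, Hyy⟩ := W.exists_uyy_bound
  obtain ⟨θ, hθ, hθ1', hθ2'⟩ : ∃ θ, 0 < θ ∧ θ ≤ θ1 ∧ θ ≤ c / 2 :=
    ⟨min θ1 (c / 2), by positivity, min_le_left _ _, min_le_right _ _⟩
  obtain ⟨A, hA⟩ : ∃ A, A = (A1 + 1 / η1 + A2 + 1 / (η1 * η2)) / κ := ⟨_, rfl⟩
  have hA0 : 0 < A := by rw [hA]; positivity
  have hAκ : A * κ = A1 + 1 / η1 + A2 + 1 / (η1 * η2) := by rw [hA]; field_simp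
  have base : ∀ Y δ ω, δ ≤ 1 → 0 < ω → ω ≤ 1 → (∀ x y, Y ≤ y → pdy u x y ≤ δ) →
      (∀ x, ω ≤ 1 - u x Y) → ∀ x y, Y ≤ y →
      pdy u x y ≤ A * (δ + Real.exp (-θ * (y - Y)) / ω) * wa F (u x y) := by
    intro Y δ ω hδ1 hω hω1 hδ hbot x y hy
    have hδ0 : 0 < δ := (W.uy_pos 0 Y).trans_le (hδ 0 Y le_rfl)
    obtain ⟨E, hE⟩ : ∃ E, E = Real.exp (-θ * (y - Y)) / ω := ⟨_, rfl⟩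
    have hE0 : 0 < E := by rw [hE]; positivity
    rw [← hE]
    have hu1 := W.lt_one x y
    have hu2 := W.neg_one_lt x y
    have key : ∀ t, 0 ≤ t → t ≤ 1 - u x y ^ 2 →
        pdy u x y ≤ (A1 + 1 / η1 + A2 + 1 / (η1 * η2)) * (δ + E) * t →
        pdy u x y ≤ A * (δ + E) * wa F (u x y) := by
      intro t ht0 ht h
      have h1 := (H0 _ (W.mem' x y)).1
      have h2 := mul_le_mul_of_nonneg_left ht hκ.le
      have h3 := mul_le_mul_of_nonneg_left (h2.trans h1) (by positivity : 0 ≤ A * (δ + E))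
      rw [← hAκ] at h
      linarith
    have p1 : 0 < 1 / η1 := by positivity
    have p2 : 0 < 1 / (η1 * η2) := by positivity
    by_cases h1 : 1 - u x y ≤ η1
    · refine key (1 - u x y) (by linarith) (by nlinarith) ?_
      have b := H1 Y δ (ω * η1) (by positivity) (by nlinarith) hδ
        (fun x => (by nlinarith : ω * η1 ≤ ω).trans (hbot x)) x y hy h1
      refine b.trans (mul_le_mul_of_nonneg_right ?_ (by linarith))
      have e1 : Real.exp (-θ1 * (y - Y)) ≤ Real.exp (-θ * (y - Y)) :=
        Real.exp_le_exp.2 (by nlinarith)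
      have e2 : Real.exp (-θ1 * (y - Y)) / (ω * η1) ≤ 1 / η1 * E := by
        rw [hE, show 1 / η1 * (Real.exp (-θ * (y - Y)) / ω) = Real.exp (-θ * (y - Y)) / (ω * η1) by
          field_simp]
        exact div_le_div_of_nonneg_right e1 (by positivity)
      have e3 : δ * (Real.exp (-θ1 * (y - Y)) / (ω * η1)) ≤ 1 * (1 / η1 * E) :=
        mul_le_mul hδ1 e2 (by positivity) zero_le_one
      have q1 := mul_pos hA1 hE0
      have q2 := mul_pos p1 hδ0
      have q3 := mul_pos hA2 (add_pos hδ0 hE0)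
      have q4 := mul_pos p2 (add_pos hδ0 hE0)
      linarith
    by_cases h2 : 1 + u x y ≤ η2
    · refine key (1 + u x y) (by linarith) (by nlinarith) ?_
      have b := H2 Y δ hδ x y hy h2
      refine b.trans (mul_le_mul_of_nonneg_right ?_ (by linarith))
      have e1 : Real.exp (-(c / 2) * (y - Y)) ≤ Real.exp (-θ * (y - Y)) :=
        Real.exp_le_exp.2 (by nlinarith)
      have e2 : Real.exp (-(c / 2) * (y - Y)) ≤ E := by
        rw [hE, le_div_iff₀ hω]
        have := mul_le_mul e1 hω1 hω.le (Real.exp_pos _).le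
        linarith
      have q3 := mul_le_mul_of_nonneg_left e2 hA2.le
      have q1 := mul_pos hA1 (add_pos hδ0 hE0)
      have q2 := mul_pos p1 (add_pos hδ0 hE0)
      have q4 := mul_pos p2 (add_pos hδ0 hE0)
      linarith
    · push Not at h1 h2
      refine key (η1 * η2) (by positivity) ?_ ?_
      · have := mul_le_mul h1.le h2.le hη2.le (by linarith)
        linarith
      · have q0 : 1 / (η1 * η2) * (δ + E) * (η1 * η2) = δ + E := by field_simp
        have q1 : 0 < (A1 + 1 / η1 + A2) * (δ + E) * (η1 * η2) := by positivity
        linarith [hδ x y hy]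
  obtain ⟨M, hM⟩ : ∃ M, M = A * Real.exp θ * Real.exp (C1 * 2) := ⟨_, rfl⟩
  have hM0 : 0 < M := by rw [hM]; positivity
  refine ⟨A + C2 * M, θ, by positivity, hθ, ?_⟩
  intro Y δ ω hδ1 hω hω1 hδ hbot x y hy
  have hδ0 : 0 < δ := (W.uy_pos 0 Y).trans_le (hδ 0 Y le_rfl)
  have b := base Y δ ω hδ1 hω hω1 hδ hbot
  obtain ⟨E, hE⟩ : ∃ E, E = Real.exp (-θ * (y - Y)) / ω := ⟨_, rfl⟩
  have hE0 : 0 < E := by rw [hE]; positivity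
  have ha := W.a_pos x y
  have hyy := Hyy x y (M * (δ + E) * wa F (u x y)) (by positivity) (by
    intro x' y' hx' hy'
    have hy1 : Y ≤ y' := by linarith [(abs_le.1 hy').1]
    refine (b x' y' hy1).trans ?_
    have e1 : Real.exp (-θ * (y' - Y)) / ω ≤ Real.exp θ * E := by
      rw [hE, mul_div_assoc', ← Real.exp_add]
      refine div_le_div_of_nonneg_right (Real.exp_le_exp.2 ?_) hω.le
      nlinarith [(abs_le.1 hy').1]
    have e2 : δ ≤ Real.exp θ * δ := le_mul_of_one_le_left hδ0.le (Real.one_le_exp hθ.le)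
    have e3 : A * (δ + Real.exp (-θ * (y' - Y)) / ω) ≤ A * (Real.exp θ * (δ + E)) :=
      mul_le_mul_of_nonneg_left (by linarith) hA0.le
    have e4 : wa F (u x' y') ≤ Real.exp (C1 * 2) * wa F (u x y) := by
      refine (Har x y x' y').trans (mul_le_mul_of_nonneg_right (Real.exp_le_exp.2 ?_) ha.le)
      exact mul_le_mul_of_nonneg_left (by linarith) hC1.le
    refine (mul_le_mul e3 e4 (W.a_pos _ _).le (by positivity)).trans (le_of_eq ?_)
    rw [hM]; ring)
  have b1 := b x y (by linarith)
  rw [← hE] at b1 ⊢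
  have s1 : 0 < A * (δ + E) * wa F (u x y) := by positivity
  have s2 : 0 < C2 * (M * (δ + E) * wa F (u x y)) := by positivity
  refine ⟨?_, ?_, ?_⟩
  · linarith
  · linarith [hyy.1]
  · linarith [hyy.2]

lemma exists_gap (W : Wave F c u) (Y : ℝ) : ∃ ω, 0 < ω ∧ ω ≤ 1 ∧ ∀ x, ω ≤ 1 - u x Y := by
  obtain ⟨R1, h1⟩ := eventually_atTop.1
    ((W.tendsto_neg_one_atTop Y).eventually (gt_mem_nhds (by norm_num : (-1 : ℝ) < 0)))
  obtain ⟨R2, h2⟩ := eventually_atBot.1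
    ((W.tendsto_neg_one_atBot Y).eventually (gt_mem_nhds (by norm_num : (-1 : ℝ) < 0)))
  obtain ⟨z, -, hz⟩ := (isCompact_Icc (a := min R2 0) (b := max R1 0)).exists_isMaxOn
    ⟨0, min_le_right _ _, le_max_right _ _⟩ (W.sm.continuous_x Y).continuousOn
  refine ⟨min 1 (1 - u z Y), lt_min one_pos (by linarith [W.lt_one z Y]), min_le_left _ _,
    fun x => ?_⟩
  by_cases hx : x ∈ Icc (min R2 0) (max R1 0)
  · exact (min_le_right _ _).trans (by linarith [show u x Y ≤ u z Y from hz hx])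
  · refine (min_le_left _ _).trans ?_
    rw [mem_Icc, not_and_or, not_le, not_le] at hx
    rcases hx with hx | hx
    · linarith [h2 x (hx.le.trans (min_le_left _ _))]
    · linarith [h1 x ((le_max_left _ _).trans hx.le)]

/-- For large `y` all `y`-derivatives are small relative to `a(u)`. -/
theorem exists_small (W : Wave F c u) {ε : ℝ} (hε : 0 < ε) : ∃ Y, ∀ x y, Y ≤ y →
    pdy u x y ≤ ε * wa F (u x y) ∧ |pdx (pdy u) x y| ≤ ε * wa F (u x y) ∧
      |pdy (pdy u) x y| ≤ ε * wa F (u x y) := by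
  obtain ⟨C, θ, hC, hθ, H⟩ := W.exists_barrier
  obtain ⟨R, hR⟩ := W.exists_uy_small (lt_min one_pos (by positivity : 0 < ε / (2 * C)))
  obtain ⟨ω, hω, hω1, hgap⟩ := W.exists_gap R
  have h1 := H R (min 1 (ε / (2 * C))) ω (min_le_left _ _) hω hω1
    (fun x y hy => (hR x y (Or.inr (hy.trans (le_abs_self _)))).le) hgap
  have ht : Tendsto (fun y => Real.exp (-θ * (y - R))) atTop (𝓝 0) := by
    refine Real.tendsto_exp_atBot.comp ?_
    exact (tendsto_atTop_add_const_right _ (-R) tendsto_id).const_mul_atTop_of_neg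
      (neg_neg_of_pos hθ)
  obtain ⟨Y, hY⟩ := eventually_atTop.1 (ht.eventually (gt_mem_nhds
    (by positivity : 0 < ε / (2 * C) * ω)))
  refine ⟨max Y (R + 1), fun x y hy => ?_⟩
  obtain ⟨a1, a2, a3⟩ := h1 x y ((le_max_right _ _).trans hy)
  have h2 := hY y ((le_max_left _ _).trans hy)
  rw [← div_lt_iff₀ hω] at h2
  have h3 : C * (min 1 (ε / (2 * C)) + Real.exp (-θ * (y - R)) / ω) ≤ ε := by
    have e : C * (ε / (2 * C) + ε / (2 * C)) = ε := by field_simp; ring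
    exact (mul_le_mul_of_nonneg_left (add_le_add (min_le_right _ _) h2.le) hC.le).trans e.le
  have h4 := mul_le_mul_of_nonneg_right h3 (W.a_pos x y).le
  exact ⟨a1.trans h4, a2.trans h4, a3.trans h4⟩

end Wave

end barrier

/-! ### Integrals over horizontal lines -/

section lines

/-- `∫ u_y²` over a horizontal line. -/
noncomputable def lg (u : ℝ → ℝ → ℝ) (y : ℝ) : ℝ := ∫ x, pdy u x y ^ 2

/-- Energy of a horizontal line. -/
noncomputable def lE (F : ℝ → ℝ) (u : ℝ → ℝ → ℝ) (y : ℝ) : ℝ := ∫ x, ed F u x y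

/-- Momentum flux `∫ u_x u_y` over a half line. -/
noncomputable def lN (u : ℝ → ℝ → ℝ) (x₀ y : ℝ) : ℝ := ∫ x in Ioi x₀, pdx u x y * pdy u x y

namespace Wave

variable {F : ℝ → ℝ} {c : ℝ} {u : ℝ → ℝ → ℝ}

lemma exists_harnack_F (W : Wave F c u) : ∃ C, 0 < C ∧ ∀ x y y',
    F (u x y') ≤ Real.exp (C * |y' - y|) * F (u x y) := by
  obtain ⟨C, hC, H⟩ := W.exists_harnack
  refine ⟨2 * C, by positivity, fun x y y' => ?_⟩
  have h := H x y x y'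
  rw [sub_self, abs_zero, zero_add] at h
  have h1 := pow_le_pow_left₀ (W.a_pos x y').le h 2
  rw [mul_pow, W.a_sq, W.a_sq, ← Real.exp_nat_mul] at h1
  have e : ((2 : ℕ) : ℝ) * (C * |y' - y|) = 2 * C * |y' - y| := by push_cast; ring
  rw [e] at h1
  linarith

lemma exists_F_le_ed (W : Wave F c u) : ∃ Y, ∀ x y, Y ≤ y → F (u x y) ≤ 2 * ed F u x y := by
  obtain ⟨Y, hY⟩ := W.exists_small (by norm_num : (0 : ℝ) < 1 / 2)
  refine ⟨Y, fun x y hy => ?_⟩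
  have h1 := (hY x y hy).1
  have h2 := pow_le_pow_left₀ (W.uy_pos x y).le h1 2
  rw [mul_pow, W.a_sq] at h2
  unfold ed
  nlinarith [sq_nonneg (pdx u x y), W.F_pos x y]

lemma integrable_F (W : Wave F c u) (y : ℝ) : Integrable (fun x => F (u x y)) := by
  obtain ⟨Y, hY⟩ := W.exists_F_le_ed
  obtain ⟨C, hC, H⟩ := W.exists_harnack_F
  have hcont : Continuous (fun x => F (u x y)) := W.continuous_Fu.comp (Continuous.prodMk_left y)
  refine ((W.integrable_ed (max Y y)).const_mul (Real.exp (C * |y - max Y y|) * 2)).mono'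
    hcont.aestronglyMeasurable (Eventually.of_forall fun x => ?_)
  rw [Real.norm_eq_abs, abs_of_pos (W.F_pos x y), mul_assoc]
  exact (H x (max Y y) y).trans
    (mul_le_mul_of_nonneg_left (hY x _ (le_max_left _ _)) (Real.exp_pos _).le)

lemma integral_ed_le (W : Wave F c u) (y : ℝ) : lE F u y ≤ 2 * wPhi F 1 := by
  refine le_of_tendsto (intervalIntegral_tendsto_integral (W.integrable_ed y)
    tendsto_neg_atTop_atBot tendsto_id) ?_
  filter_upwards [eventually_ge_atTop 0] with n hn
  have hn' : -n ≤ id n := by simp only [id]; linarith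
  have h1 := W.strip_ineq hn' (le_refl y)
  rw [intervalIntegral.integral_same] at h1
  simp only [id] at *
  linarith [W.hF.wPhi_nonneg (W.neg_one_lt (-n) y).le, W.hF.wPhi_nonneg (W.neg_one_lt n y).le]

lemma exists_integral_F_le (W : Wave F c u) : ∃ Y, ∀ y, Y ≤ y →
    ∫ x, F (u x y) ≤ 4 * wPhi F 1 := by
  obtain ⟨Y, hY⟩ := W.exists_F_le_ed
  refine ⟨Y, fun y hy => ?_⟩
  have h1 : ∫ x, F (u x y) ≤ ∫ x, 2 * ed F u x y :=
    integral_mono (W.integrable_F y) ((W.integrable_ed y).const_mul 2) fun x => hY x y hy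
  rw [integral_const_mul] at h1
  have := W.integral_ed_le y
  unfold lE at this
  linarith

lemma integrable_of_le (W : Wave F c u) {f : ℝ → ℝ} {C y : ℝ} (hf : Continuous f)
    (h : ∀ x, |f x| ≤ C * F (u x y)) : Integrable f :=
  ((W.integrable_F y).const_mul C).mono' hf.aestronglyMeasurable (Eventually.of_forall h)

/-- Differentiation under the integral over a horizontal line. -/
lemma hasDerivAt_integral_of_integrableOn (W : Wave F c u) {f f' : ℝ → ℝ → ℝ} {C : ℝ} {S : Set ℝ}
    {y : ℝ} (hf : Continuous (fun p : ℝ × ℝ => f p.1 p.2))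
    (hf' : Continuous (fun p : ℝ × ℝ => f' p.1 p.2))
    (hd : ∀ x y, HasDerivAt (fun t => f x t) (f' x y) y)
    (h : IntegrableOn (fun x => f x y) S) (h' : ∀ x y, |f' x y| ≤ C * F (u x y)) :
    HasDerivAt (fun y => ∫ x in S, f x y) (∫ x in S, f' x y) y := by
  obtain ⟨H0, hH0, H⟩ := W.exists_harnack_F
  have hc : ∀ y, Continuous (fun x => f x y) := fun y => hf.comp (Continuous.prodMk_left y)
  have hc' : ∀ y, Continuous (fun x => f' x y) := fun y => hf'.comp (Continuous.prodMk_left y)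
  have hC : 0 ≤ C := by
    by_contra hneg
    push Not at hneg
    have := mul_neg_of_neg_of_pos hneg (W.F_pos 0 0)
    linarith [h' 0 0, abs_nonneg (f' 0 0)]
  refine (hasDerivAt_integral_of_dominated_loc_of_deriv_le (μ := volume.restrict S)
    (F := fun y x => f x y) (F' := fun y x => f' x y) (s := Icc (y - 1) (y + 1))
    (bound := fun x => C * (Real.exp H0 * F (u x y))) (Icc_mem_nhds (by linarith) (by linarith))
    (Eventually.of_forall fun y => (hc y).aestronglyMeasurable)
    h (hc' y).aestronglyMeasurable ?_ ?_ ?_).2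
  · refine Eventually.of_forall fun x t ht => (h' x t).trans (mul_le_mul_of_nonneg_left ?_ hC)
    refine (H x y t).trans (mul_le_mul_of_nonneg_right (Real.exp_le_exp.2 ?_) (W.F_pos x y).le)
    have : |t - y| ≤ 1 := abs_le.2 ⟨by linarith [ht.1], by linarith [ht.2]⟩
    nlinarith
  · exact (((W.integrable_F y).const_mul _).const_mul _).integrableOn
  · exact Eventually.of_forall fun x t _ => hd x t

lemma hasDerivAt_integral (W : Wave F c u) {f f' : ℝ → ℝ → ℝ} {C : ℝ} (S : Set ℝ)
    (hf : Continuous (fun p : ℝ × ℝ => f p.1 p.2)) (hf' : Continuous (fun p : ℝ × ℝ => f' p.1 p.2))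
    (hd : ∀ x y, HasDerivAt (fun t => f x t) (f' x y) y)
    (h : ∀ x y, |f x y| ≤ C * F (u x y)) (hdb : ∀ x y, |f' x y| ≤ C * F (u x y)) (y : ℝ) :
    HasDerivAt (fun y => ∫ x in S, f x y) (∫ x in S, f' x y) y :=
  W.hasDerivAt_integral_of_integrableOn hf hf' hd
    (W.integrable_of_le (hf.comp (Continuous.prodMk_left y)) (h · y)).integrableOn hdb

/-- Products of quantities bounded by `a(u)` are bounded by `F(u)`. -/
lemma abs_mul_le (W : Wave F c u) {p q A B x y : ℝ} (hp : |p| ≤ A * wa F (u x y))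
    (hq : |q| ≤ B * wa F (u x y)) : |p * q| ≤ 2 * (A * B) * F (u x y) := by
  rw [abs_mul]
  have h := mul_le_mul hp hq (abs_nonneg _) ((abs_nonneg _).trans hp)
  have e := W.a_sq x y
  calc |p| * |q| ≤ A * B * wa F (u x y) ^ 2 := by linarith
    _ = _ := by rw [e]; ring

lemma abs_ux_le' (W : Wave F c u) (x y : ℝ) : |pdx u x y| ≤ 1 * wa F (u x y) := by
  rw [one_mul]; exact W.abs_ux_le x y

lemma abs_uy_le' (W : Wave F c u) (x y : ℝ) : |pdy u x y| ≤ 1 * wa F (u x y) := by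
  rw [one_mul, abs_of_pos (W.uy_pos x y)]; exact W.uy_le x y

lemma integrable_uy2 (W : Wave F c u) (y : ℝ) : Integrable (fun x => pdy u x y ^ 2) :=
  W.integrable_of_le (C := 2 * (1 * 1)) ((W.continuous_uy.comp (Continuous.prodMk_left y)).pow 2)
    fun x => by rw [sq]; exact W.abs_mul_le (W.abs_uy_le' x y) (W.abs_uy_le' x y)

lemma integrable_ux2 (W : Wave F c u) (y : ℝ) : Integrable (fun x => pdx u x y ^ 2) :=
  W.integrable_of_le (C := 2 * (1 * 1)) ((W.continuous_ux.comp (Continuous.prodMk_left y)).pow 2)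
    fun x => by rw [sq]; exact W.abs_mul_le (W.abs_ux_le' x y) (W.abs_ux_le' x y)

lemma integrable_uxuy (W : Wave F c u) (y : ℝ) : Integrable (fun x => pdx u x y * pdy u x y) :=
  W.integrable_of_le (C := 2 * (1 * 1))
    ((W.continuous_ux.mul W.continuous_uy).comp (Continuous.prodMk_left y))
    fun x => W.abs_mul_le (W.abs_ux_le' x y) (W.abs_uy_le' x y)

lemma lg_nonneg (y : ℝ) : 0 ≤ lg u y := integral_nonneg fun _ => sq_nonneg _

lemma tendsto_Fu_atTop (W : Wave F c u) (y : ℝ) : Tendsto (fun x => F (u x y)) atTop (𝓝 0) := by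
  rw [← W.hF.zero_neg_one]; exact (W.hF.continuous.tendsto _).comp (W.tendsto_neg_one_atTop y)

lemma tendsto_Fu_atBot (W : Wave F c u) (y : ℝ) : Tendsto (fun x => F (u x y)) atBot (𝓝 0) := by
  rw [← W.hF.zero_neg_one]; exact (W.hF.continuous.tendsto _).comp (W.tendsto_neg_one_atBot y)

lemma tendsto_of_le {l : Filter ℝ} {f : ℝ → ℝ} {C y : ℝ}
    (hl : Tendsto (fun x => F (u x y)) l (𝓝 0)) (h : ∀ x, |f x| ≤ C * F (u x y)) :
    Tendsto f l (𝓝 0) := by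
  refine squeeze_zero_norm h ?_
  simpa using hl.const_mul C

lemma hasDerivAt_lE (W : Wave F c u) (y : ℝ) : HasDerivAt (lE F u) (c * lg u y) y := by
  obtain ⟨C, hC, H⟩ := W.exists_second_bound
  have hc := W.hc
  have b1 : ∀ x y, |pdx (pdx u) x y * pdy u x y + pdx u x y * pdx (pdy u) x y| ≤
      4 * C * F (u x y) := by
    intro x y
    obtain ⟨h1, h2, -⟩ := H x y
    have e1 := W.abs_mul_le h1 (W.abs_uy_le' x y)
    have e2 := W.abs_mul_le (W.abs_ux_le' x y) h2
    refine (abs_add_le _ _).trans ?_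
    linarith
  have cf : ∀ y, Continuous (fun x => pdx (pdx u) x y * pdy u x y + pdx u x y * pdx (pdy u) x y) :=
    fun y => W.continuous_flux'.comp (Continuous.prodMk_left y)
  have h := W.hasDerivAt_integral (f := ed F u) (f' := fun x y =>
    pdx (pdx u) x y * pdy u x y + pdx u x y * pdx (pdy u) x y + c * pdy u x y ^ 2)
    (C := 2 + 4 * C + 2 * c) univ W.continuous_ed
    (W.continuous_flux'.add ((W.continuous_uy.pow 2).const_mul c)) W.hasDerivAt_ed_y
    (fun x y => by
      rw [abs_of_nonneg (W.ed_nonneg x y)]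
      have := mul_pos hC (W.F_pos x y)
      have := mul_pos hc (W.F_pos x y)
      linarith [W.ed_le x y])
    (fun x y => by
      have e1 := b1 x y
      have e2 := W.abs_mul_le (W.abs_uy_le' x y) (W.abs_uy_le' x y)
      rw [← sq] at e2
      refine (abs_add_le _ _).trans ?_
      rw [abs_mul, abs_of_pos hc]
      have := mul_le_mul_of_nonneg_left e2 hc.le
      have := W.F_pos x y
      linarith) y
  simp only [setIntegral_univ] at h
  refine h.congr_deriv ?_
  rw [integral_add (W.integrable_of_le (cf y) (b1 · y)) ((W.integrable_uy2 y).const_mul c),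
    integral_const_mul]
  have h0 : ∫ x, (pdx (pdx u) x y * pdy u x y + pdx u x y * pdx (pdy u) x y) = 0 - 0 := by
    refine integral_of_hasDerivAt_of_tendsto (fun x => W.hasDerivAt_flux_x x y)
      (W.integrable_of_le (cf y) (b1 · y)) ?_ ?_
    · exact tendsto_of_le (W.tendsto_Fu_atBot y)
        fun x => W.abs_mul_le (W.abs_ux_le' x y) (W.abs_uy_le' x y)
    · exact tendsto_of_le (W.tendsto_Fu_atTop y)
        fun x => W.abs_mul_le (W.abs_ux_le' x y) (W.abs_uy_le' x y)
  rw [h0]; simp [lg]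

lemma hasDerivAt_lN (W : Wave F c u) (x₀ y : ℝ) : HasDerivAt (lN u x₀)
    (-(c * lN u x₀ y) - (F (u x₀ y) + pdy u x₀ y ^ 2 / 2 - pdx u x₀ y ^ 2 / 2)) y := by
  obtain ⟨C, hC, H⟩ := W.exists_second_bound
  have hc := W.hc
  have b1 : ∀ x y, |pdx (pdy u) x y * pdy u x y + pdx u x y * pdy (pdy u) x y| ≤
      (2 + 4 * C) * F (u x y) := by
    intro x y
    obtain ⟨-, h1, h2⟩ := H x y
    have e1 := W.abs_mul_le h1 (W.abs_uy_le' x y)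
    have e2 := W.abs_mul_le (W.abs_ux_le' x y) h2
    have e3 := W.F_pos x y
    refine (abs_add_le _ _).trans ?_
    linarith
  have b2 : ∀ x y, |pdx u x y * pdy u x y| ≤ (2 + 4 * C) * F (u x y) := by
    intro x y
    have e1 := W.abs_mul_le (W.abs_ux_le' x y) (W.abs_uy_le' x y)
    have e3 := mul_pos hC (W.F_pos x y)
    linarith
  have hcont : Continuous (fun p : ℝ × ℝ =>
      pdx (pdy u) p.1 p.2 * pdy u p.1 p.2 + pdx u p.1 p.2 * pdy (pdy u) p.1 p.2) :=
    (W.smxy.continuous.mul W.continuous_uy).add (W.continuous_ux.mul W.smyy.continuous)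
  have h := W.hasDerivAt_integral (f := fun x y => pdx u x y * pdy u x y) (f' := fun x y =>
    pdx (pdy u) x y * pdy u x y + pdx u x y * pdy (pdy u) x y)
    (C := 2 + 4 * C) (Ioi x₀) (W.continuous_ux.mul W.continuous_uy) hcont
    (fun x y => (W.hasDerivAt_ux_y x y).mul (W.smy.hasDerivAt_y x y)) b2 b1 y
  refine h.congr_deriv ?_
  have hd : ∀ x, HasDerivAt (fun t => F (u t y) + pdy u t y ^ 2 / 2 - pdx u t y ^ 2 / 2)
      (pdx (pdy u) x y * pdy u x y + pdx u x y * pdy (pdy u) x y +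
        c * (pdx u x y * pdy u x y)) x := by
    intro x
    refine (((W.hasDerivAt_Fu_x x y).add (((W.smy.hasDerivAt_x x y).pow 2).div_const 2)).sub
      (((W.smx.hasDerivAt_x x y).pow 2).div_const 2)).congr_deriv ?_
    rw [← W.pde x y]; simp; ring
  have i1 : Integrable (fun x => pdx (pdy u) x y * pdy u x y + pdx u x y * pdy (pdy u) x y) :=
    W.integrable_of_le (hcont.comp (Continuous.prodMk_left y)) (b1 · y)
  have i2 := (W.integrable_uxuy y).const_mul c
  have hb : ∀ x, |F (u x y) + pdy u x y ^ 2 / 2 - pdx u x y ^ 2 / 2| ≤ 2 * F (u x y) := by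
    intro x
    have := W.modica x y
    have := W.F_pos x y
    rw [abs_le]; constructor <;> nlinarith [sq_nonneg (pdx u x y), sq_nonneg (pdy u x y)]
  have h0 := integral_Ioi_of_hasDerivAt_of_tendsto' (a := x₀) (fun x _ => hd x)
    (i1.add i2).integrableOn (tendsto_of_le (W.tendsto_Fu_atTop y) hb)
  rw [integral_add i1.integrableOn i2.integrableOn, integral_const_mul] at h0
  unfold lN
  linarith

lemma two_Phi_le (W : Wave F c u) (x y : ℝ) :
    2 * wPhi F (u x y) ≤ lE F u y + lg u y / 2 := by
  have hn : Tendsto (fun n : ℝ => 2 * wPhi F (u x y) - wPhi F (u n y) - wPhi F (u (-n) y)) atTop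
      (𝓝 (2 * wPhi F (u x y) - 0 - 0)) := by
    have h0 := BalancedDoubleWell.wPhi_neg_one F
    have t1 := (W.hF.continuous_wPhi.tendsto (-1)).comp (W.tendsto_neg_one_atTop y)
    have t2 := (W.hF.continuous_wPhi.tendsto (-1)).comp
      ((W.tendsto_neg_one_atBot y).comp tendsto_neg_atTop_atBot)
    rw [h0] at t1 t2
    exact (t1.const_sub _).sub t2
  simp only [sub_zero] at hn
  refine le_of_tendsto hn ?_
  filter_upwards [eventually_ge_atTop |x|] with n hnx
  have hx := abs_le.1 hnx
  have h1 := le_of_abs_le (W.abs_Phi_sub_le hx.1 y)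
  have h2 := neg_le_of_abs_le (W.abs_Phi_sub_le hx.2 y)
  have c1 : Continuous (fun x => ed F u x y) := W.continuous_ed.comp (Continuous.prodMk_left y)
  have c2 : Continuous (fun x => pdy u x y ^ 2) :=
    (W.continuous_uy.comp (Continuous.prodMk_left y)).pow 2
  have e1 := intervalIntegral.integral_add_adjacent_intervals
    (c1.intervalIntegrable (μ := volume) (-n) x) (c1.intervalIntegrable x n)
  have e2 := intervalIntegral.integral_add_adjacent_intervals
    (c2.intervalIntegrable (μ := volume) (-n) x) (c2.intervalIntegrable x n)
  have le : -n ≤ n := by linarith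
  have f1 : (∫ x in (-n)..n, ed F u x y) ≤ lE F u y := by
    rw [intervalIntegral.integral_of_le le]
    exact setIntegral_le_integral (W.integrable_ed y) (Eventually.of_forall fun x => W.ed_nonneg x y)
  have f2 : (∫ x in (-n)..n, pdy u x y ^ 2) ≤ lg u y := by
    rw [intervalIntegral.integral_of_le le]
    exact setIntegral_le_integral (W.integrable_uy2 y) (Eventually.of_forall fun x => sq_nonneg _)
  linarith

end Wave

end lines

/-! ### Algebraic decay of the energy defect -/

section decay

lemma le_of_hasDerivAt_nonpos {f f' : ℝ → ℝ} {a b : ℝ} (hab : a ≤ b)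
    (hd : ∀ t ∈ Icc a b, HasDerivAt f (f' t) t) (h : ∀ t ∈ Icc a b, f' t ≤ 0) : f b ≤ f a := by
  have : AntitoneOn f (Icc a b) := by
    apply antitoneOn_of_hasDerivWithinAt_nonpos (convex_Icc a b)
      (fun t ht => (hd t ht).continuousAt.continuousWithinAt)
      (fun t ht => (hd t (interior_subset ht)).hasDerivWithinAt)
      (fun t ht => h t (interior_subset ht))
  exact this (left_mem_Icc.2 hab) (right_mem_Icc.2 hab) hab

lemma sq_le_of_forall_add_div {p K D : ℝ} (hp : 0 ≤ p) (hK : 0 < K) (hD : 0 ≤ D)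
    (h : ∀ l, 0 < l → p ≤ K * (l + D / l)) : p ^ 2 ≤ 4 * K ^ 2 * D := by
  rcases hp.eq_or_lt with h0 | h0
  · rw [← h0, zero_pow two_ne_zero]; positivity
  · have h1 := h (p / (2 * K)) (by positivity)
    have e : K * (p / (2 * K) + D / (p / (2 * K))) = p / 2 + 2 * K ^ 2 * D / p := by
      field_simp
    rw [e] at h1
    have h2 : p / 2 ≤ 2 * K ^ 2 * D / p := by linarith
    rw [le_div_iff₀ h0] at h2
    nlinarith

/-- A discrete Riccati inequality forces decay like `1 / n`. -/
lemma le_div_of_sq_le {b : ℕ → ℝ} {K : ℝ} (hK : 0 < K) (hb : ∀ n, 0 ≤ b n)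
    (h : ∀ n, b (n + 1) ^ 2 ≤ K * (b n - b (n + 1))) (n : ℕ) :
    b n ≤ (b 0 + 2 * K) / (n + 1) := by
  have hM : 0 < b 0 + 2 * K := by linarith [hb 0]
  induction n with
  | zero => simp; linarith
  | succ n ih =>
    by_contra hc
    push Not at hc
    push_cast at hc
    have hn : (0 : ℝ) ≤ n := Nat.cast_nonneg n
    set M := b 0 + 2 * K with hMd
    have hMK : 2 * K ≤ M := by linarith [hb 0]
    have h1 : (M / ((n : ℝ) + 1 + 1)) ^ 2 < b (n + 1) ^ 2 :=
      pow_lt_pow_left₀ hc (by positivity) two_ne_zero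
    have h2 := h n
    have h3 : K * (b n - b (n + 1)) ≤ K * (M / (n + 1) - M / ((n : ℝ) + 1 + 1)) :=
      mul_le_mul_of_nonneg_left (by linarith) hK.le
    have e : K * (M / ((n : ℝ) + 1) - M / ((n : ℝ) + 1 + 1))
        = M * K / (((n : ℝ) + 1) * (n + 1 + 1)) := by
      field_simp; ring
    have h4 : M * K / (((n : ℝ) + 1) * (n + 1 + 1)) ≤ (M / ((n : ℝ) + 1 + 1)) ^ 2 := by
      rw [div_pow, div_le_div_iff₀ (by positivity) (by positivity)]
      have : K * ((n : ℝ) + 1 + 1) ≤ M * (n + 1) := by nlinarith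
      have := mul_le_mul_of_nonneg_left this (by positivity : 0 ≤ M * ((n : ℝ) + 1 + 1))
      nlinarith
    linarith

/-- Energy defect of a horizontal line. -/
noncomputable def lP (F : ℝ → ℝ) (u : ℝ → ℝ → ℝ) (y : ℝ) : ℝ := 2 * wPhi F 1 - lE F u y

namespace Wave

variable {F : ℝ → ℝ} {c : ℝ} {u : ℝ → ℝ → ℝ}

lemma lP_nonneg (W : Wave F c u) (y : ℝ) : 0 ≤ lP F u y := by
  have := W.integral_ed_le y
  unfold lP; linarith

lemma hasDerivAt_lP (W : Wave F c u) (y : ℝ) : HasDerivAt (lP F u) (-(c * lg u y)) y :=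
  ((W.hasDerivAt_lE y).const_sub _)

lemma antitone_lP (W : Wave F c u) : Antitone (lP F u) :=
  antitone_of_hasDerivAt_nonpos (fun y => W.hasDerivAt_lP y) fun y => by
    have := mul_nonneg W.hc.le (lg_nonneg (u := u) y)
    simpa using this

lemma lP_le (W : Wave F c u) (x y : ℝ) :
    lP F u y ≤ 2 * (wPhi F 1 - wPhi F (u x y)) + lg u y / 2 := by
  have := W.two_Phi_le x y
  unfold lP; linarith

lemma exists_argmax (W : Wave F c u) (y : ℝ) : ∃ x₀, ∀ x, u x y ≤ u x₀ y := by
  refine (W.sm.continuous_x y).exists_forall_ge' 0 ?_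
  rw [cocompact_eq_atBot_atTop]
  exact eventually_sup.2
    ⟨((W.tendsto_neg_one_atBot y).eventually (gt_mem_nhds (W.neg_one_lt 0 y))).mono
      fun x hx => le_of_lt hx,
    ((W.tendsto_neg_one_atTop y).eventually (gt_mem_nhds (W.neg_one_lt 0 y))).mono
      fun x hx => le_of_lt hx⟩

/-- The ratio `u_x / a(u)` varies slowly in `y`. -/
lemma exists_ratio_small (W : Wave F c u) : ∃ Y, ∀ x y₀ y, Y ≤ y₀ → y₀ ≤ y → y ≤ y₀ + 1 →
    pdx u x y₀ = 0 → pdx u x y ^ 2 ≤ F (u x y) := by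
  obtain ⟨κ, C, -, hC, H⟩ := W.hF.exists_wa_bounds
  obtain ⟨Y, hY⟩ := W.exists_small (ε := 1 / (2 * (1 + C))) (by positivity)
  refine ⟨Y, fun x y₀ y h0 h1 h2 hx => ?_⟩
  have hd : ∀ t, HasDerivAt (fun t => pdx u x t / wa F (u x t))
      ((pdx (pdy u) x t * wa F (u x t) - pdx u x t *
        (deriv F (u x t) / wa F (u x t) * pdy u x t)) / wa F (u x t) ^ 2) t := fun t =>
    (W.hasDerivAt_ux_y x t).div (W.hasDerivAt_a_y x t) (W.a_pos x t).ne'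
  have hb : ∀ t ∈ Icc y₀ y, ‖(pdx (pdy u) x t * wa F (u x t) - pdx u x t *
        (deriv F (u x t) / wa F (u x t) * pdy u x t)) / wa F (u x t) ^ 2‖ ≤ 1 / 2 := by
    intro t ht
    obtain ⟨h3, h4, -⟩ := hY x t (h0.trans ht.1)
    have ha := W.a_pos x t
    have h5 : |deriv F (u x t) / wa F (u x t)| ≤ C := by
      rw [abs_div, abs_of_pos ha, div_le_iff₀ ha]; exact (H _ (W.mem' x t)).2.2
    have h6 := W.abs_ux_le x t
    rw [Real.norm_eq_abs, abs_div, abs_of_pos (pow_pos ha 2), div_le_iff₀ (pow_pos ha 2)]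
    have h7 : |deriv F (u x t) / wa F (u x t) * pdy u x t| ≤
        C * (1 / (2 * (1 + C)) * wa F (u x t)) := by
      rw [abs_mul, abs_of_pos (W.uy_pos x t)]
      exact mul_le_mul h5 h3 (W.uy_pos x t).le hC.le
    calc _ ≤ |pdx (pdy u) x t * wa F (u x t)| +
          |pdx u x t * (deriv F (u x t) / wa F (u x t) * pdy u x t)| := abs_sub _ _
      _ ≤ (1 / (2 * (1 + C)) * wa F (u x t)) * wa F (u x t) +
          wa F (u x t) * (C * (1 / (2 * (1 + C)) * wa F (u x t))) := by
          rw [abs_mul, abs_mul, abs_of_pos ha]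
          exact add_le_add (mul_le_mul_of_nonneg_right h4 ha.le)
            (mul_le_mul h6 h7 (abs_nonneg _) ha.le)
      _ = _ := by field_simp
  have h := Convex.norm_image_sub_le_of_norm_hasDerivWithin_le
    (fun t _ => (hd t).hasDerivWithinAt) hb (convex_Icc y₀ y) (left_mem_Icc.2 h1)
    (right_mem_Icc.2 h1)
  simp only [hx, zero_div, sub_zero, Real.norm_eq_abs] at h
  have ha := W.a_pos x y
  have h3 : |pdx u x y / wa F (u x y)| ≤ 1 / 2 := by
    refine h.trans ?_
    rw [abs_of_nonneg (by linarith)]; linarith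
  rw [abs_div, abs_of_pos ha, div_le_iff₀ ha] at h3
  have h4 := pow_le_pow_left₀ (abs_nonneg _) h3 2
  rw [sq_abs, mul_pow, W.a_sq] at h4
  linarith [W.F_pos x y]

lemma abs_lN_le (W : Wave F c u) {l M y : ℝ} (hl : 0 < l) (hM : ∫ x, F (u x y) ≤ M) (x₀ : ℝ) :
    |lN u x₀ y| ≤ 2 * M * l + lg u y / (4 * l) := by
  have h1 : |lN u x₀ y| ≤ ∫ x in Ioi x₀, |pdx u x y * pdy u x y| := by
    unfold lN
    exact abs_integral_le_integral_abs
  have h2 : ∫ x in Ioi x₀, |pdx u x y * pdy u x y| ≤ ∫ x, |pdx u x y * pdy u x y| :=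
    setIntegral_le_integral (W.integrable_uxuy y).abs (Eventually.of_forall fun x => abs_nonneg _)
  have i1 := ((W.integrable_F y).const_mul (2 * l))
  have i2 := ((W.integrable_uy2 y).div_const (4 * l))
  have h3 : ∫ x, |pdx u x y * pdy u x y| ≤
      ∫ x, (2 * l * F (u x y) + pdy u x y ^ 2 / (4 * l)) := by
    refine integral_mono (W.integrable_uxuy y).abs (i1.add i2) fun x => ?_
    have h4 := W.modica x y
    have h5 : l * pdx u x y ^ 2 ≤ l * (2 * F (u x y)) :=
      mul_le_mul_of_nonneg_left (by linarith [sq_nonneg (pdy u x y)]) hl.le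
    have h6 : |pdx u x y * pdy u x y| ≤ l * pdx u x y ^ 2 + pdy u x y ^ 2 / (4 * l) := by
      have e : l * pdx u x y ^ 2 + pdy u x y ^ 2 / (4 * l) - |pdx u x y * pdy u x y| =
          (2 * l * |pdx u x y| - |pdy u x y|) ^ 2 / (4 * l) := by
        rw [abs_mul, sub_sq, mul_pow, sq_abs, sq_abs]; field_simp; ring
      have : 0 ≤ (2 * l * |pdx u x y| - |pdy u x y|) ^ 2 / (4 * l) := by positivity
      linarith
    simp only []
    linarith
  rw [integral_add i1 i2, integral_const_mul, integral_div] at h3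
  have h4 : 2 * l * ∫ x, F (u x y) ≤ 2 * l * M := mul_le_mul_of_nonneg_left hM (by positivity)
  have h5 : lg u y = ∫ x, pdy u x y ^ 2 := rfl
  rw [← h5] at h3
  linarith

lemma exists_lP_step (W : Wave F c u) : ∃ K Y, 0 < K ∧ ∀ y, Y ≤ y →
    lP F u (y + 1) ^ 2 ≤ K * (lP F u y - lP F u (y + 1)) := by
  have hc := W.hc
  obtain ⟨Y1, h1⟩ := W.exists_ratio_small
  obtain ⟨Y2, h2⟩ := W.exists_integral_F_le
  obtain ⟨C, hC, h3⟩ := W.hF.exists_one_sub_wPhi_le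
  obtain ⟨Y3, h4⟩ := eventually_atTop.1
    ((W.hu.2.1 0).eventually (lt_mem_nhds (by norm_num : (0 : ℝ) < 1)))
  have he : 0 < wPhi F 1 := W.hF.wPhi_one_pos
  obtain ⟨M, hM⟩ : ∃ M, M = 4 * wPhi F 1 := ⟨_, rfl⟩
  have hMp : 0 < M := by rw [hM]; positivity
  obtain ⟨K, hK⟩ : ∃ K, K = 48 * C * (1 + c) * M + 6 * C * (1 + c) / c + (3 / c) + 1 := ⟨_, rfl⟩
  have hKp : 0 < K := by rw [hK]; positivity
  have hP2 : ∀ y, lP F u y ≤ M := by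
    intro y
    have : 0 ≤ lE F u y := integral_nonneg fun x => W.ed_nonneg x y
    unfold lP; linarith
  refine ⟨4 * (K + M) ^ 2, max Y1 (max Y2 Y3), by positivity, fun y₀ hy => ?_⟩
  have hy1 : Y1 ≤ y₀ := (le_max_left _ _).trans hy
  have hy2 : Y2 ≤ y₀ := ((le_max_left _ _).trans (le_max_right _ _)).trans hy
  have hy3 : Y3 ≤ y₀ := ((le_max_right _ _).trans (le_max_right _ _)).trans hy
  obtain ⟨x₀, hx₀⟩ := W.exists_argmax y₀
  have hcrit : pdx u x₀ y₀ = 0 :=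
    IsLocalMax.deriv_eq_zero (Eventually.of_forall hx₀)
  have hD : 0 ≤ lP F u y₀ - lP F u (y₀ + 1) := by
    have := W.antitone_lP (by linarith : y₀ ≤ y₀ + 1)
    linarith
  refine sq_le_of_forall_add_div (W.lP_nonneg _) (by positivity) hD fun l hl => ?_
  have hDl : 0 ≤ (lP F u y₀ - lP F u (y₀ + 1)) / l := by positivity
  rcases le_or_gt l 1 with hl1 | hl1
  swap
  · have t1 := hP2 (y₀ + 1)
    have t2 : M * 1 ≤ M * l := mul_le_mul_of_nonneg_left hl1.le hMp.le
    have t3 : 0 ≤ K * l := by positivity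
    have t4 : 0 ≤ (K + M) * ((lP F u y₀ - lP F u (y₀ + 1)) / l) := by positivity
    linarith
  obtain ⟨p, hp⟩ : ∃ p, p = lP F u (y₀ + 1) := ⟨_, rfl⟩
  have hψ : ∀ y ∈ Icc y₀ (y₀ + 1), HasDerivAt (fun y => p * ((y - y₀) ^ 2 / 2 - (y - y₀) ^ 3 / 3)
      + 4 * C * (((y - y₀) * (1 - (y - y₀))) * lN u x₀ y) - 8 * C * (1 + c) * M * l * y
      + (C * (1 + c) / l + 1 / 2) * (lP F u y / c))
      (p * ((y - y₀) * (1 - (y - y₀))) + 4 * C * ((1 - 2 * (y - y₀)) * lN u x₀ y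
        + ((y - y₀) * (1 - (y - y₀))) * (-(c * lN u x₀ y)
          - (F (u x₀ y) + pdy u x₀ y ^ 2 / 2 - pdx u x₀ y ^ 2 / 2))) - 8 * C * (1 + c) * M * l
      - (C * (1 + c) / l + 1 / 2) * lg u y) y := by
    intro y _
    have d0 : HasDerivAt (fun y : ℝ => y - y₀) 1 y := (hasDerivAt_id y).sub_const y₀
    have d1 := (((d0.pow 2).div_const 2).sub ((d0.pow 3).div_const 3)).const_mul p
    have d2 := (((d0.mul (d0.const_sub 1)).mul (W.hasDerivAt_lN x₀ y))).const_mul (4 * C)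
    have d3 := (hasDerivAt_id y).const_mul (8 * C * (1 + c) * M * l)
    have d4 := ((W.hasDerivAt_lP y).div_const c).const_mul (C * (1 + c) / l + 1 / 2)
    refine (((d1.add d2).sub d3).add d4).congr_deriv ?_
    simp only [Pi.mul_apply]
    field_simp
    ring
  have hψ' := le_of_hasDerivAt_nonpos (by linarith) hψ ?_
  · simp only [sub_self, add_sub_cancel_left] at hψ'
    rw [← hp] at hψ' ⊢
    have key : p ≤ (48 * C * (1 + c) * M) * l + (6 * C * (1 + c) / c) * ((lP F u y₀ - p) / l)
        + 3 / c * (lP F u y₀ - p) := by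
      have e : (48 * C * (1 + c) * M) * l + (6 * C * (1 + c) / c) * ((lP F u y₀ - p) / l)
        + 3 / c * (lP F u y₀ - p) = 6 * (8 * C * (1 + c) * M * l +
          (C * (1 + c) / l + 1 / 2) * (lP F u y₀ / c) - (C * (1 + c) / l + 1 / 2) * (p / c)) := by
        field_simp; ring
      rw [e]
      nlinarith
    rw [← hp] at hD hDl
    have t1 : (lP F u y₀ - p) ≤ (lP F u y₀ - p) / l := by
      rw [le_div_iff₀ hl]; nlinarith
    have t2 : 3 / c * (lP F u y₀ - p) ≤ 3 / c * ((lP F u y₀ - p) / l) :=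
      mul_le_mul_of_nonneg_left t1 (by positivity)
    have k1 : 48 * C * (1 + c) * M ≤ K + M := by
      have : 0 ≤ 6 * C * (1 + c) / c + 3 / c := by positivity
      linarith
    have k2 : 6 * C * (1 + c) / c + 3 / c ≤ K + M := by
      have : 0 ≤ 48 * C * (1 + c) * M := by positivity
      linarith
    have t3 := mul_le_mul_of_nonneg_right k1 hl.le
    have t4 := mul_le_mul_of_nonneg_right k2 hDl
    linarith
  · intro y hy'
    have s0 : 0 ≤ y - y₀ := by linarith [hy'.1]
    have s1 : y - y₀ ≤ 1 := by linarith [hy'.2]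
    have hu0 : 0 ≤ u x₀ y := by
      have a1 := h4 y₀ hy3
      have a2 := hx₀ 0
      have a3 := (W.strictMono x₀).monotone hy'.1
      linarith
    have b1 := h3 _ ⟨hu0, (W.lt_one x₀ y).le⟩
    have b2 := h1 x₀ y₀ y hy1 hy'.1 hy'.2 hcrit
    have b3 := W.lP_le x₀ y
    have b4 : p ≤ lP F u y := by rw [hp]; exact W.antitone_lP hy'.2
    have b5 := W.abs_lN_le hl ((h2 y (hy2.trans hy'.1)).trans hM.ge) x₀
    have hg := lg_nonneg (u := u) y
    have uy2 := sq_nonneg (pdy u x₀ y)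
    obtain ⟨T, hT⟩ : ∃ T, T = F (u x₀ y) + pdy u x₀ y ^ 2 / 2 - pdx u x₀ y ^ 2 / 2 := ⟨_, rfl⟩
    rw [← hT]
    have hT1 : F (u x₀ y) ≤ 2 * T := by linarith
    generalize y - y₀ = s at *
    generalize lN u x₀ y = N at *
    generalize lg u y = g at *
    have χ0 : 0 ≤ s * (1 - s) := mul_nonneg s0 (by linarith)
    have χ1 : s * (1 - s) ≤ 1 := by nlinarith
    have b6 : p ≤ 4 * C * T + g / 2 := by
      have := mul_le_mul_of_nonneg_left hT1 hC.le
      linarith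
    have b7 := mul_le_mul_of_nonneg_right b6 χ0
    have b8 : (1 - 2 * s - c * (s * (1 - s))) * N ≤ (1 + c) * (2 * M * l + g / (4 * l)) := by
      refine (le_abs_self _).trans ?_
      rw [abs_mul]
      refine mul_le_mul ?_ b5 (abs_nonneg _) (by positivity)
      rw [abs_le]
      constructor <;> nlinarith
    have b9 := mul_le_mul_of_nonneg_left b8 (by positivity : 0 ≤ 4 * C)
    have b10 : s * (1 - s) * g ≤ 1 * g := mul_le_mul_of_nonneg_right χ1 hg
    have e : 4 * C * ((1 + c) * (2 * M * l + g / (4 * l))) =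
        8 * C * (1 + c) * M * l + C * (1 + c) / l * g := by
      field_simp; ring
    rw [e] at b9
    linarith

/-- The energy defect decays like `1 / y`. -/
lemma exists_lP_le (W : Wave F c u) : ∃ C, 0 < C ∧ ∀ y, 1 ≤ y → lP F u y ≤ C / y := by
  obtain ⟨K, Y, hK, h⟩ := W.exists_lP_step
  obtain ⟨Z, hZ⟩ : ∃ Z, Z = max Y 1 := ⟨_, rfl⟩
  have hZ1 : 1 ≤ Z := hZ ▸ le_max_right _ _
  have hb := le_div_of_sq_le (b := fun n => lP F u (Z + n)) hK (fun n => W.lP_nonneg _)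
    (fun n => by
      have := h (Z + n) ((le_max_left Y 1).trans (by rw [← hZ]; have : (0 : ℝ) ≤ n := n.cast_nonneg
                                                     linarith))
      push_cast
      rwa [← add_assoc])
  simp only [CharP.cast_eq_zero, add_zero] at hb
  have h0 := W.lP_nonneg Z
  have hM : 0 < lP F u Z + 2 * K := by linarith
  have h1 := W.lP_nonneg 1
  refine ⟨(lP F u Z + 2 * K) * (Z + 1) + lP F u 1 * Z + 1, by positivity, fun y hy => ?_⟩
  rw [le_div_iff₀ (by linarith)]
  rcases le_or_gt y Z with hyz | hyz
  · have t1 := W.antitone_lP hy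
    have t2 := mul_le_mul t1 hyz (by linarith) h1
    have : 0 ≤ (lP F u Z + 2 * K) * (Z + 1) := by positivity
    linarith
  · have hf := Nat.floor_le (by linarith : 0 ≤ y - Z)
    have hl := Nat.lt_floor_add_one (y - Z)
    have t1 := W.antitone_lP (by linarith : Z + (⌊y - Z⌋₊ : ℝ) ≤ y)
    have t2 := hb ⌊y - Z⌋₊
    rw [le_div_iff₀ (by positivity)] at t2
    have hn : (0 : ℝ) ≤ (⌊y - Z⌋₊ : ℕ) := Nat.cast_nonneg _
    generalize ((⌊y - Z⌋₊ : ℕ) : ℝ) = n at *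
    have t3 : y ≤ (Z + 1) * (n + 1) := by nlinarith
    have t4 := mul_le_mul t1 t3 (by linarith) (W.lP_nonneg _)
    have t5 := mul_le_mul_of_nonneg_right t2 (by linarith : 0 ≤ Z + 1)
    have t6 : 0 ≤ lP F u 1 * Z := by positivity
    linarith
end Wave

end decay

/-! ### Structure of the zero level set -/

section level

/-- At height `y` the vertical variation of `u` is at most `ε` times `a(u)`. -/
def FlatAt (F : ℝ → ℝ) (u : ℝ → ℝ → ℝ) (ε y : ℝ) : Prop :=
  ∀ x, pdy u x y ≤ ε * wa F (u x y) ∧ |pdx (pdy u) x y| ≤ ε * wa F (u x y) ∧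
    |pdy (pdy u) x y| ≤ ε * wa F (u x y)

/-- `k₁ < k₂` are the zeros of `u(·, y)`, which is positive exactly between them. -/
structure IsLevel (u : ℝ → ℝ → ℝ) (y k₁ k₂ : ℝ) : Prop where
  lt : k₁ < k₂
  left : u k₁ y = 0
  right : u k₂ y = 0
  mid : ∀ x, k₁ < x → x < k₂ → 0 < u x y
  out_left : ∀ x, x < k₁ → u x y < 0
  out_right : ∀ x, k₂ < x → u x y < 0

namespace Wave

variable {F : ℝ → ℝ} {c : ℝ} {u : ℝ → ℝ → ℝ}

lemma flatAt_nonneg (W : Wave F c u) {ε y : ℝ} (h : FlatAt F u ε y) : 0 < ε := by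
  have h1 := (h 0).1
  have h2 := W.uy_pos 0 y
  have h3 := W.a_pos 0 y
  by_contra hc
  push Not at hc
  have := mul_nonpos_of_nonpos_of_nonneg hc h3.le
  linarith

lemma hasDerivAt_defect_x (W : Wave F c u) (x y : ℝ) :
    HasDerivAt (fun x => F (u x y) - pdx u x y ^ 2 / 2)
      (pdx u x y * (pdy (pdy u) x y + c * pdy u x y)) x := by
  refine ((W.hasDerivAt_Fu_x x y).sub (((W.smx.hasDerivAt_x x y).pow 2).div_const 2)).congr_deriv ?_
  have := W.pde x y
  simp only [Nat.cast_ofNat, Nat.add_one_sub_one, pow_one]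
  rw [← this]; ring

lemma defect_nonneg (W : Wave F c u) (x y : ℝ) : 0 ≤ F (u x y) - pdx u x y ^ 2 / 2 := by
  have := W.modica x y
  have := sq_nonneg (pdy u x y)
  linarith

lemma flatAt_rhs (W : Wave F c u) {ε y : ℝ} (h : FlatAt F u ε y) (x : ℝ) :
    |pdy (pdy u) x y + c * pdy u x y| ≤ (1 + c) * ε * wa F (u x y) := by
  obtain ⟨h1, -, h2⟩ := h x
  have h3 : |c * pdy u x y| ≤ c * (ε * wa F (u x y)) := by
    rw [abs_mul, abs_of_pos W.hc, abs_of_pos (W.uy_pos x y)]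
    exact mul_le_mul_of_nonneg_left h1 W.hc.le
  have := abs_add_le (pdy (pdy u) x y) (c * pdy u x y)
  linarith

/-- Near-conservation of the one dimensional energy. -/
lemma exists_defect_le (W : Wave F c u) : ∃ C Y, 0 < C ∧ ∀ y ε, Y ≤ y → FlatAt F u ε y →
    ∀ x, F (u x y) - pdx u x y ^ 2 / 2 ≤ C * ε := by
  have hc := W.hc
  have he := W.hF.wPhi_one_pos
  obtain ⟨Y, hY⟩ := W.exists_integral_F_le
  refine ⟨2 * ((1 + c) * (4 * wPhi F 1)), Y, by positivity, fun y ε hy h x => ?_⟩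
  have hε := W.flatAt_nonneg h
  have hb : ∀ x, |pdx u x y * (pdy (pdy u) x y + c * pdy u x y)| ≤
      2 * (1 * ((1 + c) * ε)) * F (u x y) := fun x =>
    W.abs_mul_le (W.abs_ux_le' x y) (W.flatAt_rhs h x)
  have hcont : Continuous (fun x => pdx u x y * (pdy (pdy u) x y + c * pdy u x y)) := by
    have c1 := W.smx.continuous_x y
    have c2 := W.smy.continuous_x y
    have c3 := W.smyy.continuous_x y
    fun_prop
  have hi := W.integrable_of_le hcont hb
  have h0 := integral_Iic_of_hasDerivAt_of_tendsto' (a := x) (m := 0)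
    (fun x _ => W.hasDerivAt_defect_x x y) hi.integrableOn
    (tendsto_of_le (C := 1) (W.tendsto_Fu_atBot y) fun x => by
      rw [abs_of_nonneg (W.defect_nonneg x y)]
      linarith [sq_nonneg (pdx u x y)])
  rw [sub_zero] at h0
  rw [← h0]
  have h1 : ∫ x in Iic x, pdx u x y * (pdy (pdy u) x y + c * pdy u x y) ≤
      ∫ x in Iic x, 2 * (1 * ((1 + c) * ε)) * F (u x y) :=
    setIntegral_mono hi.integrableOn ((W.integrable_F y).const_mul _).integrableOn
      fun x => (le_abs_self _).trans (hb x)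
  have h2 : ∫ x in Iic x, 2 * (1 * ((1 + c) * ε)) * F (u x y) ≤
      ∫ x, 2 * (1 * ((1 + c) * ε)) * F (u x y) :=
    setIntegral_le_integral ((W.integrable_F y).const_mul _) (Eventually.of_forall fun x =>
      mul_nonneg (by positivity) (W.F_pos x y).le)
  simp only [integral_const_mul] at h1 h2
  have h3 : 2 * (1 * ((1 + c) * ε)) * ∫ x, F (u x y) ≤
      2 * (1 * ((1 + c) * ε)) * (4 * wPhi F 1) :=
    mul_le_mul_of_nonneg_left (hY y hy) (by positivity)
  linarith

lemma exists_lg_le (W : Wave F c u) : ∃ C Y, 0 < C ∧ ∀ y ε, Y ≤ y → FlatAt F u ε y →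
    lg u y ≤ C * ε ^ 2 := by
  have he := W.hF.wPhi_one_pos
  obtain ⟨Y, hY⟩ := W.exists_integral_F_le
  refine ⟨2 * (4 * wPhi F 1), Y, by positivity, fun y ε hy h => ?_⟩
  have h1 : lg u y ≤ ∫ x, 2 * ε ^ 2 * F (u x y) :=
    integral_mono (W.integrable_uy2 y) ((W.integrable_F y).const_mul _) fun x => by
      have := pow_le_pow_left₀ (W.uy_pos x y).le (h x).1 2
      rw [mul_pow, W.a_sq] at this
      simp only []
      linarith
  rw [integral_const_mul] at h1
  have := mul_le_mul_of_nonneg_left (hY y hy) (by positivity : 0 ≤ 2 * ε ^ 2)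
  linarith

/-- Sum of the oscillations of `Φ(u)` over four consecutive intervals. -/
lemma four_Phi_le (W : Wave F c u) {p a b d q : ℝ} (y : ℝ) (h1 : p ≤ a) (h2 : a ≤ b) (h3 : b ≤ d)
    (h4 : d ≤ q) : 2 * wPhi F (u a y) + 2 * wPhi F (u d y) - 2 * wPhi F (u b y)
      - wPhi F (u p y) - wPhi F (u q y) ≤ lE F u y + lg u y / 2 := by
  have i1 := le_of_abs_le (W.abs_Phi_sub_le h1 y)
  have i2 := neg_le_of_abs_le (W.abs_Phi_sub_le h2 y)
  have i3 := le_of_abs_le (W.abs_Phi_sub_le h3 y)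
  have i4 := neg_le_of_abs_le (W.abs_Phi_sub_le h4 y)
  have c1 : Continuous (fun x => ed F u x y) := W.continuous_ed.comp (Continuous.prodMk_left y)
  have c2 : Continuous (fun x => pdy u x y ^ 2) :=
    (W.continuous_uy.comp (Continuous.prodMk_left y)).pow 2
  have j1 := fun a b => c1.intervalIntegrable (μ := volume) a b
  have j2 := fun a b => c2.intervalIntegrable (μ := volume) a b
  have e1 := intervalIntegral.integral_add_adjacent_intervals (j1 p a) (j1 a b)
  have e2 := intervalIntegral.integral_add_adjacent_intervals (j1 p b) (j1 b d)
  have e3 := intervalIntegral.integral_add_adjacent_intervals (j1 p d) (j1 d q)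
  have e4 := intervalIntegral.integral_add_adjacent_intervals (j2 p a) (j2 a b)
  have e5 := intervalIntegral.integral_add_adjacent_intervals (j2 p b) (j2 b d)
  have e6 := intervalIntegral.integral_add_adjacent_intervals (j2 p d) (j2 d q)
  have le : p ≤ q := by linarith
  have f1 : (∫ x in p..q, ed F u x y) ≤ lE F u y := by
    rw [intervalIntegral.integral_of_le le]
    exact setIntegral_le_integral (W.integrable_ed y) (Eventually.of_forall fun x => W.ed_nonneg x y)
  have f2 : (∫ x in p..q, pdy u x y ^ 2) ≤ lg u y := by
    rw [intervalIntegral.integral_of_le le]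
    exact setIntegral_le_integral (W.integrable_uy2 y) (Eventually.of_forall fun x => sq_nonneg _)
  linarith

lemma exists_interior_max {f : ℝ → ℝ} (hf : Continuous f) {p x q : ℝ} (h1 : p < x) (h2 : x < q)
    (hp : f p < f x) (hq : f q < f x) : ∃ z, p < z ∧ z < q ∧ f x ≤ f z ∧ IsLocalMax f z := by
  obtain ⟨z, hz, hm⟩ := isCompact_Icc.exists_isMaxOn (s := Icc p q) ⟨x, h1.le, h2.le⟩ hf.continuousOn
  have hx := hm ⟨h1.le, h2.le⟩
  have hx' : f x ≤ f z := hx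
  have z1 : p < z := lt_of_le_of_ne hz.1 (by rintro rfl; linarith)
  have z2 : z < q := lt_of_le_of_ne hz.2 (by rintro rfl; linarith)
  exact ⟨z, z1, z2, hx', hm.isLocalMax (Icc_mem_nhds z1 z2)⟩

lemma exists_no_two_bumps (W : Wave F c u) : ∃ Y, ∀ y, Y ≤ y → ∀ a b d, a < b → b < d →
    0 ≤ u a y → u b y ≤ 0 → 0 ≤ u d y → False := by
  have he := W.hF.wPhi_one_pos
  obtain ⟨C1, Y1, hC1, h1⟩ := W.exists_defect_le
  obtain ⟨C2, Y2, hC2, h2⟩ := W.exists_lg_le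
  obtain ⟨C3, hC3, h3⟩ := W.hF.exists_one_sub_wPhi_le
  obtain ⟨C4, hC4, h4⟩ := W.hF.exists_wPhi_le
  have hF0 : 0 < F 0 := W.hF.pos (by norm_num) (by norm_num)
  obtain ⟨e, hE⟩ : ∃ e, e = wPhi F 1 := ⟨_, rfl⟩
  rw [← hE] at he
  obtain ⟨ε, hε0, hε1, hε2, hε3, hε4⟩ : ∃ ε, 0 < ε ∧ C1 * ε < F 0 ∧ C3 * (C1 * ε) ≤ e / 16 ∧
      C4 * (C1 * ε) ≤ e / 16 ∧ C2 * ε ^ 2 ≤ e / 16 := by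
    have t : ∀ f : ℝ → ℝ, Continuous f → f 0 = 0 → ∀ r > 0, ∀ᶠ ε in 𝓝[>] (0 : ℝ), f ε < r := by
      intro f hf h0 r hr
      have := (hf.tendsto 0).eventually (gt_mem_nhds (by rw [h0]; exact hr))
      exact nhdsWithin_le_nhds this
    have := (t (fun ε => C1 * ε) (by fun_prop) (by simp) (F 0) hF0).and
      ((t (fun ε => C3 * (C1 * ε)) (by fun_prop) (by simp) (e / 16) (by positivity)).and
      ((t (fun ε => C4 * (C1 * ε)) (by fun_prop) (by simp) (e / 16) (by positivity)).and
      ((t (fun ε => C2 * ε ^ 2) (by fun_prop) (by simp) (e / 16) (by positivity)).and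
      self_mem_nhdsWithin)))
    obtain ⟨ε, a1, a2, a3, a4, a5⟩ := this.exists
    exact ⟨ε, a5, a1, a2.le, a3.le, a4.le⟩
  obtain ⟨Y, hY⟩ := W.exists_small hε0
  refine ⟨max Y (max Y1 Y2), fun y hy a b d hab hbd ha hb hd => ?_⟩
  have hfl : FlatAt F u ε y := fun x => hY x y ((le_max_left _ _).trans hy)
  have hdef := h1 y ε (((le_max_left _ _).trans (le_max_right _ _)).trans hy) hfl
  have hg := h2 y ε (((le_max_right _ _).trans (le_max_right _ _)).trans hy) hfl
  have hcr : ∀ x, pdx u x y = 0 → F (u x y) ≤ C1 * ε := by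
    intro x hx
    have := hdef x
    rw [hx] at this
    simpa using this
  have hcont := W.sm.continuous_x y
  -- an interior minimum
  obtain ⟨b', hb1, hb2, hb3, hb4⟩ : ∃ z, a < z ∧ z < d ∧ u z y ≤ u b y ∧ pdx u z y = 0 := by
    by_cases h0 : u b y = 0 ∧ ∀ x ∈ Icc a d, 0 ≤ u x y
    · refine ⟨b, hab, hbd, le_rfl, IsLocalMin.deriv_eq_zero (f := fun t => u t y) ?_⟩
      filter_upwards [Icc_mem_nhds hab hbd] with x hx
      rw [h0.1]; exact h0.2 x hx
    · obtain ⟨x, hx, hx0, hxb⟩ : ∃ x ∈ Icc a d, u x y < 0 ∧ u x y ≤ u b y := by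
        by_cases hb0 : u b y = 0
        · have : ¬ ∀ x ∈ Icc a d, 0 ≤ u x y := fun h => h0 ⟨hb0, h⟩
          push Not at this
          obtain ⟨x, hx, hx'⟩ := this
          exact ⟨x, hx, hx', by rw [hb0]; exact hx'.le⟩
        · exact ⟨b, ⟨hab.le, hbd.le⟩, lt_of_le_of_ne hb hb0, le_rfl⟩
      have xa : a < x := lt_of_le_of_ne hx.1 (by rintro rfl; linarith)
      have xd : x < d := lt_of_le_of_ne hx.2 (by rintro rfl; linarith)
      obtain ⟨z, z1, z2, z3, z4⟩ := exists_interior_max (f := fun t => -u t y)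
        hcont.neg xa xd (by linarith) (by linarith)
      refine ⟨z, z1, z2, by linarith, IsLocalMin.deriv_eq_zero (f := fun t => u t y) ?_⟩
      exact z4.mono fun t ht => neg_le_neg_iff.1 ht
  have hb0 : u b' y < 0 := by
    rcases lt_or_eq_of_le (hb3.trans hb) with h | h
    · exact h
    · have := hcr _ hb4
      rw [h] at this
      linarith
  have e0 := BalancedDoubleWell.wPhi_neg_one F
  obtain ⟨R, hR1, hR2, hR3, hR4, hR5, hR6⟩ : ∃ R, -R < a ∧ d < R ∧ u R y < 0 ∧ u (-R) y < 0 ∧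
      wPhi F (u R y) < e / 16 ∧ wPhi F (u (-R) y) < e / 16 := by
    have t1 := W.tendsto_neg_one_atTop y
    have t2 := (W.tendsto_neg_one_atBot y).comp tendsto_neg_atTop_atBot
    have t3 := (W.hF.continuous_wPhi.tendsto (-1)).comp t1
    have t4 := (W.hF.continuous_wPhi.tendsto (-1)).comp t2
    rw [e0] at t3 t4
    obtain ⟨R, a1, a2, a3, a4, a5, a6⟩ := ((eventually_gt_atTop (-a)).and
      ((eventually_gt_atTop d).and ((t1.eventually (gt_mem_nhds (by norm_num : (-1 : ℝ) < 0))).and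
      ((t2.eventually (gt_mem_nhds (by norm_num : (-1 : ℝ) < 0))).and
      ((t3.eventually (gt_mem_nhds (by positivity : (0 : ℝ) < e / 16))).and
      (t4.eventually (gt_mem_nhds (by positivity : (0 : ℝ) < e / 16)))))))).exists
    exact ⟨R, by linarith, a2, a3, a4, a5, a6⟩
  obtain ⟨a', p1, p2, p3, p4⟩ := exists_interior_max hcont hR1 hb1 (by linarith) (by linarith)
  obtain ⟨d', q1, q2, q3, q4⟩ := exists_interior_max hcont hb2 hR2 (by linarith) (by linarith)
  have r1 := h3 _ ⟨ha.trans p3, (W.lt_one a' y).le⟩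
  have r2 := h3 _ ⟨hd.trans q3, (W.lt_one d' y).le⟩
  have r3 := h4 _ ⟨(W.neg_one_lt b' y).le, hb0.le⟩
  have s1 := mul_le_mul_of_nonneg_left (hcr a' p4.deriv_eq_zero) hC3.le
  have s2 := mul_le_mul_of_nonneg_left (hcr d' q4.deriv_eq_zero) hC3.le
  have s3 := mul_le_mul_of_nonneg_left (hcr b' hb4) hC4.le
  have fin := W.four_Phi_le y p1.le p2.le q1.le q2.le
  have hE2 : lE F u y ≤ 2 * wPhi F 1 := W.integral_ed_le y
  rw [← hE] at r1 r2 hE2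
  linarith

/-- For large `y` the function `u(·, y)` has exactly two zeros. -/
lemma exists_isLevel (W : Wave F c u) : ∃ Y, ∃ k₁ k₂ : ℝ → ℝ, ∀ y, Y ≤ y →
    IsLevel u y (k₁ y) (k₂ y) := by
  obtain ⟨Y1, h1⟩ := W.exists_no_two_bumps
  obtain ⟨Y2, h2⟩ := eventually_atTop.1
    ((W.hu.2.1 0).eventually (lt_mem_nhds (by norm_num : (0 : ℝ) < 1)))
  have key : ∀ y, ∃ k : ℝ × ℝ, max Y1 Y2 ≤ y → IsLevel u y k.1 k.2 := by
    intro y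
    by_cases hy : max Y1 Y2 ≤ y
    swap
    · exact ⟨(0, 0), fun h => absurd h hy⟩
    have hb := h1 y ((le_max_left _ _).trans hy)
    have h0 := h2 y ((le_max_right _ _).trans hy)
    have hcont := W.sm.continuous_x y
    obtain ⟨R, r1, r2⟩ := (((W.tendsto_neg_one_atTop y).eventually
      (gt_mem_nhds (by norm_num : (-1 : ℝ) < 0))).and (eventually_gt_atTop 0)).exists
    obtain ⟨L, l1, l2⟩ := (((W.tendsto_neg_one_atBot y).eventually
      (gt_mem_nhds (by norm_num : (-1 : ℝ) < 0))).and (eventually_lt_atBot 0)).exists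
    obtain ⟨k₁, hk1, hk1'⟩ := intermediate_value_Icc l2.le hcont.continuousOn
      (⟨l1.le, h0.le⟩ : (0 : ℝ) ∈ Icc (u L y) (u 0 y))
    obtain ⟨k₂, hk2, hk2'⟩ := intermediate_value_Icc' r2.le hcont.continuousOn
      (⟨r1.le, h0.le⟩ : (0 : ℝ) ∈ Icc (u R y) (u 0 y))
    simp only [] at hk1' hk2'
    have k1 : k₁ < 0 := lt_of_le_of_ne hk1.2 (by rintro rfl; linarith)
    have k2 : 0 < k₂ := lt_of_le_of_ne hk2.1 (by rintro rfl; linarith)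
    refine ⟨(k₁, k₂), fun _ => ⟨k1.trans k2, hk1', hk2', fun x x1 x2 => ?_, fun x hx => ?_,
      fun x hx => ?_⟩⟩
    · by_contra hn
      push Not at hn
      exact hb k₁ x k₂ x1 x2 hk1'.ge hn hk2'.ge
    · by_contra hn
      push Not at hn
      exact hb x k₁ 0 hx k1 hn hk1'.le h0.le
    · by_contra hn
      push Not at hn
      exact hb 0 k₂ x k2 hx h0.le hk2'.le hn
  choose k hk using key
  exact ⟨max Y1 Y2, fun y => (k y).1, fun y => (k y).2, hk⟩

end Wave

namespace IsLevel

variable {u : ℝ → ℝ → ℝ} {y k₁ k₂ : ℝ}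

lemma zero_set (h : IsLevel u y k₁ k₂) : {x : ℝ | u x y = 0} = {k₁, k₂} := by
  ext x
  simp only [mem_ofPred_eq, mem_insert_iff, mem_singleton_iff]
  constructor
  · intro hx
    by_contra hn
    push Not at hn
    rcases lt_or_gt_of_ne hn.1 with h1 | h1
    · linarith [h.out_left x h1]
    · rcases lt_or_gt_of_ne hn.2 with h2 | h2
      · linarith [h.mid x h1 h2]
      · linarith [h.out_right x h2]
  · rintro (rfl | rfl)
    · exact h.left
    · exact h.right

lemma reflect (h : IsLevel u y k₁ k₂) : IsLevel (fun x y => u (-x) y) y (-k₂) (-k₁) where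
  lt := by linarith [h.lt]
  left := by simpa using h.right
  right := by simpa using h.left
  mid x h1 h2 := h.mid _ (by linarith) (by linarith)
  out_left x hx := h.out_right _ (by linarith)
  out_right x hx := h.out_left _ (by linarith)

end IsLevel

end level

/-! ### Regularity of the level curves -/

section curves

lemma Sm.exists_implicit {u : ℝ → ℝ → ℝ} (h : Sm 3 u) {x₀ y₀ : ℝ} (h0 : u x₀ y₀ = 0)
    (hx : pdx u x₀ y₀ ≠ 0) : ∃ ψ : ℝ → ℝ, ContDiffAt ℝ 3 ψ y₀ ∧ ψ y₀ = x₀ ∧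
      ∀ᶠ y in 𝓝 y₀, u (ψ y) y = 0 := by
  have hs : ContDiffAt ℝ 3 (fun p : ℝ × ℝ => u p.2 p.1) (y₀, x₀) := (h.swap).contDiffAt
  have hinv : (fderiv ℝ (fun p : ℝ × ℝ => u p.2 p.1) (y₀, x₀) ∘L
      ContinuousLinearMap.inr ℝ ℝ ℝ).IsInvertible := by
    refine ⟨ContinuousLinearEquiv.unitsEquivAut ℝ (Units.mk0 _ hx), ?_⟩
    ext
    have e := Sm.pdy_eq (n := 2) h.swap y₀ x₀
    simp only [ContinuousLinearMap.comp_apply, ContinuousLinearMap.inr_apply]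
    rw [← e]
    simp [pdx, pdy]
  refine ⟨hs.implicitFunction (by norm_num) hinv, hs.contDiffAt_implicitFunction (by norm_num) hinv,
    hs.implicitFunction_apply_self (by norm_num) hinv, ?_⟩
  filter_upwards [hs.eventually_apply_implicitFunction (by norm_num) hinv] with y hy
  rw [← h0]; exact hy

namespace Wave

variable {F : ℝ → ℝ} {c : ℝ} {u : ℝ → ℝ → ℝ}

lemma exists_slope_level (W : Wave F c u) : ∃ b Y, 0 < b ∧ ∀ y k₁ k₂, Y ≤ y → IsLevel u y k₁ k₂ →
    b ≤ pdx u k₁ y ∧ pdx u k₂ y ≤ -b := by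
  have hF0 : 0 < F 0 := W.hF.pos (by norm_num) (by norm_num)
  obtain ⟨C, Y1, hC, h1⟩ := W.exists_defect_le
  obtain ⟨Y2, h2⟩ := W.exists_small (ε := F 0 / (2 * C)) (by positivity)
  refine ⟨Real.sqrt (F 0), max Y1 Y2, Real.sqrt_pos.2 hF0, fun y k₁ k₂ hy hk => ?_⟩
  have hd := h1 y _ ((le_max_left _ _).trans hy) (fun x => h2 x y ((le_max_right _ _).trans hy))
  have key : ∀ k, u k y = 0 → Real.sqrt (F 0) ≤ |pdx u k y| := by
    intro k hk
    have := hd k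
    rw [hk, show C * (F 0 / (2 * C)) = F 0 / 2 by field_simp] at this
    rw [← Real.sqrt_sq_eq_abs]
    exact Real.sqrt_le_sqrt (by linarith)
  constructor
  · have h3 := (W.sm.hasDerivAt_x k₁ y).nonneg_of_right hk.lt fun x hx => by
      rw [hk.left]; exact (hk.mid x hx.1 hx.2).le
    rw [← abs_of_nonneg h3]; exact key _ hk.left
  · have h3 := (W.sm.hasDerivAt_x k₂ y).neg.nonneg_of_right (b := k₂ + 1) (by linarith)
      fun x hx => by
        have := hk.out_right x hx.1
        simp only [Pi.neg_apply]
        rw [hk.right]; linarith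
    have h4 := key _ hk.right
    rw [abs_of_nonpos (by linarith)] at h4
    linarith

/-- The right zero is a `C³` function of the height. -/
lemma exists_contDiffAt_level (W : Wave F c u) : ∃ Y, ∀ (k₁ k₂ : ℝ → ℝ) (Y' : ℝ),
    (∀ y, Y' ≤ y → IsLevel u y (k₁ y) (k₂ y)) → ∀ y, Y < y → Y' < y → ContDiffAt ℝ 3 k₂ y := by
  obtain ⟨b, Y, hb, h⟩ := W.exists_slope_level
  refine ⟨Y, fun k₁ k₂ Y' hk y hy hy' => ?_⟩
  have hk0 := hk y hy'.le
  have hs := h y _ _ hy.le hk0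
  obtain ⟨ψ, p1, p2, p3⟩ := W.sm.exists_implicit hk0.right (by linarith)
  refine p1.congr_of_eventuallyEq ?_
  have hc : ContinuousAt (fun t => pdx u (ψ t) t) y :=
    ContinuousAt.comp (g := fun p : ℝ × ℝ => pdx u p.1 p.2) (f := fun t => (ψ t, t))
      W.continuous_ux.continuousAt (p1.continuousAt.prodMk continuousAt_id)
  have hn : ∀ᶠ t in 𝓝 y, pdx u (ψ t) t < 0 :=
    hc.eventually (gt_mem_nhds (by simp only [p2]; linarith))
  filter_upwards [p3, hn, Ioi_mem_nhds hy, Ioi_mem_nhds hy'] with t t1 t2 t3 t4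
  have hkt := hk t (le_of_lt t4)
  have : ψ t ∈ ({k₁ t, k₂ t} : Set ℝ) := by rw [← hkt.zero_set]; exact t1
  rcases this with e | e
  · have := (h t _ _ (le_of_lt t3) hkt).1
    rw [e] at t2; linarith
  · exact e.symm

/-- Speed of the zeros. -/
lemma exists_level_deriv (W : Wave F c u) : ∃ C Y, 0 < C ∧ ∀ (k₁ k₂ : ℝ → ℝ) (Y' : ℝ),
    (∀ y, Y' ≤ y → IsLevel u y (k₁ y) (k₂ y)) → ∀ y, Y < y → Y' < y →
      HasDerivAt k₂ (deriv k₂ y) y ∧ ∀ ε, FlatAt F u ε y → |deriv k₂ y| ≤ C * ε := by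
  obtain ⟨b, Y1, hb, h1⟩ := W.exists_slope_level
  obtain ⟨Y2, h2⟩ := W.exists_contDiffAt_level
  have ha : 0 < wa F 0 := W.hF.wa_pos ⟨by norm_num, by norm_num⟩
  refine ⟨wa F 0 / b, max Y1 Y2, by positivity, fun k₁ k₂ Y' hk y hy hy' => ?_⟩
  have hcd := h2 k₁ k₂ Y' hk y ((le_max_right _ _).trans_lt hy) hy'
  have hd : HasDerivAt k₂ (deriv k₂ y) y := (hcd.differentiableAt (by norm_num)).hasDerivAt
  refine ⟨hd, fun ε hε => ?_⟩
  have h3 := W.sm.chain (n := 2) hd (hasDerivAt_id y)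
  have h4 : HasDerivAt (fun t => u (k₂ t) t) 0 y := by
    refine (hasDerivAt_const y (0 : ℝ)).congr_of_eventuallyEq ?_
    filter_upwards [Ioi_mem_nhds hy'] with t ht
    exact (hk t (le_of_lt ht)).right
  have h5 := h3.unique h4
  have h6 := (h1 y _ _ ((le_max_left _ _).trans hy.le) (hk y hy'.le)).2
  have h7 := (hε (k₂ y)).1
  rw [(hk y hy'.le).right] at h7
  simp only [id, mul_one] at h5
  have h8 : |pdx u (k₂ y) y| * |deriv k₂ y| ≤ ε * wa F 0 := by
    rw [← abs_mul, show pdx u (k₂ y) y * deriv k₂ y = - pdy u (k₂ y) y by linarith, abs_neg,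
      abs_of_pos (W.uy_pos _ _)]
    exact h7
  rw [abs_of_nonpos (by linarith : pdx u (k₂ y) y ≤ 0)] at h8
  have h9 := mul_le_mul_of_nonneg_right (by linarith : b ≤ - pdx u (k₂ y) y) (abs_nonneg (deriv k₂ y))
  rw [div_mul_eq_mul_div, le_div_iff₀ hb]
  linarith

lemma tendsto_level (W : Wave F c u) {k₁ k₂ : ℝ → ℝ} {Y : ℝ}
    (hk : ∀ y, Y ≤ y → IsLevel u y (k₁ y) (k₂ y)) : Tendsto k₂ atTop atTop := by
  refine tendsto_atTop.2 fun R => ?_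
  have h1 := (W.hu.2.1 R).eventually (lt_mem_nhds (by norm_num : (0 : ℝ) < 1))
  filter_upwards [h1, eventually_ge_atTop Y] with y hy hY
  by_contra hn
  push Not at hn
  linarith [(hk y hY).out_right R hn]

end Wave

end curves

/-! ### Polynomial rates -/

section rates

lemma mul_sub_le_integral {f : ℝ → ℝ} (hf : Integrable f) (h0 : ∀ x, 0 ≤ f x) {a b k : ℝ}
    (hab : a ≤ b) (h : ∀ x ∈ Icc a b, k ≤ f x) : k * (b - a) ≤ ∫ x, f x := by
  have h1 : ∫ x in a..b, k ≤ ∫ x in a..b, f x :=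
    intervalIntegral.integral_mono_on hab (by simp) hf.intervalIntegrable h
  have h2 : ∫ x in a..b, f x ≤ ∫ x, f x := by
    rw [intervalIntegral.integral_of_le hab]
    exact setIntegral_le_integral hf (Eventually.of_forall h0)
  rw [intervalIntegral.integral_const, smul_eq_mul] at h1
  linarith

namespace Wave

variable {F : ℝ → ℝ} {c : ℝ} {u : ℝ → ℝ → ℝ}

lemma exists_hasDerivAt_lg (W : Wave F c u) : ∃ (g' : ℝ → ℝ) (B Y : ℝ), 0 < B ∧
    (∀ y, HasDerivAt (lg u) (g' y) y) ∧ ∀ y, Y ≤ y → |g' y| ≤ B := by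
  obtain ⟨C, hC, H⟩ := W.exists_second_bound
  obtain ⟨Y, hY⟩ := W.exists_integral_F_le
  have he := W.hF.wPhi_one_pos
  have b1 : ∀ x y, |pdy u x y ^ 2| ≤ (4 * C + 2) * F (u x y) := fun x y => by
    have h := W.abs_mul_le (W.abs_uy_le' x y) (W.abs_uy_le' x y)
    rw [← sq] at h
    nlinarith [W.F_pos x y]
  have b2 : ∀ x y, |2 * (pdy u x y * pdy (pdy u) x y)| ≤ (4 * C + 2) * F (u x y) := fun x y => by
    have h := W.abs_mul_le (W.abs_uy_le' x y) (H x y).2.2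
    rw [abs_mul, abs_two]
    nlinarith [W.F_pos x y]
  have hcy : Continuous (fun p : ℝ × ℝ => 2 * (pdy u p.1 p.2 * pdy (pdy u) p.1 p.2)) :=
    (W.continuous_uy.mul W.smyy.continuous).const_mul 2
  refine ⟨fun y => ∫ x, 2 * (pdy u x y * pdy (pdy u) x y), (4 * C + 2) * (4 * wPhi F 1), Y,
    by positivity, fun y => ?_, fun y hy => ?_⟩
  · have := W.hasDerivAt_integral univ (f := fun x y => pdy u x y ^ 2)
      (f' := fun x y => 2 * (pdy u x y * pdy (pdy u) x y)) (W.continuous_uy.pow 2) hcy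
      (fun x y => (((W.smy.hasDerivAt_y x y).pow 2).congr_deriv (by simp; ring))) b1 b2 y
    simp only [Measure.restrict_univ] at this
    exact this
  · have i1 : Integrable (fun x => 2 * (pdy u x y * pdy (pdy u) x y)) :=
      W.integrable_of_le (hcy.comp (Continuous.prodMk_left y)) (b2 · y)
    refine (abs_integral_le_integral_abs).trans ((integral_mono i1.abs
      ((W.integrable_F y).const_mul _) (fun x => b2 x y)).trans ?_)
    rw [integral_const_mul]
    exact mul_le_mul_of_nonneg_left (hY y hy) (by positivity)

lemma lg_le_of_integral_le (W : Wave F c u) {y M : ℝ} (hM : ∫ x, F (u x y) ≤ M) :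
    lg u y ≤ 2 * M := by
  have h : lg u y ≤ ∫ x, 2 * F (u x y) :=
    integral_mono (W.integrable_uy2 y) ((W.integrable_F y).const_mul 2) fun x => by
      have := W.modica x y
      simp only []
      linarith [sq_nonneg (pdx u x y)]
  rw [integral_const_mul] at h
  linarith

lemma exists_lg_sq_le (W : Wave F c u) : ∃ C Y, 0 < C ∧ 1 ≤ Y ∧
    ∀ y, Y ≤ y → lg u y ^ 2 ≤ C / y := by
  obtain ⟨g', B, Y, hB, h1, h2⟩ := W.exists_hasDerivAt_lg
  obtain ⟨Y', hY'⟩ := W.exists_integral_F_le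
  obtain ⟨C, hC, hP⟩ := W.exists_lP_le
  have he := W.hF.wPhi_one_pos
  have hc := W.hc
  refine ⟨4 * B * C / c, max (max (2 * |Y|) Y') (max 2 (2 * (2 * (4 * wPhi F 1)) / B)),
    by positivity, (by norm_num : (1 : ℝ) ≤ 2).trans ((le_max_left _ _).trans (le_max_right _ _)),
    fun y hy => ?_⟩
  have a1 : 2 * |Y| ≤ y := ((le_max_left _ _).trans (le_max_left _ _)).trans hy
  have a2 : Y' ≤ y := ((le_max_right _ _).trans (le_max_left _ _)).trans hy
  have a3 : 2 ≤ y := ((le_max_left _ _).trans (le_max_right _ _)).trans hy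
  have a4 : 2 * (2 * (4 * wPhi F 1)) / B ≤ y := ((le_max_right _ _).trans (le_max_right _ _)).trans hy
  have hg := W.lg_le_of_integral_le (hY' y a2)
  have hg0 := Wave.lg_nonneg (u := u) y
  obtain ⟨g, hgd⟩ : ∃ g, g = lg u y := ⟨_, rfl⟩
  rw [← hgd] at hg hg0 ⊢
  obtain ⟨h, hh⟩ : ∃ h, h = g / B := ⟨_, rfl⟩
  have hh0 : 0 ≤ h := by rw [hh]; positivity
  have hgB : g = B * h := by rw [hh]; field_simp
  have hh2 : 2 * h ≤ y := by
    refine le_trans ?_ a4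
    rw [le_div_iff₀ hB]
    linarith
  have hL : ∀ s, Y ≤ s → s ≤ y → g - lg u s ≤ B * (y - s) := fun s hs hsy => by
    have := le_of_hasDerivAt_nonpos (f := fun t => lg u t - B * t) (f' := fun t => g' t - B) hsy
      (fun t _ => ((h1 t).sub ((hasDerivAt_id t).const_mul B)).congr_deriv (by simp))
      (fun t ht => by linarith [(abs_le.1 (h2 t (hs.trans ht.1))).2])
    simp only [← hgd] at this
    linarith
  have hΘ := le_of_hasDerivAt_nonpos (a := y - h) (b := y)
    (f := fun s => lP F u s + c * (g * s + B * (y - s) ^ 2 / 2))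
    (f' := fun s => -(c * lg u s) + c * (g - B * (y - s))) (by linarith)
    (fun t _ => ((W.hasDerivAt_lP t).add ((((hasDerivAt_id t).const_mul g).add
      (((((hasDerivAt_id t).const_sub y).pow 2).const_mul B).div_const 2)).const_mul c)).congr_deriv
      (by simp; left; ring))
    (fun t ht => by
      have := mul_le_mul_of_nonneg_left
        (hL t (by linarith [ht.1, le_abs_self Y]) ht.2) hc.le
      linarith)
  have hP1 := W.lP_nonneg y
  have hP2 := hP (y - h) (by linarith)
  have hP3 : C / (y - h) ≤ 2 * C / y := by
    rw [div_le_div_iff₀ (by linarith) (by linarith)]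
    nlinarith
  have e1 : g ^ 2 = 2 * B * (g * h - B * h ^ 2 / 2) := by rw [hgB]; ring
  have e2 : c * (g * h - B * h ^ 2 / 2) ≤ 2 * C / y := by
    simp only [sub_self, sub_sub_cancel] at hΘ
    linarith
  have e3 : g * h - B * h ^ 2 / 2 ≤ 2 * C / y / c := by
    rw [le_div_iff₀ hc]; linarith
  rw [e1]
  refine (mul_le_mul_of_nonneg_left e3 (by positivity)).trans (le_of_eq ?_)
  field_simp
  ring

lemma exists_uy_cube_le (W : Wave F c u) : ∃ C, 0 < C ∧ ∀ x y, pdy u x y ^ 3 ≤ C * lg u y := by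
  obtain ⟨G, hG, H⟩ := W.exists_deriv_bound
  refine ⟨8 * G, by positivity, fun x y => ?_⟩
  obtain ⟨v, hv⟩ : ∃ v, v = pdy u x y := ⟨_, rfl⟩
  have hv0 : 0 < v := hv ▸ W.uy_pos x y
  have h := mul_sub_le_integral (k := (v / 2) ^ 2) (a := x) (b := x + v / (2 * G))
    (W.integrable_uy2 y) (fun _ => sq_nonneg _) (by linarith [show 0 < v / (2 * G) by positivity])
    (fun t ht => by
      refine pow_le_pow_left₀ (by positivity) ?_ 2
      have h1 := Wave.abs_le_of_lipschitz (f := fun x => pdy u x y) (f' := fun x => pdx (pdy u) x y)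
        (C := G) (fun t => W.smy.hasDerivAt_x t y) (fun t => (H t y).2.2.2.2.2.2.1) x t
      simp only [← hv] at h1
      rw [abs_of_nonneg (by linarith [ht.1] : 0 ≤ t - x)] at h1
      have h2 : G * (t - x) ≤ G * (v / (2 * G)) :=
        mul_le_mul_of_nonneg_left (by linarith [ht.2]) hG.le
      have h3 : G * (v / (2 * G)) = v / 2 := by field_simp
      linarith [(abs_le.1 h1).1])
  have e : (v / 2) ^ 2 * (x + v / (2 * G) - x) = v ^ 3 / (8 * G) := by field_simp; ring
  rw [e, div_le_iff₀ (by positivity)] at h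
  rw [← hv]
  unfold lg
  linarith

lemma exists_uy_le_rpow (W : Wave F c u) : ∃ C Y, 0 < C ∧ 1 ≤ Y ∧
    ∀ x y, Y ≤ y → pdy u x y ≤ C * y ^ (-(1 / 6) : ℝ) := by
  obtain ⟨C, Y, hC, hY, h⟩ := W.exists_lg_sq_le
  obtain ⟨K, hK, h'⟩ := W.exists_uy_cube_le
  refine ⟨(K ^ 2 * C) ^ (1 / 6 : ℝ), Y, by positivity, hY, fun x y hy => ?_⟩
  have hy0 : 0 < y := by linarith
  have h1 : pdy u x y ^ 6 ≤ K ^ 2 * C * y⁻¹ := by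
    have e := pow_le_pow_left₀ (pow_pos (W.uy_pos x y) 3).le (h' x y) 2
    rw [← pow_mul, mul_pow] at e
    have e2 := mul_le_mul_of_nonneg_left (h y hy) (sq_nonneg K)
    rw [div_eq_mul_inv] at e2
    norm_num at e
    linarith
  have h2 := Real.rpow_le_rpow (pow_pos (W.uy_pos x y) 6).le h1 (by norm_num : (0 : ℝ) ≤ ((6 : ℕ) : ℝ)⁻¹)
  rw [Real.pow_rpow_inv_natCast (W.uy_pos x y).le (by norm_num),
    Real.mul_rpow (by positivity) (by positivity), Real.inv_rpow hy0.le, ← Real.rpow_neg hy0.le] at h2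
  norm_num at h2 ⊢
  exact h2

/-- A primitive controlling `g(s) s^{7/8}`. -/
lemma exists_weight (W : Wave F c u) : ∃ A A' : ℝ → ℝ, (∀ s, 1 ≤ s → HasDerivAt A (A' s) s ∧
    lg u s * s ^ (7 / 8 : ℝ) ≤ A' s ∧ A s ≤ 0) ∧ Tendsto A atTop (𝓝 0) := by
  obtain ⟨C, hC, hP⟩ := W.exists_lP_le
  have hc := W.hc
  have key : ∀ s : ℝ, 1 ≤ s → lP F u s * s ^ (7 / 8 : ℝ) ≤ C * s ^ (-(1 / 8) : ℝ) := fun s hs => by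
    have hs0 : 0 < s := by linarith
    have := mul_le_mul_of_nonneg_right (hP s hs) (Real.rpow_nonneg hs0.le (7 / 8))
    refine this.trans (le_of_eq ?_)
    rw [div_mul_eq_mul_div, mul_div_assoc, ← Real.rpow_sub_one hs0.ne']
    norm_num
  refine ⟨fun s => -(lP F u s * s ^ (7 / 8 : ℝ)) / c - 7 * C / c * s ^ (-(1 / 8) : ℝ),
    fun s => (c * lg u s * s ^ (7 / 8 : ℝ) - lP F u s * ((7 / 8 : ℝ) * s ^ ((7 / 8 : ℝ) - 1))) / c
      - 7 * C / c * (-(1 / 8) * s ^ (-(1 / 8) - 1 : ℝ)), fun s hs => ⟨?_, ?_, ?_⟩, ?_⟩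
  · have hs0 : s ≠ 0 := by linarith
    exact ((((W.hasDerivAt_lP s).mul (Real.hasDerivAt_rpow_const (p := 7 / 8) (Or.inl hs0))).neg.div_const
      c).sub ((Real.hasDerivAt_rpow_const (p := -(1 / 8)) (Or.inl hs0)).const_mul _)).congr_deriv (by ring)
  · have hs0 : 0 < s := by linarith
    have h1 := mul_le_mul_of_nonneg_right (hP s hs) (Real.rpow_nonneg hs0.le (7 / 8 - 1))
    have e1 : C / s * s ^ ((7 / 8 : ℝ) - 1) = C * s ^ (-(1 / 8) - 1 : ℝ) := by
      rw [Real.rpow_sub_one hs0.ne' (-(1 / 8))]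
      norm_num
      ring
    rw [e1] at h1
    have e2 : (c * lg u s * s ^ (7 / 8 : ℝ) - lP F u s * ((7 / 8 : ℝ) * s ^ ((7 / 8 : ℝ) - 1))) / c
      - 7 * C / c * (-(1 / 8) * s ^ (-(1 / 8) - 1 : ℝ)) = lg u s * s ^ (7 / 8 : ℝ) +
        7 / 8 / c * (C * s ^ (-(1 / 8) - 1 : ℝ) - lP F u s * s ^ ((7 / 8 : ℝ) - 1)) := by
      field_simp; ring
    refine le_of_le_of_eq ?_ e2.symm
    have : 0 ≤ 7 / 8 / c * (C * s ^ (-(1 / 8) - 1 : ℝ) - lP F u s * s ^ ((7 / 8 : ℝ) - 1)) :=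
      mul_nonneg (by positivity) (by linarith)
    linarith
  · have hs0 : 0 < s := by linarith
    have h1 : 0 ≤ lP F u s * s ^ (7 / 8 : ℝ) / c :=
      div_nonneg (mul_nonneg (W.lP_nonneg s) (by positivity)) hc.le
    have h2 : 0 ≤ 7 * C / c * s ^ (-(1 / 8) : ℝ) := by positivity
    simp only [neg_div]
    linarith
  · have t0 : Tendsto (fun s : ℝ => s ^ (-(1 / 8) : ℝ)) atTop (𝓝 0) :=
      tendsto_rpow_neg_atTop (by norm_num)
    have t1 : Tendsto (fun s : ℝ => lP F u s * s ^ (7 / 8 : ℝ)) atTop (𝓝 0) := by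
      have t2 := t0.const_mul C
      rw [mul_zero] at t2
      refine squeeze_zero' ?_ ?_ t2
      · filter_upwards [eventually_ge_atTop 1] with s hs
        exact mul_nonneg (W.lP_nonneg s) (by positivity)
      · filter_upwards [eventually_ge_atTop 1] with s hs using key s hs
    simpa using (t1.neg.div_const c).sub (t0.const_mul (7 * C / c))

lemma integrable_Phi (W : Wave F c u) (y : ℝ) : Integrable (fun x => wPhi F (u x y)) := by
  obtain ⟨ω, h0, h1, h2⟩ := W.exists_gap y
  obtain ⟨C, hC, h3⟩ := W.hF.exists_wPhi_le
  have hF1 : 0 < F (1 - ω) := W.hF.pos (by linarith) (by linarith)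
  have he := W.hF.wPhi_one_pos
  refine W.integrable_of_le (C := C + wPhi F 1 / F (1 - ω)) (y := y)
    (W.hF.continuous_wPhi.comp (W.sm.continuous_x y)) fun x => ?_
  rw [abs_of_nonneg (W.hF.wPhi_nonneg (W.neg_one_lt x y).le)]
  have hFu := W.F_pos x y
  rcases le_total (u x y) 0 with h | h
  · have := h3 _ ⟨(W.neg_one_lt x y).le, h⟩
    have : 0 ≤ wPhi F 1 / F (1 - ω) * F (u x y) := by positivity
    linarith
  · have h4 : F (1 - ω) ≤ F (u x y) := W.hF.antitoneOn.antitoneOn ⟨h, by linarith [h2 x]⟩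
      ⟨by linarith, by linarith⟩ (by linarith [h2 x])
    have h5 : wPhi F 1 / F (1 - ω) * F (1 - ω) ≤ wPhi F 1 / F (1 - ω) * F (u x y) :=
      mul_le_mul_of_nonneg_left h4 (by positivity)
    rw [div_mul_cancel₀ _ hF1.ne'] at h5
    have : 0 ≤ C * F (u x y) := by positivity
    linarith [W.hF.wPhi_le_one (W.lt_one x y).le]

lemma abs_a_uy_le (W : Wave F c u) (x y : ℝ) : |wa F (u x y) * pdy u x y| ≤ 2 * (1 * 1) * F (u x y) :=
  W.abs_mul_le (by rw [one_mul, abs_of_pos (W.a_pos x y)]) (W.abs_uy_le' x y)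

lemma continuous_Phi (W : Wave F c u) : Continuous (fun p : ℝ × ℝ => wPhi F (u p.1 p.2)) :=
  W.hF.continuous_wPhi.comp W.sm.continuous

lemma hasDerivAt_integral_Phi (W : Wave F c u) (S : Set ℝ) (y : ℝ) :
    HasDerivAt (fun y => ∫ x in S, wPhi F (u x y)) (∫ x in S, wa F (u x y) * pdy u x y) y :=
  W.hasDerivAt_integral_of_integrableOn (f := fun x y => wPhi F (u x y)) W.continuous_Phi
    (W.continuous_au.mul W.continuous_uy) W.hasDerivAt_Phi_y (W.integrable_Phi y).integrableOn
    W.abs_a_uy_le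

lemma integral_a_uy_le (W : Wave F c u) {l M y : ℝ} (hl : 0 < l) (hM : ∫ x, F (u x y) ≤ M) :
    ∫ x, wa F (u x y) * pdy u x y ≤ 2 * M * l + lg u y / (4 * l) := by
  have i1 := ((W.integrable_F y).const_mul (2 * l))
  have i2 := ((W.integrable_uy2 y).div_const (4 * l))
  have i0 : Integrable (fun x => wa F (u x y) * pdy u x y) :=
    W.integrable_of_le ((W.continuous_au.mul W.continuous_uy).comp (Continuous.prodMk_left y))
      (W.abs_a_uy_le · y)
  have h3 : ∫ x, wa F (u x y) * pdy u x y ≤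
      ∫ x, (2 * l * F (u x y) + pdy u x y ^ 2 / (4 * l)) := by
    refine integral_mono i0 (i1.add i2) fun x => ?_
    have e : 2 * l * F (u x y) + pdy u x y ^ 2 / (4 * l) - wa F (u x y) * pdy u x y =
        (2 * l * wa F (u x y) - pdy u x y) ^ 2 / (4 * l) := by
      have : F (u x y) = wa F (u x y) ^ 2 / 2 := by rw [W.a_sq]; ring
      rw [this]; field_simp; ring
    have : 0 ≤ (2 * l * wa F (u x y) - pdy u x y) ^ 2 / (4 * l) := by positivity
    simp only []
    linarith
  rw [integral_add i1 i2, integral_const_mul, integral_div] at h3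
  have h4 : 2 * l * ∫ x, F (u x y) ≤ 2 * l * M := mul_le_mul_of_nonneg_left hM (by positivity)
  have h5 : lg u y = ∫ x, pdy u x y ^ 2 := rfl
  rw [← h5] at h3
  linarith

lemma exists_gap_le_rpow (W : Wave F c u) : ∃ C Y, 0 < C ∧ 1 ≤ Y ∧ ∀ y k₁ k₂, Y ≤ y →
    IsLevel u y k₁ k₂ → k₂ - k₁ ≤ C * y ^ (1 / 8 : ℝ) := by
  obtain ⟨A, A', hA, -⟩ := W.exists_weight
  obtain ⟨Y0, hY0⟩ := W.exists_integral_F_le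
  have he := W.hF.wPhi_one_pos
  obtain ⟨M, hM⟩ : ∃ M, M = 4 * wPhi F 1 := ⟨_, rfl⟩
  have hM0 : 0 < M := by rw [hM]; positivity
  have hΦ0 : 0 < wPhi F 0 := by
    have := W.hF.strictMonoOn_wPhi (a := -1) (b := 0) (by norm_num) (by norm_num) (by norm_num)
    rwa [BalancedDoubleWell.wPhi_neg_one F] at this
  obtain ⟨Y, hY⟩ : ∃ Y, Y = max Y0 1 := ⟨_, rfl⟩
  obtain ⟨S, hS⟩ : ∃ S : ℝ → ℝ, S = fun y => ∫ x, wPhi F (u x y) := ⟨_, rfl⟩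
  have hSd : ∀ y, HasDerivAt S (∫ x, wa F (u x y) * pdy u x y) y := fun y => by
    have := W.hasDerivAt_integral_Phi univ y
    simp only [Measure.restrict_univ] at this
    rw [hS]; exact this
  have hS0 : ∀ y, 0 ≤ S y := fun y => by
    rw [hS]; exact integral_nonneg fun x => W.hF.wPhi_nonneg (W.neg_one_lt x y).le
  have hmono : ∀ y, Y ≤ y → S y ≤ (S Y - A Y) + 16 * M * y ^ (1 / 8 : ℝ) := fun y hy => by
    have hY1 : 1 ≤ Y := hY ▸ le_max_right _ _
    have := le_of_hasDerivAt_nonpos (f := fun t => S t - A t / 4 - 16 * M * t ^ (1 / 8 : ℝ))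
      (f' := fun t => (∫ x, wa F (u x t) * pdy u x t) - A' t / 4 -
        16 * M * (1 / 8 * t ^ (1 / 8 - 1 : ℝ))) hy
      (fun t ht => ((hSd t).sub ((hA t (hY1.trans ht.1)).1.div_const 4)).sub
        ((Real.hasDerivAt_rpow_const (p := 1 / 8) (Or.inl (by linarith [ht.1]))).const_mul _))
      (fun t ht => by
        have ht0 : 0 < t := by linarith [ht.1]
        have h1 := W.integral_a_uy_le (l := t ^ (-(7 / 8) : ℝ)) (by positivity)
          (hY0 t ((hY ▸ le_max_left _ _ : Y0 ≤ Y).trans ht.1))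
        have e : lg u t / (4 * t ^ (-(7 / 8) : ℝ)) = lg u t * t ^ (7 / 8 : ℝ) / 4 := by
          rw [Real.rpow_neg ht0.le]; field_simp
        rw [e, ← hM] at h1
        have h2 := (hA t (hY1.trans ht.1)).2.1
        norm_num at h1 h2 ⊢
        linarith)
    have h0 : 0 ≤ Y ^ (1 / 8 : ℝ) := by positivity
    have h0' : 0 ≤ 16 * M * Y ^ (1 / 8 : ℝ) := by positivity
    linarith [(hA y (hY1.trans hy)).2.2, (hA Y hY1).2.2]
  refine ⟨((S Y - A Y) + 16 * M) / wPhi F 0, Y, ?_, hY ▸ le_max_right _ _, fun y k₁ k₂ hy hk => ?_⟩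
  · have := (hA Y (hY ▸ le_max_right _ _)).2.2
    have := hS0 Y
    exact div_pos (by linarith) hΦ0
  · have h1 := mul_sub_le_integral (k := wPhi F 0) (W.integrable_Phi y)
      (fun x => W.hF.wPhi_nonneg (W.neg_one_lt x y).le) hk.lt.le (fun x hx => by
        refine W.hF.monotone_wPhi ?_
        rcases hx.1.eq_or_lt with h | h
        · rw [← h, hk.left]
        rcases hx.2.eq_or_lt with h' | h'
        · rw [h', hk.right]
        exact (hk.mid x h h').le)
    have h2 := hmono y hy
    have hY1 : 1 ≤ Y := hY ▸ le_max_right _ _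
    have h3 : 1 ≤ y ^ (1 / 8 : ℝ) := Real.one_le_rpow (hY1.trans hy) (by norm_num)
    have h4 : 0 ≤ S Y - A Y := by linarith [hS0 Y, (hA Y hY1).2.2]
    have h5 := mul_le_mul_of_nonneg_left h3 h4
    have h6 : S y = ∫ x, wPhi F (u x y) := by rw [hS]
    rw [div_mul_eq_mul_div, le_div_iff₀ hΦ0]
    linarith

end Wave

end rates

/-! ### Flatness rate -/

section flat

/-- The zero curves of a wave, together with a flatness rate `ε`. -/
structure Branch (F : ℝ → ℝ) (c : ℝ) (u : ℝ → ℝ → ℝ) (k₁ k₂ ε : ℝ → ℝ) : Prop where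
  wave : Wave F c u
  level : ∀ᶠ y in atTop, IsLevel u y (k₁ y) (k₂ y)
  flat : ∀ᶠ y in atTop, FlatAt F u (ε y) y
  rate : ∃ C, ∀ᶠ y in atTop, ε y ≤ C * y ^ (-(1 / 6) : ℝ)
  eps : Tendsto ε atTop (𝓝 0)
  eps_gap : Tendsto (fun y => ε y * (k₂ y - k₁ y)) atTop (𝓝 0)

lemma FlatAt.reflect {F : ℝ → ℝ} {u : ℝ → ℝ → ℝ} {ε y : ℝ} (h : FlatAt F u ε y) :
    FlatAt F (fun x y => u (-x) y) ε y := by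
  intro x
  have h' := h (-x)
  rw [Wave.pdy_reflect, Wave.pdx_reflect, Wave.pdy_reflect]
  simp only [abs_neg]
  exact h'

lemma Branch.reflect {F : ℝ → ℝ} {c : ℝ} {u : ℝ → ℝ → ℝ} {k₁ k₂ ε : ℝ → ℝ}
    (B : Branch F c u k₁ k₂ ε) :
    Branch F c (fun x y => u (-x) y) (fun y => -k₂ y) (fun y => -k₁ y) ε where
  wave := B.wave.reflect
  level := B.level.mono fun _ h => h.reflect
  flat := B.flat.mono fun _ h => h.reflect
  rate := B.rate
  eps := B.eps
  eps_gap := B.eps_gap.congr fun y => by ring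

namespace Wave

variable {F : ℝ → ℝ} {c : ℝ} {u : ℝ → ℝ → ℝ}

lemma exists_gap_exp (W : Wave F c u) : ∃ κ C, 0 < κ ∧ κ ≤ 1 ∧ 0 < C ∧ ∀ y k₁ k₂,
    IsLevel u y k₁ k₂ → ∀ x, κ * Real.exp (-(C * (k₂ - k₁))) ≤ 1 - u x y := by
  obtain ⟨C, hC, H⟩ := W.exists_harnack
  obtain ⟨κ0, C', -, hC', H'⟩ := W.hF.exists_wa_bounds
  have ha : 0 < wa F 0 := W.hF.wa_pos ⟨by norm_num, by norm_num⟩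
  refine ⟨min 1 (wa F 0 / (2 * C')), C, lt_min one_pos (by positivity), min_le_left _ _, hC,
    fun y k₁ k₂ hk x => ?_⟩
  have hD : 0 < k₂ - k₁ := sub_pos.2 hk.lt
  have he : Real.exp (-(C * (k₂ - k₁))) ≤ 1 := Real.exp_le_one_iff.2 (by
    have : 0 < C * (k₂ - k₁) := by positivity
    linarith)
  have he0 := Real.exp_pos (-(C * (k₂ - k₁)))
  rcases le_total (u x y) 0 with hu | hu
  · have : min 1 (wa F 0 / (2 * C')) * Real.exp (-(C * (k₂ - k₁))) ≤ 1 * 1 :=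
      mul_le_mul (min_le_left _ _) he he0.le (by norm_num)
    linarith
  · have hx1 : k₁ ≤ x := by
      by_contra hn
      push Not at hn
      linarith [hk.out_left x hn]
    have hx2 : x ≤ k₂ := by
      by_contra hn
      push Not at hn
      linarith [hk.out_right x hn]
    have h1 := H x y k₂ y
    rw [hk.right, sub_self, abs_zero, add_zero, abs_of_nonneg (by linarith : 0 ≤ k₂ - x)] at h1
    have h2 : wa F 0 ≤ Real.exp (C * (k₂ - k₁)) * wa F (u x y) :=
      h1.trans (mul_le_mul_of_nonneg_right (Real.exp_le_exp.2
        (mul_le_mul_of_nonneg_left (by linarith) hC.le)) (W.a_pos x y).le)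
    have h3 := (H' _ (W.mem' x y)).2.1
    have h4 : 1 - u x y ^ 2 ≤ 2 * (1 - u x y) := by nlinarith [sq_nonneg (1 - u x y)]
    have h5 : wa F 0 ≤ Real.exp (C * (k₂ - k₁)) * (2 * C' * (1 - u x y)) :=
      h2.trans (mul_le_mul_of_nonneg_left (by nlinarith) (Real.exp_pos _).le)
    have h6 : wa F 0 / (2 * C') * Real.exp (-(C * (k₂ - k₁))) ≤ 1 - u x y := by
      rw [Real.exp_neg, ← div_eq_mul_inv, div_div, div_le_iff₀ (by positivity)]
      linarith
    exact (mul_le_mul_of_nonneg_right (min_le_right _ _) he0.le).trans h6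

lemma exists_flatAt_rpow (W : Wave F c u) : ∃ C, 0 < C ∧ ∀ᶠ y in atTop,
    FlatAt F u (C * y ^ (-(1 / 6) : ℝ)) y := by
  obtain ⟨C0, θ, hC0, hθ, H⟩ := W.exists_barrier
  obtain ⟨C1, Y1, hC1, hY1, H1⟩ := W.exists_uy_le_rpow
  obtain ⟨κ, C2, hκ, hκ1, hC2, H2⟩ := W.exists_gap_exp
  obtain ⟨C3, Y3, hC3, hY3, H3⟩ := W.exists_gap_le_rpow
  obtain ⟨Y4, k₁, k₂, H4⟩ := W.exists_isLevel
  have t1 : Tendsto (fun t : ℝ => C1 * t ^ (-(1 / 6) : ℝ)) atTop (𝓝 0) := by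
    have := (tendsto_rpow_neg_atTop (y := 1 / 6) (by norm_num)).const_mul C1
    rwa [mul_zero] at this
  have t2 : Tendsto (fun t : ℝ => C2 * C3 * t ^ (-(7 / 8) : ℝ)) atTop (𝓝 0) := by
    have := (tendsto_rpow_neg_atTop (y := 7 / 8) (by norm_num)).const_mul (C2 * C3)
    rwa [mul_zero] at this
  have t3 := tendsto_rpow_mul_exp_neg_mul_atTop_nhds_zero (1 / 6) (θ / 2) (by positivity)
  have ht : ∀ᶠ t : ℝ in atTop, FlatAt F u (C0 * (C1 + κ⁻¹) * t ^ (-(1 / 6) : ℝ)) (2 * t) := by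
    filter_upwards [t1.eventually (gt_mem_nhds (by norm_num : (0 : ℝ) < 1)),
      t2.eventually (gt_mem_nhds (by positivity : (0 : ℝ) < θ / 2)),
      t3.eventually (gt_mem_nhds (by norm_num : (0 : ℝ) < 1)),
      eventually_ge_atTop Y1, eventually_ge_atTop Y3, eventually_ge_atTop Y4,
      eventually_ge_atTop 1] with t a1 a2 a3 a4 a5 a6 a7
    have ht0 : 0 < t := by linarith
    have hD := H3 t _ _ a5 (H4 t a6)
    have hE : C2 * (k₂ t - k₁ t) ≤ θ / 2 * t := by
      have e1 : C2 * C3 * t ^ (1 / 8 : ℝ) = C2 * C3 * t ^ (-(7 / 8) : ℝ) * t := by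
        rw [mul_assoc, mul_assoc, mul_assoc, ← Real.rpow_add_one ht0.ne']; norm_num
      have e2 := mul_le_mul_of_nonneg_left hD hC2.le
      have e3 := mul_le_mul_of_nonneg_right a2.le ht0.le
      linarith
    have key : Real.exp (-θ * (2 * t - t)) / (κ * Real.exp (-(C2 * (k₂ t - k₁ t)))) ≤
        κ⁻¹ * t ^ (-(1 / 6) : ℝ) := by
      have e1 : Real.exp (-θ * (2 * t - t)) / (κ * Real.exp (-(C2 * (k₂ t - k₁ t)))) =
          κ⁻¹ * Real.exp (-θ * t + C2 * (k₂ t - k₁ t)) := by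
        rw [Real.exp_neg, Real.exp_add, show 2 * t - t = t by ring]; field_simp
      rw [e1]
      refine mul_le_mul_of_nonneg_left ?_ (by positivity)
      have e2 : Real.exp (-θ * t + C2 * (k₂ t - k₁ t)) ≤ Real.exp (-(θ / 2) * t) :=
        Real.exp_le_exp.2 (by linarith)
      refine e2.trans ?_
      rw [Real.rpow_neg ht0.le, ← one_div, le_div_iff₀ (by positivity)]
      linarith
    intro x
    have := H t (C1 * t ^ (-(1 / 6) : ℝ)) (κ * Real.exp (-(C2 * (k₂ t - k₁ t)))) a1.le
      (by positivity) ((H2 t _ _ (H4 t a6) (k₁ t)).trans (by rw [(H4 t a6).left]; norm_num))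
      (fun x y hy => (H1 x y (a4.trans hy)).trans (mul_le_mul_of_nonneg_left
        (Real.rpow_le_rpow_of_nonpos ht0 hy (by norm_num)) hC1.le))
      (fun x => H2 t _ _ (H4 t a6) x) x (2 * t) (by linarith)
    have e : C0 * (C1 * t ^ (-(1 / 6) : ℝ) + Real.exp (-θ * (2 * t - t)) /
        (κ * Real.exp (-(C2 * (k₂ t - k₁ t))))) * wa F (u x (2 * t)) ≤
        C0 * (C1 + κ⁻¹) * t ^ (-(1 / 6) : ℝ) * wa F (u x (2 * t)) := by
      refine mul_le_mul_of_nonneg_right ?_ (W.a_pos _ _).le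
      have := mul_le_mul_of_nonneg_left key hC0.le
      linarith
    exact ⟨this.1.trans e, this.2.1.trans e, this.2.2.trans e⟩
  refine ⟨C0 * (C1 + κ⁻¹) * (1 / 2) ^ (-(1 / 6) : ℝ), by positivity, ?_⟩
  have hh : Tendsto (fun y : ℝ => 1 / 2 * y) atTop atTop :=
    tendsto_id.const_mul_atTop (by norm_num)
  filter_upwards [hh.eventually ht, eventually_gt_atTop 0] with y hy hy0
  rw [Real.mul_rpow (by norm_num) hy0.le, show 2 * (1 / 2 * y) = y by ring] at hy
  rw [mul_assoc]
  exact hy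

lemma exists_branch (W : Wave F c u) : ∃ k₁ k₂ ε : ℝ → ℝ, Branch F c u k₁ k₂ ε := by
  obtain ⟨C, hC, h⟩ := W.exists_flatAt_rpow
  obtain ⟨C3, Y3, hC3, hY3, H3⟩ := W.exists_gap_le_rpow
  obtain ⟨Y4, k₁, k₂, H4⟩ := W.exists_isLevel
  refine ⟨k₁, k₂, fun y => C * y ^ (-(1 / 6) : ℝ), W, (eventually_ge_atTop Y4).mono H4, h,
    ⟨C, Eventually.of_forall fun y => le_rfl⟩, ?_, ?_⟩
  · have := (tendsto_rpow_neg_atTop (y := 1 / 6) (by norm_num)).const_mul C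
    rwa [mul_zero] at this
  · have t := (tendsto_rpow_neg_atTop (y := 1 / 24) (by norm_num)).const_mul (C * C3)
    rw [mul_zero] at t
    refine squeeze_zero' ?_ ?_ t
    · filter_upwards [eventually_ge_atTop Y4, eventually_gt_atTop 0] with y h1 h2
      exact mul_nonneg (by positivity) (sub_nonneg.2 (H4 y h1).lt.le)
    · filter_upwards [eventually_ge_atTop Y4, eventually_ge_atTop Y3] with y h1 h2
      have hy0 : 0 < y := by linarith
      have := mul_le_mul_of_nonneg_left (H3 y _ _ h2 (H4 y h1))
        (by positivity : 0 ≤ C * y ^ (-(1 / 6) : ℝ))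
      refine this.trans (le_of_eq ?_)
      rw [mul_mul_mul_comm, ← Real.rpow_add hy0]
      norm_num

end Wave

end flat

/-! ### One-dimensional slices -/

section slice

lemma BalancedDoubleWell.exists_crit_half {F : ℝ → ℝ} (hF : BalancedDoubleWell F) :
    ∃ η₀, 0 < η₀ ∧ ∀ s ∈ Ioo (-1 : ℝ) 1, ∀ η q, η ≤ η₀ → F s ≤ η → |q| ≤ η * wa F s →
      0 ≤ s → deriv F s - q < 0 := by
  obtain ⟨κ, hκ, h1⟩ := hF.exists_lower_half
  obtain ⟨C, hC, h2⟩ := hF.exists_taylor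
  obtain ⟨κ', C', -, hC', h3⟩ := hF.exists_wa_bounds
  have hM : 0 < deriv (deriv F) 1 := hF.2.2.2.2.1
  obtain ⟨M, hMd⟩ : ∃ M, M = deriv (deriv F) 1 := ⟨_, rfl⟩
  rw [← hMd] at hM h2
  refine ⟨min (M / (8 * C')) (κ * (M / (4 * C)) ^ 2), by positivity, ?_⟩
  intro s hs η q hη hFs hq h0
  have e1 : η ≤ M / (8 * C') := hη.trans (min_le_left _ _)
  have e2 : η ≤ κ * (M / (4 * C)) ^ 2 := hη.trans (min_le_right _ _)
  have hw : 0 < 1 - s := by linarith [hs.2]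
  have a1 := h1 s ⟨h0, hs.2.le⟩
  have a2 := (h2 (1 - s) ⟨hw.le, by linarith⟩).2.1
  have a3 := (h3 s ⟨hs.1.le, hs.2.le⟩).2.1
  rw [show 1 - (1 - s) = s by ring] at a2
  have hη0 : 0 < η := lt_of_lt_of_le (hF.pos hs.1 hs.2) hFs
  have b1 : 1 - s ≤ M / (4 * C) := by
    have : (1 - s) ^ 2 ≤ (M / (4 * C)) ^ 2 := by
      have : κ * (1 - s) ^ 2 ≤ κ * (M / (4 * C)) ^ 2 := by linarith
      exact le_of_mul_le_mul_left this hκ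
    exact le_of_sq_le_sq this (by positivity)
  rw [le_div_iff₀ (by positivity)] at b1 e1
  have b2 : wa F s ≤ C' * (2 * (1 - s)) := a3.trans (mul_le_mul_of_nonneg_left (by nlinarith) hC'.le)
  have b3 : |q| ≤ η * (C' * (2 * (1 - s))) := hq.trans (mul_le_mul_of_nonneg_left b2 hη0.le)
  have b4 := neg_le_of_abs_le b3
  have b5 := le_of_abs_le a2
  have b6 := mul_le_mul_of_nonneg_right b1 hw.le
  have b7 := mul_le_mul_of_nonneg_right e1 hw.le
  have b8 := mul_pos hM hw
  nlinarith

lemma BalancedDoubleWell.exists_crit {F : ℝ → ℝ} (hF : BalancedDoubleWell F) :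
    ∃ η₀, 0 < η₀ ∧ ∀ s ∈ Ioo (-1 : ℝ) 1, ∀ η q, η ≤ η₀ → F s ≤ η → |q| ≤ η * wa F s →
      (0 ≤ s → deriv F s - q < 0) ∧ (s ≤ 0 → 0 < deriv F s - q) := by
  obtain ⟨η₁, h1, H1⟩ := hF.exists_crit_half
  obtain ⟨η₂, h2, H2⟩ := hF.reflect.exists_crit_half
  refine ⟨min η₁ η₂, lt_min h1 h2, fun s hs η q hη hFs hq => ⟨fun h =>
    H1 s hs η q (hη.trans (min_le_left _ _)) hFs hq h, fun h => ?_⟩⟩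
  have hd : deriv (fun s => F (-s)) (-s) = -deriv F s := by
    rw [deriv_comp_neg, neg_neg]
  have := H2 (-s) ⟨by linarith [hs.2], by linarith [hs.1]⟩ η (-q) (hη.trans (min_le_right _ _))
    (by simpa using hFs) (by simpa [wa] using hq) (by linarith)
  rw [hd] at this
  linarith

/-- A nearly conservative positive pulse: `U' = V`, `V' = F'(U) - Q` with a relative error and an
energy defect of size `η`, and zeros exactly at `k₁ < k₂`. -/
structure Slice (F U V Q : ℝ → ℝ) (η k₁ k₂ : ℝ) : Prop where
  well : BalancedDoubleWell F
  dU : ∀ x, HasDerivAt U (V x) x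
  dV : ∀ x, HasDerivAt V (deriv F (U x) - Q x) x
  Q_le : ∀ x, |Q x| ≤ η * wa F (U x)
  mem : ∀ x, U x ∈ Ioo (-1 : ℝ) 1
  defect_nonneg : ∀ x, 0 ≤ F (U x) - V x ^ 2 / 2
  defect_le : ∀ x, F (U x) - V x ^ 2 / 2 ≤ η
  lt : k₁ < k₂
  left : U k₁ = 0
  right : U k₂ = 0
  mid : ∀ x, k₁ < x → x < k₂ → 0 < U x
  out_left : ∀ x, x < k₁ → U x < 0
  out_right : ∀ x, k₂ < x → U x < 0
  top : Tendsto U atTop (𝓝 (-1))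
  bot : Tendsto U atBot (𝓝 (-1))

/-- If the zeros of `f` on `[a, b)` are strictly increasing, then `f` stays nonnegative. -/
lemma nonneg_of_zeros_increasing {f f' : ℝ → ℝ} {a b : ℝ} (hd : ∀ x, HasDerivAt f (f' x) x)
    (ha : 0 ≤ f a) (h : ∀ x ∈ Ico a b, f x = 0 → 0 < f' x) : ∀ x ∈ Icc a b, 0 ≤ f x := by
  intro x hx
  exact image_le_of_deriv_right_lt_deriv_boundary (f := fun _ => (0 : ℝ)) (f' := fun _ => 0)
    continuousOn_const (fun x _ => hasDerivWithinAt_const _ _ _) ha hd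
    (fun x hx h0 => h x hx h0.symm) hx

namespace Slice

variable {F U V Q : ℝ → ℝ} {η k₁ k₂ : ℝ}

lemma reflect (S : Slice F U V Q η k₁ k₂) :
    Slice F (fun x => U (-x)) (fun x => -V (-x)) (fun x => Q (-x)) η (-k₂) (-k₁) where
  well := S.well
  dU x := by
    have := HasDerivAt.comp (h₂ := U) x (S.dU (-x)) (hasDerivAt_neg x)
    exact this.congr_deriv (by ring)
  dV x := by
    have := (HasDerivAt.comp (h₂ := V) x (S.dV (-x)) (hasDerivAt_neg x)).neg
    exact this.congr_deriv (by ring)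
  Q_le x := S.Q_le _
  mem x := S.mem _
  defect_nonneg x := by simpa using S.defect_nonneg (-x)
  defect_le x := by simpa using S.defect_le (-x)
  lt := neg_lt_neg S.lt
  left := by simpa using S.right
  right := by simpa using S.left
  mid x h1 h2 := S.mid _ (by linarith) (by linarith)
  out_left x h := S.out_right _ (by linarith)
  out_right x h := S.out_left _ (by linarith)
  top := S.bot.comp tendsto_neg_atTop_atBot
  bot := S.top.comp tendsto_neg_atBot_atTop

lemma mem' (S : Slice F U V Q η k₁ k₂) (x : ℝ) : U x ∈ Icc (-1 : ℝ) 1 := Ioo_subset_Icc_self (S.mem x)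

lemma a_pos (S : Slice F U V Q η k₁ k₂) (x : ℝ) : 0 < wa F (U x) := S.well.wa_pos (S.mem x)

lemma F_pos (S : Slice F U V Q η k₁ k₂) (x : ℝ) : 0 < F (U x) := S.well.pos (S.mem x).1 (S.mem x).2

lemma η_nonneg (S : Slice F U V Q η k₁ k₂) : 0 ≤ η := (S.defect_nonneg 0).trans (S.defect_le 0)

lemma a_sq (S : Slice F U V Q η k₁ k₂) (x : ℝ) : wa F (U x) ^ 2 = 2 * F (U x) := S.well.wa_sq (S.mem' x)

lemma abs_V_le (S : Slice F U V Q η k₁ k₂) (x : ℝ) : |V x| ≤ wa F (U x) := by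
  refine abs_le_of_sq_le_sq ?_ (S.a_pos x).le
  have := S.defect_nonneg x
  rw [S.a_sq]; linarith

lemma continuous_V (S : Slice F U V Q η k₁ k₂) : Continuous V := continuous_iff_continuousAt.2 fun x => (S.dV x).continuousAt

lemma dF (S : Slice F U V Q η k₁ k₂) (x : ℝ) : HasDerivAt (fun x => F (U x)) (deriv F (U x) * V x) x :=
  HasDerivAt.comp (h₂ := F) x (S.well.hasDerivAt (U x)) (S.dU x)

lemma dΦ (S : Slice F U V Q η k₁ k₂) (x : ℝ) : HasDerivAt (fun x => wPhi F (U x)) (wa F (U x) * V x) x :=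
  HasDerivAt.comp (h₂ := wPhi F) x (S.well.hasDerivAt_wPhi (U x)) (S.dU x)

lemma dA (S : Slice F U V Q η k₁ k₂) (x : ℝ) : HasDerivAt (fun x => wa F (U x)) (deriv F (U x) / wa F (U x) * V x) x :=
  HasDerivAt.comp (h₂ := wa F) x (S.well.hasDerivAt_wa (S.mem x)) (S.dU x)

lemma dDefect (S : Slice F U V Q η k₁ k₂) (x : ℝ) : HasDerivAt (fun x => F (U x) - V x ^ 2 / 2) (V x * Q x) x := by
  refine ((S.dF x).sub (((S.dV x).pow 2).div_const 2)).congr_deriv ?_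
  simp only [Nat.cast_ofNat, Nat.add_one_sub_one, pow_one]
  ring

lemma exists_crit (hF : BalancedDoubleWell F) : ∃ η₀, 0 < η₀ ∧
    ∀ U V Q η k₁ k₂, Slice F U V Q η k₁ k₂ → η ≤ η₀ → ∀ x, V x = 0 →
      (0 ≤ U x → deriv F (U x) - Q x < 0) ∧ (U x ≤ 0 → 0 < deriv F (U x) - Q x) := by
  obtain ⟨η₀, h0, H⟩ := hF.exists_crit
  refine ⟨η₀, h0, fun U V Q η k₁ k₂ S hη x hV => H (U x) (S.mem x) η (Q x) hη ?_ (S.Q_le x)⟩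
  have := S.defect_le x
  rw [hV] at this
  linarith

/-- The sign of the slope outside and inside the pulse. -/
lemma exists_sign (hF : BalancedDoubleWell F) : ∃ η₀, 0 < η₀ ∧
    ∀ U V Q η k₁ k₂, Slice F U V Q η k₁ k₂ → η ≤ η₀ →
      (∀ x, k₂ ≤ x → V x < 0) ∧
      (∀ x, k₁ ≤ x → V x ≤ 0 → ∀ z ∈ Icc x k₂, V z ≤ 0) := by
  obtain ⟨η₀, h0, H⟩ := exists_crit hF
  refine ⟨η₀, h0, fun U V Q η k₁ k₂ S hη => ⟨fun x hx => ?_, fun x hx hV z hz => ?_⟩⟩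
  · have hneg : ∀ z, k₂ ≤ z → U z ≤ 0 := fun z hz => by
      rcases eq_or_lt_of_le hz with rfl | h
      · exact S.right.le
      · exact (S.out_right z h).le
    by_contra hV
    push Not at hV
    have h1 : ∀ z, x ≤ z → 0 ≤ V z := fun z hz =>
      nonneg_of_zeros_increasing S.dV hV (fun t ht h => (H _ _ _ _ _ _ S hη t h).2
        (hneg t (hx.trans ht.1))) z ⟨hz, le_refl z⟩
    have h2 : ∀ z, x ≤ z → U x ≤ U z := fun z hz => by
      have := le_of_hasDerivAt_nonpos (f := fun t => -U t) hz (fun t _ => (S.dU t).neg)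
        (fun t ht => by simpa using h1 t ht.1)
      simpa using this
    have := ge_of_tendsto S.top (eventually_atTop.2 ⟨x, h2⟩)
    linarith [(S.mem x).1]
  · have hpos : ∀ t, k₁ ≤ t → t < k₂ → 0 ≤ U t := fun t ht ht' => by
      rcases eq_or_lt_of_le ht with rfl | h
      · exact S.left.ge
      · exact (S.mid t h ht').le
    have := nonneg_of_zeros_increasing (f := fun t => -V t) (fun t => (S.dV t).neg)
      (by simpa using hV) (fun t ht h => by
        have := (H _ _ _ _ _ _ S hη t (by simpa using h)).1 (hpos t (hx.trans ht.1) ht.2)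
        linarith) z hz
    simpa using this

/-- Exponential decay outside the pulse. -/
lemma exists_exterior (hF : BalancedDoubleWell F) : ∃ η₀ κ C, 0 < η₀ ∧ 0 < κ ∧ 0 < C ∧
    ∀ U V Q η k₁ k₂, Slice F U V Q η k₁ k₂ → η ≤ η₀ → ∀ x, k₂ ≤ x →
      wPhi F (U x) ≤ C * Real.exp (-(κ * (x - k₂))) := by
  obtain ⟨η₁, h1, H1⟩ := exists_sign hF
  obtain ⟨C, hC, H2⟩ := hF.exists_wPhi_le
  obtain ⟨κ, hκ, H3⟩ := hF.reflect.exists_lower_half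
  obtain ⟨C', hC', H4⟩ := hF.reflect.exists_taylor
  refine ⟨min η₁ (1 / (2 * C)), √κ, C * (deriv (deriv fun s => F (-s)) 1 / 2 + C'),
    by positivity, by positivity, ?_, ?_⟩
  · have := hF.reflect.2.2.2.2.1
    positivity
  intro U V Q η k₁ k₂ S hη x hx
  have hη1 := hη.trans (min_le_left _ _)
  have hη2 := hη.trans (min_le_right _ _)
  rw [le_div_iff₀ (by positivity)] at hη2
  have hV := (H1 _ _ _ _ _ _ S hη1).1
  have hU : ∀ z, k₂ ≤ z → U z ≤ 0 := fun z hz => by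
    rcases eq_or_lt_of_le hz with rfl | h
    · exact S.right.le
    · exact (S.out_right z h).le
  have lF : Tendsto (fun x => F (U x)) atTop (𝓝 0) := by
    have := (hF.continuous.tendsto (-1)).comp S.top
    rwa [hF.zero_neg_one] at this
  have lΦ : Tendsto (fun x => wPhi F (U x)) atTop (𝓝 0) := by
    have := (hF.continuous_wPhi.tendsto (-1)).comp S.top
    rwa [BalancedDoubleWell.wPhi_neg_one F] at this
  have lG : Tendsto (fun x => F (U x) - V x ^ 2 / 2) atTop (𝓝 0) :=
    squeeze_zero (fun x => S.defect_nonneg x) (fun x => by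
      have := sq_nonneg (V x); linarith) lF
  have key : ∀ z, k₂ ≤ z → F (U z) - V z ^ 2 / 2 ≤ η * wPhi F (U z) := by
    intro z hz
    have hmono : ∀ t, z ≤ t → F (U z) - V z ^ 2 / 2 - η * wPhi F (U z) ≤
        F (U t) - V t ^ 2 / 2 - η * wPhi F (U t) := by
      intro t ht
      have := le_of_hasDerivAt_nonpos
        (f := fun t => -(F (U t) - V t ^ 2 / 2 - η * wPhi F (U t))) ht
        (fun r _ => ((S.dDefect r).sub ((S.dΦ r).const_mul η)).neg) (fun r hr => by
          have v := hV r (hz.trans hr.1)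
          have q := (abs_le.1 (S.Q_le r)).2
          have := mul_le_mul_of_nonpos_left q v.le
          linarith)
      exact neg_le_neg_iff.1 this
    have l := (lG.sub (lΦ.const_mul η))
    rw [mul_zero, sub_zero] at l
    have := ge_of_tendsto l (eventually_atTop.2 ⟨z, hmono⟩)
    linarith
  have hVle : ∀ z, k₂ ≤ z → V z ≤ -(√κ * (1 + U z)) := by
    intro z hz
    have a1 := key z hz
    have a2 := H2 (U z) ⟨(S.mem z).1.le, hU z hz⟩
    have a3 := H3 (-U z) ⟨by linarith [hU z hz], by linarith [(S.mem z).1]⟩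
    simp only [neg_neg, sub_neg_eq_add] at a3
    have a4 := mul_le_mul_of_nonneg_left a2 S.η_nonneg
    have a5 : F (U z) ≤ V z ^ 2 := by
      have := mul_le_mul_of_nonneg_right hη2 (S.F_pos z).le
      linarith
    have a6 : (√κ * (1 + U z)) ^ 2 ≤ V z ^ 2 := by
      rw [mul_pow, Real.sq_sqrt hκ.le]; linarith
    have a7 := sq_le_sq.1 a6
    rw [abs_of_neg (hV z hz)] at a7
    linarith [le_abs_self (√κ * (1 + U z))]
  have hdecay : 1 + U x ≤ Real.exp (-(√κ * (x - k₂))) := by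
    have := le_of_hasDerivAt_nonpos
      (f := fun t => (1 + U t) * Real.exp (√κ * (t - k₂))) hx
      (fun t _ => ((S.dU t).const_add 1).mul
        ((((hasDerivAt_id t).sub_const k₂).const_mul (√κ)).exp)) (fun t ht => by
        have v := hVle t ht.1
        have := mul_le_mul_of_nonneg_right v (Real.exp_pos (√κ * (t - k₂))).le
        simp only [id]
        linarith)
    simp only [S.right, sub_self, mul_zero, Real.exp_zero] at this
    rw [Real.exp_neg, ← one_div, le_div_iff₀ (Real.exp_pos _)]
    linarith
  have a2 := H2 (U x) ⟨(S.mem x).1.le, hU x hx⟩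
  have w0 : 0 < 1 + U x := by linarith [(S.mem x).1]
  have w1 : 1 + U x ≤ 1 := by linarith [hU x hx]
  have a8 := (H4 (1 + U x) ⟨w0.le, by linarith⟩).2.2
  rw [show -(1 - (1 + U x)) = U x by ring] at a8
  have hM := hF.reflect.2.2.2.2.1
  generalize deriv (deriv fun s => F (-s)) 1 = M at *
  have a9 : F (U x) ≤ (M / 2 + C') * (1 + U x) := by
    have := le_of_abs_le a8
    have e2 : (1 + U x) ^ 2 ≤ 1 + U x := by nlinarith
    have e3 : (1 + U x) ^ 3 ≤ 1 + U x := by nlinarith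
    have := mul_le_mul_of_nonneg_left e2 hM.le
    have := mul_le_mul_of_nonneg_left e3 hC'.le
    linarith
  calc wPhi F (U x) ≤ C * ((M / 2 + C') * (1 + U x)) := a2.trans (mul_le_mul_of_nonneg_left a9 hC.le)
    _ ≤ C * ((M / 2 + C') * Real.exp (-(√κ * (x - k₂)))) := by gcongr
    _ = _ := by ring

end Slice

end slice

/-! ### Estimates inside the pulse -/

section pulse

lemma BalancedDoubleWell.exists_near_one {F : ℝ → ℝ} (hF : BalancedDoubleWell F) :
    ∃ C c₀, 0 < C ∧ 0 < c₀ ∧ ∀ s, 0 ≤ s → s < 1 →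
      |wa F s - √(deriv (deriv F) 1) * (1 - s)| ≤ C * (1 - s) ^ 2 ∧
      |deriv F s + √(deriv (deriv F) 1) ^ 2 * (1 - s)| ≤ C * (1 - s) ^ 2 ∧
      c₀ * (1 - s) ≤ wa F s ∧ wa F s ≤ C * (1 - s) ∧
      wPhi F 1 - wPhi F s ≤ C * (1 - s) ∧
      ∀ g η, 0 ≤ g → g * F s ≤ η →
        (√(deriv (deriv F) 1) + 2 * (deriv F s / wa F s)) * g ≤ C * η := by
  have hM : 0 < deriv (deriv F) 1 := hF.2.2.2.2.1
  obtain ⟨μ, hμd⟩ : ∃ μ, μ = √(deriv (deriv F) 1) := ⟨_, rfl⟩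
  have hμ : 0 < μ := by rw [hμd]; positivity
  have hμ2 : deriv (deriv F) 1 = μ ^ 2 := by rw [hμd, Real.sq_sqrt hM.le]
  obtain ⟨C₁, hC₁, h1⟩ := hF.exists_taylor
  obtain ⟨κ', C₂, hκ', hC₂, h2⟩ := hF.exists_wa_bounds
  obtain ⟨κ, hκ, h3⟩ := hF.exists_lower_half
  obtain ⟨C₃, hC₃, h4⟩ := hF.exists_one_sub_wPhi_le
  rw [← hμd]
  rw [hμ2] at h1
  obtain ⟨C₄, hC₄⟩ : ∃ C₄, C₄ = C₁ + μ / 2 * (2 * C₁ / μ) := ⟨_, rfl⟩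
  have hC₄p : 0 < C₄ := by rw [hC₄]; positivity
  obtain ⟨w₀, hw₀⟩ : ∃ w₀, w₀ = μ ^ 2 / (2 * C₄) := ⟨_, rfl⟩
  have hw₀p : 0 < w₀ := by rw [hw₀]; positivity
  obtain ⟨C₅, hC₅⟩ : ∃ C₅, C₅ = (μ + 2 * C₂) / (κ * w₀ ^ 2) := ⟨_, rfl⟩
  have hC₅p : 0 < C₅ := by rw [hC₅]; positivity
  have d1 : 0 < 2 * C₁ / μ := by positivity
  have d2 : 0 < C₃ * (C₂ * C₂) * 2 := by positivity
  refine ⟨2 * C₁ / μ + C₁ + 2 * C₂ + C₃ * (C₂ * C₂) * 2 + C₅, κ', by positivity, hκ', ?_⟩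
  intro s hs0 hs1
  have hs : s ∈ Icc (-1 : ℝ) 1 := ⟨by linarith, hs1.le⟩
  have hw : 0 < 1 - s := by linarith
  obtain ⟨-, t1, t2⟩ := h1 (1 - s) ⟨hw.le, by linarith⟩
  rw [sub_sub_cancel] at t1 t2
  obtain ⟨b1, b2, b3⟩ := h2 s hs
  have ha : 0 < wa F s := hF.wa_pos ⟨by linarith, hs1⟩
  have hsq := hF.wa_sq hs
  have b1' : κ' * (1 - s) ≤ wa F s := le_trans (mul_le_mul_of_nonneg_left (by nlinarith) hκ'.le) b1
  have b2' : wa F s ≤ 2 * C₂ * (1 - s) := by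
    have : C₂ * (1 - s ^ 2) ≤ C₂ * (2 * (1 - s)) := mul_le_mul_of_nonneg_left (by nlinarith) hC₂.le
    linarith
  have r1 : |wa F s - μ * (1 - s)| ≤ 2 * C₁ / μ * (1 - s) ^ 2 := by
    have e : (wa F s - μ * (1 - s)) * (wa F s + μ * (1 - s)) =
        2 * (F s - μ ^ 2 * (1 - s) ^ 2 / 2) := by linear_combination hsq
    have e' : |wa F s - μ * (1 - s)| * (wa F s + μ * (1 - s)) ≤ 2 * (C₁ * (1 - s) ^ 3) := by
      rw [← abs_of_pos (show 0 < wa F s + μ * (1 - s) by positivity), ← abs_mul, e, abs_mul,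
        abs_two]
      exact mul_le_mul_of_nonneg_left t2 (by norm_num)
    have e'' : |wa F s - μ * (1 - s)| * (μ * (1 - s)) ≤ 2 * C₁ / μ * (1 - s) ^ 2 * (μ * (1 - s)) := by
      have := mul_nonneg (abs_nonneg (wa F s - μ * (1 - s))) ha.le
      have h : 2 * C₁ / μ * (1 - s) ^ 2 * (μ * (1 - s)) = 2 * (C₁ * (1 - s) ^ 3) := by
        field_simp
      rw [h]
      linarith
    exact le_of_mul_le_mul_right e'' (by positivity)
  have w2 : 0 ≤ (1 - s) ^ 2 := sq_nonneg _
  have hup : ∀ K K' z : ℝ, K ≤ K' → 0 ≤ z → K * z ≤ K' * z := fun K K' z h hz =>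
    mul_le_mul_of_nonneg_right h hz
  refine ⟨r1.trans (hup _ _ _ (by linarith) w2), t1.trans (hup _ _ _ (by linarith) w2), b1',
    b2'.trans (hup _ _ _ (by linarith) hw.le), ?_, ?_⟩
  · have h5 := h4 s ⟨hs0, hs1.le⟩
    have h6 : wa F s ^ 2 ≤ (2 * C₂ * (1 - s)) ^ 2 := by gcongr
    have h7 : (1 - s) ^ 2 ≤ 1 - s := by nlinarith
    have h8 : F s ≤ (C₂ * C₂) * 2 * (1 - s) := by
      have := mul_le_mul_of_nonneg_left h7 (mul_pos hC₂ hC₂).le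
      nlinarith
    have h9 := mul_le_mul_of_nonneg_left h8 hC₃.le
    have := hup (C₃ * (C₂ * C₂) * 2) (2 * C₁ / μ + C₁ + 2 * C₂ + C₃ * (C₂ * C₂) * 2 + C₅) _
      (by linarith) hw.le
    linarith
  · intro g η hg hgη
    have hη : 0 ≤ η := (mul_nonneg hg (hF.nonneg hs.1 hs.2)).trans hgη
    refine le_trans ?_ (hup C₅ _ η (by linarith) hη)
    rcases le_total (1 - s) w₀ with h | h
    · have k1 : deriv F s + μ / 2 * wa F s ≤ 0 := by
        have := le_of_abs_le r1
        have := le_of_abs_le t1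
        have k2 : μ / 2 * wa F s ≤ μ / 2 * (μ * (1 - s) + 2 * C₁ / μ * (1 - s) ^ 2) :=
          mul_le_mul_of_nonneg_left (by linarith) (by positivity)
        have k3 : C₄ * (1 - s) ^ 2 ≤ μ ^ 2 / 2 * (1 - s) := by
          have : C₄ * (1 - s) ≤ C₄ * w₀ := mul_le_mul_of_nonneg_left h hC₄p.le
          have e : C₄ * w₀ = μ ^ 2 / 2 := by rw [hw₀]; field_simp
          have := mul_le_mul_of_nonneg_right this hw.le
          rw [e] at this
          linarith
        rw [hC₄] at k3
        linarith
      have k4 : μ + 2 * (deriv F s / wa F s) ≤ 0 := by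
        have : deriv F s / wa F s ≤ -(μ / 2) := by rw [div_le_iff₀ ha]; linarith
        linarith
      have := mul_nonpos_of_nonpos_of_nonneg k4 hg
      have : 0 ≤ C₅ * η := by positivity
      linarith
    · have k1 : deriv F s / wa F s ≤ C₂ := by rw [div_le_iff₀ ha]; exact (le_abs_self _).trans b3
      have k2 : κ * w₀ ^ 2 ≤ F s := le_trans (by gcongr) (h3 s ⟨hs0, hs1.le⟩)
      have k3 : g * (κ * w₀ ^ 2) ≤ η := (mul_le_mul_of_nonneg_left k2 hg).trans hgη
      have k4 : (μ + 2 * (deriv F s / wa F s)) * g ≤ (μ + 2 * C₂) * g := by gcongr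
      refine k4.trans ?_
      rw [hC₅, div_mul_eq_mul_div, le_div_iff₀ (by positivity), mul_assoc]
      exact mul_le_mul_of_nonneg_left k3 (by positivity)

namespace Slice

variable {F U V Q : ℝ → ℝ} {η k₁ k₂ : ℝ}

lemma nonneg_mid (S : Slice F U V Q η k₁ k₂) {x : ℝ} (h1 : k₁ ≤ x) (h2 : x ≤ k₂) : 0 ≤ U x := by
  rcases eq_or_lt_of_le h1 with rfl | h
  · exact S.left.ge
  rcases eq_or_lt_of_le h2 with rfl | h'
  · exact S.right.ge
  exact (S.mid x h h').le

lemma dRatio (S : Slice F U V Q η k₁ k₂) (x : ℝ) : HasDerivAt (fun x => V x / wa F (U x))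
    (deriv F (U x) / wa F (U x) * (1 - V x ^ 2 / wa F (U x) ^ 2) - Q x / wa F (U x)) x := by
  have ha := (S.a_pos x).ne'
  refine ((S.dV x).div (S.dA x) ha).congr_deriv ?_
  field_simp
  ring

lemma exists_mid_half (hF : BalancedDoubleWell F) : ∃ η₀ C K, 0 < η₀ ∧ 0 < C ∧ 0 < K ∧
    ∀ U V Q η k₁ k₂, Slice F U V Q η k₁ k₂ → η ≤ η₀ → ∀ x, k₁ ≤ x → x ≤ k₂ → 0 ≤ V x →
      1 - U x ≤ C * Real.exp (K * (η * (k₂ - k₁))) *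
        Real.exp (-(√(deriv (deriv F) 1) * (x - k₁))) := by
  obtain ⟨η₀, h0, H⟩ := exists_sign hF
  obtain ⟨C, c₀, hC, hc₀, hN⟩ := hF.exists_near_one
  refine ⟨η₀, Real.exp (2 + C / c₀), C + 2, h0, Real.exp_pos _, by positivity, ?_⟩
  intro U V Q η k₁ k₂ S hη x hx1 hx2 hVx
  have hμ := Real.sqrt_nonneg (deriv (deriv F) 1)
  generalize √(deriv (deriv F) 1) = μ at *
  have hη0 := S.η_nonneg
  have hV : ∀ t ∈ Icc k₁ x, 0 ≤ V t := fun t ht => by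
    have := (H _ _ _ _ _ _ S.reflect hη).2 (-x) (by linarith) (by simpa using hVx) (-t)
      ⟨by linarith [ht.2], by linarith [ht.1]⟩
    simpa using this
  have hw : ∀ t, 0 < 1 - U t := fun t => by linarith [(S.mem t).2]
  have key := le_of_hasDerivAt_nonpos (f := fun t => Real.log (1 - U t) + μ * (t - k₁) +
      2 * (V t / wa F (U t)) - C / c₀ * U t - (C + 2) * η * (t - k₁)) hx1
    (fun t _ => ((((((S.dU t).const_sub 1).log (hw t).ne').add
      (((hasDerivAt_id t).sub_const k₁).const_mul μ)).add ((S.dRatio t).const_mul 2)).sub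
      ((S.dU t).const_mul (C / c₀))).sub (((hasDerivAt_id t).sub_const k₁).const_mul ((C + 2) * η)))
    (fun t ht => by
      obtain ⟨n1, n2, n3, n4, n5, n6⟩ := hN (U t) (S.nonneg_mid ht.1 (ht.2.trans hx2)) (S.mem t).2
      have ha := S.a_pos t
      have hv := hV t ht
      have hva := (abs_of_nonneg hv) ▸ S.abs_V_le t
      have hwt := hw t
      have hsq := S.a_sq t
      have hdef := S.defect_le t
      have hq : |Q t / wa F (U t)| ≤ η := by
        rw [abs_div, abs_of_pos ha, div_le_iff₀ ha]; exact S.Q_le t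
      have q1 : V t / wa F (U t) ≤ 1 := by rw [div_le_one ha]; exact hva
      have q0 : 0 ≤ V t / wa F (U t) := by positivity
      have e0 : V t ^ 2 / wa F (U t) ^ 2 = (V t / wa F (U t)) ^ 2 := by rw [div_pow]
      have g0 : 0 ≤ 1 - V t ^ 2 / wa F (U t) ^ 2 := by
        rw [e0]; nlinarith
      have g1 := n6 (1 - V t ^ 2 / wa F (U t) ^ 2) η g0 (by
        have : (1 - V t ^ 2 / wa F (U t) ^ 2) * F (U t) = F (U t) - V t ^ 2 / 2 := by
          rw [hsq]; have := (S.F_pos t).ne'; field_simp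
        rw [this]; exact hdef)
      have g2 : -V t / (1 - U t) + μ ≤ μ * (1 - V t / wa F (U t)) + C / c₀ * V t := by
        have e : -V t / (1 - U t) + μ = μ * (1 - V t / wa F (U t)) +
            V t * ((μ * (1 - U t) - wa F (U t)) / (wa F (U t) * (1 - U t))) := by
          field_simp; ring
        rw [e]
        have : (μ * (1 - U t) - wa F (U t)) / (wa F (U t) * (1 - U t)) ≤ C / c₀ := by
          rw [div_le_div_iff₀ (by positivity) hc₀]
          have m1 := neg_le_of_abs_le n1
          have m2 : (μ * (1 - U t) - wa F (U t)) * c₀ ≤ C * (1 - U t) ^ 2 * c₀ :=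
            mul_le_mul_of_nonneg_right (by linarith) hc₀.le
          have m3 : C * (1 - U t) * (c₀ * (1 - U t)) ≤ C * (1 - U t) * wa F (U t) :=
            mul_le_mul_of_nonneg_left n3 (by positivity)
          linarith
        have := mul_le_mul_of_nonneg_left this hv
        linarith
      have g3 : (V t / wa F (U t)) ^ 2 ≤ V t / wa F (U t) := by nlinarith
      have g4 : μ * (1 - V t / wa F (U t)) ≤ μ * (1 - V t ^ 2 / wa F (U t) ^ 2) :=
        mul_le_mul_of_nonneg_left (by rw [e0]; linarith) hμ
      have g5 := neg_le_of_abs_le hq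
      linarith)
  simp only [S.left, sub_self, sub_zero, Real.log_one, mul_zero, add_zero, zero_add] at key
  have ha := S.a_pos x
  have q0 : 0 ≤ V x / wa F (U x) := div_nonneg hVx ha.le
  have q1 : V k₁ / wa F 0 ≤ 1 := by
    have h := S.a_pos k₁
    have h' := (le_abs_self _).trans (S.abs_V_le k₁)
    rw [S.left] at h h'
    rwa [div_le_one h]
  have b1 : C / c₀ * U x ≤ C / c₀ * 1 := mul_le_mul_of_nonneg_left (S.mem x).2.le (by positivity)
  have b2 : (C + 2) * (η * (x - k₁)) ≤ (C + 2) * (η * (k₂ - k₁)) := by gcongr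
  have hlog : Real.log (1 - U x) ≤ 2 + C / c₀ + (C + 2) * (η * (k₂ - k₁)) + -(μ * (x - k₁)) := by
    linarith
  rw [← Real.exp_add, ← Real.exp_add]
  exact (Real.log_le_iff_le_exp (hw x)).1 hlog

lemma exists_mid_upper (hF : BalancedDoubleWell F) : ∃ η₀ C, 0 < η₀ ∧ 0 < C ∧
    ∀ U V Q η k₁ k₂, Slice F U V Q η k₁ k₂ → η ≤ η₀ → η * (k₂ - k₁) ≤ 1 →
      ∀ x, k₁ ≤ x → x ≤ k₂ → 1 - U x ≤ C * (Real.exp (-(√(deriv (deriv F) 1) * (x - k₁))) +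
        Real.exp (-(√(deriv (deriv F) 1) * (k₂ - x)))) := by
  obtain ⟨η₀, C, K, h0, hC, hK, H⟩ := exists_mid_half hF
  refine ⟨η₀, C * Real.exp K, h0, by positivity, ?_⟩
  intro U V Q η k₁ k₂ S hη hD x hx1 hx2
  have e1 : Real.exp (K * (η * (k₂ - k₁))) ≤ Real.exp K :=
    Real.exp_le_exp.2 (mul_le_of_le_one_right hK.le hD)
  generalize √(deriv (deriv F) 1) = μ at *
  have p1 := Real.exp_pos (-(μ * (x - k₁)))
  have p2 := Real.exp_pos (-(μ * (k₂ - x)))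
  have e2 := mul_le_mul_of_nonneg_left e1 hC.le
  rcases le_total 0 (V x) with hV | hV
  · have h := H U V Q η k₁ k₂ S hη x hx1 hx2 hV
    have := mul_le_mul_of_nonneg_right e2 p1.le
    have : 0 ≤ C * Real.exp K * Real.exp (-(μ * (k₂ - x))) := by positivity
    linarith
  · have h := H _ _ _ _ _ _ S.reflect hη (-x) (by linarith) (by linarith) (by simpa using hV)
    rw [neg_neg, show -k₁ - -k₂ = k₂ - k₁ by ring, show -x - -k₂ = k₂ - x by ring] at h
    have := mul_le_mul_of_nonneg_right e2 p2.le
    have : 0 ≤ C * Real.exp K * Real.exp (-(μ * (x - k₁))) := by positivity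
    linarith

/-- The exact exponential lower bound inside the pulse. -/
lemma exists_mid_lower (hF : BalancedDoubleWell F) : ∃ η₀ c', 0 < η₀ ∧ 0 < c' ∧
    ∀ U V Q η k₁ k₂, Slice F U V Q η k₁ k₂ → η ≤ η₀ → η * (k₂ - k₁) ≤ 1 →
      ∀ x, k₁ ≤ x → x ≤ k₂ → c' * Real.exp (-(√(deriv (deriv F) 1) * (x - k₁))) ≤ 1 - U x := by
  obtain ⟨η₀, M, h0, hM, H⟩ := exists_mid_upper hF
  obtain ⟨C, c₀, hC, hc₀, hN⟩ := hF.exists_near_one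
  have hμ : 0 < √(deriv (deriv F) 1) := Real.sqrt_pos.2 hF.2.2.2.2.1
  generalize √(deriv (deriv F) 1) = μ at *
  refine ⟨η₀, Real.exp (-(2 * (C * M / μ))), h0, Real.exp_pos _, ?_⟩
  intro U V Q η k₁ k₂ S hη hD x hx1 hx2
  have hw : ∀ t, 0 < 1 - U t := fun t => by linarith [(S.mem t).2]
  have d1 : ∀ t, HasDerivAt (fun t => Real.exp (-(μ * (k₂ - t)))) (Real.exp (-(μ * (k₂ - t))) * μ) t :=
    fun t => ((((hasDerivAt_id t).const_sub k₂).const_mul μ).neg.exp).congr_deriv (by simp)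
  have d2 : ∀ t, HasDerivAt (fun t => Real.exp (-(μ * (t - k₁)))) (Real.exp (-(μ * (t - k₁))) * -μ) t :=
    fun t => ((((hasDerivAt_id t).sub_const k₁).const_mul μ).neg.exp).congr_deriv (by simp)
  have key := le_of_hasDerivAt_nonpos (f := fun t => -Real.log (1 - U t) - μ * (t - k₁) -
      C * M / μ * (Real.exp (-(μ * (k₂ - t))) - Real.exp (-(μ * (t - k₁))))) hx1
    (fun t _ => ((((S.dU t).const_sub 1).log (hw t).ne').neg.sub
      (((hasDerivAt_id t).sub_const k₁).const_mul μ)).sub (((d1 t).sub (d2 t)).const_mul (C * M / μ)))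
    (fun t ht => by
      obtain ⟨n1, -⟩ := hN (U t) (S.nonneg_mid ht.1 (ht.2.trans hx2)) (S.mem t).2
      have hb := H _ _ _ _ _ _ S hη hD t ht.1 (ht.2.trans hx2)
      have hv := (le_abs_self _).trans (S.abs_V_le t)
      have e : C * M / μ * (Real.exp (-(μ * (k₂ - t))) * μ - Real.exp (-(μ * (t - k₁))) * -μ) =
          C * (M * (Real.exp (-(μ * (t - k₁))) + Real.exp (-(μ * (k₂ - t))))) := by
        field_simp; ring
      have b1 := mul_le_mul_of_nonneg_left hb hC.le
      have b2 : V t / (1 - U t) ≤ μ + C * (1 - U t) := by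
        rw [div_le_iff₀ (hw t)]
        linarith [le_of_abs_le n1]
      rw [e, neg_div, neg_neg]
      linarith)
  simp only [S.left, sub_self, sub_zero, Real.log_one, mul_zero, neg_zero, Real.exp_zero] at key
  have p : 0 < C * M / μ := by positivity
  have b1 : C * M / μ * Real.exp (-(μ * (k₂ - x))) ≤ C * M / μ * 1 :=
    mul_le_mul_of_nonneg_left (Real.exp_le_one_iff.2 (by
      have := mul_nonneg hμ.le (sub_nonneg.2 hx2); linarith)) p.le
  have b2 : 0 < C * M / μ * Real.exp (-(μ * (x - k₁))) := by positivity
  have b3 : 0 < C * M / μ * Real.exp (-(μ * (k₂ - k₁))) := by positivity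
  rw [← Real.exp_add, ← Real.le_log_iff_exp_le (hw x)]
  linarith

end Slice

/-- The amplitude of the exponentially decaying mode of `1 - U`. -/
noncomputable def amp (μ : ℝ) (U V : ℝ → ℝ) (k x : ℝ) : ℝ :=
  (1 - U x + V x / μ) / 2 * Real.exp (μ * (x - k))

namespace Slice

variable {F U V Q : ℝ → ℝ} {η k₁ k₂ : ℝ}

lemma exists_amp (hF : BalancedDoubleWell F) : ∃ η₀ C, 0 < η₀ ∧ 0 < C ∧
    ∀ U V Q η k₁ k₂, Slice F U V Q η k₁ k₂ → η ≤ η₀ → η * (k₂ - k₁) ≤ 1 →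
      ∀ z x, k₁ ≤ z → z ≤ x → x ≤ (k₁ + k₂) / 2 →
        |amp √(deriv (deriv F) 1) U V k₁ x - amp √(deriv (deriv F) 1) U V k₁ z| ≤
          C * (Real.exp (-(√(deriv (deriv F) 1) * (z - k₁))) + η * (k₂ - k₁)) := by
  obtain ⟨η₀, M, h0, hM, H⟩ := exists_mid_upper hF
  obtain ⟨C, c₀, hC, hc₀, hN⟩ := hF.exists_near_one
  have hμ : 0 < √(deriv (deriv F) 1) := Real.sqrt_pos.2 hF.2.2.2.2.1
  generalize √(deriv (deriv F) 1) = μ at *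
  obtain ⟨L, hL⟩ : ∃ L, L = 1 / (2 * μ) * (C * (2 * M) ^ 2 + C * (2 * M)) := ⟨_, rfl⟩
  have hLp : 0 < L := by rw [hL]; positivity
  refine ⟨η₀, L / μ + L, h0, by positivity, ?_⟩
  intro U V Q η k₁ k₂ S hη hD z x hz hzx hx
  have hη0 := S.η_nonneg
  have hlt := S.lt
  have d0 : ∀ t, HasDerivAt (fun t => Real.exp (μ * (t - k₁))) (Real.exp (μ * (t - k₁)) * μ) t :=
    fun t => ((((hasDerivAt_id t).sub_const k₁).const_mul μ).exp).congr_deriv (by simp)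
  have d2 : ∀ t, HasDerivAt (fun t => Real.exp (-(μ * (t - k₁)))) (Real.exp (-(μ * (t - k₁))) * -μ) t :=
    fun t => ((((hasDerivAt_id t).sub_const k₁).const_mul μ).neg.exp).congr_deriv (by simp)
  have dA : ∀ t, HasDerivAt (fun t => amp μ U V k₁ t)
      (1 / (2 * μ) * (deriv F (U t) + μ ^ 2 * (1 - U t) - Q t) * Real.exp (μ * (t - k₁))) t := by
    intro t
    refine ((((((S.dU t).const_sub 1).add ((S.dV t).div_const μ)).div_const 2).mul (d0 t)).congr_deriv ?_)
    simp only [Pi.add_apply]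
    field_simp
    ring
  have bA : ∀ t ∈ Icc z x, |1 / (2 * μ) * (deriv F (U t) + μ ^ 2 * (1 - U t) - Q t) *
      Real.exp (μ * (t - k₁))| ≤ L * (Real.exp (-(μ * (t - k₁))) + η) := by
    intro t ht
    have t1 : k₁ ≤ t := hz.trans ht.1
    have t2 : t ≤ (k₁ + k₂) / 2 := ht.2.trans hx
    obtain ⟨n1, n2, n3, n4, -⟩ := hN (U t) (S.nonneg_mid t1 (by linarith)) (S.mem t).2
    have hw : 0 < 1 - U t := by linarith [(S.mem t).2]
    have hb := H _ _ _ _ _ _ S hη hD t t1 (by linarith)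
    have he : Real.exp (-(μ * (k₂ - t))) ≤ Real.exp (-(μ * (t - k₁))) :=
      Real.exp_le_exp.2 (neg_le_neg (mul_le_mul_of_nonneg_left (by linarith) hμ.le))
    have hE : Real.exp (-(μ * (t - k₁))) * Real.exp (μ * (t - k₁)) = 1 := by
      rw [← Real.exp_add]; simp
    generalize Real.exp (-(μ * (t - k₁))) = E at *
    have hP := Real.exp_pos (μ * (t - k₁))
    generalize Real.exp (μ * (t - k₁)) = P at *
    have hb' : 1 - U t ≤ 2 * M * E := by
      have := mul_le_mul_of_nonneg_left he hM.le
      linarith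
    have hE0 : 0 < E := pos_of_mul_pos_left (by rw [hE]; norm_num) hP.le
    have hq := (S.Q_le t).trans (mul_le_mul_of_nonneg_left n4 hη0)
    have b1 : |deriv F (U t) + μ ^ 2 * (1 - U t) - Q t| ≤
        C * (2 * M * E) ^ 2 + η * (C * (2 * M * E)) := by
      refine (abs_sub _ _).trans (add_le_add (n2.trans ?_) (hq.trans ?_)) <;> gcongr
    rw [abs_mul, abs_mul, abs_of_pos hP, abs_of_pos (by positivity : 0 < 1 / (2 * μ))]
    calc _ ≤ 1 / (2 * μ) * (C * (2 * M * E) ^ 2 + η * (C * (2 * M * E))) * P := by gcongr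
      _ = 1 / (2 * μ) * (C * (2 * M) ^ 2 * E + η * (C * (2 * M))) * (E * P) := by ring
      _ = 1 / (2 * μ) * (C * (2 * M) ^ 2 * E + η * (C * (2 * M))) := by rw [hE, mul_one]
      _ ≤ 1 / (2 * μ) * ((C * (2 * M) ^ 2 + C * (2 * M)) * (E + η)) := by
        have : 0 ≤ C * (2 * M) * E := by positivity
        have : 0 ≤ C * (2 * M) ^ 2 * η := by positivity
        gcongr
        linarith
      _ = _ := by rw [hL]; ring
  have dR : ∀ t, HasDerivAt (fun t => L * (-(Real.exp (-(μ * (t - k₁))) / μ) + η * t))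
      (L * (Real.exp (-(μ * (t - k₁))) + η)) t := fun t =>
    ((((d2 t).div_const μ).neg.add ((hasDerivAt_id t).const_mul η)).const_mul L).congr_deriv (by
      field_simp)
  have u1 := le_of_hasDerivAt_nonpos hzx (fun t _ => (dA t).sub (dR t))
    (fun t ht => by linarith [le_of_abs_le (bA t ht)])
  have u2 := le_of_hasDerivAt_nonpos hzx (fun t _ => (dA t).neg.sub (dR t))
    (fun t ht => by linarith [neg_le_of_abs_le (bA t ht)])
  simp only [Pi.sub_apply, Pi.neg_apply] at u1 u2
  have p1 : 0 < L * (Real.exp (-(μ * (x - k₁))) / μ) := by positivity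
  have p2 : 0 < L * Real.exp (-(μ * (z - k₁))) := by positivity
  have p3 : η * (x - z) ≤ η * (k₂ - k₁) := mul_le_mul_of_nonneg_left (by linarith) hη0
  have p4 := mul_le_mul_of_nonneg_left p3 hLp.le
  have p5 : 0 ≤ L / μ * (η * (k₂ - k₁)) := by
    have := sub_pos.2 hlt
    positivity
  have e1 : L * (Real.exp (-(μ * (z - k₁))) / μ) = L / μ * Real.exp (-(μ * (z - k₁))) := by ring
  rw [abs_le]
  constructor <;> linarith

end Slice

end pulse

/-! ### The limiting profile of the walls -/

section profile

lemma BalancedDoubleWell.exists_wa_lipschitz {F : ℝ → ℝ} (hF : BalancedDoubleWell F) :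
    ∃ K, 0 < K ∧ ∀ s ∈ Ioo (-1 : ℝ) 1, ∀ t ∈ Ioo (-1 : ℝ) 1, |wa F t - wa F s| ≤ K * |t - s| := by
  obtain ⟨κ, C, hκ, hC, h⟩ := hF.exists_wa_bounds
  refine ⟨C, hC, fun s hs t ht => ?_⟩
  refine (convex_Ioo (-1 : ℝ) 1).norm_image_sub_le_of_norm_hasDerivWithin_le
    (f' := fun r => deriv F r / wa F r) (fun r hr => (hF.hasDerivAt_wa hr).hasDerivWithinAt)
    (fun r hr => ?_) hs ht
  have ha := hF.wa_pos hr
  rw [Real.norm_eq_abs, abs_div, abs_of_pos ha, div_le_iff₀ ha]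
  exact (h r (Ioo_subset_Icc_self hr)).2.2

/-- Grönwall's inequality starting from zero, on both sides. -/
lemma abs_le_of_abs_deriv_le {f f' : ℝ → ℝ} {K δ R : ℝ} (hK : 0 < K) (hδ : 0 ≤ δ)
    (hd : ∀ s, HasDerivAt f (f' s) s) (h0 : f 0 = 0)
    (hb : ∀ s, |s| ≤ R → |f' s| ≤ K * |f s| + δ) :
    ∀ s, |s| ≤ R → |f s| ≤ δ / K * Real.exp (K * R) := by
  have main : ∀ g g' : ℝ → ℝ, (∀ s, HasDerivAt g (g' s) s) → g 0 = 0 →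
      (∀ s, |s| ≤ R → |g' s| ≤ K * |g s| + δ) → ∀ s, 0 ≤ s → s ≤ R →
        |g s| ≤ δ / K * Real.exp (K * R) := by
    intro g g' hg hg0 hgb s hs hsR
    have := norm_le_gronwallBound_of_norm_deriv_right_le (f := g) (f' := g') (a := 0) (b := R)
      (δ := 0) (K := K) (ε := δ) (fun x _ => (hg x).continuousAt.continuousWithinAt)
      (fun x _ => (hg x).hasDerivWithinAt) (by simp [hg0])
      (fun x hx => hgb x (by rw [abs_of_nonneg hx.1]; exact hx.2.le)) s ⟨hs, hsR⟩
    rw [gronwallBound_of_K_ne_0 hK.ne', Real.norm_eq_abs] at this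
    refine this.trans ?_
    have e1 : Real.exp (K * (s - 0)) ≤ Real.exp (K * R) := Real.exp_le_exp.2 (by
      rw [sub_zero]; gcongr)
    have : δ / K * (Real.exp (K * (s - 0)) - 1) ≤ δ / K * Real.exp (K * R) :=
      mul_le_mul_of_nonneg_left (by linarith) (by positivity)
    linarith
  intro s hs
  rcases le_total 0 s with h | h
  · exact main f f' hd h0 hb s h (by rwa [abs_of_nonneg h] at hs)
  · have := main (fun s => f (-s)) (fun s => -f' (-s)) (fun s => by
      have := HasDerivAt.comp (h₂ := f) s (hd (-s)) (hasDerivAt_neg s)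
      exact this.congr_deriv (by ring)) (by simpa using h0)
      (fun s hs => by rw [abs_neg]; exact hb (-s) (by rwa [abs_neg])) (-s) (by linarith)
      (by rwa [abs_of_nonpos h] at hs)
    simpa using this

namespace Slice

variable {F : ℝ → ℝ}

lemma exists_slope (hF : BalancedDoubleWell F) (R : ℝ) : ∃ η₀ C, 0 < η₀ ∧ 0 < C ∧
    ∀ U V Q η k₁ k₂, Slice F U V Q η k₁ k₂ → η ≤ η₀ → ∀ x, |x - k₁| ≤ R →
      |V x - wa F (U x)| ≤ C * η := by
  obtain ⟨η₁, h1, H⟩ := exists_sign hF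
  obtain ⟨κ, C, hκ, hC, hb⟩ := hF.exists_wa_bounds
  have ha0 : 0 < wa F 0 := hF.wa_pos ⟨by norm_num, by norm_num⟩
  obtain ⟨δ, hδ⟩ : ∃ δ, δ = wa F 0 * Real.exp (-(C * R)) := ⟨_, rfl⟩
  have hδp : 0 < δ := by rw [hδ]; positivity
  refine ⟨min η₁ (δ ^ 2 / 4), 2 / δ, by positivity, by positivity, ?_⟩
  intro U V Q η k₁ k₂ S hη x hx
  have hη1 := hη.trans (min_le_left _ _)
  have hη2 := hη.trans (min_le_right _ _)
  have hlow : ∀ z, |z - k₁| ≤ R → δ ≤ wa F (U z) := by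
    intro z hz
    have hL := Wave.abs_le_of_lipschitz (C := C) (fun t => (S.dA t).log (S.a_pos t).ne') (fun t => by
      have ha := S.a_pos t
      have hv := S.abs_V_le t
      have h2 := (hb (U t) (S.mem' t)).2.2
      rw [abs_div, abs_mul, abs_div, abs_of_pos ha, div_le_iff₀ ha, div_mul_eq_mul_div,
        div_le_iff₀ ha]
      exact mul_le_mul h2 hv (abs_nonneg _) (by positivity)) k₁ z
    rw [S.left] at hL
    have h3 := neg_le_of_abs_le hL
    have h4 : C * |z - k₁| ≤ C * R := by gcongr
    have h5 : Real.log (wa F 0) + -(C * R) ≤ Real.log (wa F (U z)) := by linarith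
    have h6 := Real.exp_le_exp.2 h5
    rwa [Real.exp_add, Real.exp_log ha0, Real.exp_log (S.a_pos z), ← hδ] at h6
  have hne : ∀ z, |z - k₁| ≤ R → V z ≠ 0 := by
    intro z hz hV
    have h2 := S.defect_le z
    rw [hV] at h2
    have h3 := S.a_sq z
    have h4 : δ ^ 2 ≤ wa F (U z) ^ 2 := pow_le_pow_left₀ hδp.le (hlow z hz) 2
    have : 0 < δ ^ 2 := by positivity
    linarith
  have hk : 0 < V k₁ := by
    have := (H _ _ _ _ _ _ S.reflect hη1).1 (-k₁) le_rfl
    simpa using this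
  have hpos : 0 < V x := by
    by_contra hc
    push Not at hc
    obtain ⟨z, hz, hz0⟩ := intermediate_value_uIcc (f := V) (a := k₁) (b := x)
      S.continuous_V.continuousOn (show (0 : ℝ) ∈ uIcc (V k₁) (V x) from by
        rw [uIcc_of_ge (by linarith)]; exact ⟨hc, hk.le⟩)
    exact hne z ((Set.abs_sub_left_of_mem_uIcc hz).trans hx) hz0
  have hle := le_of_abs_le (S.abs_V_le x)
  have hd := hlow x hx
  have hsq := S.a_sq x
  have hdef := S.defect_le x
  rw [abs_sub_comm, abs_of_nonneg (by linarith), div_mul_eq_mul_div, le_div_iff₀ hδp]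
  have : (wa F (U x) - V x) * δ ≤ (wa F (U x) - V x) * (wa F (U x) + V x) :=
    mul_le_mul_of_nonneg_left (by linarith) (by linarith)
  nlinarith

lemma exists_compare (hF : BalancedDoubleWell F) (R : ℝ) : ∃ η₀ C, 0 < η₀ ∧ 0 < C ∧
    ∀ U V Q η k₁ k₂ U' V' Q' η' k₁' k₂', Slice F U V Q η k₁ k₂ → Slice F U' V' Q' η' k₁' k₂' →
      η ≤ η₀ → η' ≤ η₀ → ∀ s, |s| ≤ R → |U (k₁ + s) - U' (k₁' + s)| ≤ C * (η + η') := by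
  obtain ⟨η₀, C, h0, hC, H⟩ := exists_slope hF R
  obtain ⟨K, hK, hL⟩ := hF.exists_wa_lipschitz
  refine ⟨η₀, C / K * Real.exp (K * R), h0, by positivity, ?_⟩
  intro U V Q η k₁ k₂ U' V' Q' η' k₁' k₂' S S' hη hη' s hs
  have e := S.η_nonneg
  have e' := S'.η_nonneg
  have := abs_le_of_abs_deriv_le (f := fun s => U (k₁ + s) - U' (k₁' + s)) (K := K)
    (δ := C * (η + η')) (R := R) hK (by positivity)
    (fun s => ((S.dU (k₁ + s)).comp_const_add k₁ s).sub ((S'.dU (k₁' + s)).comp_const_add k₁' s))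
    (by simp [S.left, S'.left]) (fun s hs => by
      have a1 := H _ _ _ _ _ _ S hη (k₁ + s) (by simpa using hs)
      have a2 := H _ _ _ _ _ _ S' hη' (k₁' + s) (by simpa using hs)
      have a3 := hL _ (S'.mem (k₁' + s)) _ (S.mem (k₁ + s))
      rw [abs_le] at a1 a2 a3 ⊢
      constructor <;> linarith [a1.1, a1.2, a2.1, a2.2, a3.1, a3.2]) s hs
  refine this.trans (le_of_eq ?_)
  ring

end Slice

/-- A family of pulses becoming conservative, with separating walls. -/
structure Pulses (F : ℝ → ℝ) (U V Q : ℝ → ℝ → ℝ) (η k₁ k₂ : ℝ → ℝ) : Prop where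
  well : BalancedDoubleWell F
  slice : ∀ᶠ y in atTop, Slice F (U y) (V y) (Q y) (η y) (k₁ y) (k₂ y)
  eps : Tendsto η atTop (𝓝 0)
  eps_gap : Tendsto (fun y => η y * (k₂ y - k₁ y)) atTop (𝓝 0)
  gap : Tendsto (fun y => k₂ y - k₁ y) atTop atTop

lemma Branch.exists_pulses {F : ℝ → ℝ} {c : ℝ} {u : ℝ → ℝ → ℝ} {k₁ k₂ ε : ℝ → ℝ}
    (B : Branch F c u k₁ k₂ ε) : ∃ K, 0 < K ∧ Pulses F (fun y x => u x y) (fun y x => pdx u x y)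
      (fun y x => pdy (pdy u) x y + c * pdy u x y) (fun y => K * ε y) k₁ k₂ := by
  have W := B.wave
  obtain ⟨C, Y, hC, H⟩ := W.exists_defect_le
  have hc := W.hc
  refine ⟨1 + c + C, by positivity, W.hF, ?_, ?_, ?_, ?_⟩
  · filter_upwards [B.level, B.flat, eventually_ge_atTop Y] with y hl hf hy
    have hε := W.flatAt_nonneg hf
    exact
    { well := W.hF
      dU := fun x => W.sm.hasDerivAt_x x y
      dV := fun x => (W.smx.hasDerivAt_x x y).congr_deriv (by have := W.pde x y; linarith)
      Q_le := fun x => (W.flatAt_rhs hf x).trans (mul_le_mul_of_nonneg_right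
        (mul_le_mul_of_nonneg_right (by linarith) hε.le) (W.a_pos x y).le)
      mem := fun x => W.mem x y
      defect_nonneg := fun x => W.defect_nonneg x y
      defect_le := fun x => (H y (ε y) hy hf x).trans
        (mul_le_mul_of_nonneg_right (by linarith) hε.le)
      lt := hl.lt
      left := hl.left
      right := hl.right
      mid := hl.mid
      out_left := hl.out_left
      out_right := hl.out_right
      top := W.tendsto_neg_one_atTop y
      bot := W.tendsto_neg_one_atBot y }
  · have := B.eps.const_mul (1 + c + C)
    rwa [mul_zero] at this
  · have := B.eps_gap.const_mul (1 + c + C)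
    rw [mul_zero] at this
    exact this.congr fun y => by ring
  · obtain ⟨Y', hY'⟩ := eventually_atTop.1 B.level
    have t1 := W.tendsto_level hY'
    have t2 := W.reflect.tendsto_level (fun y hy => (hY' y hy).reflect)
    exact (t1.atTop_add_atTop t2).congr fun y => by ring

namespace Pulses

variable {F : ℝ → ℝ} {U V Q : ℝ → ℝ → ℝ} {η k₁ k₂ : ℝ → ℝ}

lemma reflect (P : Pulses F U V Q η k₁ k₂) : Pulses F (fun y x => U y (-x))
    (fun y x => -V y (-x)) (fun y x => Q y (-x)) η (fun y => -k₂ y) (fun y => -k₁ y) where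
  well := P.well
  slice := P.slice.mono fun _ h => h.reflect
  eps := P.eps
  eps_gap := P.eps_gap.congr fun y => by ring
  gap := P.gap.congr fun y => by ring

lemma eventually_small (P : Pulses F U V Q η k₁ k₂) {η₀ : ℝ} (h : 0 < η₀) :
    ∀ᶠ y in atTop, Slice F (U y) (V y) (Q y) (η y) (k₁ y) (k₂ y) ∧ η y ≤ η₀ ∧
      η y * (k₂ y - k₁ y) ≤ 1 := by
  filter_upwards [P.slice, P.eps.eventually (ge_mem_nhds h),
    P.eps_gap.eventually (ge_mem_nhds one_pos)] with y h1 h2 h3 using ⟨h1, h2, h3⟩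

lemma exists_profile (P : Pulses F U V Q η k₁ k₂) : ∃ ψ : ℝ → ℝ, ∀ s,
    Tendsto (fun y => U y (k₁ y + s)) atTop (𝓝 (ψ s)) ∧
    Tendsto (fun y => U y (k₂ y - s)) atTop (𝓝 (ψ s)) := by
  have key : ∀ s, ∃ l, Tendsto (fun y => U y (k₁ y + s)) atTop (𝓝 l) ∧
      Tendsto (fun y => U y (k₂ y - s)) atTop (𝓝 l) := by
    intro s
    obtain ⟨η₀, C, h0, hC, H⟩ := Slice.exists_compare P.well |s|
    have hc : CauchySeq (fun y => U y (k₁ y + s)) := by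
      rw [Metric.cauchySeq_iff]
      intro δ hδ
      have hδ' : 0 < min η₀ (δ / (4 * C)) := by positivity
      obtain ⟨Y, hY⟩ := eventually_atTop.1 (P.eventually_small hδ')
      refine ⟨Y, fun y hy z hz => ?_⟩
      obtain ⟨S, hS, -⟩ := hY y hy
      obtain ⟨S', hS', -⟩ := hY z hz
      have b := H _ _ _ _ _ _ _ _ _ _ _ _ S S' (hS.trans (min_le_left _ _))
        (hS'.trans (min_le_left _ _)) s le_rfl
      have b1 := hS.trans (min_le_right _ _)
      have b2 := hS'.trans (min_le_right _ _)
      rw [le_div_iff₀ (by positivity)] at b1 b2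
      rw [Real.dist_eq]
      linarith
    obtain ⟨l, hl⟩ := cauchySeq_tendsto_of_complete hc
    refine ⟨l, hl, ?_⟩
    have hd : Tendsto (fun y => U y (k₁ y + s) - U y (k₂ y - s)) atTop (𝓝 0) := by
      have b0 : Tendsto (fun y => C * (η y + η y)) atTop (𝓝 0) := by
        have := (P.eps.add P.eps).const_mul C
        rwa [add_zero, mul_zero] at this
      refine squeeze_zero_norm' ?_ b0
      filter_upwards [P.eventually_small h0] with y hy
      have b := H _ _ _ _ _ _ _ _ _ _ _ _ hy.1 hy.1.reflect hy.2.1 hy.2.1 s le_rfl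
      rwa [show -(-k₂ y + s) = k₂ y - s by ring] at b
    have := hl.sub hd
    rw [sub_zero] at this
    exact this.congr fun y => by ring
  choose ψ hψ using key
  exact ⟨ψ, hψ⟩

lemma tendsto_slope (P : Pulses F U V Q η k₁ k₂) {s l : ℝ}
    (h : Tendsto (fun y => U y (k₁ y + s)) atTop (𝓝 l)) :
    Tendsto (fun y => V y (k₁ y + s)) atTop (𝓝 (wa F l)) := by
  obtain ⟨η₀, C, h0, hC, H⟩ := Slice.exists_slope P.well |s|
  have hd : Tendsto (fun y => V y (k₁ y + s) - wa F (U y (k₁ y + s))) atTop (𝓝 0) := by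
    have b0 := P.eps.const_mul C
    rw [mul_zero] at b0
    refine squeeze_zero_norm' ?_ b0
    filter_upwards [P.eventually_small h0] with y hy
    exact H _ _ _ _ _ _ hy.1 hy.2.1 _ (by simp)
  have := hd.add ((P.well.continuous_wa.tendsto l).comp h)
  rw [zero_add] at this
  exact this.congr fun y => by simp

/-- A function which is eventually within any positive distance of a constant converges; two such
functions with the same constants have the same limit. -/
lemma exists_tendsto_of_eventually {f g : ℝ → ℝ} (h : ∀ δ, 0 < δ → ∃ L, ∀ᶠ y in atTop,
    |f y - L| ≤ δ ∧ |g y - L| ≤ δ) : ∃ l, Tendsto f atTop (𝓝 l) ∧ Tendsto g atTop (𝓝 l) := by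
  have hc : CauchySeq f := by
    rw [Metric.cauchySeq_iff]
    intro δ hδ
    obtain ⟨L, hL⟩ := h (δ / 3) (by positivity)
    obtain ⟨Y, hY⟩ := eventually_atTop.1 hL
    refine ⟨Y, fun y hy z hz => ?_⟩
    have a1 := abs_le.1 (hY y hy).1
    have a2 := abs_le.1 (hY z hz).1
    rw [Real.dist_eq, abs_lt]
    constructor <;> linarith [a1.1, a1.2, a2.1, a2.2]
  obtain ⟨l, hl⟩ := cauchySeq_tendsto_of_complete hc
  refine ⟨l, hl, ?_⟩
  have hd : Tendsto (fun y => f y - g y) atTop (𝓝 0) := by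
    rw [Metric.tendsto_nhds]
    intro δ hδ
    obtain ⟨L, hL⟩ := h (δ / 3) (by positivity)
    filter_upwards [hL] with y hy
    have a1 := abs_le.1 hy.1
    have a2 := abs_le.1 hy.2
    rw [Real.dist_eq, abs_lt]
    constructor <;> linarith [a1.1, a1.2, a2.1, a2.2]
  have := hl.sub hd
  rw [sub_zero] at this
  exact this.congr fun y => by ring

lemma tendsto_amp (P : Pulses F U V Q η k₁ k₂) (μ : ℝ) {s l : ℝ}
    (h : Tendsto (fun y => U y (k₁ y + s)) atTop (𝓝 l)) :
    Tendsto (fun y => amp μ (U y) (V y) (k₁ y) (k₁ y + s)) atTop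
      (𝓝 ((1 - l + wa F l / μ) / 2 * Real.exp (μ * s))) := by
  have := (((h.const_sub 1).add ((P.tendsto_slope h).div_const μ)).div_const 2).mul_const
    (Real.exp (μ * s))
  exact this.congr fun y => by simp [amp]

lemma eventually_amp (P : Pulses F U V Q η k₁ k₂) : ∃ C, 0 < C ∧ ∀ s, 0 ≤ s → ∀ δ, 0 < δ →
    ∀ᶠ y in atTop, |amp √(deriv (deriv F) 1) (U y) (V y) (k₁ y) ((k₁ y + k₂ y) / 2) -
      amp √(deriv (deriv F) 1) (U y) (V y) (k₁ y) (k₁ y + s)| ≤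
        C * Real.exp (-(√(deriv (deriv F) 1) * s)) + δ := by
  obtain ⟨η₀, C, h0, hC, H⟩ := Slice.exists_amp P.well
  refine ⟨C, hC, fun s hs δ hδ => ?_⟩
  filter_upwards [P.eventually_small h0, P.gap.eventually_ge_atTop (2 * s),
    P.eps_gap.eventually (ge_mem_nhds (show 0 < δ / C by positivity))] with y hy hg he
  have := H _ _ _ _ _ _ hy.1 hy.2.1 hy.2.2 (k₁ y + s) ((k₁ y + k₂ y) / 2) (by linarith) (by linarith)
    le_rfl
  rw [le_div_iff₀ hC] at he
  rw [add_sub_cancel_left] at this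
  linarith

/-- At the midpoint the pulse deviates from `1` by `2 a₀ exp (-μ D / 2)`, `D` being the gap. -/
lemma exists_mid_limit (P : Pulses F U V Q η k₁ k₂) : ∃ a₀, 0 < a₀ ∧
    Tendsto (fun y => (1 - U y ((k₁ y + k₂ y) / 2)) *
      Real.exp (√(deriv (deriv F) 1) * ((k₂ y - k₁ y) / 2))) atTop (𝓝 (2 * a₀)) ∧
    Tendsto (fun y => V y ((k₁ y + k₂ y) / 2) *
      Real.exp (√(deriv (deriv F) 1) * ((k₂ y - k₁ y) / 2))) atTop (𝓝 0) := by
  obtain ⟨ψ, hψ⟩ := P.exists_profile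
  obtain ⟨C, hC, H⟩ := P.eventually_amp
  obtain ⟨C', hC', H'⟩ := P.reflect.eventually_amp
  obtain ⟨η₀, c', h0, hc', hlow⟩ := Slice.exists_mid_lower P.well
  have hμ : 0 < √(deriv (deriv F) 1) := Real.sqrt_pos.2 P.well.2.2.2.2.1
  generalize √(deriv (deriv F) 1) = μ at *
  obtain ⟨l, h1, h2⟩ := exists_tendsto_of_eventually
    (f := fun y => amp μ (U y) (V y) (k₁ y) ((k₁ y + k₂ y) / 2))
    (g := fun y => amp μ (fun x => U y (-x)) (fun x => -V y (-x)) (-k₂ y) ((-k₂ y + -k₁ y) / 2))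
    (fun δ hδ => by
      have hlim : Tendsto (fun s => (C + C') * Real.exp (-(μ * s))) atTop (𝓝 0) := by
        have := (Real.tendsto_exp_neg_atTop_nhds_zero.comp
          (tendsto_id.const_mul_atTop hμ)).const_mul (C + C')
        rw [mul_zero] at this
        exact this
      obtain ⟨s, hs, hs0⟩ := ((hlim.eventually (ge_mem_nhds (show 0 < δ / 3 by positivity))).and
        (eventually_ge_atTop (0 : ℝ))).exists
      have hp := Real.exp_pos (-(μ * s))
      have p1 := mul_pos hC hp
      have p2 := mul_pos hC' hp
      refine ⟨(1 - ψ s + wa F (ψ s) / μ) / 2 * Real.exp (μ * s), ?_⟩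
      have t1 := P.tendsto_amp μ (hψ s).1
      have t2 := P.reflect.tendsto_amp μ (s := s) (l := ψ s) ((hψ s).2.congr fun y => by
        rw [show -(-k₂ y + s) = k₂ y - s by ring])
      filter_upwards [H s hs0 (δ / 3) (by positivity), H' s hs0 (δ / 3) (by positivity),
        Metric.tendsto_nhds.1 t1 (δ / 3) (by positivity),
        Metric.tendsto_nhds.1 t2 (δ / 3) (by positivity)] with y a1 a2 a3 a4
      rw [Real.dist_eq, abs_lt] at a3 a4
      rw [abs_le] at a1 a2
      rw [abs_le, abs_le]
      refine ⟨⟨?_, ?_⟩, ?_, ?_⟩ <;> linarith [a1.1, a1.2, a2.1, a2.2, a3.1, a3.2, a4.1, a4.2])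
  have e1 : ∀ y, amp μ (U y) (V y) (k₁ y) ((k₁ y + k₂ y) / 2) =
      (1 - U y ((k₁ y + k₂ y) / 2) + V y ((k₁ y + k₂ y) / 2) / μ) / 2 *
        Real.exp (μ * ((k₂ y - k₁ y) / 2)) := fun y => by
    rw [amp, show (k₁ y + k₂ y) / 2 - k₁ y = (k₂ y - k₁ y) / 2 by ring]
  have e2 : ∀ y, amp μ (fun x => U y (-x)) (fun x => -V y (-x)) (-k₂ y) ((-k₂ y + -k₁ y) / 2) =
      (1 - U y ((k₁ y + k₂ y) / 2) - V y ((k₁ y + k₂ y) / 2) / μ) / 2 *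
        Real.exp (μ * ((k₂ y - k₁ y) / 2)) := fun y => by
    rw [amp, show (-k₂ y + -k₁ y) / 2 - -k₂ y = (k₂ y - k₁ y) / 2 by ring,
      show -((-k₂ y + -k₁ y) / 2) = (k₁ y + k₂ y) / 2 by ring]
    ring
  have r1 : Tendsto (fun y => (1 - U y ((k₁ y + k₂ y) / 2)) *
      Real.exp (μ * ((k₂ y - k₁ y) / 2))) atTop (𝓝 (2 * l)) := by
    have := h1.add h2
    rw [← two_mul] at this
    exact this.congr fun y => by rw [e1, e2]; ring
  refine ⟨l, ?_, r1, ?_⟩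
  · have : c' ≤ 2 * l := ge_of_tendsto r1 (by
      filter_upwards [P.eventually_small h0] with y hy
      have hlt := hy.1.lt
      have := hlow _ _ _ _ _ _ hy.1 hy.2.1 hy.2.2 ((k₁ y + k₂ y) / 2) (by linarith) (by linarith)
      rw [show (k₁ y + k₂ y) / 2 - k₁ y = (k₂ y - k₁ y) / 2 by ring, Real.exp_neg,
        ← div_eq_mul_inv, div_le_iff₀ (Real.exp_pos _)] at this
      exact this)
    linarith
  · have := (h1.sub h2).const_mul μ
    rw [sub_self, mul_zero] at this
    exact this.congr fun y => by rw [e1, e2]; field_simp; ring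

end Pulses

end profile

/-! ### Position of the walls -/

section position

lemma integrable_exp_neg_mul_abs {κ : ℝ} (hκ : 0 < κ) :
    Integrable fun s : ℝ => Real.exp (-(κ * |s|)) := by
  rw [← integrableOn_univ, ← Iic_union_Ioi (a := (0 : ℝ))]
  refine IntegrableOn.union ?_ ?_
  · refine (integrableOn_exp_mul_Iic hκ 0).congr_fun (fun s hs => ?_) measurableSet_Iic
    have h : s ≤ 0 := hs
    simp only [abs_of_nonpos h, mul_neg, neg_neg]
  · refine (integrableOn_exp_mul_Ioi (neg_neg_of_pos hκ) 0).congr_fun (fun s hs => ?_) measurableSet_Ioi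
    have h : 0 < s := hs
    simp only [abs_of_pos h, neg_mul]

namespace Pulses

variable {F : ℝ → ℝ} {U V Q : ℝ → ℝ → ℝ} {η k₁ k₂ : ℝ → ℝ}

lemma exists_integral_limit (P : Pulses F U V Q η k₁ k₂)
    (hI : ∀ y, Integrable fun x => wPhi F (U y x)) :
    ∃ l, Tendsto (fun y => (∫ x in Ioi ((k₁ y + k₂ y) / 2), wPhi F (U y x)) -
      wPhi F 1 * ((k₂ y - k₁ y) / 2)) atTop (𝓝 l) := by
  obtain ⟨ψ, hψ⟩ := P.exists_profile
  obtain ⟨η₁, κ, C₁, h1, hκ, hC₁, H1⟩ := Slice.exists_exterior P.well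
  obtain ⟨η₂, M, h2, hM, H2⟩ := Slice.exists_mid_upper P.well
  obtain ⟨C, c₀, hC, hc₀, hN⟩ := P.well.exists_near_one
  have hμ : 0 < √(deriv (deriv F) 1) := Real.sqrt_pos.2 P.well.2.2.2.2.1
  generalize √(deriv (deriv F) 1) = μ at *
  have hF := P.well
  obtain ⟨h, hh⟩ : ∃ h : ℝ → ℝ → ℝ, h = fun y s =>
      (Ioi ((k₁ y + k₂ y) / 2)).indicator (fun x => wPhi F (U y x)) (k₂ y + s) -
        (Ioc ((k₁ y + k₂ y) / 2 - k₂ y) 0).indicator (fun _ => wPhi F 1) s := ⟨_, rfl⟩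
  have i1 : ∀ y, Integrable (fun s => (Ioi ((k₁ y + k₂ y) / 2)).indicator
      (fun x => wPhi F (U y x)) (k₂ y + s)) := fun y =>
    ((hI y).indicator measurableSet_Ioi).comp_add_left (k₂ y)
  have i2 : ∀ y, Integrable ((Ioc ((k₁ y + k₂ y) / 2 - k₂ y) 0).indicator (fun _ => wPhi F 1)) :=
    fun y => (integrable_indicator_iff measurableSet_Ioc).2 (integrableOn_const (by simp))
  have hInt : ∀ᶠ y in atTop, ∫ s, h y s = (∫ x in Ioi ((k₁ y + k₂ y) / 2), wPhi F (U y x)) -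
      wPhi F 1 * ((k₂ y - k₁ y) / 2) := by
    filter_upwards [P.slice] with y hy
    have hlt := hy.lt
    rw [hh]
    simp only
    rw [integral_sub (i1 y) (i2 y), integral_add_left_eq_self
      ((Ioi ((k₁ y + k₂ y) / 2)).indicator fun x => wPhi F (U y x)),
      integral_indicator measurableSet_Ioi, integral_indicator measurableSet_Ioc,
      setIntegral_const, Real.volume_real_Ioc_of_le (by linarith), smul_eq_mul]
    ring
  refine ⟨∫ s, (wPhi F (ψ (-s)) - (Iic 0).indicator (fun _ => wPhi F 1) s), ?_⟩
  refine Tendsto.congr' hInt ?_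
  refine tendsto_integral_filter_of_dominated_convergence
    (fun s => C₁ * Real.exp (-(κ * |s|)) + C * (2 * M) * Real.exp (-(μ * |s|))) ?_ ?_ ?_ ?_
  · refine Eventually.of_forall fun y => ?_
    rw [hh]
    exact ((i1 y).sub (i2 y)).aestronglyMeasurable
  · filter_upwards [P.eventually_small (lt_min h1 h2)] with y hy
    obtain ⟨S, hη, hD⟩ := hy
    refine Eventually.of_forall fun s => ?_
    have hlt := S.lt
    have p1 : 0 < C₁ * Real.exp (-(κ * |s|)) := by positivity
    have p2 : 0 < C * (2 * M) * Real.exp (-(μ * |s|)) := by positivity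
    rw [hh]
    simp only [Real.norm_eq_abs, indicator_apply, mem_Ioi, mem_Ioc]
    rcases lt_or_ge 0 s with hs | hs
    · rw [if_pos (by linarith), if_neg (by simp [hs]), sub_zero,
        abs_of_nonneg (hF.wPhi_nonneg (S.mem (k₂ y + s)).1.le)]
      have := H1 _ _ _ _ _ _ S (hη.trans (min_le_left _ _)) (k₂ y + s) (by linarith)
      rw [add_sub_cancel_left] at this
      rw [abs_of_pos hs] at *
      linarith
    · rcases lt_or_ge ((k₁ y + k₂ y) / 2 - k₂ y) s with hs' | hs'
      · rw [if_pos (by linarith), if_pos ⟨hs', hs⟩, abs_sub_comm,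
          abs_of_nonneg (sub_nonneg.2 (hF.wPhi_le_one (S.mem (k₂ y + s)).2.le))]
        have n5 := (hN (U y (k₂ y + s)) (S.nonneg_mid (by linarith) (by linarith))
          (S.mem _).2).2.2.2.2.1
        have b := H2 _ _ _ _ _ _ S (hη.trans (min_le_right _ _)) hD (k₂ y + s) (by linarith)
          (by linarith)
        have e1 : Real.exp (-(μ * (k₂ y + s - k₁ y))) ≤ Real.exp (-(μ * |s|)) :=
          Real.exp_le_exp.2 (neg_le_neg (mul_le_mul_of_nonneg_left (by
            rw [abs_of_nonpos hs]; linarith) hμ.le))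
        have e2 : k₂ y - (k₂ y + s) = |s| := by rw [abs_of_nonpos hs]; ring
        rw [e2] at b
        have b' : 1 - U y (k₂ y + s) ≤ 2 * M * Real.exp (-(μ * |s|)) := by
          have := mul_le_mul_of_nonneg_left e1 hM.le
          linarith
        have := mul_le_mul_of_nonneg_left b' hC.le
        linarith
      · rw [if_neg (by linarith), if_neg (by rintro ⟨h, -⟩; linarith), sub_zero, abs_zero]
        positivity
  · exact ((integrable_exp_neg_mul_abs hκ).const_mul _).add
      ((integrable_exp_neg_mul_abs hμ).const_mul _)
  · refine Eventually.of_forall fun s => ?_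
    have t := ((hF.continuous_wPhi.tendsto _).comp (hψ (-s)).2).sub_const
      ((Iic 0).indicator (fun _ => wPhi F 1) s)
    refine t.congr' ?_
    filter_upwards [P.gap.eventually_gt_atTop (-2 * s), P.slice] with y hy S
    have hlt := S.lt
    rw [hh]
    simp only [Function.comp, sub_neg_eq_add, indicator_apply, mem_Ioi, mem_Ioc, mem_Iic]
    rw [if_pos (show (k₁ y + k₂ y) / 2 < k₂ y + s by linarith)]
    congr 1
    have : (k₁ y + k₂ y) / 2 - k₂ y < s := by linarith
    simp [this]

end Pulses

namespace Branch

variable {F : ℝ → ℝ} {c : ℝ} {u : ℝ → ℝ → ℝ} {k₁ k₂ ε : ℝ → ℝ}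

lemma exists_integral_right (B : Branch F c u k₁ k₂ ε) : ∃ l, Tendsto (fun y =>
    (∫ x in Ioi ((k₁ y + k₂ y) / 2), wPhi F (u x y)) - wPhi F 1 * ((k₂ y - k₁ y) / 2))
      atTop (𝓝 l) := by
  obtain ⟨K, -, P⟩ := B.exists_pulses
  exact P.exists_integral_limit B.wave.integrable_Phi

end Branch

end position

/-! ### Calculus lemmas for asymptotic differential equations -/

section asymptotic

lemma hasDerivAt_integral_moving {f : ℝ → ℝ → ℝ} (hf : Continuous fun p : ℝ × ℝ => f p.1 p.2)
    {m : ℝ → ℝ} {m' y₀ : ℝ} (hm : HasDerivAt m m' y₀) :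
    HasDerivAt (fun y => ∫ x in (m y₀)..(m y), f x y) (m' * f (m y₀) y₀) y₀ := by
  have key : (fun y => (∫ x in (m y₀)..(m y), f x y) - f (m y₀) y₀ * (m y - m y₀))
      =o[𝓝 y₀] fun y => m y - m y₀ := by
    rw [Asymptotics.isLittleO_iff]
    intro δ hδ
    have hc := Metric.continuousAt_iff.1 (hf.continuousAt (x := (m y₀, y₀))) δ hδ
    obtain ⟨r, hr, h⟩ := hc
    have hm1 : ∀ᶠ y in 𝓝 y₀, dist (m y) (m y₀) < r :=
      hm.continuousAt.eventually (Metric.ball_mem_nhds _ hr)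
    have hm2 : ∀ᶠ y in 𝓝 y₀, dist y y₀ < r := Metric.ball_mem_nhds _ hr
    filter_upwards [hm1, hm2] with y h1 h2
    have hInt : IntervalIntegrable (fun x => f x y) volume (m y₀) (m y) :=
      (hf.comp (Continuous.prodMk_left y)).intervalIntegrable _ _
    have e : (∫ x in (m y₀)..(m y), f x y) - f (m y₀) y₀ * (m y - m y₀) =
        ∫ x in (m y₀)..(m y), (f x y - f (m y₀) y₀) := by
      rw [intervalIntegral.integral_sub hInt intervalIntegrable_const,
        intervalIntegral.integral_const, smul_eq_mul]
      ring
    rw [e, Real.norm_eq_abs (m y - m y₀)]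
    refine intervalIntegral.norm_integral_le_of_norm_le_const fun x hx => ?_
    have hx1 : |x - m y₀| ≤ |m y - m y₀| := by
      have := uIoc_subset_uIcc hx
      exact abs_sub_left_of_mem_uIcc this
    have h3 := @h (x, y) (by
      rw [Prod.dist_eq]
      refine max_lt ?_ h2
      exact lt_of_le_of_lt hx1 h1)
    exact h3.le
  have k2 : (fun y => (∫ x in (m y₀)..(m y), f x y) - f (m y₀) y₀ * (m y - m y₀))
      =o[𝓝 y₀] fun y => y - y₀ := key.trans_isBigO hm.isBigO_sub
  have k3 : HasDerivAt
      (fun y => (∫ x in (m y₀)..(m y), f x y) - f (m y₀) y₀ * (m y - m y₀)) 0 y₀ := by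
    rw [hasDerivAt_iff_isLittleO]
    simpa using k2
  have k4 := k3.add ((hm.sub_const (m y₀)).const_mul (f (m y₀) y₀))
  refine (k4.congr_deriv (by ring)).congr_of_eventuallyEq (Eventually.of_forall fun y => ?_)
  simp

lemma hasDerivAt_integral_Ioi_moving {f : ℝ → ℝ → ℝ}
    (hf : Continuous fun p : ℝ × ℝ => f p.1 p.2) (hi : ∀ y, Integrable fun x => f x y)
    {m : ℝ → ℝ} {m' I' y₀ : ℝ} (hm : HasDerivAt m m' y₀)
    (hI : HasDerivAt (fun y => ∫ x in Ioi (m y₀), f x y) I' y₀) :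
    HasDerivAt (fun y => ∫ x in Ioi (m y), f x y) (I' - m' * f (m y₀) y₀) y₀ := by
  refine (hI.sub (hasDerivAt_integral_moving hf hm)).congr_of_eventuallyEq
    (Eventually.of_forall fun y => ?_)
  have h := intervalIntegral.integral_interval_add_Ioi (a := m y₀) (b := m y)
    (hi y).integrableOn (hi y).integrableOn
  simp only [Pi.sub_apply]
  linarith

lemma le_of_eventually_hasDerivAt {f f' : ℝ → ℝ} (h : ∀ᶠ y in atTop, HasDerivAt f (f' y) y ∧ f' y ≤ 0) :
    ∃ Y, ∀ a b, Y ≤ a → a ≤ b → f b ≤ f a := by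
  obtain ⟨Y, hY⟩ := eventually_atTop.1 h
  exact ⟨Y, fun a b ha hab => le_of_hasDerivAt_nonpos hab (fun t ht => (hY t (ha.trans ht.1)).1)
    fun t ht => (hY t (ha.trans ht.1)).2⟩

/-- A function whose derivative is dominated by that of a convergent function converges. -/
lemma exists_tendsto_of_abs_deriv_le {q q' H H' : ℝ → ℝ} {l : ℝ}
    (h : ∀ᶠ y in atTop, HasDerivAt q (q' y) y ∧ HasDerivAt H (H' y) y ∧ |q' y| ≤ H' y)
    (hH : Tendsto H atTop (𝓝 l)) : ∃ l', Tendsto q atTop (𝓝 l') := by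
  obtain ⟨Y₁, h1⟩ := le_of_eventually_hasDerivAt (f := fun y => q y - H y) (f' := fun y => q' y - H' y)
    (h.mono fun y hy => ⟨hy.1.sub hy.2.1, by linarith [le_abs_self (q' y), hy.2.2]⟩)
  obtain ⟨Y₂, h2⟩ := le_of_eventually_hasDerivAt (f := fun y => -q y - H y)
    (f' := fun y => -q' y - H' y)
    (h.mono fun y hy => ⟨hy.1.neg.sub hy.2.1, by linarith [neg_abs_le (q' y), hy.2.2]⟩)
  refine cauchy_map_iff_exists_tendsto.1 (Metric.cauchy_iff.2 ⟨inferInstance, fun δ hδ => ?_⟩)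
  obtain ⟨Y₃, h3⟩ := eventually_atTop.1 (Metric.tendsto_nhds.1 hH (δ / 4) (by positivity))
  obtain ⟨Y, hY⟩ : ∃ Y, Y = max Y₁ (max Y₂ Y₃) := ⟨_, rfl⟩
  have e1 : Y₁ ≤ Y := hY ▸ le_max_left _ _
  have e2 : Y₂ ≤ Y := hY ▸ (le_max_left _ _).trans (le_max_right _ _)
  have e3 : Y₃ ≤ Y := hY ▸ (le_max_right _ _).trans (le_max_right _ _)
  have hd : ∀ a, Y ≤ a → |q a - q Y| < δ / 2 := by
    intro a ha
    have a1 := h1 Y a e1 ha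
    have a2 := h2 Y a e2 ha
    have a3 := abs_lt.1 (h3 a (e3.trans ha))
    have a4 := abs_lt.1 (h3 Y e3)
    rw [abs_lt]
    constructor <;> linarith [a3.1, a3.2, a4.1, a4.2]
  refine ⟨q '' Ici Y, image_mem_map (Ici_mem_atTop Y), ?_⟩
  rintro _ ⟨a, ha, rfl⟩ _ ⟨b, hb, rfl⟩
  have b1 := abs_lt.1 (hd a ha)
  have b2 := abs_lt.1 (hd b hb)
  rw [Real.dist_eq, abs_lt]
  constructor <;> linarith [b1.1, b1.2, b2.1, b2.2]

lemma tendsto_zero_of_linear {w α γ : ℝ → ℝ} {a : ℝ} (ha : 0 < a) (hα : Tendsto α atTop (𝓝 a))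
    (hγ : Tendsto γ atTop (𝓝 0))
    (h : ∀ᶠ y in atTop, HasDerivAt w (-(α y * w y) + γ y) y) : Tendsto w atTop (𝓝 0) := by
  suffices hs : Tendsto (fun y => w y ^ 2) atTop (𝓝 0) by
    have := hs.sqrt
    simp only [Real.sqrt_sq_eq_abs, Real.sqrt_zero] at this
    exact (tendsto_zero_iff_abs_tendsto_zero _).2 this
  refine Metric.tendsto_nhds.2 fun δ hδ => ?_
  have hα' : ∀ᶠ y in atTop, a / 2 ≤ α y := hα.eventually_const_le (by linarith)
  have hγ2 : Tendsto (fun y => γ y ^ 2) atTop (𝓝 0) := by simpa using hγ.pow 2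
  have hγ' : ∀ᶠ y in atTop, γ y ^ 2 ≤ a ^ 2 * δ / 8 := hγ2.eventually_le_const (by positivity)
  obtain ⟨Y, hY⟩ := le_of_eventually_hasDerivAt
    (f := fun y => (w y ^ 2 - δ / 2) * Real.exp (a / 2 * y))
    (f' := fun y => (2 * w y * (-(α y * w y) + γ y) + a / 2 * (w y ^ 2 - δ / 2)) * Real.exp (a / 2 * y))
    (by
      filter_upwards [h, hα', hγ'] with y h1 h2 h3
      refine ⟨?_, ?_⟩
      · have d1 := (h1.pow 2).sub_const (δ / 2)
        have d2 : HasDerivAt (fun y => Real.exp (a / 2 * y)) (Real.exp (a / 2 * y) * (a / 2)) y := by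
          simpa using ((hasDerivAt_id y).const_mul (a / 2)).exp
        refine (d1.mul d2).congr_deriv ?_
        simp only [Nat.cast_ofNat, Pi.pow_apply]
        ring
      · refine mul_nonpos_of_nonpos_of_nonneg ?_ (Real.exp_pos _).le
        have e1 : 0 ≤ (α y - a / 2) * w y ^ 2 := mul_nonneg (by linarith) (sq_nonneg _)
        have e2 : 2 * γ y * w y ≤ a / 2 * w y ^ 2 + 2 / a * γ y ^ 2 := by
          have e3 : 0 ≤ 2 / a * (a / 2 * w y - γ y) ^ 2 := by positivity
          have e4 : 2 / a * (a / 2 * w y - γ y) ^ 2 =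
              a / 2 * w y ^ 2 + 2 / a * γ y ^ 2 - 2 * γ y * w y := by
            field_simp
            ring
          linarith
        have e5 : 2 / a * γ y ^ 2 ≤ a * δ / 4 := by
          have := mul_le_mul_of_nonneg_left h3 (show 0 ≤ 2 / a by positivity)
          have e6 : 2 / a * (a ^ 2 * δ / 8) = a * δ / 4 := by
            field_simp
            ring
          linarith
        linarith)
  have hlim : Tendsto (fun y => ((w Y ^ 2 - δ / 2) * Real.exp (a / 2 * Y)) * Real.exp (-(a / 2 * y)))
      atTop (𝓝 0) := by
    have t : Tendsto (fun y : ℝ => Real.exp (-(a / 2 * y))) atTop (𝓝 0) :=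
      Real.tendsto_exp_neg_atTop_nhds_zero.comp (tendsto_id.const_mul_atTop (by positivity))
    simpa using t.const_mul ((w Y ^ 2 - δ / 2) * Real.exp (a / 2 * Y))
  filter_upwards [eventually_ge_atTop Y, hlim.eventually_lt_const (show (0 : ℝ) < δ / 2 by positivity)]
    with y hy h2
  have h3 := mul_le_mul_of_nonneg_right (hY Y y le_rfl hy) (Real.exp_pos (-(a / 2 * y))).le
  rw [mul_assoc, ← Real.exp_add, add_neg_cancel, Real.exp_zero, mul_one] at h3
  rw [Real.dist_eq, sub_zero, abs_of_nonneg (sq_nonneg _)]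
  linarith

lemma tendsto_of_linear {v α β : ℝ → ℝ} {a B : ℝ} (ha : 0 < a) (hα : Tendsto α atTop (𝓝 a))
    (hβ : Tendsto β atTop (𝓝 B))
    (h : ∀ᶠ y in atTop, HasDerivAt v (-(α y * v y) + β y) y) : Tendsto v atTop (𝓝 (B / a)) := by
  have hγ : Tendsto (fun y => β y - α y * (B / a)) atTop (𝓝 0) := by
    have := hβ.sub (hα.mul_const (B / a))
    rwa [mul_div_cancel₀ B ha.ne', sub_self] at this
  have t := tendsto_zero_of_linear (w := fun y => v y - B / a) ha hα hγ (h.mono fun y hy =>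
    (hy.sub_const (B / a)).congr_deriv (by ring))
  simpa using t.add_const (B / a)

lemma tendsto_div_of_deriv {h h' : ℝ → ℝ} {L : ℝ} (hd : ∀ᶠ y in atTop, HasDerivAt h (h' y) y)
    (hL : Tendsto h' atTop (𝓝 L)) : Tendsto (fun y => h y / y) atTop (𝓝 L) := by
  refine Metric.tendsto_nhds.2 fun δ hδ => ?_
  have hL' := Metric.tendsto_nhds.1 hL (δ / 2) (by positivity)
  obtain ⟨Y₁, h1⟩ := le_of_eventually_hasDerivAt (f := fun y => h y - (L + δ / 2) * y)
    (f' := fun y => h' y - (L + δ / 2) * 1) (by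
      filter_upwards [hd, hL'] with y h1 h2
      exact ⟨h1.sub ((hasDerivAt_id y).const_mul _), by linarith [(abs_lt.1 h2).2]⟩)
  obtain ⟨Y₂, h2⟩ := le_of_eventually_hasDerivAt (f := fun y => (L - δ / 2) * y - h y)
    (f' := fun y => (L - δ / 2) * 1 - h' y) (by
      filter_upwards [hd, hL'] with y h1 h2
      exact ⟨((hasDerivAt_id y).const_mul _).sub h1, by linarith [(abs_lt.1 h2).1]⟩)
  have t1 : Tendsto (fun y => (h Y₁ - (L + δ / 2) * Y₁) / y) atTop (𝓝 0) :=
    tendsto_const_nhds.div_atTop tendsto_id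
  have t2 : Tendsto (fun y => ((L - δ / 2) * Y₂ - h Y₂) / y) atTop (𝓝 0) :=
    tendsto_const_nhds.div_atTop tendsto_id
  filter_upwards [eventually_ge_atTop Y₁, eventually_ge_atTop Y₂, eventually_gt_atTop 0,
    t1.eventually_lt_const (show (0 : ℝ) < δ / 2 by positivity),
    t2.eventually_lt_const (show (0 : ℝ) < δ / 2 by positivity)] with y y1 y2 y0 s1 s2
  have a1 := div_le_div_of_nonneg_right (h1 Y₁ y le_rfl y1) y0.le
  have a2 := div_le_div_of_nonneg_right (h2 Y₂ y le_rfl y2) y0.le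
  rw [sub_div, mul_div_cancel_right₀ _ y0.ne'] at a1 a2
  rw [Real.dist_eq, abs_lt]
  constructor <;> linarith

end asymptotic

/-! ### Momentum of the right half of the pulse -/

section momentum

/-- The momentum carried by the part of the wave to the right of the moving point `m`. -/
noncomputable def momentum (u : ℝ → ℝ → ℝ) (m : ℝ → ℝ) (y : ℝ) : ℝ := -lN u (m y) y

/-- The flux of momentum through the moving point `m`, whose velocity is `m'`. -/
noncomputable def force (F : ℝ → ℝ) (u : ℝ → ℝ → ℝ) (m m' : ℝ → ℝ) (y : ℝ) : ℝ :=
  F (u (m y) y) + pdy u (m y) y ^ 2 / 2 - pdx u (m y) y ^ 2 / 2 +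
    m' y * (pdx u (m y) y * pdy u (m y) y)

namespace Wave

variable {F : ℝ → ℝ} {c : ℝ} {u : ℝ → ℝ → ℝ}

lemma hasDerivAt_momentum (W : Wave F c u) {m m' : ℝ → ℝ} {y : ℝ} (hm : HasDerivAt m (m' y) y) :
    HasDerivAt (momentum u m) (-(c * momentum u m y) + force F u m m' y) y := by
  have h := hasDerivAt_integral_Ioi_moving (f := fun x y => pdx u x y * pdy u x y)
    (W.continuous_ux.mul W.continuous_uy) W.integrable_uxuy hm (W.hasDerivAt_lN (m y) y)
  refine h.neg.congr_deriv ?_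
  simp only [momentum, force]
  ring

lemma integrable_a_uy (W : Wave F c u) (y : ℝ) : Integrable fun x => wa F (u x y) * pdy u x y :=
  W.integrable_of_le ((W.continuous_au.mul W.continuous_uy).comp (Continuous.prodMk_left y))
    (W.abs_a_uy_le · y)

lemma integrable_a_ux (W : Wave F c u) (y : ℝ) : Integrable fun x => wa F (u x y) * pdx u x y :=
  W.integrable_of_le ((W.continuous_au.mul W.continuous_ux).comp (Continuous.prodMk_left y))
    fun x => W.abs_mul_le (A := 1) (B := 1) (by rw [one_mul, abs_of_pos (W.a_pos x y)])
      (W.abs_ux_le' x y)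

lemma hasDerivAt_mass (W : Wave F c u) {m : ℝ → ℝ} {m' y : ℝ} (hm : HasDerivAt m m' y) :
    HasDerivAt (fun y => ∫ x in Ioi (m y), wPhi F (u x y))
      ((∫ x in Ioi (m y), (wa F (u x y) + pdx u x y) * pdy u x y) + momentum u m y -
        m' * wPhi F (u (m y) y)) y := by
  have h := hasDerivAt_integral_Ioi_moving (f := fun x y => wPhi F (u x y)) W.continuous_Phi
    W.integrable_Phi hm (W.hasDerivAt_integral_Phi (Ioi (m y)) y)
  refine h.congr_deriv ?_
  simp only [add_mul]
  rw [integral_add (W.integrable_a_uy y).integrableOn (W.integrable_uxuy y).integrableOn]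
  simp only [momentum, lN]
  ring

lemma integral_defect_nonneg (W : Wave F c u) (x₀ y : ℝ) :
    0 ≤ ∫ x in Ioi x₀, (wa F (u x y) + pdx u x y) * pdy u x y := by
  refine integral_nonneg fun x => mul_nonneg ?_ (W.uy_pos x y).le
  have := neg_le_of_abs_le (W.abs_ux_le' x y)
  linarith

lemma integral_defect_sq_le (W : Wave F c u) (x₀ y : ℝ) :
    ∫ x in Ioi x₀, (wa F (u x y) + pdx u x y) ^ 2 ≤
      4 * (wPhi F 1 - wPhi F (u x₀ y)) + lg u y := by
  have iA := W.integrable_a_ux y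
  have iE : Integrable fun x => 2 * ed F u x y + pdy u x y ^ 2 :=
    ((W.integrable_ed y).const_mul 2).add (W.integrable_uy2 y)
  have e0 : ∀ x, 2 * ed F u x y + pdy u x y ^ 2 = wa F (u x y) ^ 2 + pdx u x y ^ 2 := fun x => by
    rw [W.a_sq]
    unfold ed
    ring
  have h0 := BalancedDoubleWell.wPhi_neg_one F
  have t1 := (W.hF.continuous_wPhi.tendsto (-1)).comp (W.tendsto_neg_one_atTop y)
  have t2 := (W.hF.continuous_wPhi.tendsto (-1)).comp (W.tendsto_neg_one_atBot y)
  rw [h0] at t1 t2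
  have r1 := integral_Ioi_of_hasDerivAt_of_tendsto' (a := x₀)
    (fun x _ => W.hasDerivAt_Phi_x x y) iA.integrableOn t1
  have r2 := integral_Iic_of_hasDerivAt_of_tendsto' (a := x₀)
    (fun x _ => W.hasDerivAt_Phi_x x y) iA.integrableOn t2
  have s1 : ∫ x in Ioi x₀, (wa F (u x y) + pdx u x y) ^ 2 =
      (∫ x in Ioi x₀, (2 * ed F u x y + pdy u x y ^ 2)) +
        2 * ∫ x in Ioi x₀, wa F (u x y) * pdx u x y := by
    rw [← integral_const_mul, ← integral_add iE.integrableOn (iA.const_mul 2).integrableOn]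
    refine integral_congr_ae (Eventually.of_forall fun x => ?_)
    simp only [e0]
    ring
  have s2 : ∫ x in Iic x₀, (wa F (u x y) - pdx u x y) ^ 2 =
      (∫ x in Iic x₀, (2 * ed F u x y + pdy u x y ^ 2)) -
        2 * ∫ x in Iic x₀, wa F (u x y) * pdx u x y := by
    rw [← integral_const_mul, ← integral_sub iE.integrableOn (iA.const_mul 2).integrableOn]
    refine integral_congr_ae (Eventually.of_forall fun x => ?_)
    simp only [e0]
    ring
  have s3 : 0 ≤ ∫ x in Iic x₀, (wa F (u x y) - pdx u x y) ^ 2 := integral_nonneg fun x => sq_nonneg _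
  have s4 := intervalIntegral.integral_Iic_add_Ioi iE.integrableOn (iE.integrableOn (s := Ioi x₀))
  have s5 : ∫ x, (2 * ed F u x y + pdy u x y ^ 2) = 2 * lE F u y + lg u y := by
    rw [integral_add ((W.integrable_ed y).const_mul 2) (W.integrable_uy2 y), integral_const_mul]
    rfl
  have s6 := W.integral_ed_le y
  linarith

lemma integral_defect_le (W : Wave F c u) {l : ℝ} (hl : 0 < l) (x₀ y : ℝ) :
    ∫ x in Ioi x₀, (wa F (u x y) + pdx u x y) * pdy u x y ≤
      l / 2 * (4 * (wPhi F 1 - wPhi F (u x₀ y)) + lg u y) + lg u y / (2 * l) := by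
  have i0 : Integrable fun x => (wa F (u x y) + pdx u x y) * pdy u x y := by
    simp only [add_mul]
    exact (W.integrable_a_uy y).add (W.integrable_uxuy y)
  have i1 : Integrable fun x => l / 2 * (wa F (u x y) + pdx u x y) ^ 2 := by
    have e0 : (fun x => l / 2 * (wa F (u x y) + pdx u x y) ^ 2) = fun x =>
        l / 2 * (2 * F (u x y) + (pdx u x y ^ 2 + 2 * (wa F (u x y) * pdx u x y))) := by
      funext x
      rw [← W.a_sq]
      ring
    rw [e0]
    exact (((W.integrable_F y).const_mul 2).add
      ((W.integrable_ux2 y).add ((W.integrable_a_ux y).const_mul 2))).const_mul _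
  have i2 := (W.integrable_uy2 y).div_const (2 * l)
  have h : ∫ x in Ioi x₀, (wa F (u x y) + pdx u x y) * pdy u x y ≤
      ∫ x in Ioi x₀, (l / 2 * (wa F (u x y) + pdx u x y) ^ 2 + pdy u x y ^ 2 / (2 * l)) := by
    refine integral_mono i0.integrableOn (i1.add i2).integrableOn fun x => ?_
    generalize wa F (u x y) + pdx u x y = r
    generalize pdy u x y = s
    have e : l / 2 * r ^ 2 + s ^ 2 / (2 * l) - r * s = (l * r - s) ^ 2 / (2 * l) := by
      field_simp
      ring
    have : 0 ≤ (l * r - s) ^ 2 / (2 * l) := by positivity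
    simp only []
    linarith
  rw [integral_add i1.integrableOn i2.integrableOn, integral_const_mul, integral_div] at h
  have h2 := mul_le_mul_of_nonneg_left (W.integral_defect_sq_le x₀ y) (show 0 ≤ l / 2 by positivity)
  have h3 : ∫ x in Ioi x₀, pdy u x y ^ 2 ≤ lg u y :=
    setIntegral_le_integral (W.integrable_uy2 y) (Eventually.of_forall fun x => sq_nonneg _)
  have h4 := div_le_div_of_nonneg_right h3 (show 0 ≤ 2 * l by positivity)
  linarith

end Wave

namespace Branch

variable {F : ℝ → ℝ} {c : ℝ} {u : ℝ → ℝ → ℝ} {k₁ k₂ ε : ℝ → ℝ}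

lemma exists_right_deriv (B : Branch F c u k₁ k₂ ε) : ∃ C, 0 < C ∧ ∀ᶠ y in atTop,
    HasDerivAt k₂ (deriv k₂ y) y ∧ |deriv k₂ y| ≤ C * ε y := by
  obtain ⟨C, Y, hC, H⟩ := B.wave.exists_level_deriv
  obtain ⟨Y', hY'⟩ := eventually_atTop.1 B.level
  refine ⟨C, hC, ?_⟩
  filter_upwards [eventually_gt_atTop Y, eventually_gt_atTop Y', B.flat] with y h1 h2 h3
  exact ⟨(H k₁ k₂ Y' hY' y h1 h2).1, (H k₁ k₂ Y' hY' y h1 h2).2 _ h3⟩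

lemma exists_center (B : Branch F c u k₁ k₂ ε) : ∃ (m' : ℝ → ℝ) (C : ℝ), 0 < C ∧ ∀ᶠ y in atTop,
    HasDerivAt (fun y => (k₁ y + k₂ y) / 2) (m' y) y ∧ |m' y| ≤ C * ε y := by
  obtain ⟨C₁, hC₁, h1⟩ := B.reflect.exists_right_deriv
  obtain ⟨C₂, hC₂, h2⟩ := B.exists_right_deriv
  refine ⟨fun y => (-deriv (fun y => -k₁ y) y + deriv k₂ y) / 2, (C₁ + C₂) / 2, by positivity, ?_⟩
  filter_upwards [h1, h2] with y g1 g2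
  refine ⟨?_, ?_⟩
  · refine ((g1.1.neg.add g2.1).div_const 2).congr_of_eventuallyEq (Eventually.of_forall fun t => ?_)
    simp
  · rw [abs_div, abs_two, div_le_iff₀ two_pos]
    have := abs_add_le (-deriv (fun y => -k₁ y) y) (deriv k₂ y)
    rw [abs_neg] at this
    linarith [g1.2, g2.2]

lemma exists_force_limit (B : Branch F c u k₁ k₂ ε) {m' : ℝ → ℝ} {C : ℝ}
    (hm' : ∀ᶠ y in atTop, |m' y| ≤ C * ε y) : ∃ L, 0 < L ∧
    Tendsto (fun y => F (u ((k₁ y + k₂ y) / 2) y) *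
      Real.exp (√(deriv (deriv F) 1) * (k₂ y - k₁ y))) atTop (𝓝 L) ∧
    Tendsto (fun y => force F u (fun y => (k₁ y + k₂ y) / 2) m' y *
      Real.exp (√(deriv (deriv F) 1) * (k₂ y - k₁ y))) atTop (𝓝 L) := by
  obtain ⟨K, hK, P⟩ := B.exists_pulses
  obtain ⟨a₀, ha₀, hw, hv⟩ := P.exists_mid_limit
  obtain ⟨C', hC', hT⟩ := B.wave.hF.exists_taylor
  have W := B.wave
  have hμ2 : 0 < deriv (deriv F) 1 := W.hF.2.2.2.2.1
  have hμ : 0 < √(deriv (deriv F) 1) := Real.sqrt_pos.2 hμ2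
  have hgap := P.gap
  rw [← Real.sq_sqrt hμ2.le] at hT
  simp only [force]
  generalize √(deriv (deriv F) 1) = μ at *
  have hexp : ∀ y, Real.exp (μ * (k₂ y - k₁ y)) = Real.exp (μ * ((k₂ y - k₁ y) / 2)) ^ 2 := fun y => by
    rw [← Real.exp_nat_mul]
    congr 1
    push_cast
    ring
  have hinv : Tendsto (fun y => Real.exp (-(μ * ((k₂ y - k₁ y) / 2)))) atTop (𝓝 0) :=
    Real.tendsto_exp_neg_atTop_nhds_zero.comp
      ((hgap.atTop_div_const two_pos).const_mul_atTop hμ)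
  have hw0 : Tendsto (fun y => 1 - u ((k₁ y + k₂ y) / 2) y) atTop (𝓝 0) := by
    have t := hw.mul hinv
    rw [mul_zero] at t
    refine t.congr fun y => ?_
    rw [mul_assoc, ← Real.exp_add, add_neg_cancel, Real.exp_zero, mul_one]
  have hw2 : Tendsto (fun y => (1 - u ((k₁ y + k₂ y) / 2) y) ^ 2 *
      Real.exp (μ * (k₂ y - k₁ y))) atTop (𝓝 ((2 * a₀) ^ 2)) := by
    refine (hw.pow 2).congr fun y => ?_
    rw [hexp, mul_pow]
  have hv2 : Tendsto (fun y => pdx u ((k₁ y + k₂ y) / 2) y ^ 2 *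
      Real.exp (μ * (k₂ y - k₁ y))) atTop (𝓝 0) := by
    have t := hv.pow 2
    rw [zero_pow two_ne_zero] at t
    refine t.congr fun y => ?_
    rw [hexp, mul_pow]
  have hF : Tendsto (fun y => F (u ((k₁ y + k₂ y) / 2) y) *
      Real.exp (μ * (k₂ y - k₁ y))) atTop (𝓝 (μ ^ 2 / 2 * (2 * a₀) ^ 2)) := by
    have t1 := hw2.const_mul (μ ^ 2 / 2)
    have t2 : Tendsto (fun y => F (u ((k₁ y + k₂ y) / 2) y) * Real.exp (μ * (k₂ y - k₁ y)) -
        μ ^ 2 / 2 * ((1 - u ((k₁ y + k₂ y) / 2) y) ^ 2 * Real.exp (μ * (k₂ y - k₁ y))))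
        atTop (𝓝 0) := by
      have t3 := (hw0.mul hw2).const_mul C'
      rw [zero_mul, mul_zero] at t3
      refine squeeze_zero_norm (fun y => ?_) t3
      have h1 := (hT (1 - u ((k₁ y + k₂ y) / 2) y) ⟨by linarith [W.lt_one ((k₁ y + k₂ y) / 2) y],
        by linarith [W.neg_one_lt ((k₁ y + k₂ y) / 2) y]⟩).2.2
      rw [sub_sub_cancel] at h1
      generalize u ((k₁ y + k₂ y) / 2) y = s at *
      have h2 := mul_le_mul_of_nonneg_right h1 (Real.exp_pos (μ * (k₂ y - k₁ y))).le
      have hE := abs_of_pos (Real.exp_pos (μ * (k₂ y - k₁ y)))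
      generalize Real.exp (μ * (k₂ y - k₁ y)) = E at *
      rw [Real.norm_eq_abs]
      rw [show F s * E - μ ^ 2 / 2 * ((1 - s) ^ 2 * E) = (F s - μ ^ 2 * (1 - s) ^ 2 / 2) * E by ring,
        abs_mul]
      rw [hE]
      linarith
    have t := t2.add t1
    rw [zero_add] at t
    exact t.congr fun y => by ring
  have hU : Tendsto (fun y => pdy u ((k₁ y + k₂ y) / 2) y ^ 2 *
      Real.exp (μ * (k₂ y - k₁ y))) atTop (𝓝 0) := by
    have t := ((B.eps.pow 2).const_mul 2).mul hF
    rw [zero_pow two_ne_zero, mul_zero, zero_mul] at t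
    refine squeeze_zero' (Eventually.of_forall fun y => by positivity) ?_ t
    filter_upwards [B.flat] with y hy
    have h1 := (hy ((k₁ y + k₂ y) / 2)).1
    have h2 := pow_le_pow_left₀ (W.uy_pos ((k₁ y + k₂ y) / 2) y).le h1 2
    rw [mul_pow, W.a_sq] at h2
    have h3 := mul_le_mul_of_nonneg_right h2 (Real.exp_pos (μ * (k₂ y - k₁ y))).le
    linarith
  have hX : Tendsto (fun y => m' y * (pdx u ((k₁ y + k₂ y) / 2) y * pdy u ((k₁ y + k₂ y) / 2) y) *
      Real.exp (μ * (k₂ y - k₁ y))) atTop (𝓝 0) := by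
    have t := (B.eps.const_mul C).mul (hv2.add hU)
    rw [mul_zero, zero_mul] at t
    refine squeeze_zero_norm' ?_ t
    filter_upwards [hm'] with y hy
    rw [Real.norm_eq_abs, abs_mul, abs_mul, abs_of_pos (Real.exp_pos _)]
    have h1 : |pdx u ((k₁ y + k₂ y) / 2) y * pdy u ((k₁ y + k₂ y) / 2) y| ≤
        pdx u ((k₁ y + k₂ y) / 2) y ^ 2 + pdy u ((k₁ y + k₂ y) / 2) y ^ 2 := by
      rw [abs_le]
      constructor <;> nlinarith [sq_nonneg (pdx u ((k₁ y + k₂ y) / 2) y + pdy u ((k₁ y + k₂ y) / 2) y),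
        sq_nonneg (pdx u ((k₁ y + k₂ y) / 2) y - pdy u ((k₁ y + k₂ y) / 2) y),
        sq_nonneg (pdx u ((k₁ y + k₂ y) / 2) y), sq_nonneg (pdy u ((k₁ y + k₂ y) / 2) y)]
    have h2 := mul_le_mul hy h1 (abs_nonneg _) ((abs_nonneg _).trans hy)
    have h3 := mul_le_mul_of_nonneg_right h2 (Real.exp_pos (μ * (k₂ y - k₁ y))).le
    linarith
  refine ⟨μ ^ 2 / 2 * (2 * a₀) ^ 2, by positivity, hF, ?_⟩
  have t := ((hF.add (hU.div_const 2)).sub (hv2.div_const 2)).add hX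
  rw [zero_div, add_zero, sub_zero, add_zero] at t
  exact t.congr fun y => by ring

end Branch

end momentum

/-! ### Reduction of the wall positions to a primitive of the momentum -/

section walls

lemma exists_primitive {p p' : ℝ → ℝ} (h : ∀ᶠ y in atTop, HasDerivAt p (p' y) y) :
    ∃ Z : ℝ → ℝ, ∀ᶠ y in atTop, HasDerivAt Z (p y) y := by
  obtain ⟨Y, hY⟩ := eventually_atTop.1 h
  have hc : Continuous fun t => p (max t Y) := by
    refine continuous_iff_continuousAt.2 fun t => ?_
    exact ContinuousAt.comp (g := p) (hY _ (le_max_right t Y)).continuousAt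
      (continuous_id.max continuous_const).continuousAt
  refine ⟨fun y => ∫ t in Y..y, p (max t Y), ?_⟩
  filter_upwards [eventually_ge_atTop Y] with y hy
  have := hc.integral_hasStrictDerivAt Y y
  rw [max_eq_left hy] at this
  exact this.hasDerivAt

namespace Wave

variable {F : ℝ → ℝ} {c : ℝ} {u : ℝ → ℝ → ℝ}

lemma tendsto_momentum (W : Wave F c u) (m : ℝ → ℝ) : Tendsto (momentum u m) atTop (𝓝 0) := by
  obtain ⟨C, Y, hC, hY1, hg⟩ := W.exists_lg_sq_le
  obtain ⟨Y', hF⟩ := W.exists_integral_F_le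
  have t1 : Tendsto (fun y : ℝ => 2 * (4 * wPhi F 1) * y ^ (-(1 / 8) : ℝ)) atTop (𝓝 0) := by
    simpa using (tendsto_rpow_neg_atTop (show (0 : ℝ) < 1 / 8 by norm_num)).const_mul
      (2 * (4 * wPhi F 1))
  have t2 : Tendsto (fun y : ℝ => √C / 4 * y ^ (-(3 / 8) : ℝ)) atTop (𝓝 0) := by
    simpa using (tendsto_rpow_neg_atTop (show (0 : ℝ) < 3 / 8 by norm_num)).const_mul (√C / 4)
  have t := t1.add t2
  rw [add_zero] at t
  refine squeeze_zero_norm' ?_ t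
  filter_upwards [eventually_ge_atTop Y, eventually_ge_atTop Y', eventually_gt_atTop 0]
    with y h1 h2 h0
  rw [Real.norm_eq_abs, momentum, abs_neg]
  have h3 := W.abs_lN_le (l := y ^ (-(1 / 8) : ℝ)) (by positivity) (hF y h2) (m y)
  have h4 : lg u y ≤ √C * y ^ (-(1 / 2) : ℝ) := by
    have h5 := Real.abs_le_sqrt (hg y h1)
    rw [Real.sqrt_div' _ h0.le] at h5
    refine (le_abs_self _).trans (h5.trans (le_of_eq ?_))
    rw [Real.rpow_neg h0.le, ← Real.sqrt_eq_rpow, div_eq_mul_inv]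
  have h6 : lg u y / (4 * y ^ (-(1 / 8) : ℝ)) ≤ √C / 4 * y ^ (-(3 / 8) : ℝ) := by
    rw [div_le_iff₀ (by positivity)]
    refine h4.trans (le_of_eq ?_)
    have : y ^ (-(1 / 2) : ℝ) = y ^ (-(3 / 8) : ℝ) * y ^ (-(1 / 8) : ℝ) := by
      rw [← Real.rpow_add h0]
      norm_num
    rw [this]
    ring
  linarith

lemma lN_sub_reflect (W : Wave F c u) (x₀ y : ℝ) :
    lN u x₀ y - lN (fun x y => u (-x) y) (-x₀) y = ∫ x, pdx u x y * pdy u x y := by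
  have h1 : lN (fun x y => u (-x) y) (-x₀) y = -∫ x in Iic x₀, pdx u x y * pdy u x y := by
    have h2 := integral_comp_neg_Ioi (-x₀) fun x => pdx u x y * pdy u x y
    rw [neg_neg] at h2
    rw [← h2, ← integral_neg]
    simp only [lN, Wave.pdx_reflect, Wave.pdy_reflect, neg_mul]
  rw [h1, ← intervalIntegral.integral_Iic_add_Ioi (W.integrable_uxuy y).integrableOn
    ((W.integrable_uxuy y).integrableOn (s := Ioi x₀))]
  simp only [lN]
  ring

lemma hasDerivAt_total_momentum (W : Wave F c u) (y : ℝ) :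
    HasDerivAt (fun y => ∫ x, pdx u x y * pdy u x y) (-(c * ∫ x, pdx u x y * pdy u x y)) y := by
  have h1 := W.hasDerivAt_lN 0 y
  have h2 := W.reflect.hasDerivAt_lN (-0) y
  have e := W.lN_sub_reflect 0
  refine ((h1.sub h2).congr_of_eventuallyEq (Eventually.of_forall fun t => (e t).symm)).congr_deriv ?_
  rw [← e y]
  simp only [Wave.pdx_reflect, Wave.pdy_reflect, neg_neg, neg_sq]
  ring

end Wave

namespace Branch

variable {F : ℝ → ℝ} {c : ℝ} {u : ℝ → ℝ → ℝ} {k₁ k₂ ε : ℝ → ℝ}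

lemma exists_gap_le_force (B : Branch F c u k₁ k₂ ε) {m' : ℝ → ℝ} {C : ℝ}
    (hm' : ∀ᶠ y in atTop, |m' y| ≤ C * ε y) : ∃ K, 0 < K ∧ ∀ᶠ y in atTop,
      wPhi F 1 - wPhi F (u ((k₁ y + k₂ y) / 2) y) ≤
        K * force F u (fun y => (k₁ y + k₂ y) / 2) m' y := by
  obtain ⟨L, hL, h1, h2⟩ := B.exists_force_limit hm'
  obtain ⟨K, hK, h3⟩ := B.wave.hF.exists_one_sub_wPhi_le
  refine ⟨2 * K, by positivity, ?_⟩
  filter_upwards [h1.eventually_le_const (show L < 3 / 2 * L by linarith),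
    h2.eventually_const_le (show 3 / 4 * L < L by linarith), B.level] with y g1 g2 g3
  have h4 : 0 ≤ u ((k₁ y + k₂ y) / 2) y :=
    (g3.mid _ (by linarith [g3.lt]) (by linarith [g3.lt])).le
  have h5 := h3 _ ⟨h4, (B.wave.lt_one ((k₁ y + k₂ y) / 2) y).le⟩
  have h6 : F (u ((k₁ y + k₂ y) / 2) y) ≤ 2 * force F u (fun y => (k₁ y + k₂ y) / 2) m' y := by
    refine le_of_mul_le_mul_right ?_ (Real.exp_pos (√(deriv (deriv F) 1) * (k₂ y - k₁ y)))
    linarith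
  have h7 := mul_le_mul_of_nonneg_left h6 hK.le
  linarith

lemma exists_dominator (B : Branch F c u k₁ k₂ ε) {m m' : ℝ → ℝ}
    (hm : ∀ᶠ y in atTop, HasDerivAt m (m' y) y) : ∃ G G' : ℝ → ℝ, Tendsto G atTop (𝓝 0) ∧
      ∀ᶠ y in atTop, HasDerivAt G (G' y) y ∧ force F u m m' y * y ^ (-(1 / 6) : ℝ) ≤ G' y := by
  have W := B.wave
  have hc := W.hc
  obtain ⟨A, A', hA, hA0⟩ := W.exists_weight
  obtain ⟨Y', hF⟩ := W.exists_integral_F_le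
  obtain ⟨M, hM⟩ : ∃ M, M = 4 * wPhi F 1 := ⟨_, rfl⟩
  rw [← hM] at hF
  refine ⟨fun y => momentum u m y * y ^ (-(1 / 6) : ℝ) +
      (c + 1) * (-(48 * M) * y ^ (-(1 / 24) : ℝ) + A y),
    fun y => (-(c * momentum u m y) + force F u m m' y) * y ^ (-(1 / 6) : ℝ) +
      momentum u m y * (-(1 / 6) * y ^ (-(1 / 6) - 1 : ℝ)) +
      (c + 1) * (-(48 * M) * (-(1 / 24) * y ^ (-(1 / 24) - 1 : ℝ)) + A' y), ?_, ?_⟩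
  · have t1 := (W.tendsto_momentum m).mul
      (tendsto_rpow_neg_atTop (show (0 : ℝ) < 1 / 6 by norm_num))
    have t2 := (tendsto_rpow_neg_atTop (show (0 : ℝ) < 1 / 24 by norm_num)).const_mul (-(48 * M))
    have t := t1.add ((t2.add hA0).const_mul (c + 1))
    simpa using t
  · filter_upwards [hm, eventually_ge_atTop Y', eventually_ge_atTop 1] with y h1 h2 h3
    have h0 : 0 < y := by linarith
    obtain ⟨a1, a2, -⟩ := hA y h3
    refine ⟨((W.hasDerivAt_momentum h1).mul (Real.hasDerivAt_rpow_const (Or.inl h0.ne'))).add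
      ((((Real.hasDerivAt_rpow_const (Or.inl h0.ne')).const_mul _).add a1).const_mul _), ?_⟩
    have b1 := W.abs_lN_le (l := y ^ (-(7 / 8) : ℝ)) (by positivity) (hF y h2) (m y)
    rw [← abs_neg] at b1
    change |momentum u m y| ≤ _ at b1
    have b2 : lg u y / (4 * y ^ (-(7 / 8) : ℝ)) = lg u y * y ^ (7 / 8 : ℝ) / 4 := by
      rw [Real.rpow_neg h0.le]
      field_simp
    rw [b2] at b1
    have b3 : y ^ (-(7 / 8) : ℝ) * y ^ (-(1 / 6) : ℝ) = y ^ (-(1 / 24) - 1 : ℝ) := by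
      rw [← Real.rpow_add h0]
      norm_num
    have b4 : y ^ (-(1 / 6) - 1 : ℝ) ≤ y ^ (-(1 / 6) : ℝ) :=
      Real.rpow_le_rpow_of_exponent_le h3 (by norm_num)
    have b5 : y ^ (-(1 / 6) : ℝ) ≤ 1 := Real.rpow_le_one_of_one_le_of_nonpos h3 (by norm_num)
    have b6 : 0 ≤ lg u y * y ^ (7 / 8 : ℝ) := mul_nonneg (Wave.lg_nonneg y) (by positivity)
    have b7 : (0 : ℝ) < y ^ (-(1 / 6) : ℝ) := by positivity
    have b8 : (0 : ℝ) < y ^ (-(1 / 6) - 1 : ℝ) := by positivity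
    generalize y ^ (-(1 / 24) - 1 : ℝ) = z₁ at *
    generalize y ^ (-(1 / 6) - 1 : ℝ) = z₂ at *
    generalize y ^ (-(1 / 6) : ℝ) = z₃ at *
    generalize y ^ (-(7 / 8) : ℝ) = z₄ at *
    generalize lg u y * y ^ (7 / 8 : ℝ) = z₅ at *
    generalize momentum u m y = p at *
    have d1 : |p| * z₃ ≤ 2 * M * z₁ + z₅ / 4 := by
      have e1 := mul_le_mul_of_nonneg_right b1 b7.le
      have e2 := mul_le_mul_of_nonneg_left b5 b6
      have e3 : 2 * M * (z₄ * z₃) = 2 * M * z₁ := by rw [b3]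
      linarith
    have d2 : p * z₂ ≤ |p| * z₃ :=
      (mul_le_mul_of_nonneg_right (le_abs_self p) b8.le).trans
        (mul_le_mul_of_nonneg_left b4 (abs_nonneg p))
    have d3 : c * (p * z₃) ≤ c * (|p| * z₃) :=
      mul_le_mul_of_nonneg_left (mul_le_mul_of_nonneg_right (le_abs_self p) b7.le) hc.le
    have d4 : (c + 1) * (|p| * z₃) ≤ (c + 1) * (2 * M * z₁ + A' y) :=
      mul_le_mul_of_nonneg_left (by linarith) (by linarith)
    have d5 : 0 ≤ |p| * z₃ := by positivity
    linarith

/-- The right wall follows any primitive of the momentum, up to a convergent error. -/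
lemma exists_right_wall (B : Branch F c u k₁ k₂ ε) {Z : ℝ → ℝ}
    (hZ : ∀ᶠ y in atTop, HasDerivAt Z (momentum u (fun y => (k₁ y + k₂ y) / 2) y) y) :
    ∃ l, Tendsto (fun y => wPhi F 1 * k₂ y - Z y) atTop (𝓝 l) := by
  have W := B.wave
  obtain ⟨m', C, hC, hm⟩ := B.exists_center
  obtain ⟨K, hK, hgap⟩ := B.exists_gap_le_force (hm.mono fun y h => h.2)
  obtain ⟨G, G', hG0, hG⟩ := B.exists_dominator (hm.mono fun y h => h.1)
  obtain ⟨A, A', hA, hA0⟩ := W.exists_weight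
  obtain ⟨R, hR⟩ := B.rate
  obtain ⟨l₀, hl₀⟩ := B.exists_integral_right
  obtain ⟨m, hmdef⟩ : ∃ m : ℝ → ℝ, m = fun y => (k₁ y + k₂ y) / 2 := ⟨_, rfl⟩
  have hmy : ∀ y, (k₁ y + k₂ y) / 2 = m y := fun y => by rw [hmdef]
  simp only [hmy] at hm hgap hG hl₀ hZ
  obtain ⟨N, hN⟩ : ∃ N, N = (2 + C * |R|) * K := ⟨_, rfl⟩
  have hN0 : 0 ≤ N := by rw [hN]; positivity
  obtain ⟨l', hl'⟩ := exists_tendsto_of_abs_deriv_le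
    (q := fun y => (∫ x in Ioi (m y), wPhi F (u x y)) + wPhi F 1 * m y - Z y)
    (q' := fun y => (∫ x in Ioi (m y), (wa F (u x y) + pdx u x y) * pdy u x y) +
      m' y * (wPhi F 1 - wPhi F (u (m y) y)))
    (H := fun y => N * G y + A y) (H' := fun y => N * G' y + A' y) (l := N * 0 + 0) (by
      filter_upwards [hm, hgap, hG, hR, hZ, eventually_ge_atTop 1] with y h1 h2 h3 h4 h5 h6
      have h0 : 0 < y := by linarith
      obtain ⟨a1, a2, -⟩ := hA y h6
      refine ⟨?_, (h3.1.const_mul N).add a1, ?_⟩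
      · refine (((W.hasDerivAt_mass h1.1).add (h1.1.const_mul (wPhi F 1))).sub h5).congr_deriv ?_
        ring
      · have e0 : 0 ≤ wPhi F 1 - wPhi F (u (m y) y) :=
          sub_nonneg.2 (W.hF.wPhi_le_one (W.lt_one (m y) y).le)
        have e1 := W.integral_defect_nonneg (m y) y
        have b7 : (0 : ℝ) < y ^ (-(1 / 6) : ℝ) := by positivity
        have e2 := W.integral_defect_le b7 (m y) y
        have e3 : |m' y| ≤ C * (|R| * y ^ (-(1 / 6) : ℝ)) :=
          h1.2.trans (mul_le_mul_of_nonneg_left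
            (h4.trans (mul_le_mul_of_nonneg_right (le_abs_self R) b7.le)) hC.le)
        have e4 : y ^ (-(1 / 6) : ℝ) ≤ y ^ (7 / 8 : ℝ) :=
          Real.rpow_le_rpow_of_exponent_le h6 (by norm_num)
        have e5 : lg u y / (2 * y ^ (-(1 / 6) : ℝ)) ≤ lg u y * y ^ (7 / 8 : ℝ) / 2 := by
          have e6 : lg u y / (2 * y ^ (-(1 / 6) : ℝ)) = lg u y * y ^ (1 / 6 : ℝ) / 2 := by
            rw [Real.rpow_neg h0.le]
            field_simp
          have e7 := mul_le_mul_of_nonneg_left (Real.rpow_le_rpow_of_exponent_le h6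
            (show (1 / 6 : ℝ) ≤ 7 / 8 by norm_num)) (Wave.lg_nonneg (u := u) y)
          linarith
        have e8 := mul_le_mul_of_nonneg_left e4 (Wave.lg_nonneg (u := u) y)
        have e9 := mul_le_mul_of_nonneg_right e3 e0
        have f1 := mul_le_mul_of_nonneg_left h3.2 hN0
        have f2 : (2 + C * |R|) * y ^ (-(1 / 6) : ℝ) * (wPhi F 1 - wPhi F (u (m y) y)) ≤
            (2 + C * |R|) * y ^ (-(1 / 6) : ℝ) * (K * force F u m m' y) :=
          mul_le_mul_of_nonneg_left h2 (by positivity)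
        have f3 : (2 + C * |R|) * y ^ (-(1 / 6) : ℝ) * (K * force F u m m' y) =
            N * (force F u m m' y * y ^ (-(1 / 6) : ℝ)) := by
          rw [hN]
          ring
        have f4 : |m' y * (wPhi F 1 - wPhi F (u (m y) y))| =
            |m' y| * (wPhi F 1 - wPhi F (u (m y) y)) := by rw [abs_mul, abs_of_nonneg e0]
        refine (abs_add_le _ _).trans ?_
        rw [f4, abs_of_nonneg e1]
        linarith)
    ((hG0.const_mul N).add hA0)
  refine ⟨l' - l₀, (hl'.sub hl₀).congr fun y => ?_⟩
  have : m y = (k₁ y + k₂ y) / 2 := (hmy y).symm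
  rw [this]
  ring

lemma exists_left_wall (B : Branch F c u k₁ k₂ ε) {Z : ℝ → ℝ}
    (hZ : ∀ᶠ y in atTop, HasDerivAt Z (momentum u (fun y => (k₁ y + k₂ y) / 2) y) y) :
    ∃ l, Tendsto (fun y => -(wPhi F 1 * k₁ y) - Z y) atTop (𝓝 l) := by
  have W := B.wave
  have hc := W.hc
  have e : ∀ y, momentum (fun x y => u (-x) y) (fun y => (-k₂ y + -k₁ y) / 2) y =
      momentum u (fun y => (k₁ y + k₂ y) / 2) y + ∫ x, pdx u x y * pdy u x y := fun y => by
    rw [← W.lN_sub_reflect ((k₁ y + k₂ y) / 2) y]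
    simp only [momentum]
    rw [show (-k₂ y + -k₁ y) / 2 = -((k₁ y + k₂ y) / 2) by ring]
    ring
  have hM : Tendsto (fun y => ∫ x, pdx u x y * pdy u x y) atTop (𝓝 0) := by
    have t := (W.reflect.tendsto_momentum fun y => (-k₂ y + -k₁ y) / 2).sub
      (W.tendsto_momentum fun y => (k₁ y + k₂ y) / 2)
    rw [sub_zero] at t
    exact t.congr fun y => by rw [e]; ring
  obtain ⟨l, hl⟩ := B.reflect.exists_right_wall
    (Z := fun y => Z y - (∫ x, pdx u x y * pdy u x y) / c) (hZ.mono fun y hy => by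
      refine (hy.sub ((W.hasDerivAt_total_momentum y).div_const c)).congr_deriv ?_
      rw [e]
      field_simp
      ring)
  have t := hl.sub (hM.div_const c)
  rw [zero_div, sub_zero] at t
  exact ⟨l, t.congr fun y => by ring⟩

end Branch

end walls

/-! ### Logarithmic law for the walls -/

section logarithmic

namespace Branch

variable {F : ℝ → ℝ} {c : ℝ} {u : ℝ → ℝ → ℝ} {k₁ k₂ ε : ℝ → ℝ}

lemma exists_log_asymptotics (B : Branch F c u k₁ k₂ ε) : ∃ C₁ C₂ : ℝ,
    Tendsto (fun y => k₁ y + (1 / (2 * √(deriv (deriv F) 1))) * Real.log y) atTop (𝓝 C₁) ∧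
    Tendsto (fun y => k₂ y - (1 / (2 * √(deriv (deriv F) 1))) * Real.log y) atTop (𝓝 C₂) := by
  have W := B.wave
  have hc := W.hc
  have he : 0 < wPhi F 1 := W.hF.wPhi_one_pos
  have hμ : 0 < √(deriv (deriv F) 1) := Real.sqrt_pos.2 W.hF.2.2.2.2.1
  obtain ⟨m', C, hC, hm⟩ := B.exists_center
  obtain ⟨L, hL, -, hτ⟩ := B.exists_force_limit (hm.mono fun y h => h.2)
  have hp : ∀ᶠ y in atTop, HasDerivAt (momentum u fun y => (k₁ y + k₂ y) / 2)
      (-(c * momentum u (fun y => (k₁ y + k₂ y) / 2) y) +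
        force F u (fun y => (k₁ y + k₂ y) / 2) m' y) y :=
    hm.mono fun y h => W.hasDerivAt_momentum h.1
  have hp0 := W.tendsto_momentum fun y => (k₁ y + k₂ y) / 2
  obtain ⟨Z, hZ⟩ := exists_primitive hp
  obtain ⟨l₂, h2⟩ := B.exists_right_wall hZ
  obtain ⟨l₁, h1⟩ := B.exists_left_wall hZ
  generalize √(deriv (deriv F) 1) = μ at *
  generalize wPhi F 1 = e at *
  generalize momentum u (fun y => (k₁ y + k₂ y) / 2) = p at *
  generalize force F u (fun y => (k₁ y + k₂ y) / 2) m' = τ at *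
  obtain ⟨r, hr⟩ : ∃ r, r = 2 * μ / e := ⟨_, rfl⟩
  have hr0 : 0 < r := by rw [hr]; positivity
  have hB : Tendsto (fun y => τ y * Real.exp (r * Z y)) atTop
      (𝓝 (L * Real.exp (-(μ / e * (l₂ + l₁))))) := by
    have t := hτ.mul (((h2.add h1).const_mul (μ / e)).neg.rexp)
    refine t.congr fun y => ?_
    rw [mul_assoc, ← Real.exp_add]
    congr 2
    rw [hr]
    field_simp
    ring
  have hB0 : 0 < L * Real.exp (-(μ / e * (l₂ + l₁))) := by positivity
  generalize L * Real.exp (-(μ / e * (l₂ + l₁))) = B₁ at *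
  have hexp : ∀ᶠ y in atTop, HasDerivAt (fun y => Real.exp (r * Z y))
      (r * (p y * Real.exp (r * Z y))) y := hZ.mono fun y hy =>
    (hy.const_mul r).exp.congr_deriv (by ring)
  have hα : Tendsto (fun y => c - r * p y) atTop (𝓝 c) := by
    have t := (hp0.const_mul r).const_sub c
    rwa [mul_zero, sub_zero] at t
  have hv := tendsto_of_linear (v := fun y => p y * Real.exp (r * Z y)) hc hα hB (by
    filter_upwards [hp, hexp] with y g1 g2
    exact (g1.mul g2).congr_deriv (by ring))
  have hlim := tendsto_div_of_deriv hexp (hv.const_mul r)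
  have hK : 0 < r * (B₁ / c) := by positivity
  have hlog : Tendsto (fun y => r * Z y - Real.log y) atTop (𝓝 (Real.log (r * (B₁ / c)))) := by
    refine (hlim.log hK.ne').congr' ?_
    filter_upwards [eventually_gt_atTop 0] with y hy
    rw [Real.log_div (Real.exp_pos _).ne' hy.ne', Real.log_exp]
  have t2 := (h2.div_const e).add (hlog.const_mul (1 / (2 * μ)))
  have t1 := ((h1.div_const e).add (hlog.const_mul (1 / (2 * μ)))).neg
  refine ⟨_, _, t1.congr fun y => ?_, t2.congr fun y => ?_⟩
  · rw [hr]
    field_simp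
    ring
  · rw [hr]
    field_simp
    ring

lemma exists_contDiffOn_right (B : Branch F c u k₁ k₂ ε) :
    ∃ Y, ContDiffOn ℝ 3 k₂ (Ioi Y) := by
  obtain ⟨Y, H⟩ := B.wave.exists_contDiffAt_level
  obtain ⟨Y', hY'⟩ := eventually_atTop.1 B.level
  exact ⟨max Y Y', fun y hy => (H k₁ k₂ Y' hY' y ((le_max_left _ _).trans_lt hy)
    ((le_max_right _ _).trans_lt hy)).contDiffWithinAt⟩

lemma exists_contDiffOn_left (B : Branch F c u k₁ k₂ ε) :
    ∃ Y, ContDiffOn ℝ 3 k₁ (Ioi Y) := by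
  obtain ⟨Y, H⟩ := B.reflect.exists_contDiffOn_right
  exact ⟨Y, H.neg.congr fun y _ => (neg_neg (k₁ y)).symm⟩

end Branch

end logarithmic

end

/-- The two branches of the zero level set have logarithmic asymptotics:
`k₁(y) = -(1/(2μ)) ln y + C₁ + o(1)` and `k₂(y) = (1/(2μ)) ln y + C₂ + o(1)`
as `y → ∞`, where `μ = √(F''(1))` (Lemma 2.7). -/
theorem level_set_log_asymptotics
    (F : ℝ → ℝ) (hF : BalancedDoubleWell F) (c : ℝ) (hc : 0 < c)
    (u : ℝ → ℝ → ℝ) (hu : IsTravelingWave F c u) :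
    ∃ Y₀ > (0 : ℝ), ∃ k₁ k₂ : ℝ → ℝ,
      ContDiffOn ℝ 3 k₁ (Set.Ioi Y₀) ∧ ContDiffOn ℝ 3 k₂ (Set.Ioi Y₀) ∧
      (∀ y : ℝ, Y₀ < y → k₁ y < k₂ y ∧ {x : ℝ | u x y = 0} = {k₁ y, k₂ y}) ∧
      ∃ C₁ C₂ : ℝ,
        Tendsto (fun y =>
          k₁ y + (1 / (2 * Real.sqrt (deriv (deriv F) 1))) * Real.log y)
          atTop (nhds C₁) ∧
        Tendsto (fun y =>
          k₂ y - (1 / (2 * Real.sqrt (deriv (deriv F) 1))) * Real.log y)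
          atTop (nhds C₂) := by
  have W : Wave F c u := ⟨hF, hc, hu⟩
  obtain ⟨k₁, k₂, ε, B⟩ := W.exists_branch
  obtain ⟨Y₁, h1⟩ := B.exists_contDiffOn_left
  obtain ⟨Y₂, h2⟩ := B.exists_contDiffOn_right
  obtain ⟨Y₃, h3⟩ := eventually_atTop.1 B.level
  refine ⟨max 1 (max Y₁ (max Y₂ Y₃)), lt_of_lt_of_le one_pos (le_max_left _ _), k₁, k₂,
    h1.mono (Set.Ioi_subset_Ioi (by simp)), h2.mono (Set.Ioi_subset_Ioi (by simp)),
    fun y hy => ?_, B.exists_log_asymptotics⟩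
  have h := h3 y (by simp only [max_lt_iff] at hy; exact hy.2.2.2.le)
  exact ⟨h.lt, h.zero_set⟩
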